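/- Let K be a field and let q, Q be invertible elements of K with q ≠ 1 and Q ≠ −q^f for every integer f, and let e be the multiplicative order of q (possibly infinite). Then for every n ≥ 1 the Iwahori–Hecke algebra H_{q,Q}(B_n) has finite representation type if and only if n < 2e. -/

import Mathlib

/-- A finite-dimensional right `A`-module, where `A` is a `K`-algebra.
Right modules are modules over the opposite ring `Aᵐᵒᵖ`. -/
structure FDRightModule (K A : Type) [Field K] [Ring A] [Algebra K A] : Type 1 where
  carrier : Type
  [isAddCommGroup : AddCommGroup carrier]
  [isModuleK : Module K carrier]
  [isModuleA : Module Aᵐᵒᵖ carrier]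
  [isTower : IsScalarTower K Aᵐᵒᵖ carrier]
  [isFinDim : FiniteDimensional K carrier]

attribute [instance] FDRightModule.isAddCommGroup FDRightModule.isModuleK
  FDRightModule.isModuleA FDRightModule.isTower FDRightModule.isFinDim

/-- A module is indecomposable if it is nonzero and is not the (internal) direct
sum of two nonzero submodules. -/
def IsIndecomposableModule (R M : Type*) [Ring R] [AddCommGroup M] [Module R M] : Prop :=
  Nontrivial M ∧ ∀ N₁ N₂ : Submodule R M, IsCompl N₁ N₂ → N₁ = ⊥ ∨ N₂ = ⊥

/-- A `K`-algebra `A` has finite representation type if there are only finitely many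
isomorphism classes of indecomposable finite-dimensional right `A`-modules. -/
def HasFiniteRepresentationType (K A : Type) [Field K] [Ring A] [Algebra K A] : Prop :=
  Finite (Quot fun M N : {M : FDRightModule K A // IsIndecomposableModule Aᵐᵒᵖ M.carrier} =>
    Nonempty (M.1.carrier ≃ₗ[Aᵐᵒᵖ] N.1.carrier))
/-- The multiplicative order of an element, valued in `ℕ∞`, with `⊤` for infinite order. -/
noncomputable def multOrder {M : Type*} [Monoid M] (x : M) : ℕ∞ :=
  if orderOf x = 0 then ⊤ else (orderOf x : ℕ∞)
/-- The defining relations of the Iwahori--Hecke algebra of type `Bₙ` with generators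
`T_0, …, T_{n-1}`, where `T_0` satisfies `(T_0 - α)(T_0 - β) = 0` and the other
generators satisfy `(T_i + 1)(T_i - q) = 0`. -/
inductive HeckeBRel (K : Type) [Field K] (α β q : K) (n : ℕ) :
    FreeAlgebra K (Fin n) → FreeAlgebra K (Fin n) → Prop
  | quad_zero (i : Fin n) (hi : (i : ℕ) = 0) :
      HeckeBRel K α β q n
        ((FreeAlgebra.ι K i - algebraMap K (FreeAlgebra K (Fin n)) α) *
          (FreeAlgebra.ι K i - algebraMap K (FreeAlgebra K (Fin n)) β)) 0
  | quad (i : Fin n) (hi : 0 < (i : ℕ)) :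
      HeckeBRel K α β q n
        ((FreeAlgebra.ι K i + 1) * (FreeAlgebra.ι K i - algebraMap K (FreeAlgebra K (Fin n)) q)) 0
  | braid_zero (i j : Fin n) (hi : (i : ℕ) = 0) (hj : (j : ℕ) = 1) :
      HeckeBRel K α β q n
        (FreeAlgebra.ι K i * FreeAlgebra.ι K j * FreeAlgebra.ι K i * FreeAlgebra.ι K j)
        (FreeAlgebra.ι K j * FreeAlgebra.ι K i * FreeAlgebra.ι K j * FreeAlgebra.ι K i)
  | braid (i j : Fin n) (hi : 0 < (i : ℕ)) (hij : (j : ℕ) = (i : ℕ) + 1) :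
      HeckeBRel K α β q n
        (FreeAlgebra.ι K j * FreeAlgebra.ι K i * FreeAlgebra.ι K j)
        (FreeAlgebra.ι K i * FreeAlgebra.ι K j * FreeAlgebra.ι K i)
  | comm (i j : Fin n) (hij : (i : ℕ) + 1 < (j : ℕ)) :
      HeckeBRel K α β q n (FreeAlgebra.ι K i * FreeAlgebra.ι K j)
        (FreeAlgebra.ι K j * FreeAlgebra.ι K i)

/-- The Iwahori--Hecke algebra of type `Bₙ`: the quotient of the free algebra on
`T_0, …, T_{n-1}` by the two-sided ideal generated by the defining relations, where
`T_0` satisfies `(T_0 - α)(T_0 - β) = 0`. -/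
abbrev HeckeB (K : Type) [Field K] (α β q : K) (n : ℕ) : Type := RingQuot (HeckeBRel K α β q n)

/-- A finite-dimensional `K`-vector space with a family of operators. -/
structure OpRep (K : Type) [Field K] (ι : Type) : Type 1 where
  V : Type
  [isAddCommGroup : AddCommGroup V]
  [isModule : Module K V]
  [isFinDim : FiniteDimensional K V]
  T : ι → Module.End K V

attribute [instance] OpRep.isAddCommGroup OpRep.isModule OpRep.isFinDim

namespace OpRep

variable {K : Type} [Field K] {ι : Type}

/-- Linear maps commuting with the operators indexed by `S`. -/
def IsHom (S : Set ι) (M N : OpRep K ι) (f : M.V →ₗ[K] N.V) : Prop :=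
  ∀ i ∈ S, ∀ v, f (M.T i v) = N.T i (f v)

/-- Subspaces stable under the operators indexed by `S`. -/
def Stable (S : Set ι) (M : OpRep K ι) (P : Submodule K M.V) : Prop :=
  ∀ i ∈ S, ∀ v ∈ P, M.T i v ∈ P

/-- Indecomposability with respect to the operators indexed by `S`. -/
def Indec (S : Set ι) (M : OpRep K ι) : Prop :=
  Nontrivial M.V ∧ ∀ P Q : Submodule K M.V, M.Stable S P → M.Stable S Q → IsCompl P Q →
    P = ⊥ ∨ Q = ⊥

/-- Isomorphism with respect to the operators indexed by `S`. -/
def Iso (S : Set ι) (M N : OpRep K ι) : Prop :=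
  ∃ e : M.V ≃ₗ[K] N.V, IsHom S M N e.toLinearMap

/-- `M` is a direct summand of `N`. -/
def Summand (S : Set ι) (M N : OpRep K ι) : Prop :=
  ∃ (i : M.V →ₗ[K] N.V) (p : N.V →ₗ[K] M.V), IsHom S M N i ∧ IsHom S N M p ∧ p ∘ₗ i = LinearMap.id

/-- Finitely many isomorphism classes of indecomposables in the class `C`. -/
def FinType (S : Set ι) (C : OpRep K ι → Prop) : Prop :=
  ∃ (n : ℕ) (X : Fin n → OpRep K ι), ∀ M, C M → Indec S M → ∃ j, Iso S M (X j)

variable {S : Set ι} {M N P : OpRep K ι}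

theorem IsHom.comp {g : N.V →ₗ[K] P.V} {f : M.V →ₗ[K] N.V} (hg : IsHom S N P g)
    (hf : IsHom S M N f) : IsHom S M P (g ∘ₗ f) := fun i hi v => by
  simp [hf i hi, hg i hi]

theorem IsHom.id : IsHom S M M LinearMap.id := fun _ _ _ => rfl

theorem IsHom.add {g f : M.V →ₗ[K] N.V} (hg : IsHom S M N g)
    (hf : IsHom S M N f) : IsHom S M N (g + f) := fun i hi v => by
  simp [hf i hi, hg i hi]

theorem IsHom.sum {α : Type*} {s : Finset α} {f : α → M.V →ₗ[K] N.V}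
    (hf : ∀ a ∈ s, IsHom S M N (f a)) : IsHom S M N (∑ a ∈ s, f a) := fun i hi v => by
  simp only [LinearMap.sum_apply, map_sum]
  exact Finset.sum_congr rfl fun a ha => hf a ha i hi v

theorem IsHom.symm {e : M.V ≃ₗ[K] N.V} (he : IsHom S M N e.toLinearMap) :
    IsHom S N M e.symm.toLinearMap := fun i hi v => by
  apply e.injective
  have := he i hi (e.symm v)
  simp_all

theorem Iso.symm (h : Iso S M N) : Iso S N M := by
  obtain ⟨e, he⟩ := h
  exact ⟨e.symm, he.symm⟩

theorem Iso.trans (h : Iso S M N) (h' : Iso S N P) : Iso S M P := by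
  obtain ⟨e, he⟩ := h
  obtain ⟨f, hf⟩ := h'
  exact ⟨e.trans f, hf.comp he⟩

theorem Summand.trans (h : Summand S M N) (h' : Summand S N P) : Summand S M P := by
  obtain ⟨i, p, hi, hp, hip⟩ := h
  obtain ⟨j, r, hj, hr, hjr⟩ := h'
  refine ⟨j ∘ₗ i, p ∘ₗ r, hj.comp hi, hp.comp hr, ?_⟩
  rw [LinearMap.comp_assoc, ← LinearMap.comp_assoc _ j, hjr, LinearMap.id_comp, hip]

theorem IsHom.stable_ker {f : M.V →ₗ[K] N.V} (hf : IsHom S M N f) :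
    M.Stable S (LinearMap.ker f) := fun i hi v hv => by
  rw [LinearMap.mem_ker] at *
  rw [hf i hi, hv, map_zero]

theorem IsHom.stable_range {f : M.V →ₗ[K] N.V} (hf : IsHom S M N f) :
    N.Stable S (LinearMap.range f) := by
  rintro i hi _ ⟨v, rfl⟩
  exact ⟨M.T i v, hf i hi v⟩

theorem IsHom.pow {f : Module.End K M.V} (hf : IsHom S M M f) (n : ℕ) :
    IsHom S M M (f ^ n) := by
  induction n with
  | zero => exact fun _ _ _ => rfl
  | succ n ih => rw [pow_succ]; exact ih.comp hf

/-- Fitting's lemma. -/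
theorem Indec.nilpotent_or_bijective (hM : Indec S M) {f : Module.End K M.V}
    (hf : IsHom S M M f) : IsNilpotent f ∨ Function.Bijective f := by
  obtain ⟨n, hn⟩ := Filter.eventually_atTop.mp (LinearMap.eventually_isCompl_ker_pow_range_pow f)
  have h1 := hn (n + 1) (by omega)
  rcases hM.2 _ _ (hf.pow (n + 1)).stable_ker (hf.pow (n + 1)).stable_range h1 with h | h
  · right
    have : LinearMap.ker f = ⊥ := by
      rw [eq_bot_iff, ← h]
      intro v hv
      rw [LinearMap.mem_ker] at *
      rw [pow_succ, Module.End.mul_apply, hv, map_zero]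
    have hinj := LinearMap.ker_eq_bot.mp this
    exact ⟨hinj, LinearMap.injective_iff_surjective.mp hinj⟩
  · left
    exact ⟨n + 1, LinearMap.range_eq_bot.mp h⟩

theorem IsHom.inverse {f : Module.End K M.V} (hf : IsHom S M M f) (hb : Function.Bijective f) :
    ∃ g : Module.End K M.V, IsHom S M M g ∧ g * f = 1 ∧ f * g = 1 := by
  let e := LinearEquiv.ofBijective f hb
  refine ⟨e.symm.toLinearMap, IsHom.symm (e := e) hf, ?_, ?_⟩
  · ext v; exact e.symm_apply_apply v
  · ext v; exact e.apply_symm_apply v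

theorem Indec.bijective_add (hM : Indec S M) {f g : Module.End K M.V}
    (hf : IsHom S M M f) (hg : IsHom S M M g) (hb : Function.Bijective (f + g)) :
    Function.Bijective f ∨ Function.Bijective g := by
  obtain ⟨u, hu, hu1, hu2⟩ := (hf.add hg).inverse hb
  have hbu : Function.Bijective u := by
    have : IsUnit u := ⟨⟨u, f + g, hu1, hu2⟩, rfl⟩
    exact (Module.End.isUnit_iff u).mp this
  rcases hM.nilpotent_or_bijective (hu.comp hf) with h | h
  · right
    have h1 : IsUnit (1 - u * f) := h.isUnit_one_sub
    rw [← hu1, mul_add, add_sub_cancel_left, Module.End.isUnit_iff] at h1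
    exact (Function.Bijective.of_comp_iff' hbu g).mp h1
  · left
    exact (Function.Bijective.of_comp_iff' hbu f).mp h

theorem Indec.exists_bijective (hM : Indec S M) {α : Type*} (s : Finset α)
    (f : α → Module.End K M.V) (hf : ∀ a ∈ s, IsHom S M M (f a))
    (hb : Function.Bijective (∑ a ∈ s, f a : Module.End K M.V)) :
    ∃ a ∈ s, Function.Bijective (f a) := by
  classical
  induction s using Finset.induction_on with
  | empty =>
    have := hM.1
    obtain ⟨x, y, hxy⟩ := exists_pair_ne M.V
    exact absurd (hb.1 (by simp : (∑ a ∈ ∅, f a) x = (∑ a ∈ ∅, f a) y)) hxy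
  | insert a s ha ih =>
    rw [Finset.sum_insert ha] at hb
    rcases hM.bijective_add (hf a (by simp))
      (IsHom.sum fun b hb => hf b (by simp [hb])) hb with h | h
    · exact ⟨a, by simp, h⟩
    · obtain ⟨b, hb, h⟩ := ih (fun b hb => hf b (by simp [hb])) h
      exact ⟨b, by simp [hb], h⟩

theorem summand_of_bijective {i : M.V →ₗ[K] N.V} {p : N.V →ₗ[K] M.V} (hi : IsHom S M N i)
    (hp : IsHom S N M p) (hb : Function.Bijective (p ∘ₗ i)) : Summand S M N := by
  obtain ⟨g, hg, hg1, -⟩ := (hp.comp hi).inverse hb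
  exact ⟨i, g ∘ₗ p, hi, hg.comp hp, hg1⟩

/-- A representation with maps to and from a given one. -/
structure Component (S : Set ι) (M : OpRep K ι) where
  Y : OpRep K ι
  i : Y.V →ₗ[K] M.V
  p : M.V →ₗ[K] Y.V
  isHom_i : IsHom S Y M i
  isHom_p : IsHom S M Y p

/-- Krull-Schmidt: an indecomposable summand of a sum is a summand of one of the terms. -/
theorem Indec.summand_of_sum (hM : Indec S M) (hMP : Summand S M P) {α : Type} [Fintype α]
    (c : α → Component S P) (h : ∑ j, (c j).i ∘ₗ (c j).p = LinearMap.id) :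
    ∃ j, Summand S M (c j).Y := by
  obtain ⟨a, b, ha, hb, hab⟩ := hMP
  have key : (∑ j, (b ∘ₗ (c j).i) ∘ₗ ((c j).p ∘ₗ a) : Module.End K M.V) = LinearMap.id := by
    rw [← hab]
    ext v
    have := congrArg (fun f => b (f (a v))) h
    simpa using this
  have hc j := hb.comp (c j).isHom_i
  have hc' j := (c j).isHom_p.comp ha
  obtain ⟨j, -, hj⟩ := hM.exists_bijective Finset.univ
    (fun j => (b ∘ₗ (c j).i) ∘ₗ ((c j).p ∘ₗ a)) (fun j _ => (hc j).comp (hc' j)) (by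
      rw [key]; exact Function.bijective_id)
  exact ⟨j, summand_of_bijective (hc' j) (hc j) hj⟩

theorem isCompl_range_ker {V W : Type} [AddCommGroup V] [Module K V] [AddCommGroup W] [Module K W]
    {i : V →ₗ[K] W} {p : W →ₗ[K] V} (h : p ∘ₗ i = LinearMap.id) :
    IsCompl (LinearMap.range i) (LinearMap.ker p) := by
  have h' : ∀ v, p (i v) = v := fun v => congrArg (fun f => f v) h
  refine IsCompl.of_eq ?_ ?_
  · rw [eq_bot_iff]
    rintro _ ⟨⟨v, rfl⟩, hv⟩
    have hv : p (i v) = 0 := hv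
    rw [h'] at hv
    simp [hv]
  · rw [eq_top_iff]
    intro v _
    rw [← add_sub_cancel (i (p v)) v]
    exact Submodule.add_mem_sup ⟨_, rfl⟩ (by simp [h'])

theorem Indec.iso_of_summand (hM : Indec S M) (hN : Indec S N) (h : Summand S M N) :
    Iso S M N := by
  obtain ⟨i, p, hi, hp, hip⟩ := h
  have hc := isCompl_range_ker hip
  have h' : ∀ v, p (i v) = v := fun v => congrArg (fun f => f v) hip
  have hinj : Function.Injective i := Function.LeftInverse.injective h'
  rcases hN.2 _ _ hi.stable_range hp.stable_ker hc with h | h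
  · exfalso
    have := hM.1
    obtain ⟨v, hv⟩ := exists_ne (0 : M.V)
    exact hv (hinj (by rw [LinearMap.range_eq_bot.mp h]; simp))
  · have hr : LinearMap.range i = ⊤ := by simpa [h] using hc.sup_eq_top
    exact ⟨LinearEquiv.ofBijective i ⟨hinj, LinearMap.range_eq_top.mp hr⟩, hi⟩

open Classical in
/-- Restriction of the operators to a subspace. -/
noncomputable def sub (M : OpRep K ι) (P : Submodule K M.V) : OpRep K ι where
  V := P
  T i := if h : ∀ v ∈ P, M.T i v ∈ P then (M.T i).restrict h else 0

theorem Stable.isHom_subtype {P : Submodule K M.V} (hP : M.Stable S P) :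
    IsHom S (M.sub P) M P.subtype := fun i hi v => by
  have h : ∀ v ∈ P, M.T i v ∈ P := hP i hi
  have : (M.sub P).T i = (M.T i).restrict h := by simp only [sub]; exact dif_pos h
  rw [this]
  rfl

theorem IsHom.cancel {g : N.V →ₗ[K] P.V} {f : M.V →ₗ[K] N.V} (hg : IsHom S N P g)
    (hinj : Function.Injective g) (h : IsHom S M P (g ∘ₗ f)) : IsHom S M N f := fun i hi v => by
  apply hinj
  rw [hg i hi]
  exact h i hi v

/-- The two summands attached to a pair of complementary stable subspaces. -/
theorem Stable.exists_proj {P Q : Submodule K M.V} (hP : M.Stable S P) (hQ : M.Stable S Q)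
    (h : IsCompl P Q) : ∃ (p : M.V →ₗ[K] (M.sub P).V) (r : M.V →ₗ[K] (M.sub Q).V),
      IsHom S M (M.sub P) p ∧ IsHom S M (M.sub Q) r ∧
      P.subtype ∘ₗ p + Q.subtype ∘ₗ r = LinearMap.id := by
  let p := P.projectionOnto Q h
  let r := Q.projectionOnto P h.symm
  have hpr : ∀ v, (p v : M.V) + (r v : M.V) = v := fun v =>
    Submodule.projection_add_projection_eq_self h v
  have key : ∀ i ∈ S, ∀ v, (p (M.T i v) : M.V) = M.T i (p v) ∧
      (r (M.T i v) : M.V) = M.T i (r v) := by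
    intro i hi v
    have h1 : (p (M.T i v) : M.V) - M.T i (p v) = M.T i (r v) - r (M.T i v) := by
      have h2 := hpr (M.T i v)
      have h3 : M.T i v = M.T i (p v) + M.T i (r v) := by rw [← map_add, hpr]
      rw [sub_eq_sub_iff_add_eq_add, h2, h3, add_comm]
    have h4 : (p (M.T i v) : M.V) - M.T i (p v) ∈ P ⊓ Q := by
      refine ⟨P.sub_mem (p _).2 (hP i hi _ (p v).2), ?_⟩
      rw [h1]
      exact Q.sub_mem (hQ i hi _ (r v).2) (r _).2
    rw [h.inf_eq_bot, Submodule.mem_bot] at h4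
    exact ⟨sub_eq_zero.mp h4, (sub_eq_zero.mp (h1.symm.trans h4)).symm⟩
  exact ⟨p, r, hP.isHom_subtype.cancel P.subtype_injective fun i hi v => (key i hi v).1,
    hQ.isHom_subtype.cancel Q.subtype_injective fun i hi v => (key i hi v).2,
    LinearMap.ext hpr⟩

/-- A component of a component. -/
def Component.comp (c : Component S M) (d : Component S c.Y) : Component S M where
  Y := d.Y
  i := c.i ∘ₗ d.i
  p := d.p ∘ₗ c.p
  isHom_i := c.isHom_i.comp d.isHom_i
  isHom_p := d.isHom_p.comp c.isHom_p

theorem Component.sum_comp (c : Component S M) {α : Type} [Fintype α] (d : α → Component S c.Y)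
    (h : ∑ j, (d j).i ∘ₗ (d j).p = LinearMap.id) :
    ∑ j, (c.comp (d j)).i ∘ₗ (c.comp (d j)).p = c.i ∘ₗ c.p := by
  ext v
  have := congrArg (fun f => c.i (f (c.p v))) h
  rw [LinearMap.sum_apply]
  calc _ = ∑ x, c.i ((d x).i ((d x).p (c.p v))) := rfl
    _ = _ := by simpa using this

/-- Every finite-dimensional representation is a finite direct sum of indecomposables. -/
theorem exists_decomposition (S : Set ι) (M : OpRep K ι) : ∃ (α : Type) (_ : Fintype α)
    (c : α → Component S M), (∀ j, Indec S (c j).Y) ∧ (∀ j, Function.Injective (c j).i) ∧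
    ∑ j, (c j).i ∘ₗ (c j).p = LinearMap.id := by
  induction hd : Module.finrank K M.V using Nat.strong_induction_on generalizing M with
  | _ d ih =>
  by_cases hn : Nontrivial M.V
  swap
  · rw [not_nontrivial_iff_subsingleton] at hn
    exact ⟨Empty, inferInstance, fun j => j.elim, fun j => j.elim, fun j => j.elim,
      LinearMap.ext fun v => Subsingleton.elim _ _⟩
  by_cases hI : Indec S M
  · exact ⟨Unit, inferInstance, fun _ => ⟨M, LinearMap.id, LinearMap.id, IsHom.id, IsHom.id⟩,
      fun _ => hI, fun _ => Function.injective_id, by simp⟩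
  have : ∃ P Q : Submodule K M.V, M.Stable S P ∧ M.Stable S Q ∧ IsCompl P Q ∧ P ≠ ⊥ ∧ Q ≠ ⊥ := by
    by_contra! hcon
    exact hI ⟨hn, fun P Q hP hQ hPQ => or_iff_not_imp_left.mpr (hcon P Q hP hQ hPQ)⟩
  obtain ⟨P, Q, hP, hQ, hPQ, hP0, hQ0⟩ := this
  obtain ⟨p, r, hp, hr, hpr⟩ := hP.exists_proj hQ hPQ
  have hdim := Submodule.finrank_add_eq_of_isCompl hPQ
  have hP1 : 0 < Module.finrank K P := Module.finrank_pos_iff.mpr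
    ((Submodule.nontrivial_iff_ne_bot).mpr hP0)
  have hQ1 : 0 < Module.finrank K Q := Module.finrank_pos_iff.mpr
    ((Submodule.nontrivial_iff_ne_bot).mpr hQ0)
  obtain ⟨α, _, c, h1, h2, h3⟩ := ih (Module.finrank K P) (by omega) (M.sub P) rfl
  obtain ⟨α', _, c', h1', h2', h3'⟩ := ih (Module.finrank K Q) (by omega) (M.sub Q) rfl
  let b : Component S M := ⟨M.sub P, P.subtype, p, hP.isHom_subtype, hp⟩
  let b' : Component S M := ⟨M.sub Q, Q.subtype, r, hQ.isHom_subtype, hr⟩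
  refine ⟨α ⊕ α', inferInstance, Sum.elim (fun j => b.comp (c j)) (fun j => b'.comp (c' j)), ?_⟩
  refine ⟨by rintro (j | j); exacts [h1 j, h1' j], ?_, ?_⟩
  · rintro (j | j)
    · exact P.subtype_injective.comp (h2 j)
    · exact Q.subtype_injective.comp (h2' j)
  · rw [Fintype.sum_sum_type]
    exact (congrArg₂ _ (b.sum_comp c h3) (b'.sum_comp c' h3')).trans hpr

/-- Colouring criterion for finiteness. -/
theorem finType_of_colour {C : OpRep K ι → Prop} {α : Type} [Finite α] (col : α → OpRep K ι → Prop)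
    (h1 : ∀ M, C M → Indec S M → ∃ a, col a M)
    (h2 : ∀ a M N, C M → Indec S M → C N → Indec S N → col a M → col a N → Iso S M N) :
    FinType S C := by
  classical
  obtain ⟨n, ⟨e⟩⟩ := Finite.exists_equiv_fin α
  by_cases h0 : ∃ M, C M ∧ Indec S M
  swap
  · push Not at h0
    exact ⟨0, fun j => j.elim0, fun M hM hI => absurd hI (h0 M hM)⟩
  obtain ⟨M₀, -⟩ := h0
  refine ⟨n, fun j => if h : ∃ M, C M ∧ Indec S M ∧ col (e.symm j) M then h.choose else M₀,
    fun M hM hI => ?_⟩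
  obtain ⟨a, ha⟩ := h1 M hM hI
  have h : ∃ M, C M ∧ Indec S M ∧ col (e.symm (e a)) M := ⟨M, hM, hI, by simpa using ha⟩
  refine ⟨e a, ?_⟩
  beta_reduce
  rw [dif_pos h]
  exact h2 _ _ _ hM hI h.choose_spec.1 h.choose_spec.2.1 (by simpa using ha) h.choose_spec.2.2

theorem FinType.or {C C' : OpRep K ι → Prop} (h : FinType S C) (h' : FinType S C') :
    FinType S fun M => C M ∨ C' M := by
  obtain ⟨n, X, hX⟩ := h
  obtain ⟨n', X', hX'⟩ := h'
  refine ⟨n + n', Fin.append X X', fun M hM hI => ?_⟩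
  rcases hM with hM | hM
  · obtain ⟨j, hj⟩ := hX M hM hI
    exact ⟨Fin.castAdd n' j, by rwa [Fin.append_left]⟩
  · obtain ⟨j, hj⟩ := hX' M hM hI
    exact ⟨Fin.natAdd n j, by rwa [Fin.append_right]⟩

/-- Indecomposable summands of finitely many representations. -/
theorem finType_of_summand {C : OpRep K ι → Prop} {n : ℕ} (Y : Fin n → OpRep K ι)
    (h : ∀ M, C M → Indec S M → ∃ j, Summand S M (Y j)) : FinType S C := by
  choose α hα c h1 h2 h3 using fun j => exists_decomposition S (Y j)
  have (j : Fin n) : Finite (α j) := (hα j).finite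
  refine finType_of_colour (α := Σ j, α j) (fun a M => Iso S M (c a.1 a.2).Y) ?_ ?_
  · intro M hM hI
    obtain ⟨j, hj⟩ := h M hM hI
    obtain ⟨k, hk⟩ := hI.summand_of_sum hj (c j) (h3 j)
    exact ⟨⟨j, k⟩, hI.iso_of_summand (h1 j k) hk⟩
  · intro a M N _ _ _ _ hM hN
    exact hM.trans hN.symm

/-- Let `F` be a choice of operators on powers `Fin b → N`, functorial for `S'`-homs. If every
indecomposable in `C` is a summand of `F` of itself, finiteness for `S'` implies it for `S`. -/
theorem finType_of_induced {S S' : Set ι} {C C' : OpRep K ι → Prop} (hFT : FinType S' C') {b : ℕ}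
    (F : ∀ N : OpRep K ι, ι → Module.End K (Fin b → N.V))
    (hF : ∀ (M N : OpRep K ι) (f : M.V →ₗ[K] N.V), IsHom S' M N f →
      IsHom S ⟨Fin b → M.V, F M⟩ ⟨Fin b → N.V, F N⟩ (f.compLeft (Fin b)))
    (hsub : ∀ (M N : OpRep K ι) (f : M.V →ₗ[K] N.V), IsHom S' M N f → Function.Injective f →
      C' N → C' M)
    (hC : ∀ M, C M → C' M)
    (h : ∀ M, C M → Indec S M → Summand S M ⟨Fin b → M.V, F M⟩) : FinType S C := by
  obtain ⟨n, X, hX⟩ := hFT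
  refine finType_of_summand (fun j => ⟨Fin b → (X j).V, F (X j)⟩) fun M hM hI => ?_
  obtain ⟨α, _, c, h1, h2, h3⟩ := exists_decomposition S' M
  obtain ⟨k, hk⟩ := hI.summand_of_sum (h M hM hI) (fun j => ⟨⟨Fin b → (c j).Y.V, F (c j).Y⟩,
    (c j).i.compLeft (Fin b), (c j).p.compLeft (Fin b), hF _ _ _ (c j).isHom_i,
    hF _ _ _ (c j).isHom_p⟩) (by
      ext v a
      have := congrArg (fun f => f ((LinearMap.single K (fun _ => M.V) v) a ‹_›)) h3
      simpa using this)
  obtain ⟨j, e, he⟩ := hX _ (hsub _ _ _ (c k).isHom_i (h2 k) (hC M hM)) (h1 k)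
  refine ⟨j, hk.trans ⟨_, _, hF _ _ _ he, hF _ _ _ he.symm, ?_⟩⟩
  ext v a
  simp

end OpRep

/-- Type `A` Hecke relations on `b` strands (generators `T k` with `k + 1 < b`). -/
structure IsHecke {K A : Type*} [Field K] [Ring A] [Algebra K A] (q : K) (T : ℕ → A) (b : ℕ) :
    Prop where
  quad : ∀ k, k + 1 < b → T k * T k = (q - 1) • T k + q • 1
  braid : ∀ k, k + 2 < b → T k * T (k + 1) * T k = T (k + 1) * T k * T (k + 1)
  comm : ∀ i j, i + 1 < j → j + 1 < b → T i * T j = T j * T i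

/-- Jucys-Murphy elements starting from `x`. -/
def jm {K A : Type*} [Field K] [Ring A] [Algebra K A] (q : K) (x : A) (T : ℕ → A) : ℕ → A
  | 0 => x
  | k + 1 => q⁻¹ • (T k * jm q x T k * T k)

/-- Relations satisfied by the starting element of a Jucys-Murphy sequence. -/
structure IsJMStart {A : Type*} [Ring A] (x : A) (T : ℕ → A) (b : ℕ) : Prop where
  comm : ∀ k, 0 < k → k + 1 < b → T k * x = x * T k
  braid : 1 < b → x * T 0 * x * T 0 = T 0 * x * T 0 * x

namespace IsHecke

variable {K A : Type*} [Field K] [Ring A] [Algebra K A] {q : K} {x : A} {T : ℕ → A} {b : ℕ}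

theorem mono (h : IsHecke q T b) {c : ℕ} (hc : c ≤ b) : IsHecke q T c :=
  ⟨fun k hk => h.quad k (by omega), fun k hk => h.braid k (by omega),
    fun i j hi hj => h.comm i j hi (by omega)⟩

theorem _root_.IsJMStart.one : IsJMStart (1 : A) T b := ⟨by simp, by simp⟩

theorem commute_jm_of_lt (h : IsHecke q T b) (hx : IsJMStart x T b) {i j : ℕ} (hij : j < i)
    (hi : i + 1 < b) : Commute (T i) (jm q x T j) := by
  induction j with
  | zero => exact hx.comm i hij hi
  | succ j ih =>
    have h1 : Commute (T i) (T j) := (h.comm j i hij hi).symm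
    exact ((h1.mul_right (ih (by omega))).mul_right h1).smul_right _

theorem jm_succ_mul (hq : q ≠ 0) (h : IsHecke q T b) {k : ℕ} (hk : k + 1 < b) :
    jm q x T (k + 1) * T k = T k * jm q x T k + (q - 1) • jm q x T (k + 1) := by
  rw [jm, smul_mul_assoc, mul_assoc, h.quad k hk, mul_add, smul_add]
  simp only [mul_smul_comm, smul_smul, mul_one, inv_mul_cancel₀ hq, one_smul]
  rw [mul_comm q⁻¹, add_comm]

theorem mul_jm_succ (hq : q ≠ 0) (h : IsHecke q T b) {k : ℕ} (hk : k + 1 < b) :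
    T k * jm q x T (k + 1) = jm q x T k * T k + (q - 1) • jm q x T (k + 1) := by
  rw [jm, mul_smul_comm, mul_assoc, ← mul_assoc, h.quad k hk, add_mul, smul_add]
  simp only [smul_mul_assoc, smul_smul, one_mul, inv_mul_cancel₀ hq, one_smul]
  rw [mul_comm q⁻¹, add_comm]

theorem commute_jm_of_gt (h : IsHecke q T b) (hx : IsJMStart x T b) {i j : ℕ}
    (hij : i + 1 < j) (hj : j < b) : Commute (T i) (jm q x T j) := by
  induction j, hij using Nat.le_induction with
  | base =>
    have e : jm q x T (i + 1 + 1) =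
        (q⁻¹ * q⁻¹) • (T (i + 1) * T i * jm q x T i * (T i * T (i + 1))) := by
      simp only [jm, mul_smul_comm, smul_mul_assoc, smul_smul, mul_assoc]
    have hb := h.braid i hj
    have hc := (commute_jm_of_lt h hx (Nat.lt_succ_self i) hj).eq
    simp only [Nat.succ_eq_add_one] at hc
    rw [e]
    refine Commute.smul_right ?_ _
    have h1 : T i * (T (i + 1) * T i * jm q x T i * (T i * T (i + 1))) =
      T (i + 1) * T i * (T (i + 1) * jm q x T i) * (T i * T (i + 1)) := by
      simp only [← mul_assoc, hb]
    rw [Commute, SemiconjBy, h1, hc]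
    have h2 : T (i + 1) * T i * (jm q x T i * T (i + 1)) * (T i * T (i + 1)) =
      T (i + 1) * T i * jm q x T i * (T (i + 1) * T i * T (i + 1)) := by
      simp only [mul_assoc]
    rw [h2, ← hb]
    simp only [mul_assoc]
  | succ j hij ih =>
    have h1 : Commute (T i) (T j) := h.comm i j (by omega) hj
    exact ((h1.mul_right (ih (by omega))).mul_right h1).smul_right _

theorem commute_jm_jm (h : IsHecke q T b) (hx : IsJMStart x T b) {i j : ℕ} (hi : i < b)
    (hj : j < b) : Commute (jm q x T i) (jm q x T j) := by
  have key : ∀ j, j < b → ∀ i, i < j → Commute (jm q x T i) (jm q x T j) := by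
    intro j
    induction j with
    | zero => intro _ i hi; omega
    | succ j ih =>
      intro hj i hi
      rcases Nat.lt_succ_iff_lt_or_eq.mp hi with hi | rfl
      · have h1 : Commute (jm q x T i) (T j) := (h.commute_jm_of_lt hx hi hj).symm
        exact ((h1.mul_right (ih (by omega) i hi)).mul_right h1).smul_right _
      · cases i with
        | zero =>
          refine Commute.smul_right ?_ _
          have := hx.braid (by omega)
          simp only [jm, Commute, SemiconjBy, ← mul_assoc]
          exact this
        | succ i =>
          have h1 : Commute (T i) (jm q x T (i + 2)) := h.commute_jm_of_gt hx (by omega) hj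
          have h2 : Commute (jm q x T i) (jm q x T (i + 2)) := by
            have h3 : Commute (jm q x T i) (T (i + 1)) :=
              (h.commute_jm_of_lt hx (by omega) hj).symm
            exact ((h3.mul_right (ih (by omega) i (by omega))).mul_right h3).smul_right _
          exact ((h1.mul_left h2).mul_left h1).smul_left _
  rcases lt_trichotomy i j with h1 | rfl | h1
  · exact key j hj i h1
  · exact Commute.refl _
  · exact (key i hi j h1).symm

/-- The relative trace from `b` strands. -/
def _root_.relTrace (q : K) (T : ℕ → A) : ℕ → A → A
  | 0, _ => 0
  | b + 1, y => y + q⁻¹ • relTrace q T b (T (b - 1) * y * T (b - 1))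

end IsHecke

section relTrace

variable {K A : Type*} [Field K] [Ring A] [Algebra K A] {q : K} {x : A} {T : ℕ → A} {b : ℕ}

theorem relTrace_add (y z : A) : relTrace q T b (y + z) = relTrace q T b y + relTrace q T b z := by
  induction b generalizing y z with
  | zero => simp [relTrace]
  | succ b ih =>
    simp only [relTrace, mul_add, add_mul, ih, smul_add]
    abel

theorem relTrace_smul (c : K) (y : A) : relTrace q T b (c • y) = c • relTrace q T b y := by
  induction b generalizing y with
  | zero => simp [relTrace]
  | succ b ih =>
    simp only [relTrace, mul_smul_comm, smul_mul_assoc, ih, smul_add, smul_comm c]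

theorem relTrace_mul_left {z : A} (hz : ∀ k, k + 1 < b → Commute z (T k)) (y : A) :
    relTrace q T b (z * y) = z * relTrace q T b y := by
  induction b generalizing y with
  | zero => simp [relTrace]
  | succ b ih =>
    rcases b with - | b
    · simp [relTrace]
    simp only [relTrace, mul_add, Nat.add_sub_cancel]
    have e : T b * (z * y) * T b = z * (T b * y * T b) := by
      rw [← mul_assoc, ← (hz b (by omega)).eq]; simp only [mul_assoc]
    have := ih (fun k hk => hz k (by omega)) (T b * y * T b)
    simp only [relTrace] at this
    rw [e, this, mul_smul_comm]

theorem relTrace_mul_right {z : A} (hz : ∀ k, k + 1 < b → Commute z (T k)) (y : A) :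
    relTrace q T b (y * z) = relTrace q T b y * z := by
  induction b generalizing y with
  | zero => simp [relTrace]
  | succ b ih =>
    rcases b with - | b
    · simp [relTrace]
    simp only [relTrace, add_mul, Nat.add_sub_cancel]
    have e : T b * (y * z) * T b = (T b * y * T b) * z := by
      rw [mul_assoc (T b), mul_assoc y, (hz b (by omega)).eq]; simp only [mul_assoc]
    have := ih (fun k hk => hz k (by omega)) (T b * y * T b)
    simp only [relTrace] at this
    rw [e, this, smul_mul_assoc]

/-- The trace of the last generator is a Jucys-Murphy element. -/
theorem one_add_relTrace (hq : q ≠ 0) (h : IsHecke q T b) {n : ℕ} (hn : n < b) :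
    1 + (1 - q⁻¹) • relTrace q T n (T (n - 1)) = jm q 1 T n := by
  induction n with
  | zero => simp [relTrace, jm]
  | succ n ih =>
    have e : relTrace q T n (T (n - 1) * T n * T (n - 1)) =
        T n * relTrace q T n (T (n - 1)) * T n := by
      rcases n with - | n
      · simp [relTrace]
      simp only [Nat.add_sub_cancel]
      have hc : ∀ k, k + 1 < n + 1 → Commute (T (n + 1)) (T k) := fun k hk =>
        (h.comm k (n + 1) (by omega) (by omega)).symm
      rw [h.braid n hn, relTrace_mul_right hc, relTrace_mul_left hc]
    rw [jm, ← ih (by omega)]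
    simp only [relTrace, Nat.add_sub_cancel, e, mul_add, add_mul, mul_one, h.quad n hn,
      smul_add, smul_smul, mul_smul_comm, smul_mul_assoc]
    rw [inv_mul_cancel₀ hq, one_smul, mul_sub, inv_mul_cancel₀ hq, mul_one, mul_comm q⁻¹]
    abel

/-- Recursion for the trace of the resolvent of the last Jucys-Murphy element. -/
theorem relTrace_resolvent (hq : q ≠ 0) (h : IsHecke q T b) {z : A} (hz : ∀ a, Commute z a)
    (R : ℕ → A) (hR : ∀ k, R k * (1 - z * jm q 1 T k) = 1)
    (hR' : ∀ k, (1 - z * jm q 1 T k) * R k = 1) {n : ℕ} (hn : n + 1 < b) :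
    relTrace q T (n + 2) (R (n + 1)) = R (n + 1) + relTrace q T (n + 1) (R n) +
      (q⁻¹ * (q - 1)) • (R (n + 1) * (relTrace q T (n + 1) (T n) * R (n + 1) -
        (q - 1) • (relTrace q T (n + 1) (R n) * (R (n + 1) - 1)))) := by
  have hcR {y : A} {k : ℕ} (hy : Commute y (jm q 1 T k)) : Commute y (R k) := by
    have h1 : Commute y (1 - z * jm q 1 T k) :=
      (Commute.one_right y).sub_right ((hz y).symm.mul_right hy)
    calc y * R k = (R k * (1 - z * jm q 1 T k)) * (y * R k) := by rw [hR, one_mul]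
      _ = R k * ((1 - z * jm q 1 T k) * y) * R k := by simp only [mul_assoc]
      _ = R k * y * ((1 - z * jm q 1 T k) * R k) := by rw [← h1.eq]; simp only [mul_assoc]
      _ = R k * y := by rw [hR', mul_one]
  have hx : IsJMStart (1 : A) T b := IsJMStart.one
  have hT {k : ℕ} (hk : k + 1 < n + 1) : Commute (R (n + 1)) (T k) :=
    (hcR (h.commute_jm_of_gt hx (by omega) hn)).symm
  set L := jm q 1 T n
  set L' := jm q 1 T (n + 1)
  have hLL : Commute L L' := h.commute_jm_jm hx (by omega) hn
  have hL'R : Commute L' (R (n + 1)) := hcR (Commute.refl _)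
  have hzLR : R (n + 1) - 1 = z * L' * R (n + 1) := by
    have := hR' (n + 1)
    rw [sub_mul, one_mul] at this
    rw [← this]; abel
  have e1 : T n * R (n + 1) = R n * T n + (q - 1) • (R n * (R (n + 1) - 1)) := by
    have h1 : (1 - z * L) * T n = T n * (1 - z * L') + (q - 1) • (z * L') := by
      have := h.mul_jm_succ hq (x := 1) (show n + 1 < b from hn)
      rw [sub_mul, mul_sub, ← mul_assoc (T n), ← (hz (T n)).eq, mul_assoc z (T n), this]
      rw [mul_add, mul_smul_comm, mul_assoc]
      simp only [one_mul, mul_one]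
      abel
    calc T n * R (n + 1) = R n * ((1 - z * L) * T n) * R (n + 1) := by
          rw [← mul_assoc, hR, one_mul]
      _ = R n * T n * ((1 - z * L') * R (n + 1)) + (q - 1) • (R n * (z * L' * R (n + 1))) := by
          rw [h1, mul_add, add_mul, mul_smul_comm, smul_mul_assoc]; simp only [mul_assoc]
      _ = _ := by rw [hR', mul_one, hzLR]
  have e2 : T n * R (n + 1) * T n = q • R n + (q - 1) • (R (n + 1) * (R n * T n)) := by
    have hRR : Commute (R n) (R (n + 1)) := hcR (hcR hLL.symm).symm
    rw [e1, add_mul, mul_assoc, h.quad n hn, mul_add, ← mul_assoc, ← hRR.eq, smul_mul_assoc,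
      mul_sub, sub_mul, smul_sub, mul_smul_comm, mul_smul_comm]
    simp only [mul_one]
    abel
  have e3 : relTrace q T (n + 1) (R n * T n) = relTrace q T (n + 1) (T n) * R (n + 1) -
        (q - 1) • (relTrace q T (n + 1) (R n) * (R (n + 1) - 1)) := by
    have hc : ∀ k, k + 1 < n + 1 → Commute (R (n + 1) - 1) (T k) := fun k hk =>
      (hT hk).sub_left (Commute.one_left _)
    rw [← relTrace_mul_right fun k hk => hT hk, e1, relTrace_add, relTrace_smul,
      relTrace_mul_right hc]
    abel
  rw [relTrace]
  simp only [Nat.add_sub_cancel]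
  rw [e2, relTrace_add, relTrace_smul, relTrace_smul, relTrace_mul_left fun k hk => hT hk, e3,
    smul_add, smul_smul, smul_smul, inv_mul_cancel₀ hq, one_smul]
  abel

end relTrace

/-- The descending product `T (j + m - 1) * ⋯ * T j`. -/
def downProd {A : Type*} [Ring A] (T : ℕ → A) (j : ℕ) : ℕ → A
  | 0 => 1
  | m + 1 => T (j + m) * downProd T j m

/-- The ascending product `T j * ⋯ * T (j + m - 1)`. -/
def upProd {A : Type*} [Ring A] (T : ℕ → A) (j : ℕ) : ℕ → A
  | 0 => 1
  | m + 1 => upProd T j m * T (j + m)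

section prods

variable {K A : Type*} [Field K] [Ring A] [Algebra K A] {q : K} {x : A} {T : ℕ → A} {b : ℕ}

theorem upProd_eq_unop (j m : ℕ) :
    upProd T j m = (downProd (fun k => MulOpposite.op (T k)) j m).unop := by
  induction m with
  | zero => rfl
  | succ m ih => simp [upProd, downProd, ih]

theorem IsHecke.op (h : IsHecke q T b) : IsHecke q (fun k => MulOpposite.op (T k)) b where
  quad k hk := by rw [← MulOpposite.op_mul, h.quad k hk]; simp
  braid k hk := by
    simp only [← MulOpposite.op_mul]
    simpa only [mul_assoc] using congrArg MulOpposite.op (h.braid k hk)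
  comm i j hi hj := by
    simp only [← MulOpposite.op_mul]
    rw [h.comm i j hi hj]

theorem downProd_succ' (j m : ℕ) : downProd T j (m + 1) = downProd T (j + 1) m * T j := by
  induction m with
  | zero => simp [downProd]
  | succ m ih =>
    rw [downProd, ih, ← mul_assoc, downProd]
    congr 2; congr 1; omega

theorem downProd_mul_self (h : IsHecke q T b) {j m : ℕ} (hb : j + m + 1 < b) :
    downProd T j (m + 1) * T j = (q - 1) • downProd T j (m + 1) + q • downProd T (j + 1) m := by
  rw [downProd_succ', mul_assoc, h.quad j (by omega), mul_add]
  simp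

theorem commute_downProd_of_lt (h : IsHecke q T b) {k j m : ℕ} (hk : k + 1 < j) (hb : j + m < b) :
    downProd T j m * T k = T k * downProd T j m := by
  induction m with
  | zero => simp [downProd]
  | succ m ih =>
    rw [downProd, mul_assoc, ih (by omega), ← mul_assoc, ← h.comm k (j + m) (by omega) (by omega),
      mul_assoc]

theorem commute_downProd_of_gt (h : IsHecke q T b) {k j m : ℕ} (hk : j + m < k) (hb : k + 1 < b) :
    T k * downProd T j m = downProd T j m * T k := by
  induction m with
  | zero => simp [downProd]
  | succ m ih =>
    rw [downProd, mul_assoc, ← ih (by omega), ← mul_assoc, ← mul_assoc,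
      h.comm (j + m) k (by omega) (by omega)]

theorem downProd_mul_of_gt (h : IsHecke q T b) {k j m : ℕ} (hk : j ≤ k) (hkm : k + 1 < j + m)
    (hb : j + m < b) : downProd T j m * T (k + 1) = T k * downProd T j m := by
  induction m with
  | zero => omega
  | succ m ih =>
    rcases Nat.lt_or_ge (k + 1) (j + m) with h1 | h1
    · rw [downProd, mul_assoc, ih h1 (by omega), ← mul_assoc, ← mul_assoc,
        h.comm k (j + m) h1 (by omega)]
    · obtain ⟨m, rfl⟩ : ∃ m', m = m' + 1 := ⟨m - 1, by omega⟩
      obtain rfl : k = j + m := by omega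
      rw [downProd, downProd, mul_assoc, mul_assoc,
        ← commute_downProd_of_gt h (by omega) (by omega)]
      have := h.braid (j + m) (by omega)
      simp only [← mul_assoc, ← add_assoc] at this ⊢
      rw [this]

theorem upProd_succ' (j m : ℕ) : upProd T j (m + 1) = T j * upProd T (j + 1) m := by
  rw [upProd_eq_unop, downProd_succ', upProd_eq_unop]; rfl

theorem self_mul_upProd (h : IsHecke q T b) {j m : ℕ} (hb : j + m + 1 < b) :
    T j * upProd T j (m + 1) = (q - 1) • upProd T j (m + 1) + q • upProd T (j + 1) m := by
  simp only [upProd_eq_unop]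
  exact congrArg MulOpposite.unop (downProd_mul_self h.op hb)

theorem commute_upProd_of_lt (h : IsHecke q T b) {k j m : ℕ} (hk : k + 1 < j) (hb : j + m < b) :
    T k * upProd T j m = upProd T j m * T k := by
  simp only [upProd_eq_unop]
  exact congrArg MulOpposite.unop (commute_downProd_of_lt h.op hk hb)

theorem mul_upProd_of_gt (h : IsHecke q T b) {k j m : ℕ} (hk : j ≤ k) (hkm : k + 1 < j + m)
    (hb : j + m < b) : T (k + 1) * upProd T j m = upProd T j m * T k := by
  simp only [upProd_eq_unop]
  exact congrArg MulOpposite.unop (downProd_mul_of_gt h.op hk hkm hb)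

theorem relTrace_eq_sum (y : A) : relTrace q T b y = ∑ j ∈ Finset.range b,
    (q⁻¹) ^ (b - 1 - j) • (upProd T j (b - 1 - j) * y * downProd T j (b - 1 - j)) := by
  induction b generalizing y with
  | zero => simp [relTrace]
  | succ b ih =>
    rw [relTrace, Finset.sum_range_succ, ih, Finset.smul_sum, add_comm]
    congr 1
    · refine Finset.sum_congr rfl fun j hj => ?_
      have hj := Finset.mem_range.mp hj
      have e : b + 1 - 1 - j = (b - 1 - j) + 1 := by omega
      have e' : j + (b - 1 - j) = b - 1 := by omega
      rw [e, upProd, downProd, e', smul_smul, pow_succ']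
      simp only [mul_assoc]
    · simp [upProd, downProd]

end prods

namespace OpRep

variable {K : Type} [Field K]

/-- The generators of the product of two type `A` Hecke algebras on `b` and `c` strands. -/
def youngGens (b c : ℕ) : Set (ℕ ⊕ ℕ) := {i | Sum.elim (fun k => k + 1 < b) (fun k => k + 1 < c) i}

/-- Representations of the product of two type `A` Hecke algebras on `b` and `c` strands. -/
structure IsYoung (q : K) (b c : ℕ) (M : OpRep K (ℕ ⊕ ℕ)) : Prop where
  left : IsHecke q (fun k => M.T (.inl k)) b
  right : IsHecke q (fun k => M.T (.inr k)) c
  comm : ∀ i j, i + 1 < b → j + 1 < c → Commute (M.T (.inl i)) (M.T (.inr j))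

/-- Operators on `Fin b → N` modelling induction from `b - 1` to `b` strands. -/
noncomputable def indOp (q : K) (b : ℕ) (N : OpRep K (ℕ ⊕ ℕ)) :
    ℕ ⊕ ℕ → Module.End K (Fin b → N.V)
  | .inl k => LinearMap.pi fun j : Fin b =>
      if j.1 = k then (q - 1) • LinearMap.proj j +
        (if h : k + 1 < b then q • LinearMap.proj ⟨k + 1, h⟩ else 0)
      else if j.1 = k + 1 then (if h : k < b then LinearMap.proj ⟨k, h⟩ else 0)
      else if k < j.1 then N.T (.inl k) ∘ₗ LinearMap.proj j
      else N.T (.inl (k - 1)) ∘ₗ LinearMap.proj j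
  | .inr k => (N.T (.inr k)).compLeft (Fin b)

theorem IsYoung.of_injective {q : K} {b c : ℕ} {M N : OpRep K (ℕ ⊕ ℕ)} {f : M.V →ₗ[K] N.V}
    (hf : IsHom (youngGens b c) M N f) (hinj : Function.Injective f) (h : IsYoung q b c N) :
    IsYoung q b c M := by
  have hl k (hk : k + 1 < b) v : f (M.T (.inl k) v) = N.T (.inl k) (f v) := hf (.inl k) hk v
  have hr k (hk : k + 1 < c) v : f (M.T (.inr k) v) = N.T (.inr k) (f v) := hf (.inr k) hk v
  refine ⟨⟨fun k hk => ?_, fun k hk => ?_, fun i j hi hj => ?_⟩,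
    ⟨fun k hk => ?_, fun k hk => ?_, fun i j hi hj => ?_⟩, fun i j hi hj => ?_⟩ <;>
    ext v <;> apply hinj
  · simpa [hl k hk] using LinearMap.congr_fun (h.left.quad k hk) (f v)
  · simpa [hl k (by omega), hl (k + 1) (by omega)] using
      LinearMap.congr_fun (h.left.braid k hk) (f v)
  · simpa [hl i (by omega), hl j (by omega)] using
      LinearMap.congr_fun (h.left.comm i j hi hj) (f v)
  · simpa [hr k hk] using LinearMap.congr_fun (h.right.quad k hk) (f v)
  · simpa [hr k (by omega), hr (k + 1) (by omega)] using
      LinearMap.congr_fun (h.right.braid k hk) (f v)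
  · simpa [hr i (by omega), hr j (by omega)] using
      LinearMap.congr_fun (h.right.comm i j hi hj) (f v)
  · simpa [hl i hi, hr j hj] using LinearMap.congr_fun (h.comm i j hi hj).eq (f v)

theorem isHom_compLeft_indOp {q : K} {b c : ℕ} {M N : OpRep K (ℕ ⊕ ℕ)} {f : M.V →ₗ[K] N.V}
    (hf : IsHom (youngGens (b - 1) c) M N f) :
    IsHom (youngGens b c) ⟨Fin b → M.V, indOp q b M⟩ ⟨Fin b → N.V, indOp q b N⟩
      (f.compLeft (Fin b)) := by
  have hl k (hk : k + 1 < b - 1) v : f (M.T (.inl k) v) = N.T (.inl k) (f v) := hf (.inl k) hk v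
  have hr k (hk : k + 1 < c) v : f (M.T (.inr k) v) = N.T (.inr k) (f v) := hf (.inr k) hk v
  rintro (k | k) hk v
  · have hk : k + 1 < b := hk
    ext j
    have hj := j.2
    simp only [indOp, LinearMap.compLeft_apply, LinearMap.pi_apply, Function.comp_apply]
    split_ifs with h1 h2 h3 h4
    · simp
    · simp
    · simp
    · exact hl k (by omega) (v j)
    · exact hl (k - 1) (by omega) (v j)
  · have hk : k + 1 < c := hk
    ext j
    simp [indOp, hr k hk]

/-- The trace of an element of the commutant exhibits a summand of the induced representation. -/
theorem summand_indOp {q : K} (hq : q ≠ 0) {b c : ℕ} {M : OpRep K (ℕ ⊕ ℕ)} (hM : IsYoung q b c M)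
    {x : Module.End K M.V} (hx : IsHom (youngGens (b - 1) c) M M x) :
    ∃ (i : M.V →ₗ[K] (Fin b → M.V)) (p : (Fin b → M.V) →ₗ[K] M.V),
      IsHom (youngGens b c) M ⟨Fin b → M.V, indOp q b M⟩ i ∧
      IsHom (youngGens b c) ⟨Fin b → M.V, indOp q b M⟩ M p ∧
      p ∘ₗ i = relTrace q (fun k => M.T (.inl k)) b x := by
  set T : ℕ → Module.End K M.V := fun k => M.T (.inl k) with hT
  have hxl k (hk : k + 1 < b - 1) v : x (T k v) = T k (x v) := hx (.inl k) hk v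
  have hxr k (hk : k + 1 < c) v : x (M.T (.inr k) v) = M.T (.inr k) (x v) := hx (.inr k) hk v
  have hH : IsHecke q T b := hM.left
  have hd {k : ℕ} (hk : k + 1 < c) {j m : ℕ} (hj : j + m < b) :
      Commute (downProd T j m) (M.T (.inr k)) := by
    induction m with
    | zero => exact Commute.one_left _
    | succ m ih => exact (hM.comm (j + m) k (by omega) hk).mul_left (ih (by omega))
  have hu {k : ℕ} (hk : k + 1 < c) {j m : ℕ} (hj : j + m < b) :
      Commute (upProd T j m) (M.T (.inr k)) := by
    induction m with
    | zero => exact Commute.one_left _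
    | succ m ih => exact (ih (by omega)).mul_left (hM.comm (j + m) k (by omega) hk)
  refine ⟨LinearMap.pi fun j : Fin b => downProd T j (b - 1 - j),
    ∑ j : Fin b, (q⁻¹) ^ (b - 1 - j.1) • (upProd T j (b - 1 - j) * x) ∘ₗ LinearMap.proj j,
    ?_, ?_, ?_⟩
  · rintro (k | k) hk v
    · have hk : k + 1 < b := hk
      ext ⟨j, hj⟩
      simp only [indOp, LinearMap.pi_apply, ← Module.End.mul_apply]
      change (downProd T j (b - 1 - j) * T k) v = _
      split_ifs with h1 h2 h3 h4
      · subst h1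
        obtain ⟨m, hm⟩ : ∃ m, b - 1 - j = m + 1 := ⟨b - 2 - j, by omega⟩
        rw [hm, downProd_mul_self hH (by omega)]
        have : b - 1 - (j + 1) = m := by omega
        simp [hm, this]
      · subst h2
        have : b - 1 - k = (b - 1 - (k + 1)) + 1 := by omega
        simp only [LinearMap.proj_apply, LinearMap.pi_apply]
        rw [this, downProd_succ']
      · omega
      · rw [commute_downProd_of_lt hH (by omega) (by omega)]
        rfl
      · obtain ⟨k, rfl⟩ : ∃ k', k = k' + 1 := ⟨k - 1, by omega⟩
        rw [downProd_mul_of_gt hH (by omega) (by omega) (by omega)]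
        rfl
    · ext ⟨j, hj⟩
      exact LinearMap.congr_fun (hd hk (by omega)).eq v
  · rintro (k | k) hk v
    · have hk : k + 1 < b := hk
      simp only [LinearMap.sum_apply, map_sum]
      rw [← sub_eq_zero, ← Finset.sum_sub_distrib,
        Fintype.sum_eq_add (⟨k, by omega⟩ : Fin b) ⟨k + 1, hk⟩ (by simp)]
      · obtain ⟨m, hm⟩ : ∃ m, b - 1 - k = m + 1 := ⟨b - 2 - k, by omega⟩
        have hm' : b - 1 - (k + 1) = m := by omega
        have e1 := self_mul_upProd hH (show k + m + 1 < b by omega)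
        have e2 := upProd_succ' (T := T) k m
        have e1' w := LinearMap.congr_fun e1 w
        have e2' w := LinearMap.congr_fun e2 w
        simp only [Module.End.mul_apply, LinearMap.add_apply, LinearMap.smul_apply] at e1' e2'
        change _ - T k _ + (_ - T k _) = 0
        simp only [indOp, LinearMap.smul_apply, LinearMap.comp_apply, LinearMap.proj_apply,
          LinearMap.pi_apply, Module.End.mul_apply, hm, hm', map_smul]
        simp only [hk, dif_pos, if_true, Nat.succ_ne_self, if_false, LinearMap.add_apply,
          LinearMap.smul_apply, LinearMap.proj_apply, map_add, map_smul, e1', ← e2',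
          show k < b by omega, pow_succ]
        match_scalars <;> field_simp <;> ring
      · rintro ⟨j, hj⟩ ⟨h1, h2⟩
        simp only [ne_eq, Fin.mk.injEq] at h1 h2
        rw [sub_eq_zero]
        simp only [indOp, LinearMap.smul_apply, LinearMap.comp_apply, LinearMap.proj_apply,
          LinearMap.pi_apply, Module.End.mul_apply, map_smul, h1, h2, if_false]
        congr 1
        split_ifs with h3
        · have := LinearMap.congr_fun (commute_upProd_of_lt hH (show k + 1 < j by omega)
            (show j + (b - 1 - j) < b by omega)) (x (v ⟨j, hj⟩))
          simp only [LinearMap.comp_apply, LinearMap.proj_apply]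
          rw [hxl k (by omega)]
          exact this.symm
        · obtain ⟨k, rfl⟩ : ∃ k', k = k' + 1 := ⟨k - 1, by omega⟩
          have := LinearMap.congr_fun (mul_upProd_of_gt hH (show j ≤ k by omega)
            (show k + 1 < j + (b - 1 - j) by omega) (by omega)) (x (v ⟨j, hj⟩))
          simp only [LinearMap.comp_apply, LinearMap.proj_apply, Nat.add_sub_cancel]
          rw [hxl k (by omega)]
          exact this.symm
    · have hk : k + 1 < c := hk
      simp only [LinearMap.sum_apply, map_sum]
      refine Finset.sum_congr rfl fun j _ => ?_
      have hj := j.2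
      have := LinearMap.congr_fun (hu hk (show j.1 + (b - 1 - j.1) < b by omega)).eq (x (v j))
      simp only [Module.End.mul_apply] at this
      simp [indOp, hxr k hk, this]
  · ext v
    rw [relTrace_eq_sum, Finset.sum_range]
    simp [LinearMap.sum_apply]

theorem IsYoung.isHom_jm_pow {q : K} {b c : ℕ} {M : OpRep K (ℕ ⊕ ℕ)} (hM : IsYoung q b c M)
    (m : ℕ) : IsHom (youngGens (b - 1) c) M M (jm q 1 (fun k => M.T (.inl k)) (b - 1) ^ m) := by
  have hr : ∀ k, k + 1 < c → ∀ j, j < b →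
      Commute (M.T (.inr k)) (jm q 1 (fun k => M.T (.inl k)) j) := by
    intro k hk j
    induction j with
    | zero => exact fun _ => Commute.one_right _
    | succ j ih =>
      intro hj
      have h1 : Commute (M.T (.inr k)) (M.T (.inl j)) := (hM.comm j k hj hk).symm
      exact ((h1.mul_right (ih (by omega))).mul_right h1).smul_right _
  rintro (k | k) hk v
  · have hk : k + 1 < b - 1 := hk
    exact LinearMap.congr_fun
      ((hM.left.commute_jm_of_gt IsJMStart.one hk (by omega)).pow_right m).symm.eq v
  · have hk : k + 1 < c := hk
    rcases b with - | b
    · simp [jm]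
    · exact LinearMap.congr_fun ((hr k hk _ (by omega)).pow_right m).symm.eq v

theorem IsYoung.isHom_relTrace {q : K} (hq : q ≠ 0) {b c : ℕ} {M : OpRep K (ℕ ⊕ ℕ)}
    (hM : IsYoung q b c M) (m : ℕ) : IsHom (youngGens b c) M M
      (relTrace q (fun k => M.T (.inl k)) b (jm q 1 (fun k => M.T (.inl k)) (b - 1) ^ m)) := by
  obtain ⟨i, p, hi, hp, hip⟩ := summand_indOp hq hM (hM.isHom_jm_pow m)
  rw [← hip]
  exact hp.comp hi

/-- Indecomposables on which some trace is invertible are controlled by fewer strands. -/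
theorem finType_of_trace_bijective {q : K} (hq : q ≠ 0) {b c : ℕ}
    (h : FinType (youngGens (b - 1) c) (IsYoung q (b - 1) c)) :
    FinType (youngGens b c) fun M => IsYoung q b c M ∧ ∃ m : ℕ, Function.Bijective
      (relTrace q (fun k => M.T (.inl k)) b (jm q 1 (fun k => M.T (.inl k)) (b - 1) ^ m) :
        Module.End K M.V) := by
  refine finType_of_induced h (indOp q b) (fun M N f hf => isHom_compLeft_indOp hf)
    (fun M N f hf hinj hN => hN.of_injective hf hinj)
    (fun M hM => ⟨hM.1.left.mono (by omega), hM.1.right, fun i j hi hj =>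
      hM.1.comm i j (by omega) hj⟩) fun M hM hI => ?_
  obtain ⟨hM, m, hm⟩ := hM
  obtain ⟨i, p, hi, hp, hip⟩ := summand_indOp hq hM (hM.isHom_jm_pow m)
  exact summand_of_bijective hi hp (hip ▸ hm)

end OpRep

section weights

variable {K V : Type*} [Field K] [AddCommGroup V] [Module K V] {q : K}
  {T : ℕ → Module.End K V} {b : ℕ}

open PowerSeries in
theorem coeff_relTrace {A : Type*} [Ring A] [Algebra K A] (T : ℕ → A) (n m : ℕ) (f : A⟦X⟧) :
    coeff m (relTrace q (fun k => C (T k)) n f) = relTrace q T n (coeff m f) := by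
  induction n generalizing f with
  | zero => simp [relTrace]
  | succ n ih =>
    simp only [relTrace, map_add, PowerSeries.coeff_smul, ih, coeff_mul_C, coeff_C_mul]

open PowerSeries in
theorem jm_C {A : Type*} [Ring A] [Algebra K A] (T : ℕ → A) (n : ℕ) :
    jm q 1 (fun k => (C (T k) : A⟦X⟧)) n = C (jm q 1 T n) := by
  induction n with
  | zero => simp [jm]
  | succ n ih =>
    ext m
    simp only [jm, ih, ← map_mul, PowerSeries.coeff_smul]
    simp only [coeff_C, smul_ite, smul_zero]

open PowerSeries in
theorem IsHecke.C {A : Type*} [Ring A] [Algebra K A] {T : ℕ → A} (h : IsHecke q T b) :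
    IsHecke q (fun k => (C (T k) : A⟦X⟧)) b where
  quad k hk := by
    ext m
    rw [← map_mul, h.quad k hk]
    simp only [map_add, PowerSeries.coeff_smul, coeff_C, coeff_one]
    split_ifs <;> simp
  braid k hk := by simp only [← map_mul, h.braid k hk]
  comm i j hi hj := by simp only [← map_mul, h.comm i j hi hj]

open PowerSeries in
/-- The series `f` of operators acts on `v` through the scalar series `φ`. -/
def ActsAs (v : V) (f : (Module.End K V)⟦X⟧) (φ : K⟦X⟧) : Prop :=
  ∀ m, coeff m f v = coeff m φ • v

namespace ActsAs
open PowerSeries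
variable {v : V} {f g : (Module.End K V)⟦X⟧} {φ ψ : K⟦X⟧}

theorem add (hf : ActsAs v f φ) (hg : ActsAs v g ψ) : ActsAs v (f + g) (φ + ψ) := fun m => by
  simp [hf m, hg m, add_smul]

theorem sub (hf : ActsAs v f φ) (hg : ActsAs v g ψ) : ActsAs v (f - g) (φ - ψ) := fun m => by
  simp [hf m, hg m, sub_smul]

theorem mul (hf : ActsAs v f φ) (hg : ActsAs v g ψ) : ActsAs v (f * g) (φ * ψ) := fun m => by
  simp only [coeff_mul, LinearMap.sum_apply, Module.End.mul_apply, Finset.sum_smul]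
  refine Finset.sum_congr rfl fun a _ => ?_
  rw [hg, map_smul, hf, smul_smul, mul_comm]

theorem smul (c : K) (hf : ActsAs v f φ) : ActsAs v (c • f) (c • φ) := fun m => by
  simp [hf m, smul_smul]

theorem one : ActsAs v (1 : (Module.End K V)⟦X⟧) 1 := fun m => by
  simp only [coeff_one]
  split_ifs <;> simp

end ActsAs

open PowerSeries in
/-- If all traces of powers of the last Jucys-Murphy element are nilpotent, then the weights
satisfy a symmetric product identity. -/
theorem prod_weights_eq (hq : q ≠ 0) (hq1 : q ≠ 1) (h : IsHecke q T b) (hb : 0 < b)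
    {v : V} (hv : v ≠ 0) {i : ℕ → K} (hi : ∀ k < b, jm q 1 T k v = i k • v)
    (hnil : ∀ m : ℕ, IsNilpotent (relTrace q T b (jm q 1 T (b - 1) ^ m))) :
    ∏ k ∈ Finset.range b, (1 - Polynomial.C (i k) * Polynomial.X) ^ 2 =
      ∏ k ∈ Finset.range b, ((1 - Polynomial.C (q * i k) * Polynomial.X) *
        (1 - Polynomial.C (q⁻¹ * i k) * Polynomial.X)) := by
  set R : ℕ → (Module.End K V)⟦X⟧ := fun k => mk fun m => jm q 1 T k ^ m with hRdef
  have hR k : R k * (1 - X * jm q 1 (fun k => (C (T k) : (Module.End K V)⟦X⟧)) k) = 1 := by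
    rw [jm_C]
    ext m : 1
    rcases m with - | m
    · simp [R]
    · rw [mul_sub, mul_one, ← mul_assoc]
      simp [R, coeff_mul_C, coeff_succ_mul_X, pow_succ, coeff_one]
  have hR' k : (1 - X * jm q 1 (fun k => (C (T k) : (Module.End K V)⟦X⟧)) k) * R k = 1 := by
    rw [jm_C]
    ext m : 1
    rcases m with - | m
    · simp [R]
    · rw [sub_mul, one_mul, mul_assoc]
      simp [R, coeff_C_mul, coeff_succ_X_mul, pow_succ', coeff_one]
  set r : ℕ → K⟦X⟧ := fun k => mk fun m => i k ^ m with hrdef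
  have hr k : r k * (1 - C (i k) * X) = 1 := by
    ext m : 1
    rcases m with - | m
    · simp [r]
    · rw [mul_sub, mul_one, ← mul_assoc, mul_comm (r k), mul_assoc]
      simp [r, coeff_C_mul, coeff_succ_mul_X, pow_succ', coeff_one]
  have hacts k (hk : k < b) : ActsAs v (R k) (r k) := fun m => by
    simp only [R, r, coeff_mk]
    induction m with
    | zero => simp
    | succ m ih => rw [pow_succ, Module.End.mul_apply, hi k hk, map_smul, ih, smul_smul, pow_succ']
  have hi0 : i 0 = 1 := by
    have := hi 0 hb
    rw [jm, Module.End.one_apply] at this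
    have h2 : (i 0 - 1) • v = 0 := by rw [sub_smul, ← this]; simp
    exact sub_eq_zero.mp ((smul_eq_zero.mp h2).resolve_right hv)
  have hq' : (1 : K) - q⁻¹ ≠ 0 := by
    rw [sub_ne_zero]; intro h; exact hq1 (inv_eq_one.mp h.symm)
  have key : ∀ n, n < b → ∃ p : K⟦X⟧,
      ActsAs v (relTrace q (fun k => C (T k)) (n + 1) (R n)) p ∧
      (∏ k ∈ Finset.range (n + 1), (1 - C (i k) * X) ^ 2) * (C ((q - 1) ^ 2) * X * p - C q * (1 -
          X))
        = (∏ k ∈ Finset.range (n + 1), ((1 - C (q * i k) * X) * (1 - C (q⁻¹ * i k) * X))) *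
          (- (C q * (1 - X))) := by
    intro n
    induction n with
    | zero =>
      intro _
      refine ⟨r 0, ?_, ?_⟩
      · simpa [relTrace] using hacts 0 hb
      · have h0 := hr 0
        have hqq : C q * C q⁻¹ = (1 : K⟦X⟧) := by rw [← map_mul, mul_inv_cancel₀ hq, map_one]
        simp only [hi0, map_one, one_mul] at h0
        simp only [zero_add, Finset.prod_range_one, hi0, map_one, one_mul, mul_one, map_pow,
            map_sub]
        linear_combination (C q - 1) ^ 2 * X * (1 - X) * h0 - (1 - X) * (X - C q * X ^ 2) * hqq
    | succ n ih =>
      intro hn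
      obtain ⟨p, hp, hpe⟩ := ih (by omega)
      have hrec := relTrace_resolvent hq h.C (fun a => (commute_X a).symm) R hR hR' hn
      set t : K := (1 - q⁻¹)⁻¹ * (i (n + 1) - 1) with ht
      have hθ : ActsAs v (relTrace q (fun k => (C (T k) : (Module.End K V)⟦X⟧)) (n + 1) (C (T n)))
          (C t) := by
        intro m
        rw [coeff_relTrace, coeff_C, coeff_C]
        have h1 := one_add_relTrace hq h hn
        rw [Nat.add_sub_cancel] at h1
        split_ifs
        · have h2 := hi (n + 1) hn
          rw [← h1] at h2
          simp only [LinearMap.add_apply, Module.End.one_apply, LinearMap.smul_apply] at h2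
          rw [ht, mul_smul, eq_inv_smul_iff₀ hq', sub_smul (i (n + 1)), ← h2, one_smul,
            add_sub_cancel_left]
        · have := relTrace_smul (q := q) (T := T) (b := n + 1) (0 : K) 0
          rw [smul_zero, zero_smul] at this
          rw [this, LinearMap.zero_apply, zero_smul]
      have hrn := hacts (n + 1) hn
      refine ⟨_, hrec ▸ (hrn.add hp).add (((hrn.mul ((hθ.mul hrn).sub
        ((hp.mul (hrn.sub ActsAs.one)).smul (q - 1))))).smul (q⁻¹ * (q - 1))), ?_⟩
      rw [Finset.prod_range_succ, Finset.prod_range_succ _ (n + 1)]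
      have ht' : (C q⁻¹ * (C q - 1)) * C t = (C (i (n + 1)) - 1 : K⟦X⟧) := by
        rw [← map_one C, ← map_sub, ← map_mul, ← map_mul, ← map_sub]
        congr 1
        rw [ht]
        field_simp
      have hqq : C q * C q⁻¹ = (1 : K⟦X⟧) := by rw [← map_mul, mul_inv_cancel₀ hq, map_one]
      have h0 := hr (n + 1)
      simp only [smul_eq_C_mul, map_mul, map_sub, map_one, map_pow]  at *
      generalize (C (i (n + 1)) : K⟦X⟧) = I at *
      generalize (C q : K⟦X⟧) = Q at *
      generalize (C q⁻¹ : K⟦X⟧) = Q' at *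
      generalize r (n + 1) = ρ at *
      generalize (C t : K⟦X⟧) = τ at *
      have e1 : (1 - I * X) ^ 2 * (ρ + p + Q' * (Q - 1) * (ρ * (τ * ρ - (Q - 1) * (p * (ρ - 1))))) =
          I * (1 - X) + p * ((1 - Q * I * X) * (1 - Q' * I * X)) := by
        have e2 : (1 - I * X) * ρ = 1 := by rw [mul_comm]; exact h0
        have e3 : (1 - I * X) * (ρ - 1) = I * X := by rw [mul_sub, e2]; ring
        calc _ = (1 - I * X) * ((1 - I * X) * ρ) + (1 - I * X) ^ 2 * p + Q' * (Q - 1) *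
                (((1 - I * X) * ρ) * (τ * ((1 - I * X) * ρ) - (Q - 1) *
                  (p * ((1 - I * X) * (ρ - 1))))) := by ring
          _ = _ := by
            rw [e2, e3]
            linear_combination ht' + p * (I * X * (2 - Q) - I ^ 2 * X ^ 2) * hqq
      generalize (∏ k ∈ Finset.range (n + 1), (1 - C (i k) * X : K⟦X⟧) ^ 2) = A at *
      generalize (∏ k ∈ Finset.range (n + 1),
        ((1 - Q * C (i k) * X : K⟦X⟧) * (1 - Q' * C (i k) * X))) = B at *
      linear_combination A * (Q - 1) ^ 2 * X * e1 + (1 - Q * I * X) * (1 - Q' * I * X) * hpe +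
        A * (1 - X) * (Q * I ^ 2 * X ^ 2 - I * X) * hqq
  obtain ⟨p, hp, hpe⟩ := key (b - 1) (by omega)
  have hp0 : p = 0 := by
    ext m
    have h1 := hp m
    rw [coeff_relTrace, Nat.sub_add_cancel hb, coeff_mk] at h1
    obtain ⟨s, hs⟩ := hnil m
    have h2 : ∀ s, (relTrace q T b (jm q 1 T (b - 1) ^ m) ^ s) v = (coeff m p) ^ s • v := by
      intro s
      induction s with
      | zero => simp
      | succ s ih => rw [pow_succ, Module.End.mul_apply, h1, map_smul, ih, smul_smul, pow_succ']
    have h3 := h2 s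
    rw [hs, LinearMap.zero_apply] at h3
    exact eq_zero_of_pow_eq_zero ((smul_eq_zero.mp h3.symm).resolve_right hv)
  rw [hp0, mul_zero, zero_sub, Nat.sub_add_cancel hb] at hpe
  have hne : -(C q * (1 - X) : K⟦X⟧) ≠ 0 := by
    intro h0
    have := congrArg (coeff 0) h0
    simp [hq] at this
  have := mul_right_cancel₀ hne hpe
  apply Polynomial.coe_injective K
  have hc (f : Polynomial K) : Polynomial.coeToPowerSeries.ringHom f = (f : K⟦X⟧) := rfl
  rw [← hc, ← hc, map_prod, map_prod]
  simpa [hc] using this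

end weights

section weightCounts

open Polynomial

variable {K : Type*} [Field K] {q : K} {b : ℕ} {i : ℕ → K}

open Classical in
theorem two_mul_count_weights (hq : q ≠ 0) (hi : ∀ k < b, i k ≠ 0)
    (h : ∏ k ∈ Finset.range b, (1 - C (i k) * X) ^ 2 =
      ∏ k ∈ Finset.range b, ((1 - C (q * i k) * X) * (1 - C (q⁻¹ * i k) * X))) (r : K) :
    2 * (Finset.filter (fun k => i k = r) (Finset.range b)).card =
      (Finset.filter (fun k => i k = q⁻¹ * r) (Finset.range b)).card +
      (Finset.filter (fun k => i k = q * r) (Finset.range b)).card := by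
  have hroots {a : K} (ha : a ≠ 0) : (1 - C a * X : K[X]).roots = {a⁻¹} := by
    have : (1 - C a * X : K[X]) = C (-a) * (X - C a⁻¹) := by
      rw [mul_sub, ← C_mul]
      simp [ha]
      ring
    rw [this, roots_C_mul _ (neg_ne_zero.mpr ha), roots_X_sub_C]
  have hne {a : K} : (1 - C a * X : K[X]) ≠ 0 := by
    intro h0
    have := congrArg (coeff · 0) h0
    simp at this
  have h1 := congrArg (fun p => Multiset.count r⁻¹ p.roots) h
  beta_reduce at h1
  rw [roots_prod _ _ (Finset.prod_ne_zero_iff.mpr fun k _ => pow_ne_zero _ hne),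
    roots_prod _ _ (Finset.prod_ne_zero_iff.mpr fun k _ => mul_ne_zero hne hne),
    Multiset.count_bind, Multiset.count_bind] at h1
  change ∑ k ∈ Finset.range b, _ = ∑ k ∈ Finset.range b, _ at h1
  rw [Finset.card_filter, Finset.card_filter, Finset.card_filter, ← Finset.sum_add_distrib,
    Finset.mul_sum]
  refine Eq.trans ?_ (h1.trans ?_)
  · refine Finset.sum_congr rfl fun k hk => ?_
    rw [roots_pow, hroots (hi k (by simpa using hk)), Multiset.count_nsmul,
      Multiset.count_singleton]
    simp [eq_comm]
  · refine Finset.sum_congr rfl fun k hk => ?_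
    have hk := hi k (by simpa using hk)
    rw [roots_mul (mul_ne_zero hne hne), hroots (mul_ne_zero hq hk),
      hroots (mul_ne_zero (inv_ne_zero hq) hk), Multiset.count_add, Multiset.count_singleton,
      Multiset.count_singleton]
    congr 1 <;> congr 1 <;> rw [inv_inj, eq_iff_iff]
    · rw [eq_inv_mul_iff_mul_eq₀ hq, eq_comm]
    · rw [eq_inv_mul_iff_mul_eq₀ hq, eq_comm]

theorem eq_const_of_two_mul_eq {h : ℤ → ℕ} (h2 : ∀ m, 2 * h m = h (m - 1) + h (m + 1)) (m : ℤ) :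
    h m = h 0 := by
  set c : ℤ := h 1 - h 0 with hc
  have key : ∀ m : ℤ, (h m : ℤ) = h 0 + m * c ∧ (h (m + 1) : ℤ) = h 0 + (m + 1) * c := by
    intro m
    induction m using Int.induction_on with
    | zero => simp [hc]
    | succ m ih =>
      have := h2 (m + 1)
      rw [add_sub_cancel_right] at this
      refine ⟨ih.2, ?_⟩
      zify at this
      linarith
    | pred m ih =>
      have := h2 (-m)
      rw [sub_add_cancel]
      zify at this
      refine ⟨?_, ?_⟩ <;> linarith
  have hc0 : c = 0 := by
    by_contra hne
    rcases lt_or_gt_of_ne hne with h0 | h0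
    · have := (key (h 0 + 1)).1
      nlinarith [Int.natCast_nonneg (h (h 0 + 1))]
    · have := (key (-(h 0 + 1))).1
      nlinarith [Int.natCast_nonneg (h (-(h 0 + 1)))]
  have := (key m).1
  rw [hc0] at this
  simpa using this

open Classical in
theorem orderOf_dvd_of_prod_weights (hq : q ≠ 0) (hb : 0 < b) (h0 : i 0 = 1)
    (hi : ∀ k < b, ∃ m : ℤ, i k = q ^ m)
    (h : ∏ k ∈ Finset.range b, (1 - C (i k) * X) ^ 2 =
      ∏ k ∈ Finset.range b, ((1 - C (q * i k) * X) * (1 - C (q⁻¹ * i k) * X))) :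
    0 < orderOf q ∧ orderOf q ∣ b ∧
      (b = orderOf q → ∀ k < b, ∀ l < b, i k = i l → k = l) := by
  set γ : K → ℕ := fun r => (Finset.filter (fun k => i k = r) (Finset.range b)).card with hγ
  have hγ2 : ∀ m : ℤ, γ (q ^ m) = γ 1 := by
    intro m
    have := eq_const_of_two_mul_eq (h := fun m : ℤ => γ (q ^ m)) (fun m => by
      have := two_mul_count_weights hq (fun k hk => by
        obtain ⟨m, hm⟩ := hi k hk
        rw [hm]
        exact zpow_ne_zero _ hq) h (q ^ m)
      simp only [hγ]
      rw [this, zpow_sub_one₀ hq, zpow_add_one₀ hq, mul_comm (q ^ m), mul_comm (q ^ m)]) m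
    simpa using this
  have hγ1 : 0 < γ 1 := Finset.card_pos.mpr ⟨0, by simp [hb, h0]⟩
  have he : 0 < orderOf q := by
    by_contra he
    have he : orderOf q = 0 := by omega
    have hex : ∀ m : ℕ, ∃ k < b, i k = q ^ m := by
      intro m
      have := hγ2 m
      have : 0 < γ (q ^ m) := by rw [← zpow_natCast, this]; exact hγ1
      obtain ⟨k, hk⟩ := Finset.card_pos.mp this
      simp only [Finset.mem_filter, Finset.mem_range] at hk
      exact ⟨k, hk⟩
    choose f hf hf' using hex
    obtain ⟨x, -, y, -, hxy, hfxy⟩ := Finset.exists_ne_map_eq_of_card_lt_of_maps_to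
      (s := Finset.range (b + 1)) (t := Finset.range b) (f := f) (by simp)
      (fun m _ => by simpa using hf m)
    have h1 : q ^ x = q ^ y := by rw [← hf', ← hf', hfxy]
    have hinj {x y : ℕ} (hlt : x < y) (h1 : q ^ x = q ^ y) : False := by
      have h2 : q ^ (y - x) = 1 := by
        have h3 : q ^ x * q ^ (y - x) = q ^ x * 1 := by
          rw [← pow_add, Nat.add_sub_cancel' hlt.le, h1, mul_one]
        exact mul_left_cancel₀ (pow_ne_zero _ hq) h3
      have := orderOf_dvd_of_pow_eq_one h2
      rw [he, zero_dvd_iff] at this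
      omega
    rcases lt_or_gt_of_ne hxy with hlt | hlt
    · exact hinj hlt h1
    · exact hinj hlt h1.symm
  have hcount : b = orderOf q * γ 1 := by
    have h1 := Finset.card_eq_sum_card_fiberwise (f := i) (s := Finset.range b)
      (t := (Finset.range (orderOf q)).image (q ^ ·)) (fun k hk => by
        simp only [Finset.coe_range, Set.mem_Iio] at hk
        obtain ⟨m, hm⟩ := hi k hk
        simp only [Finset.coe_image, Finset.coe_range, Set.mem_image, Set.mem_Iio]
        have hpos : (0 : ℤ) < orderOf q := by exact_mod_cast he
        refine ⟨(m % orderOf q).toNat, ?_, ?_⟩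
        · have := Int.emod_lt_of_pos m hpos
          have := Int.emod_nonneg m hpos.ne'
          omega
        · rw [hm, ← zpow_natCast, Int.toNat_of_nonneg (Int.emod_nonneg m hpos.ne')]
          have h2 := Int.emod_add_mul_ediv m (orderOf q)
          conv_rhs => rw [← h2]
          rw [zpow_add₀ hq, zpow_mul, zpow_natCast q (orderOf q), pow_orderOf_eq_one, one_zpow,
            mul_one])
    rw [Finset.card_range, Finset.sum_image (fun x hx y hy hxy =>
      pow_injOn_Iio_orderOf (by simpa using hx) (by simpa using hy) hxy)] at h1
    rw [h1]
    have : ∀ m ∈ Finset.range (orderOf q), γ (q ^ m) = γ 1 := fun m _ => by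
      have := hγ2 m
      rwa [zpow_natCast] at this
    rw [Finset.sum_congr rfl this]
    simp
  refine ⟨he, ⟨_, hcount⟩, fun hbe k hk l hl hkl => ?_⟩
  have h1 : γ 1 = 1 := by
    rw [hbe] at hcount
    exact (Nat.eq_of_mul_eq_mul_left he (by simpa using hcount)).symm
  obtain ⟨m, hm⟩ := hi k hk
  have h2 : γ (i k) = 1 := by rw [hm, hγ2, h1]
  rw [Finset.card_eq_one] at h2
  obtain ⟨a, ha⟩ := h2
  have hk' : k ∈ ({a} : Finset ℕ) := ha ▸ by simp [hk]
  have hl' : l ∈ ({a} : Finset ℕ) := ha ▸ by simp [hl, hkl]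
  simp at hk' hl'
  rw [hk', hl']

end weightCounts

section spectrum

open Polynomial

variable {K V : Type*} [Field K] [AddCommGroup V] [Module K V]

/-- The operator `y` is annihilated by a product of linear factors with roots in `R`. -/
def SpecIn {A : Type*} [Ring A] [Algebra K A] (R : Set K) (y : A) : Prop :=
  ∃ l : List K, (∀ r ∈ l, r ∈ R) ∧ aeval y (l.map fun r => X - C r).prod = 0

theorem SpecIn.exists_eigenvector {R : Set K} {y : Module.End K V} (h : SpecIn R y) {v : V}
    (hv : v ≠ 0) : ∃ g : K[X], ∃ r ∈ R, aeval y g v ≠ 0 ∧ y (aeval y g v) = r • aeval y g v := by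
  obtain ⟨l, hl, h0⟩ := h
  replace h0 : aeval y (l.map fun r => X - C r).prod v = 0 := by rw [h0, LinearMap.zero_apply]
  induction l generalizing v with
  | nil => simp at h0; exact absurd h0 hv
  | cons r l ih =>
    by_cases hr : y v = r • v
    · exact ⟨1, r, hl r (by simp), by simpa using hv, by simpa using hr⟩
    · obtain ⟨g, s, hs, hg, hg'⟩ := ih (v := aeval y (X - C r) v)
        (by simpa [sub_eq_zero, Module.algebraMap_end_apply] using hr)
        (fun s hs => hl s (by simp [hs])) (by
          rw [← Module.End.mul_apply, ← map_mul, mul_comm]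
          simpa using h0)
      refine ⟨g * (X - C r), s, hs, ?_⟩
      rw [map_mul, Module.End.mul_apply]
      exact ⟨hg, hg'⟩

theorem SemiconjBy.aeval {A : Type*} [Ring A] [Algebra K A] {a y z : A} (h : SemiconjBy a y z)
    (g : K[X]) : SemiconjBy a (Polynomial.aeval y g) (Polynomial.aeval z g) := by
  induction g using Polynomial.induction_on' with
  | add p q hp hq => rw [map_add, map_add]; exact hp.add_right hq
  | monomial n c =>
    rw [aeval_monomial, aeval_monomial]
    exact (Algebra.commute_algebraMap_right c a).semiconjBy.mul_right (h.pow_right n)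

theorem Commute.aeval_right {A : Type*} [Ring A] [Algebra K A] {a y : A} (h : Commute a y)
    (g : K[X]) : Commute a (aeval y g) := SemiconjBy.aeval h g

theorem aeval_apply_mem {y : Module.End K V} {P : Submodule K V} (hP : ∀ v ∈ P, y v ∈ P)
    (g : K[X]) {v : V} (hv : v ∈ P) : aeval y g v ∈ P :=
  Polynomial.aeval_apply_smul_mem_of_le_comap (q := P) hv g y hP

/-- A stable subspace of a commuting family contains a simultaneous eigenvector. -/
theorem exists_weight_vector {R : Set K} {L : ℕ → Module.End K V} {b : ℕ}
    (hc : ∀ i < b, ∀ j < b, Commute (L i) (L j)) (hL : ∀ k < b, SpecIn R (L k))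
    {P : Submodule K V} (hP : ∀ k < b, ∀ v ∈ P, L k v ∈ P) (h0 : P ≠ ⊥) :
    ∃ v ∈ P, v ≠ 0 ∧ ∃ i : ℕ → K, ∀ k < b, i k ∈ R ∧ L k v = i k • v := by
  suffices ∀ m ≤ b, ∃ v ∈ P, v ≠ 0 ∧ ∃ i : ℕ → K, ∀ k < m, i k ∈ R ∧ L k v = i k • v from
    this b le_rfl
  intro m
  induction m with
  | zero =>
    intro _
    obtain ⟨v, hv, hv0⟩ := Submodule.exists_mem_ne_zero_of_ne_bot h0
    exact ⟨v, hv, hv0, 0, by simp⟩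
  | succ m ih =>
    intro hm
    obtain ⟨v, hv, hv0, i, hi⟩ := ih (by omega)
    obtain ⟨g, r, hr, hg, hg'⟩ := (hL m hm).exists_eigenvector hv0
    refine ⟨aeval (L m) g v, ?_, hg, Function.update i m r, fun k hk => ?_⟩
    · exact aeval_apply_mem (hP m hm) g hv
    · rcases Nat.lt_succ_iff_lt_or_eq.mp hk with hk | rfl
      · rw [Function.update_of_ne hk.ne]
        refine ⟨(hi k hk).1, ?_⟩
        have h1 := (hc k (by omega) m (by omega)).aeval_right g
        rw [← Module.End.mul_apply, h1.eq, Module.End.mul_apply, (hi k hk).2, map_smul]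
      · simpa using ⟨hr, hg'⟩

theorem aeval_eq_zero_of_intertwiner {x y : Module.End K V} {q : K} {l : List K} {v : V}
    (hc : Commute x y) (hq : (q • x - y) ((q • y - x) v) = 0)
    (hx : aeval x (l.map fun r => X - C r).prod v = 0) :
    aeval y (l.map fun r => (C (q * r) - X) * (C q * X - C r)).prod v = 0 := by
  induction l generalizing v with
  | nil => simpa using hx
  | cons r l ih =>
    set G : K[X] := (l.map fun r => (C (q * r) - X) * (C q * X - C r)).prod with hG
    have hcG : Commute x (aeval y G) := hc.aeval_right G
    have hyG : Commute y (aeval y G) := (Commute.refl y).aeval_right G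
    have h1 := ih (v := x v - r • v) (by
      have e : x v - r • v = (x - r • 1 : Module.End K V) v := by simp
      have h1 : Commute (x - r • 1) (q • y - x) :=
        ((hc.smul_right q).sub_right (Commute.refl x)).sub_left
          ((Commute.one_left _).smul_left r)
      have h2 : Commute (x - r • 1) (q • x - y) :=
        (((Commute.refl x).smul_right q).sub_right hc).sub_left
          ((Commute.one_left _).smul_left r)
      have h3 := LinearMap.congr_fun (h2.mul_right h1).eq v
      simp only [Module.End.mul_apply] at h3
      rw [e, ← h3, hq, map_zero]) (by
      have e : x v - r • v = aeval x (X - C r) v := by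
        simp [Module.algebraMap_end_apply]
      rw [e, ← Module.End.mul_apply, ← map_mul, mul_comm]
      simpa using hx)
    set w := aeval y G v with hw
    have hxw : x w = r • w := by
      rw [hw, ← Module.End.mul_apply, hcG.eq, Module.End.mul_apply, ← map_smul, ← sub_eq_zero,
        ← map_sub, h1]
    have hxyw : x (y w) = r • y w := by
      rw [← Module.End.mul_apply, hc.eq, Module.End.mul_apply, hxw, map_smul]
    have h2 : (q • x - y) ((q • y - x) w) = 0 := by
      have e1 : Commute (aeval y G) (q • y - x) :=
        ((hyG.symm.smul_right q).sub_right hcG.symm)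
      have e2 : Commute (aeval y G) (q • x - y) :=
        ((hcG.symm.smul_right q).sub_right hyG.symm)
      have h3 := LinearMap.congr_fun (e2.mul_right e1).eq v
      simp only [Module.End.mul_apply] at h3
      rw [hw, ← h3, hq, map_zero]
    rw [List.map_cons, List.prod_cons, ← hG, map_mul, Module.End.mul_apply, ← hw]
    simp only [LinearMap.sub_apply, LinearMap.smul_apply, map_sub, map_smul, hxw, hxyw] at h2
    simp only [map_mul, map_sub, aeval_C, aeval_X, Module.End.mul_apply, LinearMap.sub_apply,
      Module.algebraMap_end_apply, map_smul]
    rw [← h2]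
    module

end spectrum

namespace IsHecke

variable {K V : Type*} [Field K] [AddCommGroup V] [Module K V] {q : K} {x : Module.End K V}
  {T : ℕ → Module.End K V} {b : ℕ}

/-- The intertwiner exchanging two consecutive Jucys-Murphy elements. -/
def _root_.intertwiner {A : Type*} [Ring A] [Algebra K A] (q : K) (x : A) (T : ℕ → A) (k : ℕ) : A :=
  T k * jm q x T k - jm q x T k * T k

theorem intertwiner_eq (hq : q ≠ 0) (h : IsHecke q T b) {k : ℕ} (hk : k + 1 < b) :
    intertwiner q x T k =
      T k * (jm q x T k - jm q x T (k + 1)) + (q - 1) • jm q x T (k + 1) := by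
  rw [intertwiner, mul_sub, h.mul_jm_succ hq hk]
  abel

theorem semiconjBy_intertwiner_succ (hq : q ≠ 0) (h : IsHecke q T b) (hx : IsJMStart x T b) {k : ℕ}
    (hk : k + 1 < b) :
    SemiconjBy (intertwiner q x T k) (jm q x T (k + 1)) (jm q x T k) := by
  have e2 := h.mul_jm_succ (x := x) hq hk
  have hc := h.commute_jm_jm hx (show k < b by omega) hk
  rw [h.intertwiner_eq hq hk]
  generalize jm q x T k = L at *
  generalize jm q x T (k + 1) = M at *
  have e3 : L * T k = T k * M - (q - 1) • M := by rw [e2, add_sub_cancel_right]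
  rw [SemiconjBy, mul_add, mul_smul_comm, ← mul_assoc, e3, hc.eq]
  simp only [mul_sub, sub_mul, add_mul, smul_mul_assoc, mul_assoc, hc.eq]
  abel

theorem intertwiner_mul_self (hq : q ≠ 0) (h : IsHecke q T b) (hx : IsJMStart x T b) {k : ℕ}
    (hk : k + 1 < b) : intertwiner q x T k * intertwiner q x T k =
      (q • jm q x T k - jm q x T (k + 1)) * (q • jm q x T (k + 1) - jm q x T k) := by
  have e1 := h.jm_succ_mul (x := x) hq hk
  have e2 := h.mul_jm_succ (x := x) hq hk
  have hc := h.commute_jm_jm hx (show k < b by omega) hk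
  have hquad := h.quad k hk
  have hΦ := h.intertwiner_eq (x := x) hq hk
  set L := jm q x T k with hL
  set M := jm q x T (k + 1) with hM
  set Φ := intertwiner q x T k
  have e3 : T k * L = M * T k - (q - 1) • M := by rw [e1, add_sub_cancel_right]
  have e5 : Φ = (M - L) * T k - (q - 1) • M := by
    rw [hΦ, mul_sub, e3, e2, sub_mul]
    abel
  have e6 : Φ * Φ = (M - L) * (T k * T k) * (L - M) + (q - 1) • ((M - L) * (T k * M)) -
      (q - 1) • (M * (T k * L) - M * (T k * M)) - ((q - 1) * (q - 1)) • (M * M) := by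
    nth_rewrite 1 [e5]
    rw [hΦ]
    simp only [mul_sub, sub_mul, mul_add, smul_mul_assoc, mul_smul_comm, smul_sub,
      mul_assoc]
    module
  have e7 : (M - L) * (T k * T k) * (L - M) = (q - 1) • ((M - L) * (T k * L - T k * M)) +
      q • ((M - L) * (L - M)) := by
    rw [hquad, mul_add, add_mul, mul_smul_comm, smul_mul_assoc, mul_smul_comm, smul_mul_assoc,
      mul_one, mul_assoc, mul_sub (T k)]
  rw [e6, e7, e2, e3]
  simp only [mul_sub, sub_mul, mul_add, smul_mul_assoc, mul_smul_comm, smul_sub,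
    smul_add, ← mul_assoc, hc.eq]
  module

/-- The roots added when passing to the next Jucys-Murphy element. -/
def _root_.shiftRoots (q : K) (l : List K) : List K := (l.map (q * ·) ++ l.map (q⁻¹ * ·)) ++ l

theorem _root_.mem_of_mem_shiftRoots {R : Set K} (hR : ∀ r ∈ R, q * r ∈ R ∧ q⁻¹ * r ∈ R)
    {l : List K} (hl : ∀ r ∈ l, r ∈ R) : ∀ r ∈ shiftRoots q l, r ∈ R := by
  intro r hr
  simp only [shiftRoots, List.mem_append, List.mem_map] at hr
  rcases hr with (⟨r, hr, rfl⟩ | ⟨r, hr, rfl⟩) | hr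
  exacts [(hR r (hl r hr)).1, (hR r (hl r hr)).2, hl r hr]

theorem aeval_shiftRoots (hq : q ≠ 0) (h : IsHecke q T b) (hx : IsJMStart x T b) {k : ℕ}
    (hk : k + 1 < b) {l : List K}
    (hl0 : Polynomial.aeval (jm q x T k) (l.map fun r => Polynomial.X - Polynomial.C r).prod = 0) :
    Polynomial.aeval (jm q x T (k + 1))
      ((shiftRoots q l).map fun r => Polynomial.X - Polynomial.C r).prod = 0 := by
  have hc := h.commute_jm_jm hx (show k < b by omega) hk
  have hΦ1 := h.semiconjBy_intertwiner_succ hq hx hk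
  have hΦ2 := h.intertwiner_mul_self hq hx hk
  set L := jm q x T k with hL
  set M := jm q x T (k + 1) with hM
  set f := (l.map fun r => Polynomial.X - Polynomial.C r).prod with hf
  set Φ := intertwiner q x T k
  have hΦ3 : Φ * Polynomial.aeval M f = 0 := by
    have : SemiconjBy Φ (Polynomial.aeval M f) (Polynomial.aeval L f) := hΦ1.aeval f
    rw [this.eq, hl0, zero_mul]
  have hprod : ∀ l : List K, ∃ c : K, c ≠ 0 ∧
      (l.map fun r => (Polynomial.C (q * r) - Polynomial.X) *
        (Polynomial.C q * Polynomial.X - Polynomial.C r)).prod = Polynomial.C c *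
      ((l.map (q * ·) ++ l.map (q⁻¹ * ·)).map fun r => Polynomial.X - Polynomial.C r).prod := by
    intro l
    induction l with
    | nil => exact ⟨(1 : K), one_ne_zero, by simp⟩
    | cons r l ihl =>
      obtain ⟨c, hc, hcl⟩ := ihl
      refine ⟨-q * c, mul_ne_zero (neg_ne_zero.mpr hq) hc, ?_⟩
      rw [List.map_cons, List.prod_cons, hcl]
      have e : Polynomial.C q * Polynomial.C q⁻¹ = (1 : Polynomial K) := by
        rw [← Polynomial.C_mul, mul_inv_cancel₀ hq, map_one]
      simp only [List.map_cons, List.map_append, List.prod_cons, List.prod_append,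
        Polynomial.C_mul, Polynomial.C_neg, List.map_map, List.cons_append]
      generalize (List.map _ l : List (Polynomial K)).prod = A
      generalize (List.map _ l : List (Polynomial K)).prod = B
      linear_combination Polynomial.C r * (Polynomial.C q * Polynomial.C r - Polynomial.X) *
        Polynomial.C c * A * B * e
  obtain ⟨c, hc0, hcl⟩ := hprod l
  ext v
  have key := aeval_eq_zero_of_intertwiner (l := l) (v := Polynomial.aeval M f v) hc (by
    rw [← Module.End.mul_apply, ← hΦ2, ← Module.End.mul_apply, mul_assoc, hΦ3, mul_zero,
      LinearMap.zero_apply]) (by rw [← hf, hl0, LinearMap.zero_apply])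
  rw [hcl, map_mul, Polynomial.aeval_C, Module.End.mul_apply, Module.algebraMap_end_apply] at key
  rw [shiftRoots, List.map_append, List.prod_append, map_mul, Module.End.mul_apply, ← hf]
  exact (smul_eq_zero.mp key).resolve_left hc0

theorem specIn_jm (hq : q ≠ 0) (h : IsHecke q T b) (hx : IsJMStart x T b) {R : Set K}
    (hR : ∀ r ∈ R, q * r ∈ R ∧ q⁻¹ * r ∈ R) (h0 : SpecIn R x) {k : ℕ} (hk : k < b) :
    SpecIn R (jm q x T k) := by
  induction k with
  | zero => exact h0
  | succ k ih =>
    obtain ⟨l, hl, hl0⟩ := ih (by omega)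
    exact ⟨shiftRoots q l, mem_of_mem_shiftRoots hR hl, h.aeval_shiftRoots hq hx hk hl0⟩

/-- Adjacent distinct entries of a weight can be exchanged, unless they differ by a factor `q`. -/
theorem exchange (hq : q ≠ 0) (h : IsHecke q T b) (hx : IsJMStart x T b) {k : ℕ} (hk : k + 1 < b)
    {v : V} {y z : K} (hy : jm q x T k v = y • v) (hz : jm q x T (k + 1) v = z • v)
    (hyz : y ≠ z) (hv : v ≠ 0) :
    (∃ (w : V) (c : K), w = T k v - c • v ∧ w ≠ 0 ∧ jm q x T k w = z • w ∧ jm q x T (k + 1) w = y •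
        w ∧
      ∀ j < b, j ≠ k → j ≠ k + 1 → ∀ r : K, jm q x T j v = r • v → jm q x T j w = r • w) ∨
    (T k v = q • v ∧ z = q * y) ∨ (T k v = -v ∧ y = q * z) := by
  have e1 := LinearMap.congr_fun (h.jm_succ_mul (x := x) hq hk) v
  have e2 := LinearMap.congr_fun (h.mul_jm_succ (x := x) hq hk) v
  have e3 := LinearMap.congr_fun (h.quad k hk) v
  simp only [Module.End.mul_apply, LinearMap.add_apply, LinearMap.smul_apply, hy, hz, map_smul,
    Module.End.one_apply] at e1 e2 e3
  have hd : z - y ≠ 0 := sub_ne_zero.mpr hyz.symm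
  obtain ⟨c, hc⟩ : ∃ c, c * (z - y) = (q - 1) * z := ⟨(q - 1) * z / (z - y), by field_simp⟩
  by_cases hw : T k v - c • v = 0
  · right
    rw [sub_eq_zero] at hw
    rw [hw, map_smul, hw] at e3
    have h4 : (c * c - ((q - 1) * c + q)) • v = 0 := by
      rw [sub_smul, add_smul, mul_smul, e3, mul_smul, sub_self]
    have h5 : (c - q) * (c + 1) = 0 := by
      have := (smul_eq_zero.mp h4).resolve_right hv
      linear_combination this
    rcases mul_eq_zero.mp h5 with h6 | h6
    · left
      have : c = q := by linear_combination h6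
      subst this
      exact ⟨hw, by linear_combination hc⟩
    · right
      have : c = -1 := by linear_combination h6
      subst this
      exact ⟨by simpa using hw, by linear_combination hc⟩
  · left
    refine ⟨_, c, rfl, hw, ?_, ?_, fun j hj h1 h2 r hr => ?_⟩
    · have e4 : jm q x T k (T k v) = z • T k v - ((q - 1) * z) • v := by
        rw [mul_smul, e2, add_sub_cancel_right]
      rw [map_sub, map_smul, e4, hy, ← hc]
      module
    · rw [map_sub, map_smul, e1, hz, smul_smul, ← hc]
      module
    · have h3 : Commute (T k) (jm q x T j) := by
        rcases lt_or_gt_of_ne h1 with h1 | h1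
        · exact h.commute_jm_of_lt hx h1 hk
        · exact h.commute_jm_of_gt hx (by omega) hj
      have h4 := LinearMap.congr_fun h3.eq v
      simp only [Module.End.mul_apply] at h4
      rw [map_sub, map_smul, hr, ← h4, hr, map_smul, smul_sub, smul_comm]

end IsHecke

section normalForm

variable {K A : Type*} [Field K] [Ring A] [Algebra K A] {q : K} {T : ℕ → A}

/-- The subalgebra generated by the first `k` generators. -/
def hecke (K : Type*) {A : Type*} [Field K] [Ring A] [Algebra K A] (T : ℕ → A) (k : ℕ) :
    Subalgebra K A := Algebra.adjoin K (T '' Set.Iio k)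

theorem gen_mem_hecke {i k : ℕ} (hi : i < k) : T i ∈ hecke K T k :=
  Algebra.subset_adjoin ⟨i, hi, rfl⟩

theorem downProd_mem_hecke {j m k : ℕ} (h : j + m ≤ k) : downProd T j m ∈ hecke K T k := by
  induction m with
  | zero => exact one_mem _
  | succ m ih => exact mul_mem (gen_mem_hecke (by omega)) (ih (by omega))

theorem hecke_mono {k l : ℕ} (h : k ≤ l) : hecke K T k ≤ hecke K T l :=
  Algebra.adjoin_mono (Set.image_mono (Set.Iio_subset_Iio h))

theorem IsHecke.hecke_succ_le_span {k : ℕ} (h : IsHecke q T (k + 2)) {x : A}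
    (hx : x ∈ hecke K T (k + 1)) : x ∈ Submodule.span K
      {y | ∃ c ∈ hecke K T k, ∃ p ≤ k + 1, y = c * downProd T p (k + 1 - p)} := by
  set W := Submodule.span K
      {y | ∃ c ∈ hecke K T k, ∃ p ≤ k + 1, y = c * downProd T p (k + 1 - p)} with hW
  have mem {c : A} (hc : c ∈ hecke K T k) {p : ℕ} (hp : p ≤ k + 1) :
      c * downProd T p (k + 1 - p) ∈ W := Submodule.subset_span ⟨c, hc, p, hp, rfl⟩
  have hgen : ∀ i < k + 1, ∀ w ∈ W, w * T i ∈ W := by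
    intro i hi w hw
    induction hw using Submodule.span_induction with
    | zero => simp
    | add x y _ _ hx hy => rw [add_mul]; exact add_mem hx hy
    | smul a x _ hx => rw [smul_mul_assoc]; exact W.smul_mem _ hx
    | mem y hy =>
      obtain ⟨c, hc, p, hp, rfl⟩ := hy
      rcases lt_trichotomy (i + 1) p with h1 | h1 | h1
      · rw [mul_assoc, commute_downProd_of_lt h h1 (by omega), ← mul_assoc]
        exact mem (mul_mem hc (gen_mem_hecke (by omega))) hp
      · subst h1
        rw [mul_assoc, ← downProd_succ', show k + 1 - (i + 1) + 1 = k + 1 - i by omega]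
        exact mem hc (by omega)
      · rcases Nat.lt_or_ge p i with h2 | h2
        · obtain ⟨i, rfl⟩ : ∃ i', i = i' + 1 := ⟨i - 1, by omega⟩
          rw [mul_assoc, downProd_mul_of_gt h (by omega) (by omega) (by omega), ← mul_assoc]
          exact mem (mul_mem hc (gen_mem_hecke (by omega))) hp
        · obtain rfl : p = i := by omega
          obtain ⟨m, rfl⟩ : ∃ m, k = p + m := ⟨k - p, by omega⟩
          have e1 : p + m + 1 - p = m + 1 := by omega
          have e2 : p + m + 1 - (p + 1) = m := by omega
          have m1 := mem hc (show p ≤ p + m + 1 by omega)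
          have m2 := mem hc (show p + 1 ≤ p + m + 1 by omega)
          rw [e1] at m1 ⊢
          rw [e2] at m2
          rw [mul_assoc, downProd_mul_self h (by omega), mul_add, mul_smul_comm, mul_smul_comm]
          exact add_mem (W.smul_mem _ m1) (W.smul_mem _ m2)
  have key : ∀ w ∈ W, w * x ∈ W := by
    induction hx using Algebra.adjoin_induction with
    | mem x hx => obtain ⟨i, hi, rfl⟩ := hx; exact hgen i hi
    | algebraMap r =>
      intro w hw
      rw [← Algebra.commutes, ← Algebra.smul_def]
      exact W.smul_mem _ hw
    | add x y _ _ hx hy => intro w hw; rw [mul_add]; exact add_mem (hx w hw) (hy w hw)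
    | mul x y _ _ hx hy => intro w hw; rw [← mul_assoc]; exact hy _ (hx w hw)
  have h1 : (1 : A) ∈ W := by
    simpa [downProd] using mem (one_mem (hecke K T k)) (le_refl (k + 1))
  simpa using key 1 h1

theorem hecke_zero {x : A} (hx : x ∈ hecke K T 0) : ∃ r : K, x = algebraMap K A r := by
  have : hecke K T 0 = ⊥ := by simp [hecke]
  rw [this, Algebra.mem_bot] at hx
  obtain ⟨r, rfl⟩ := hx
  exact ⟨r, rfl⟩

end normalForm

section spanClaim

theorem downProd_add {A : Type*} [Ring A] (T : ℕ → A) (j m l : ℕ) :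
    downProd T j (m + l) = downProd T (j + m) l * downProd T j m := by
  induction l with
  | zero => simp [downProd]
  | succ l ih => rw [← add_assoc, downProd, ih, downProd, mul_assoc, add_assoc]

variable {K V W : Type*} [Field K] [AddCommGroup V] [Module K V] [AddCommGroup W] [Module K W]
  {q : K} {T : ℕ → Module.End K V}

theorem downProd_apply {v : V} {c : K} {j m : ℕ} (h : ∀ i, j ≤ i → i < j + m → T i v = c • v) :
    downProd T j m v = c ^ m • v := by
  induction m with
  | zero => simp [downProd]
  | succ m ih =>
    rw [downProd, Module.End.mul_apply, ih fun i h1 h2 => h i h1 (by omega), map_smul,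
      h (j + m) (by omega) (by omega), smul_smul, pow_succ]

theorem map_downProd {f : V →ₗ[K] W} {c : K} {j m : ℕ}
    (h : ∀ i, j ≤ i → i < j + m → ∀ v, f (T i v) = c • f v) (v : V) :
    f (downProd T j m v) = c ^ m • f v := by
  induction m with
  | zero => simp [downProd]
  | succ m ih =>
    rw [downProd, Module.End.mul_apply, h (j + m) (by omega) (by omega),
      ih fun i h1 h2 => h i h1 (by omega), smul_smul, pow_succ']

theorem eq_zero_of_eq_of_neg (hq : q + 1 ≠ 0) {w : W} (h : q • w = -w) : w = 0 := by
  have : (q + 1) • w = 0 := by rw [add_smul, h, one_smul, neg_add_cancel]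
  exact (smul_eq_zero.mp this).resolve_left hq

theorem apply_mem_span_of_gens {k : ℕ} {v : V} (h : ∀ i < k, ∃ c : K, T i v = c • v)
    {x : Module.End K V} (hx : x ∈ hecke K T k) : ∃ c : K, x v = c • v := by
  induction hx using Algebra.adjoin_induction with
  | mem x hx => obtain ⟨i, hi, rfl⟩ := hx; exact h i hi
  | algebraMap r => exact ⟨r, rfl⟩
  | add x y _ _ hx hy =>
    obtain ⟨c, hc⟩ := hx; obtain ⟨d, hd⟩ := hy
    exact ⟨c + d, by rw [LinearMap.add_apply, hc, hd, add_smul]⟩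
  | mul x y _ _ hx hy =>
    obtain ⟨c, hc⟩ := hx; obtain ⟨d, hd⟩ := hy
    exact ⟨d * c, by rw [Module.End.mul_apply, hd, map_smul, hc, smul_smul]⟩

theorem map_mem_span_of_gens {k : ℕ} {f : V →ₗ[K] W} (h : ∀ i < k, ∃ c : K, ∀ v,
    f (T i v) = c • f v)
    {x : Module.End K V} (hx : x ∈ hecke K T k) : ∃ c : K, ∀ v, f (x v) = c • f v := by
  induction hx using Algebra.adjoin_induction with
  | mem x hx => obtain ⟨i, hi, rfl⟩ := hx; exact h i hi
  | algebraMap r => exact ⟨r, fun v => f.map_smul r v⟩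
  | add x y _ _ hx hy =>
    obtain ⟨c, hc⟩ := hx; obtain ⟨d, hd⟩ := hy
    exact ⟨c + d, fun v => by rw [LinearMap.add_apply, map_add, hc, hd, add_smul]⟩
  | mul x y _ _ hx hy =>
    obtain ⟨c, hc⟩ := hx; obtain ⟨d, hd⟩ := hy
    exact ⟨c * d, fun v => by rw [Module.End.mul_apply, hc, hd, smul_smul]⟩

/-- The eigenvalue of `T i` in the character of the parabolic subalgebra omitting `T (a - 1)`
which is trivial below and alternating above. -/
def typeChar (q : K) (a i : ℕ) : K := if i + 1 < a then q else -1

theorem typeChar_of_lt {a i : ℕ} (h : i + 1 < a) : typeChar q a i = q := if_pos h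

theorem typeChar_of_le {a i : ℕ} (h : a ≤ i + 1) : typeChar q a i = -1 := if_neg (by omega)

theorem IsHecke.map_apply_mem_span {k : ℕ} (h : IsHecke q T (k + 1)) (hq : q + 1 ≠ 0 ∨ k ≤ 1)
    {a b : ℕ} {v : V} {f : V →ₗ[K] W}
    (hv : ∀ i < k, i + 1 ≠ a → T i v = typeChar q a i • v)
    (hf : ∀ i < k, i + 1 ≠ b → ∀ v, f (T i v) = typeChar q b i • f v)
    {x : Module.End K V} (hx : x ∈ hecke K T k) :
    f (x v) ∈ Submodule.span K {w | w = f v ∨ (a = b ∧ w = f (T (a - 1) v))} := by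
  induction k generalizing a v x with
  | zero =>
    obtain ⟨r, rfl⟩ := hecke_zero hx
    rw [Module.algebraMap_end_apply, map_smul]
    exact Submodule.smul_mem _ _ (Submodule.subset_span (Or.inl rfl))
  | succ k ih =>
    have memv : f v ∈ Submodule.span K {w | w = f v ∨ (a = b ∧ w = f (T (a - 1) v))} :=
      Submodule.subset_span (Or.inl rfl)
    by_cases ha : a = 0 ∨ k + 1 < a
    · obtain ⟨c, hc⟩ := apply_mem_span_of_gens (fun i hi => ⟨_, hv i hi (by omega)⟩) hx
      rw [hc, map_smul]
      exact Submodule.smul_mem _ _ memv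
    by_cases hb : b = 0 ∨ k + 1 < b
    · obtain ⟨c, hc⟩ := map_mem_span_of_gens (fun i hi => ⟨_, hf i hi (by omega)⟩) hx
      rw [hc]
      exact Submodule.smul_mem _ _ memv
    have hx' := h.hecke_succ_le_span hx
    clear hx
    induction hx' using Submodule.span_induction with
    | zero => simp
    | add x y _ _ hx hy => rw [LinearMap.add_apply, map_add]; exact add_mem hx hy
    | smul r x _ hx => rw [LinearMap.smul_apply, map_smul]; exact Submodule.smul_mem _ _ hx
    | mem y hy =>
      obtain ⟨c, hc, p, hp, rfl⟩ := hy
      rw [Module.End.mul_apply]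
      have hf' : ∀ i < k, i + 1 ≠ b → ∀ v, f (T i v) = typeChar q b i • f v :=
        fun i hi => hf i (by omega)
      have h' : IsHecke q T (k + 1) := h.mono (by omega)
      have hq' : q + 1 ≠ 0 ∨ k ≤ 1 := hq.imp_right fun h => by omega
      rcases Nat.lt_or_ge p a with hpa | hpa
      · obtain ⟨m, rfl⟩ : ∃ m, a = p + m + 1 := ⟨a - 1 - p, by omega⟩
        obtain ⟨l, rfl⟩ : ∃ l, k = p + m + l := ⟨k - p - m, by omega⟩
        simp only [Nat.add_sub_cancel] at *
        rw [show p + m + l + 1 - p = m + (l + 1) by omega, downProd_add, Module.End.mul_apply,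
          downProd_apply (c := q) (j := p) (m := m) (fun i h1 h2 => by
            rw [hv i (by omega) (by omega), typeChar_of_lt (by omega)]), map_smul, map_smul,
          map_smul]
        refine Submodule.smul_mem _ _ ?_
        set v' := downProd T (p + m) (l + 1) v with hv'
        have hv'' : ∀ i < p + m + l, i + 1 ≠ p + m → T i v' = typeChar q (p + m) i • v' := by
          intro i hi hi'
          rw [hv', ← Module.End.mul_apply]
          rcases Nat.lt_or_ge (i + 1) (p + m) with h1 | h1
          · rw [← commute_downProd_of_lt h h1 (by omega), Module.End.mul_apply,
              hv i (by omega) (by omega), map_smul, typeChar_of_lt (by omega),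
              typeChar_of_lt (by omega)]
          · rw [← downProd_mul_of_gt h (by omega) (by omega) (by omega), Module.End.mul_apply,
              hv (i + 1) (by omega) (by omega), map_smul, typeChar_of_le (by omega),
              typeChar_of_le (by omega)]
        refine Submodule.span_le.mpr ?_ (ih h' hq' hv'' hf' hc)
        rintro w (rfl | ⟨hab, rfl⟩)
        · rcases lt_trichotomy (p + m + 1) b with h1 | h1 | h1
          · have hq1 : q + 1 ≠ 0 := hq.resolve_right (by omega)
            obtain ⟨s, rfl⟩ : ∃ s, b = p + m + 2 + s := ⟨b - (p + m + 2), by omega⟩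
            obtain ⟨t, rfl⟩ : ∃ t, l = s + 1 + t := ⟨l - s - 1, by omega⟩
            rw [hv', show s + 1 + t + 1 = s + 2 + t by omega, downProd_add, Module.End.mul_apply,
              map_downProd (c := -1) (fun i h1 h2 v => by
                rw [hf i (by omega) (by omega), typeChar_of_le (by omega)])]
            have hz : f (downProd T (p + m) (s + 2) v) = 0 := by
              refine eq_zero_of_eq_of_neg hq1 ?_
              have e1 := hf (p + m) (by omega) (by omega) (downProd T (p + m) (s + 2) v)
              rw [typeChar_of_lt (by omega), ← Module.End.mul_apply,
                ← downProd_mul_of_gt h (by omega) (by omega) (by omega), Module.End.mul_apply,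
                hv (p + m + 1) (by omega) (by omega), typeChar_of_le (by omega)] at e1
              rw [← e1]; simp
            rw [hz, smul_zero]
            exact zero_mem _
          · rw [hv', downProd_succ', Module.End.mul_apply,
              map_downProd (c := -1) (fun i h1 h2 v => by
                rw [hf i (by omega) (by omega), typeChar_of_le (by omega)])]
            exact Submodule.smul_mem _ _ (Submodule.subset_span (Or.inr ⟨h1, rfl⟩))
          · rw [hv', map_downProd (c := -1) (fun i h1 h2 v => by
                rw [hf i (by omega) (by omega), typeChar_of_le (by omega)])]
            exact Submodule.smul_mem _ _ memv
        · have hq1 : q + 1 ≠ 0 := hq.resolve_right (by omega)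
          subst hab
          rw [hv', downProd_succ', ← Module.End.mul_apply, ← mul_assoc,
            ← commute_downProd_of_lt h (by omega) (by omega), Module.End.mul_apply,
            Module.End.mul_apply, map_downProd (c := -1) (fun i h1 h2 v => by
                rw [hf i (by omega) (by omega), typeChar_of_le (by omega)])]
          have hz : f (T (p + m - 1) (T (p + m) v)) = 0 := by
            refine eq_zero_of_eq_of_neg hq1 ?_
            have e1 := congrArg f (LinearMap.congr_fun (h.braid (p + m - 1) (by omega)) v)
            rw [show p + m - 1 + 1 = p + m by omega] at e1
            simp only [Module.End.mul_apply] at e1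
            rw [hv (p + m - 1) (by omega) (by omega), hf (p + m) (by omega) (by omega),
              typeChar_of_lt (by omega), typeChar_of_le (by omega)] at e1
            simp only [map_smul] at e1
            rw [e1, neg_one_smul]
          rw [hz, smul_zero]
          exact zero_mem _
      · rw [downProd_apply (c := -1) (fun i h1 h2 => by
            rw [hv i (by omega) (by omega), typeChar_of_le (by omega)]), map_smul, map_smul]
        exact Submodule.smul_mem _ _ (ih h' hq' (fun i hi => hv i (by omega)) hf' hc)

end spanClaim

section symmetrizer

variable {K A M : Type*} [Field K] [Ring A] [Algebra K A] [AddCommGroup M] [Module K M] [Module A M]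
  [IsScalarTower K A M] {q : K} {T : ℕ → A}

/-- The sum of the distinguished left coset representatives of the symmetric group on `k - 1`
strands in the symmetric group on `k` strands. -/
def cosetSum (T : ℕ → A) : ℕ → A
  | 0 => 0
  | k + 1 => 1 + cosetSum T k * T (k - 1)

/-- The quantum integer `1 + q + ⋯ + q ^ (k - 1)`. -/
def quantumInt (q : K) (k : ℕ) : K := ∑ j ∈ Finset.range k, q ^ j

theorem quantumInt_succ (q : K) (k : ℕ) : quantumInt q (k + 1) = 1 + quantumInt q k * q := by
  simp only [quantumInt, Finset.sum_range_succ', pow_succ, ← Finset.sum_mul]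
  simp [add_comm]

theorem quantumInt_mul_sub (q : K) (k : ℕ) : quantumInt q k * (q - 1) = q ^ k - 1 :=
  geom_sum_mul q k

theorem quantumInt_ne_zero {k : ℕ} (hk : 0 < k) (hk' : k < orderOf q) : quantumInt q k ≠ 0 := by
  intro h
  have := quantumInt_mul_sub q k
  rw [h, zero_mul, eq_comm, sub_eq_zero] at this
  exact absurd (Nat.le_of_dvd hk (orderOf_dvd_of_pow_eq_one this)) (by omega)

theorem cosetSum_mem_hecke (k : ℕ) : cosetSum T k ∈ hecke K T (k - 1) := by
  induction k with
  | zero => exact zero_mem _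
  | succ k ih =>
    rcases k with _ | k
    · simp [cosetSum]
    · exact add_mem (one_mem _) (mul_mem (hecke_mono (by omega) ih) (gen_mem_hecke (by omega)))

theorem IsHecke.commute_cosetSum {b k i : ℕ} (h : IsHecke q T b) (hk : k ≤ i) (hi : i + 1 < b) :
    Commute (T i) (cosetSum T k) := by
  induction k with
  | zero => exact Commute.zero_right _
  | succ k ih =>
    rcases k with _ | k
    · simp [cosetSum]
    · exact (Commute.one_right _).add_right
        ((ih (by omega)).mul_right (h.comm k i (by omega) hi).symm)

theorem IsHecke.smul_cosetSum_smul {k : ℕ} (h : IsHecke q T (k + 1)) {v : M}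
    (hv : ∀ i, i + 1 < k → T i • v = q • v) {i : ℕ} (hi : i < k) :
    T i • cosetSum T (k + 1) • v = q • cosetSum T (k + 1) • v := by
  induction k generalizing v i with
  | zero => omega
  | succ k ih =>
    have e : cosetSum T (k + 2) • v = v + cosetSum T (k + 1) • T k • v := by
      rw [cosetSum, add_smul, one_smul, mul_smul]; rfl
    rw [e, smul_add, smul_add]
    rcases Nat.lt_or_ge i k with h1 | h1
    · rw [hv i (by omega), ih (h.mono (by omega)) (fun j hj => ?_) h1]
      rw [← mul_smul, h.comm j k (by omega) (by omega), mul_smul, hv j (by omega),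
          smul_algebra_smul_comm]
    · obtain rfl : i = k := by omega
      have quad : T i • T i • v = (q - 1) • T i • v + q • v := by
        rw [← mul_smul, h.quad i (by omega), add_smul, smul_assoc, smul_assoc, one_smul]
      rcases i with _ | i
      · simp only [cosetSum, zero_mul, add_zero, one_smul]
        rw [quad]
        generalize T 0 • v = w
        module
      · have e2 : cosetSum T (i + 2) • T (i + 1) • v =
            T (i + 1) • v + cosetSum T (i + 1) • T i • T (i + 1) • v := by
          rw [cosetSum, add_smul, one_smul, mul_smul]; rfl
        have e3 : T (i + 1) • cosetSum T (i + 1) • T i • T (i + 1) • v =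
            q • cosetSum T (i + 1) • T i • T (i + 1) • v := by
          rw [← mul_smul, (h.commute_cosetSum le_rfl (by omega)).eq, mul_smul, ← mul_smul (T i),
            ← mul_smul (T (i + 1)), ← mul_assoc, ← h.braid i (by omega), mul_smul, mul_smul,
            hv i (by omega)]
          simp only [smul_algebra_smul_comm, mul_smul]
        rw [e2, smul_add, e3, quad]
        generalize cosetSum T (i + 1) • T i • T (i + 1) • v = u
        generalize T (i + 1) • v = w
        module

theorem cosetSum_smul {k : ℕ} {v : M} (hv : ∀ i, i + 1 < k → T i • v = q • v) :
    cosetSum T k • v = quantumInt q k • v := by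
  induction k with
  | zero => simp [cosetSum, quantumInt]
  | succ k ih =>
    rcases k with _ | k
    · simp [cosetSum, quantumInt]
    · rw [cosetSum, add_smul, mul_smul, one_smul, Nat.add_sub_cancel, hv k (by omega),
        smul_algebra_smul_comm, ih fun i hi => hv i (by omega), quantumInt_succ q (k + 1)]
      module

theorem map_cosetSum_smul {W : Type*} [AddCommGroup W] [Module K W] {f : M →ₗ[K] W} {k : ℕ}
    (hf : ∀ i, i + 1 < k → ∀ v, f (T i • v) = q • f v) (v : M) :
    f (cosetSum T k • v) = quantumInt q k • f v := by
  induction k generalizing v with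
  | zero => simp [cosetSum, quantumInt]
  | succ k ih =>
    rcases k with _ | k
    · simp [cosetSum, quantumInt]
    · rw [cosetSum, add_smul, map_add, mul_smul, one_smul,
        ih fun i hi => hf i (by omega), Nat.add_sub_cancel, hf k (by omega),
        quantumInt_succ q (k + 1)]
      module

/-- The unnormalized symmetrizer on the first `k` strands. -/
def symmetrizer (T : ℕ → A) : ℕ → A
  | 0 => 1
  | k + 1 => cosetSum T (k + 1) * symmetrizer T k

theorem symmetrizer_mem_hecke (k : ℕ) : symmetrizer T k ∈ hecke K T (k - 1) := by
  induction k with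
  | zero => exact one_mem _
  | succ k ih => exact mul_mem (cosetSum_mem_hecke _) (hecke_mono (by omega) ih)

theorem IsHecke.mul_symmetrizer {k i : ℕ} (h : IsHecke q T k) (hi : i + 1 < k) :
    T i * symmetrizer T k = q • symmetrizer T k := by
  induction k generalizing i with
  | zero => omega
  | succ k ih =>
    exact h.smul_cosetSum_smul (v := symmetrizer T k)
      (fun j hj => ih (h.mono (by omega)) hj) (show i < k by omega)

theorem symmetrizer_smul {k : ℕ} {v : M} (hv : ∀ i, i + 1 < k → T i • v = q • v) :
    symmetrizer T k • v = (∏ j ∈ Finset.range k, quantumInt q (j + 1)) • v := by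
  induction k with
  | zero => simp [symmetrizer]
  | succ k ih =>
    rw [symmetrizer, mul_smul, ih fun i hi => hv i (by omega), smul_algebra_smul_comm,
      cosetSum_smul hv, Finset.prod_range_succ, smul_smul]

theorem map_symmetrizer_smul {W : Type*} [AddCommGroup W] [Module K W] {f : M →ₗ[K] W} {k : ℕ}
    (hf : ∀ i, i + 1 < k → ∀ v, f (T i • v) = q • f v) (v : M) :
    f (symmetrizer T k • v) = (∏ j ∈ Finset.range k, quantumInt q (j + 1)) • f v := by
  induction k generalizing v with
  | zero => simp [symmetrizer]
  | succ k ih =>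
    rw [symmetrizer, mul_smul, map_cosetSum_smul hf, ih fun i hi => hf i (by omega),
      Finset.prod_range_succ, smul_smul, mul_comm]

theorem IsHecke.symmetrizer_mul {k i : ℕ} (h : IsHecke q T k) (hk : k < orderOf q)
    (hi : i + 1 < k) : symmetrizer T k * T i = q • symmetrizer T k := by
  set S := symmetrizer T k
  set S' := (symmetrizer (fun k => MulOpposite.op (T k)) k).unop
  have hN : (∏ j ∈ Finset.range k, quantumInt q (j + 1)) ≠ 0 :=
    Finset.prod_ne_zero_iff.mpr fun j hj =>
      quantumInt_ne_zero (by omega) (by have := Finset.mem_range.mp hj; omega)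
  have h1 : ∀ i, i + 1 < k → S' * T i = q • S' := fun i hi =>
    congrArg MulOpposite.unop (h.op.mul_symmetrizer hi)
  have h2 : S' * S = (∏ j ∈ Finset.range k, quantumInt q (j + 1)) • S' := by
    have := map_symmetrizer_smul (T := T) (f := LinearMap.mulLeft K S') (k := k) (q := q)
      (fun i hi v => by simp [← mul_assoc, h1 i hi]) 1
    simpa using this
  have h3 : S' * S = (∏ j ∈ Finset.range k, quantumInt q (j + 1)) • S := by
    have := map_symmetrizer_smul (T := fun k => MulOpposite.op (T k))
      (f := LinearMap.mulLeft K (MulOpposite.op S)) (k := k) (q := q)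
      (fun i hi v => by
        have : MulOpposite.op S * MulOpposite.op (T i) = q • MulOpposite.op S :=
          congrArg MulOpposite.op (h.mul_symmetrizer hi)
        simp [← mul_assoc, this]) 1
    simpa using congrArg MulOpposite.unop this
  have : S = S' := smul_right_injective _ hN (h3.symm.trans h2)
  rw [this, h1 i hi]

theorem commute_of_mem_hecke {k : ℕ} {x z : A} (hz : ∀ j < k, Commute z (T j))
    (hx : x ∈ hecke K T k) : Commute z x := by
  induction hx using Algebra.adjoin_induction with
  | mem x hx => obtain ⟨i, hi, rfl⟩ := hx; exact hz i hi
  | algebraMap r => exact (Algebra.commutes r z).symm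
  | add x y _ _ hx hy => exact hx.add_right hy
  | mul x y _ _ hx hy => exact hx.mul_right hy

/-- The images of the generators under the automorphism exchanging the two one-dimensional
characters and reversing the order of the strands. -/
def mirror (q : K) (T : ℕ → A) (b : ℕ) (k : ℕ) : A := (q - 1) • 1 - T (b - 2 - k)

theorem IsHecke.mirror {b : ℕ} (h : IsHecke q T b) : IsHecke q (mirror q T b) b where
  quad k hk := by
    have := h.quad (b - 2 - k) (by omega)
    simp only [_root_.mirror, sub_mul, mul_sub, this]
    simp only [smul_mul_assoc, mul_smul_comm, one_mul, mul_one]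
    module
  braid k hk := by
    obtain ⟨j, hj⟩ : ∃ j, b - 2 - k = j + 1 := ⟨b - 3 - k, by omega⟩
    have e1 := h.braid j (by omega)
    have e2 := h.quad j (by omega)
    have e3 := h.quad (j + 1) (by omega)
    simp only [_root_.mirror, hj, show b - 2 - (k + 1) = j by omega, sub_mul, mul_sub, e2, e3,
      smul_mul_assoc, mul_smul_comm, one_mul, mul_one]
    rw [e1]
    module
  comm i j hi hj := by
    have := h.comm (b - 2 - j) (b - 2 - i) (by omega) (by omega)
    simp only [_root_.mirror, sub_mul, mul_sub, this, smul_mul_assoc, mul_smul_comm, one_mul,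
      mul_one]
    module

end symmetrizer

section typeProj

variable {K V : Type} [Field K] [AddCommGroup V] [Module K V] {q : K} {T : ℕ → Module.End K V}
  {b a : ℕ}

/-- `v` spans a one-dimensional module of type `a` for the parabolic subalgebra omitting
`T (a - 1)`. -/
def IsTyped (q : K) (T : ℕ → Module.End K V) (b a : ℕ) (v : V) : Prop :=
  ∀ i, i + 1 < b → i + 1 ≠ a → T i v = typeChar q a i • v

/-- `p` factors through the coinvariants of type `a`. -/
def AbsorbsType {W : Type} [AddCommGroup W] [Module K W] (q : K) (T : ℕ → Module.End K V) (b a : ℕ)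
    (p : V →ₗ[K] W) : Prop :=
  ∀ i, i + 1 < b → i + 1 ≠ a → ∀ v, p (T i v) = typeChar q a i • p v

/-- The projection onto the vectors of type `a`. -/
noncomputable def typeProj (q : K) (T : ℕ → Module.End K V) (b a : ℕ) : Module.End K V :=
  if 0 < a ∧ a < b then
    ((∏ j ∈ Finset.range a, quantumInt q (j + 1)) * ∏ j ∈ Finset.range (b - a),
      quantumInt q (j + 1))⁻¹ • (symmetrizer T a * symmetrizer (mirror q T b) (b - a))
  else 0

theorem typeProj_of_not (h : ¬(0 < a ∧ a < b)) : typeProj q T b a = 0 := if_neg h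

theorem mirror_mem_hecke {k : ℕ} (hk : k + 1 < b) : mirror q T b k ∈ hecke K T (b - 1) :=
  sub_mem (Subalgebra.smul_mem _ (one_mem _) _) (gen_mem_hecke (by omega))

theorem typeProj_mem_hecke : typeProj q T b a ∈ hecke K T (b - 1) := by
  rw [typeProj]
  split_ifs with h
  · refine Subalgebra.smul_mem _ (mul_mem (hecke_mono (by omega) (symmetrizer_mem_hecke a)) ?_) _
    have : hecke K (mirror q T b) (b - a - 1) ≤ hecke K T (b - 1) := by
      refine Algebra.adjoin_le ?_
      rintro _ ⟨k, hk, rfl⟩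
      have hk : k < b - a - 1 := hk
      exact mirror_mem_hecke (by omega)
    exact this (symmetrizer_mem_hecke _)
  · exact zero_mem _

theorem prod_quantumInt_ne_zero {k : ℕ} (hk : k < orderOf q) :
    ∏ j ∈ Finset.range k, quantumInt q (j + 1) ≠ 0 :=
  Finset.prod_ne_zero_iff.mpr fun j hj =>
      quantumInt_ne_zero (by omega) (by have := Finset.mem_range.mp hj; omega)

theorem mirror_apply (v : V) (k : ℕ) : mirror q T b k v = (q - 1) • v - T (b - 2 - k) v := by
  simp [mirror]

theorem isTyped_typeProj (h : IsHecke q T b) (v : V) :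
    IsTyped q T b a (typeProj q T b a v) := by
  intro i hi hia
  rw [typeProj]
  split_ifs with ha
  · rw [LinearMap.smul_apply, map_smul, smul_comm]
    congr 1
    rw [← Module.End.mul_apply, ← LinearMap.smul_apply]
    refine LinearMap.congr_fun ?_ v
    rcases Nat.lt_or_ge (i + 1) a with h1 | h1
    · rw [← mul_assoc, (h.mono (by omega)).mul_symmetrizer h1, typeChar_of_lt h1, smul_mul_assoc]
    · rw [← mul_assoc, (commute_of_mem_hecke (K := K) (fun j hj => (h.comm j i (by omega) hi).symm)
        (symmetrizer_mem_hecke (T := T) a)).eq, mul_assoc, typeChar_of_le h1]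
      have := (h.mirror.mono (show b - a ≤ b by omega)).mul_symmetrizer
        (show b - 2 - i + 1 < b - a by omega)
      rw [mirror, show b - 2 - (b - 2 - i) = i by omega, sub_mul, smul_mul_assoc, one_mul,
        sub_eq_iff_eq_add] at this
      rw [eq_sub_iff_add_eq'.mpr this.symm, sub_smul]
      simp
  · simp

theorem absorbsType_typeProj (h : IsHecke q T b) (hb : b ≤ orderOf q) :
    AbsorbsType q T b a (typeProj q T b a) := by
  intro i hi hia v
  rw [typeProj]
  split_ifs with ha
  · rw [LinearMap.smul_apply, LinearMap.smul_apply, smul_comm]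
    congr 1
    rw [← Module.End.mul_apply, ← LinearMap.smul_apply]
    refine LinearMap.congr_fun ?_ v
    rcases Nat.lt_or_ge (i + 1) a with h1 | h1
    · rw [mul_assoc, ← (commute_of_mem_hecke (K := K) (T := mirror q T b) (fun j hj => ?_)
        (symmetrizer_mem_hecke (b - a))).eq, ← mul_assoc, (h.mono (by omega)).symmetrizer_mul
          (by omega) h1, typeChar_of_lt h1, smul_mul_assoc]
      exact (((Commute.one_right _).smul_right _)).sub_right (h.comm i _ (by omega) (by omega))
    · rw [mul_assoc, typeChar_of_le h1]
      have := (h.mirror.mono (show b - a ≤ b by omega)).symmetrizer_mul (by omega)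
        (show b - 2 - i + 1 < b - a by omega)
      rw [mirror, show b - 2 - (b - 2 - i) = i by omega, mul_sub, mul_smul_comm, mul_one,
        sub_eq_iff_eq_add] at this
      rw [eq_sub_iff_add_eq'.mpr this.symm, sub_smul]
      simp
  · simp

theorem typeProj_fix (hb : b ≤ orderOf q) (ha : 0 < a) (hab : a < b) {v : V}
    (hv : IsTyped q T b a v) : typeProj q T b a v = v := by
  have h1 : symmetrizer (mirror q T b) (b - a) v = _ :=
    symmetrizer_smul (A := Module.End K V) (q := q) (T := mirror q T b) (v := v) (k := b - a)
      (fun i hi => by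
      rw [Module.End.smul_def, mirror_apply, hv _ (by omega) (by omega), typeChar_of_le (by omega)]
      module)
  have h2 : symmetrizer T a v = _ :=
    symmetrizer_smul (A := Module.End K V) (q := q) (T := T) (v := v) (k := a)
      (fun i hi => by
      rw [Module.End.smul_def, hv _ (by omega) (by omega), typeChar_of_lt (by omega)])
  rw [typeProj, if_pos ⟨ha, hab⟩, LinearMap.smul_apply, Module.End.mul_apply, h1, map_smul, h2,
    smul_smul, smul_smul, mul_assoc, mul_comm (∏ j ∈ Finset.range (b - a), _), inv_mul_cancel₀,
        one_smul]
  exact mul_ne_zero (prod_quantumInt_ne_zero (by omega)) (prod_quantumInt_ne_zero (by omega))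

theorem AbsorbsType.map_typeProj {W : Type} [AddCommGroup W] [Module K W] (hb : b ≤ orderOf q)
    (ha : 0 < a) (hab : a < b) {p : V →ₗ[K] W} (hp : AbsorbsType q T b a p) (v : V) :
    p (typeProj q T b a v) = p v := by
  have h1 := fun v => map_symmetrizer_smul (A := Module.End K V) (q := q) (T := mirror q T b)
      (v := v) (k := b - a) (f := p) (fun i hi v => by
      rw [Module.End.smul_def, mirror_apply, map_sub, hp _ (by omega) (by omega),
        typeChar_of_le (by omega), map_smul]
      module)
  have h2 := fun v => map_symmetrizer_smul (A := Module.End K V) (q := q) (T := T) (v := v)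
    (k := a) (f := p) (fun i hi v => by
      rw [Module.End.smul_def, hp _ (by omega) (by omega), typeChar_of_lt (by omega)])
  simp only [Module.End.smul_def] at h1 h2
  rw [typeProj, if_pos ⟨ha, hab⟩, LinearMap.smul_apply, map_smul, Module.End.mul_apply, h2, h1,
    smul_smul, smul_smul, mul_assoc, inv_mul_cancel₀, one_smul]
  exact mul_ne_zero (prod_quantumInt_ne_zero (by omega)) (prod_quantumInt_ne_zero (by omega))

end typeProj

section typeRelations

variable {K V W : Type} [Field K] [AddCommGroup V] [Module K V] [AddCommGroup W] [Module K W]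
  {q : K} {T : ℕ → Module.End K V} {T' : ℕ → Module.End K W} {b a : ℕ}

theorem IsTyped.map {φ : V →ₗ[K] W} (hφ : ∀ k, k + 1 < b → ∀ v, φ (T k v) = T' k (φ v)) {v : V}
    (hv : IsTyped q T b a v) : IsTyped q T' b a (φ v) := fun i hi hia => by
  rw [← hφ i hi, hv i hi hia, map_smul]

theorem map_typeProj (h : IsHecke q T b) (h' : IsHecke q T' b) (hb : b ≤ orderOf q)
    {φ : V →ₗ[K] W} (hφ : ∀ k, k + 1 < b → ∀ v, φ (T k v) = T' k (φ v)) (v : V) :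
    φ (typeProj q T b a v) = typeProj q T' b a (φ v) := by
  by_cases ha : 0 < a ∧ a < b
  · have hp : AbsorbsType q T b a (typeProj q T' b a ∘ₗ φ) := fun i hi hia v => by
      rw [LinearMap.comp_apply, hφ i hi, absorbsType_typeProj h' hb i hi hia]; rfl
    rw [← typeProj_fix hb ha.1 ha.2 ((isTyped_typeProj h v).map hφ)]
    exact hp.map_typeProj hb ha.1 ha.2 v
  · simp [typeProj_of_not ha]

theorem typeChar_mirror {i : ℕ} (hi : i + 1 < b) (hia : i + 1 ≠ b - a) (ha : a < b) :
    typeChar q (b - a) i = (q - 1) - typeChar q a (b - 2 - i) := by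
  simp only [typeChar]
  split_ifs <;> first | omega | ring

theorem IsTyped.mirror (ha : a < b) {v : V} (hv : IsTyped q T b a v) :
    IsTyped q (mirror q T b) b (b - a) v := fun i hi hia => by
  rw [mirror_apply, typeChar_mirror hi hia ha, hv _ (by omega) (by omega), sub_smul (q - 1)]

theorem typeProj_mirror (h : IsHecke q T b) (hb : b ≤ orderOf q) (ha : 0 < a) (hab : a < b) :
    typeProj q (mirror q T b) b (b - a) = typeProj q T b a := by
  ext v
  have hp : AbsorbsType q T b a (typeProj q (mirror q T b) b (b - a)) := fun i hi hia v => by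
    have := absorbsType_typeProj h.mirror hb (a := b - a) (b - 2 - i) (by omega) (by omega) v
    rw [mirror_apply, typeChar_mirror (by omega) (by omega) hab,
      show b - 2 - (b - 2 - i) = i by omega, map_sub, map_smul, sub_smul (q - 1)] at this
    exact sub_right_injective this
  rw [← hp.map_typeProj hb ha hab, typeProj_fix hb (by omega) (by omega)
    ((isTyped_typeProj h v).mirror hab)]

/-- The nilpotent endomorphism of the space of vectors of type `a`. -/
noncomputable def typeNil (q : K) (T : ℕ → Module.End K V) (b a : ℕ) : Module.End K V :=
  1 + quantumInt q a • (typeProj q T b a * T (a - 1))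

theorem typeNil_apply (v : V) :
    typeNil q T b a v = v + quantumInt q a • typeProj q T b a (T (a - 1) v) := rfl

theorem isTyped_cosetSum (h : IsHecke q T b) (hab : a + 1 < b) {v : V} (hv : IsTyped q T b a v) :
    IsTyped q T b (a + 1) (cosetSum T (a + 1) v) := fun i hi hia => by
  rcases Nat.lt_or_ge i a with h1 | h1
  · rw [typeChar_of_lt (by omega)]
    exact (h.mono (by omega)).smul_cosetSum_smul (v := v) (fun j hj => by
      rw [Module.End.smul_def, hv j (by omega) (by omega), typeChar_of_lt hj]) h1
  · rw [← Module.End.mul_apply, (h.commute_cosetSum (by omega) hi).eq, Module.End.mul_apply,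
      hv i hi (by omega), typeChar_of_le (by omega), typeChar_of_le (by omega), map_smul]

theorem AbsorbsType.map_cosetSum {p : V →ₗ[K] W} (hab : a < b) (hp : AbsorbsType q T b a p)
    (v : V) : p (cosetSum T a v) = quantumInt q a • p v :=
  map_cosetSum_smul (A := Module.End K V) (fun i hi v => by
    rw [Module.End.smul_def, hp i (by omega) (by omega), typeChar_of_lt hi]) v

theorem quantumInt_smul_typeProj_succ (h : IsHecke q T b) (hb : b ≤ orderOf q) (hab : a + 1 < b)
    {v : V} (hv : IsTyped q T b a v) :
    quantumInt q (a + 1) • typeProj q T b (a + 1) v = cosetSum T (a + 1) v := by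
  rw [← (absorbsType_typeProj h hb).map_cosetSum hab,
    typeProj_fix hb (by omega) hab (isTyped_cosetSum h hab hv)]

theorem typeProj_cosetSum (h : IsHecke q T b) (hb : b ≤ orderOf q) (ha : 0 < a) (hab : a < b)
    {v : V} (hv : IsTyped q T b a v) : typeProj q T b a (cosetSum T (a + 1) v) =
      typeNil q T b a v := by
  rw [cosetSum, LinearMap.add_apply, Module.End.one_apply, map_add, Module.End.mul_apply,
    (absorbsType_typeProj h hb).map_cosetSum hab, typeProj_fix hb ha hab hv, typeNil_apply]

theorem typeProj_typeProj_succ (h : IsHecke q T b) (hb : b ≤ orderOf q) (ha : 0 < a)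
    (hab : a + 1 < b) {v : V} (hv : IsTyped q T b a v) :
    quantumInt q (a + 1) • typeProj q T b a (typeProj q T b (a + 1) v) = typeNil q T b a v := by
  rw [← map_smul, quantumInt_smul_typeProj_succ h hb hab hv,
    typeProj_cosetSum h hb ha (by omega) hv]

theorem add_one_ne_zero_of_lt_orderOf (hq : 2 < orderOf q) : q + 1 ≠ 0 := by
  intro h
  have h1 : q = -1 := eq_neg_of_add_eq_zero_left h
  have : orderOf q ∣ 2 := orderOf_dvd_of_pow_eq_one (by rw [h1]; norm_num)
  exact absurd (Nat.le_of_dvd (by norm_num) this) (by omega)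

theorem typeNil_typeProj_succ (h : IsHecke q T b) (hb : b ≤ orderOf q) (ha : 0 < a)
    (hab : a + 1 < b) {v : V} (hv : IsTyped q T b a v) :
    typeNil q T b (a + 1) (typeProj q T b (a + 1) v) = 0 := by
  obtain ⟨c, rfl⟩ : ∃ c, a = c + 1 := ⟨a - 1, by omega⟩
  have hp := absorbsType_typeProj h hb (a := c + 1 + 1)
  have h0 : typeProj q T b (c + 1 + 1) (T (c + 1) (T c v)) = 0 := by
    refine eq_zero_of_eq_of_neg (add_one_ne_zero_of_lt_orderOf (q := q) (by omega)) ?_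
    have e1 := hp c (by omega) (by omega) (T (c + 1) (T c v))
    have e2 := LinearMap.congr_fun (h.braid c (by omega)) v
    simp only [Module.End.mul_apply] at e2
    rw [e2, hv (c + 1) (by omega) (by omega), typeChar_of_le (by omega), typeChar_of_lt (by omega)]
      at e1
    rw [← e1]; simp
  have hC v : typeProj q T b (c + 1 + 1) (cosetSum T (c + 1) v) = _ :=
    map_cosetSum_smul (A := Module.End K V) (q := q) (k := c + 1) (fun i hi v => by
      rw [Module.End.smul_def, hp i (by omega) (by omega), typeChar_of_lt (by omega)]) v
  have h1 : typeProj q T b (c + 1 + 1) (T (c + 1) (cosetSum T (c + 1 + 1) v)) =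
      -typeProj q T b (c + 1 + 1) v := by
    rw [cosetSum, LinearMap.add_apply, Module.End.mul_apply, map_add, map_add,
      Module.End.one_apply, hv (c + 1) (by omega) (by omega), typeChar_of_le (by omega),
      ← Module.End.mul_apply (T (c + 1)), (h.commute_cosetSum (by omega) (by omega)).eq,
      Module.End.mul_apply, Nat.add_sub_cancel, hC, h0]
    simp
  rw [typeNil_apply, Nat.add_sub_cancel, ← map_smul, ← map_smul,
    quantumInt_smul_typeProj_succ h hb hab hv, h1, add_neg_cancel]

theorem typeNil_mirror (hq : q ≠ 0) (hq1 : q ≠ 1) (h : IsHecke q T b) (hb : b = orderOf q)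
    (ha : 0 < a) (hab : a < b) {v : V} (hv : IsTyped q T b a v) :
    typeNil q (mirror q T b) b (b - a) v = (q ^ a)⁻¹ • typeNil q T b a v := by
  have e : quantumInt q (b - a) = -(q ^ a)⁻¹ * quantumInt q a := by
    refine mul_right_cancel₀ (sub_ne_zero.mpr hq1) ?_
    rw [mul_assoc, quantumInt_mul_sub, quantumInt_mul_sub, pow_sub₀ q hq hab.le, hb,
      pow_orderOf_eq_one]
    have := pow_ne_zero a hq
    field_simp
    ring
  have e' : quantumInt q (b - a) * (q - 1) = (q ^ a)⁻¹ - 1 := by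
    rw [quantumInt_mul_sub, pow_sub₀ q hq hab.le, hb, pow_orderOf_eq_one, one_mul]
  rw [typeNil_apply, typeProj_mirror h hb.le ha hab, mirror_apply,
    show b - 2 - (b - a - 1) = a - 1 by omega, map_sub, map_smul, smul_sub, smul_smul, e', e,
    typeProj_fix hb.le ha hab hv, typeNil_apply]
  module

end typeRelations

section typeRelations

variable {K V : Type} [Field K] [AddCommGroup V] [Module K V] {q : K}
  {T : ℕ → Module.End K V} {b a : ℕ}

/-- The scalar relating `typeNil` at `i` to the composite of the projections to `j` and back. -/
noncomputable def typeConst (q : K) (b i j : ℕ) : K :=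
  if j = i + 1 then (quantumInt q j)⁻¹ else (quantumInt q (b - j))⁻¹ * (q ^ i)⁻¹

theorem typeConst_ne_zero {i j : ℕ} (hq : q ≠ 0) (hb : b = orderOf q) (hj : 0 < j) (hjb : j < b) :
    typeConst q b i j ≠ 0 := by
  unfold typeConst
  split_ifs
  · exact inv_ne_zero (quantumInt_ne_zero hj (by omega))
  · exact mul_ne_zero (inv_ne_zero (quantumInt_ne_zero (by omega) (by omega)))
      (inv_ne_zero (pow_ne_zero _ hq))

theorem typeProj_succ_typeProj (hq : q ≠ 0) (hq1 : q ≠ 1) (h : IsHecke q T b)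
    (hb : b = orderOf q) (ha : 0 < a) (hab : a + 1 < b) {v : V} (hv : IsTyped q T b (a + 1) v) :
    typeProj q T b (a + 1) (typeProj q T b a v) =
      typeConst q b (a + 1) a • typeNil q T b (a + 1) v := by
  have hN : quantumInt q (b - a) ≠ 0 := quantumInt_ne_zero (by omega) (by omega)
  have := typeProj_typeProj_succ h.mirror hb.le (a := b - (a + 1)) (by omega) (by omega)
    (hv.mirror hab)
  rw [show b - (a + 1) + 1 = b - a by omega, typeProj_mirror h hb.le (by omega) hab,
    typeProj_mirror h hb.le ha (by omega), typeNil_mirror hq hq1 h hb (by omega) hab hv] at this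
  rw [typeConst, if_neg (by omega), mul_smul, ← this, smul_smul, inv_mul_cancel₀ hN, one_smul]

theorem typeProj_typeProj_of_adj (hq : q ≠ 0) (hq1 : q ≠ 1) (h : IsHecke q T b)
    (hb : b = orderOf q) {i j : ℕ} (hij : j = i + 1 ∨ i = j + 1) (hi : 0 < i) (hib : i < b)
    (hj : 0 < j) (hjb : j < b) {v : V} (hv : IsTyped q T b i v) :
    typeProj q T b i (typeProj q T b j v) = typeConst q b i j • typeNil q T b i v := by
  rcases hij with rfl | rfl
  · have hN : quantumInt q (i + 1) ≠ 0 := quantumInt_ne_zero (by omega) (by omega)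
    rw [typeConst, if_pos rfl, ← typeProj_typeProj_succ h hb.le hi hjb hv, smul_smul,
      inv_mul_cancel₀ hN, one_smul]
  · exact typeProj_succ_typeProj hq hq1 h hb hj hib hv

theorem typeNil_typeProj_pred (hq : q ≠ 0) (hq1 : q ≠ 1) (h : IsHecke q T b)
    (hb : b = orderOf q) (ha : 0 < a) (hab : a + 1 < b) {v : V} (hv : IsTyped q T b (a + 1) v) :
    typeNil q T b a (typeProj q T b a v) = 0 := by
  have := typeNil_typeProj_succ h.mirror hb.le (a := b - (a + 1)) (by omega) (by omega)
    (hv.mirror hab)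
  rw [show b - (a + 1) + 1 = b - a by omega, typeProj_mirror h hb.le ha (by omega),
    typeNil_mirror hq hq1 h hb ha (by omega) (isTyped_typeProj h v)] at this
  exact (smul_eq_zero.mp this).resolve_left (inv_ne_zero (pow_ne_zero _ hq))

theorem typeProj_succ_typeNil (hq : q ≠ 0) (hq1 : q ≠ 1) (h : IsHecke q T b)
    (hb : b = orderOf q) (ha : 0 < a) (hab : a + 1 < b) {v : V} (hv : IsTyped q T b a v) :
    typeProj q T b (a + 1) (typeNil q T b a v) = 0 := by
  rw [← typeProj_typeProj_succ h hb.le ha hab hv, map_smul,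
    typeProj_succ_typeProj hq hq1 h hb ha hab (isTyped_typeProj h v),
    typeNil_typeProj_succ h hb.le ha hab hv, smul_zero, smul_zero]

theorem typeProj_typeNil_succ (hq : q ≠ 0) (hq1 : q ≠ 1) (h : IsHecke q T b)
    (hb : b = orderOf q) (ha : 0 < a) (hab : a + 1 < b) {v : V} (hv : IsTyped q T b (a + 1) v) :
    typeProj q T b a (typeNil q T b (a + 1) v) = 0 := by
  have hc0 : typeConst q b (a + 1) a ≠ 0 := typeConst_ne_zero hq hb ha (by omega)
  have e1 : typeConst q b (a + 1) a • typeProj q T b a (typeNil q T b (a + 1) v) =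
      typeProj q T b a (typeProj q T b (a + 1) (typeProj q T b a v)) := by
    rw [typeProj_succ_typeProj hq hq1 h hb ha hab hv, map_smul]
  have e2 := typeProj_typeProj_succ h hb.le ha hab (isTyped_typeProj h (a := a) v)
  rw [typeNil_typeProj_pred hq hq1 h hb ha hab hv, ← e1, smul_smul] at e2
  exact (smul_eq_zero.mp e2).resolve_left
    (mul_ne_zero (quantumInt_ne_zero (by omega) (by omega)) hc0)

theorem typeNil_typeNil (hq : q ≠ 0) (hq1 : q ≠ 1) (h : IsHecke q T b)
    (hb : b = orderOf q) (ha : 0 < a) (hab : a < b) {v : V} (hv : IsTyped q T b a v) :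
    typeNil q T b a (typeNil q T b a v) = 0 := by
  rcases Nat.lt_or_ge (a + 1) b with h1 | h1
  · rw [← typeProj_typeProj_succ h hb.le ha h1 hv, map_smul,
      typeNil_typeProj_pred hq hq1 h hb ha h1 (isTyped_typeProj h v), smul_zero]
  rcases Nat.lt_or_ge 1 a with h2 | h2
  · obtain ⟨d, rfl⟩ : ∃ d, a = d + 1 := ⟨a - 1, by omega⟩
    have e1 := typeNil_typeProj_succ h hb.le (a := d) (by omega) hab (isTyped_typeProj h v)
    rw [typeProj_succ_typeProj hq hq1 h hb (by omega) hab hv, map_smul] at e1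
    exact (smul_eq_zero.mp e1).resolve_left (typeConst_ne_zero hq hb (by omega) (by omega))
  · obtain rfl : a = 1 := by omega
    obtain rfl : b = 2 := by omega
    have ht (w : V) : IsTyped q T 2 1 w := fun i hi hi' => by omega
    have h1 (w : V) : typeNil q T 2 1 w = w + T 0 w := by
      rw [typeNil_apply, typeProj_fix hb.le ha hab (ht _)]; simp [quantumInt]
    have hqq : q = -1 := by
      have := pow_orderOf_eq_one q
      rw [← hb] at this
      exact (sq_eq_one_iff.mp this).resolve_left hq1
    have := LinearMap.congr_fun (h.quad 0 (by omega)) v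
    simp only [Module.End.mul_apply, LinearMap.add_apply, LinearMap.smul_apply,
      Module.End.one_apply] at this
    rw [h1, h1, map_add, this, hqq]
    module

theorem typeProj_apply_mem_span (h : IsHecke q T b) (hb : b = orderOf q) {c : ℕ}
    (ha : 0 < a) (hab : a < b) {v : V} (hv : IsTyped q T b a v) {x : Module.End K V}
    (hx : x ∈ hecke K T (b - 1)) : typeProj q T b c (x v) ∈ Submodule.span K
      {w | (a = c ∧ (w = v ∨ w = typeNil q T b a v)) ∨
        ((c = a + 1 ∨ a = c + 1) ∧ w = typeProj q T b c v)} := by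
  by_cases hc : 0 < c ∧ c < b
  swap
  · simp [typeProj_of_not hc]
  have hq : q + 1 ≠ 0 ∨ b - 1 ≤ 1 := by
    rcases Nat.lt_or_ge 2 b with h2 | h2
    · exact Or.inl (add_one_ne_zero_of_lt_orderOf (by omega))
    · exact Or.inr (by omega)
  have hp := absorbsType_typeProj h hb.le (a := c)
  refine Submodule.span_le.mpr ?_ (IsHecke.map_apply_mem_span (T := T) (k := b - 1)
    (h.mono (by omega)) hq (a := a) (b := c) (f := typeProj q T b c)
    (fun i hi hia => hv i (by omega) hia) (fun i hi hic v => hp i (by omega) hic v) hx)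
  rintro w (rfl | ⟨rfl, rfl⟩)
  · rcases lt_trichotomy a c with h1 | rfl | h1
    · rcases Nat.lt_or_ge (a + 1) c with h2 | h2
      · have e1 := hp a (by omega) (by omega) v
        rw [hv a (by omega) (by omega), typeChar_of_le (by omega), typeChar_of_lt (by omega),
          neg_one_smul, map_neg] at e1
        rw [eq_zero_of_eq_of_neg (hq.resolve_right (by omega)) e1.symm]
        exact zero_mem _
      · exact Submodule.subset_span (Or.inr ⟨by omega, rfl⟩)
    · rw [typeProj_fix hb.le ha hab hv]
      exact Submodule.subset_span (Or.inl ⟨rfl, Or.inl rfl⟩)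
    · rcases Nat.lt_or_ge (c + 1) a with h2 | h2
      · have e1 := hp c (by omega) (by omega) v
        rw [hv c (by omega) (by omega), typeChar_of_lt (by omega), typeChar_of_le (by omega),
          neg_one_smul, map_smul] at e1
        rw [eq_zero_of_eq_of_neg (hq.resolve_right (by omega)) e1]
        exact zero_mem _
      · exact Submodule.subset_span (Or.inr ⟨by omega, rfl⟩)
  · have hN : quantumInt q a ≠ 0 := quantumInt_ne_zero (by omega) (by omega)
    have e : typeProj q T b a (T (a - 1) v) =
        (quantumInt q a)⁻¹ • typeNil q T b a v - (quantumInt q a)⁻¹ • v := by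
      rw [typeNil_apply, smul_add, smul_smul, inv_mul_cancel₀ hN]; module
    rw [e]
    exact sub_mem (Submodule.smul_mem _ _ (Submodule.subset_span (Or.inl ⟨rfl, Or.inr rfl⟩)))
      (Submodule.smul_mem _ _ (Submodule.subset_span (Or.inl ⟨rfl, Or.inl rfl⟩)))

end typeRelations

section typeFamily

variable {K V W : Type} [Field K] [AddCommGroup V] [Module K V] [AddCommGroup W] [Module K W]
  {q : K} {T : ℕ → Module.End K V} {T' : ℕ → Module.End K W} {b a : ℕ}

/-- Subspaces stable under `T 0, …, T (b - 2)`. -/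
def IsStable (T : ℕ → Module.End K V) (b : ℕ) (P : Submodule K V) : Prop :=
  ∀ k, k + 1 < b → ∀ v ∈ P, T k v ∈ P

theorem IsStable.inf {P Q : Submodule K V} (hP : IsStable T b P) (hQ : IsStable T b Q) :
    IsStable T b (P ⊓ Q) := fun k hk v hv => ⟨hP k hk v hv.1, hQ k hk v hv.2⟩

theorem IsStable.sup {P Q : Submodule K V} (hP : IsStable T b P) (hQ : IsStable T b Q) :
    IsStable T b (P ⊔ Q) := fun k hk v hv => by
  obtain ⟨x, hx, y, hy, rfl⟩ := Submodule.mem_sup.mp hv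
  rw [map_add]
  exact Submodule.add_mem_sup (hP k hk x hx) (hQ k hk y hy)

theorem IsStable.map {P : Submodule K V} (hP : IsStable T b P) {φ : V →ₗ[K] W}
    (hφ : ∀ k, k + 1 < b → ∀ v, φ (T k v) = T' k (φ v)) : IsStable T' b (P.map φ) := by
  rintro k hk _ ⟨v, hv, rfl⟩
  exact ⟨T k v, hP k hk v hv, hφ k hk v⟩

theorem IsStable.comap {P : Submodule K W} (hP : IsStable T' b P) {φ : V →ₗ[K] W}
    (hφ : ∀ k, k + 1 < b → ∀ v, φ (T k v) = T' k (φ v)) : IsStable T b (P.comap φ) :=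
  fun k hk v hv => by
    rw [Submodule.mem_comap, hφ k hk]
    exact hP k hk _ hv

theorem IsStable.top : IsStable T b (⊤ : Submodule K V) := fun _ _ _ _ => trivial

theorem IsStable.bot : IsStable T b (⊥ : Submodule K V) := fun k _ v hv => by
  rw [(Submodule.mem_bot K).mp hv, map_zero]; exact zero_mem _

/-- The space of vectors of type `a`. -/
noncomputable def typeSpace (q : K) (T : ℕ → Module.End K V) (b a : ℕ) : Submodule K V :=
  LinearMap.range (typeProj q T b a)

theorem typeProj_mem_typeSpace (v : V) : typeProj q T b a v ∈ typeSpace q T b a := ⟨v, rfl⟩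

theorem isTyped_of_mem_typeSpace (h : IsHecke q T b) {v : V} (hv : v ∈ typeSpace q T b a) :
    IsTyped q T b a v := by
  obtain ⟨v, rfl⟩ := hv
  exact isTyped_typeProj h v

theorem typeSpace_of_not (h : ¬(0 < a ∧ a < b)) : typeSpace q T b a = ⊥ := by
  rw [typeSpace, typeProj_of_not h, LinearMap.range_zero]

theorem typeProj_of_mem_typeSpace (h : IsHecke q T b) (hb : b ≤ orderOf q) {v : V}
    (hv : v ∈ typeSpace q T b a) : typeProj q T b a v = v := by
  by_cases ha : 0 < a ∧ a < b
  · exact typeProj_fix hb ha.1 ha.2 (isTyped_of_mem_typeSpace h hv)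
  · rw [typeSpace_of_not ha, Submodule.mem_bot] at hv
    rw [hv, map_zero]

theorem typeNil_mem_typeSpace {v : V} (hv : v ∈ typeSpace q T b a) :
    typeNil q T b a v ∈ typeSpace q T b a := by
  rw [typeNil_apply]
  exact add_mem hv (Submodule.smul_mem _ _ (typeProj_mem_typeSpace _))

theorem map_typeNil (h : IsHecke q T b) (h' : IsHecke q T' b) (hb : b ≤ orderOf q)
    {φ : V →ₗ[K] W} (hφ : ∀ k, k + 1 < b → ∀ v, φ (T k v) = T' k (φ v)) (v : V) :
    φ (typeNil q T b a v) = typeNil q T' b a (φ v) := by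
  rw [typeNil_apply, typeNil_apply, map_add, map_smul, map_typeProj h h' hb hφ]
  by_cases ha : 0 < a ∧ a < b
  · rw [hφ _ (by omega)]
  · rw [typeProj_of_not ha, LinearMap.zero_apply, LinearMap.zero_apply]

/-- A family of subspaces of the type spaces stable under the induced operators. -/
structure IsTypeFamily (q : K) (T : ℕ → Module.End K V) (b : ℕ) (N : ℕ → Submodule K V) : Prop where
  le : ∀ a, N a ≤ typeSpace q T b a
  succ : ∀ a, ∀ v ∈ N a, typeProj q T b (a + 1) v ∈ N (a + 1)
  pred : ∀ a, ∀ v ∈ N (a + 1), typeProj q T b a v ∈ N a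
  nil : ∀ a, ∀ v ∈ N a, typeNil q T b a v ∈ N a

/-- The stable subspace generated by a family. -/
def familySpan (T : ℕ → Module.End K V) (b : ℕ) (N : ℕ → Submodule K V) : Submodule K V :=
  Submodule.span K {w | ∃ a, ∃ v ∈ N a, ∃ x ∈ hecke K T (b - 1), w = x v}

theorem le_familySpan (N : ℕ → Submodule K V) (a : ℕ) : N a ≤ familySpan T b N := fun v hv =>
  Submodule.subset_span ⟨a, v, hv, 1, one_mem _, rfl⟩

theorem isStable_familySpan (N : ℕ → Submodule K V) : IsStable T b (familySpan T b N) :=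
  fun k hk v hv => by
    induction hv using Submodule.span_induction with
    | mem w hw =>
      obtain ⟨a, v, hv, x, hx, rfl⟩ := hw
      exact Submodule.subset_span
        ⟨a, v, hv, T k * x, mul_mem (gen_mem_hecke (by omega)) hx, rfl⟩
    | zero => rw [map_zero]; exact zero_mem _
    | add x y _ _ hx hy => rw [map_add]; exact add_mem hx hy
    | smul c x _ hx => rw [map_smul]; exact Submodule.smul_mem _ _ hx

theorem IsTypeFamily.mem (h : IsHecke q T b) (hb : b = orderOf q) {N : ℕ → Submodule K V}
    (hN : IsTypeFamily q T b N) {w : V} (hw : w ∈ familySpan T b N)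
    (hwa : w ∈ typeSpace q T b a) : w ∈ N a := by
  rw [← typeProj_of_mem_typeSpace h hb.le hwa]
  clear hwa
  induction hw using Submodule.span_induction with
  | mem w hw =>
    obtain ⟨c, v, hv, x, hx, rfl⟩ := hw
    by_cases hc : 0 < c ∧ c < b
    · refine Submodule.span_le.mpr ?_ (typeProj_apply_mem_span h hb (c := a) hc.1 hc.2
        (isTyped_of_mem_typeSpace h (hN.le c hv)) hx)
      rintro w (⟨rfl, rfl | rfl⟩ | ⟨rfl | rfl, rfl⟩)
      · exact hv
      · exact hN.nil _ _ hv
      · exact hN.succ _ _ hv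
      · exact hN.pred _ _ hv
    · have := hN.le c hv
      rw [typeSpace_of_not hc, Submodule.mem_bot] at this
      rw [this, map_zero, map_zero]
      exact zero_mem _
  | zero => rw [map_zero]; exact zero_mem _
  | add x y _ _ hx hy => rw [map_add]; exact add_mem hx hy
  | smul c x _ hx => rw [map_smul]; exact Submodule.smul_mem _ _ hx

/-- Every subquotient is detected by the type spaces. -/
def IsTypeGenerated (q : K) (T : ℕ → Module.End K V) (b : ℕ) : Prop :=
  ∀ P Q : Submodule K V, IsStable T b P → IsStable T b Q →
    (∀ a, typeSpace q T b a ⊓ Q ≤ P) → Q ≤ P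

theorem IsTypeGenerated.isCompl (hG : IsTypeGenerated q T b) (h : IsHecke q T b)
    (hb : b = orderOf q) {N C : ℕ → Submodule K V} (hN : IsTypeFamily q T b N)
    (hC : IsTypeFamily q T b C) (hd : ∀ a, Disjoint (N a) (C a))
    (hs : ∀ a, typeSpace q T b a ≤ N a ⊔ C a) :
    IsCompl (familySpan T b N) (familySpan T b C) := by
  constructor
  · rw [disjoint_iff_inf_le]
    refine hG _ _ IsStable.bot ((isStable_familySpan N).inf (isStable_familySpan C)) ?_
    rintro a v ⟨hv, hvN, hvC⟩
    exact (hd a).le_bot ⟨hN.mem h hb hvN hv, hC.mem h hb hvC hv⟩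
  · rw [codisjoint_iff_le_sup]
    refine hG _ _ ((isStable_familySpan N).sup (isStable_familySpan C)) IsStable.top ?_
    exact fun a => inf_le_left.trans ((hs a).trans (sup_le_sup (le_familySpan N a)
      (le_familySpan C a)))

/-- Indecomposability under `T 0, …, T (b - 2)`. -/
def IsIndec (T : ℕ → Module.End K V) (b : ℕ) : Prop :=
  ∀ P Q : Submodule K V, IsStable T b P → IsStable T b Q → IsCompl P Q → P = ⊥ ∨ Q = ⊥

theorem IsTypeGenerated.eq_typeSpace (hG : IsTypeGenerated q T b) (h : IsHecke q T b)
    (hb : b = orderOf q) (hI : IsIndec T b) {N C : ℕ → Submodule K V} (hN : IsTypeFamily q T b N)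
    (hC : IsTypeFamily q T b C) (hd : ∀ a, Disjoint (N a) (C a))
    (hs : ∀ a, typeSpace q T b a ≤ N a ⊔ C a) (hne : ∃ a, N a ≠ ⊥) (a : ℕ) :
    N a = typeSpace q T b a := by
  rcases hI _ _ (isStable_familySpan N) (isStable_familySpan C) (hG.isCompl h hb hN hC hd hs)
    with h1 | h1
  · obtain ⟨c, hc⟩ := hne
    exact absurd (le_bot_iff.mp ((le_familySpan N c).trans h1.le)) hc
  · have : C a = ⊥ := le_bot_iff.mp ((le_familySpan C a).trans h1.le)
    have h2 := hs a
    rw [this, sup_bot_eq] at h2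
    exact le_antisymm (hN.le a) h2

end typeFamily

section typeModel

variable {K V W Z : Type} [Field K] [AddCommGroup V] [Module K V] [AddCommGroup W] [Module K W]
  [AddCommGroup Z] [Module K Z]
  {q : K} {T : ℕ → Module.End K V} {T' : ℕ → Module.End K W} {b a : ℕ}

/-- Linear data imitating the operators induced on the type spaces. -/
structure TypeModel (K Z : Type) [Field K] [AddCommGroup Z] [Module K Z] where
  one : ℕ → Module.End K Z
  up : ℕ → Module.End K Z
  down : ℕ → Module.End K Z
  nil : ℕ → Module.End K Z

/-- The type spaces contain the model `D` as a direct summand. -/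
structure TypeModel.IsSummand (D : TypeModel K Z) (q : K) (T : ℕ → Module.End K V) (b : ℕ)
    (x : ℕ → Z →ₗ[K] V) (f : ℕ → V →ₗ[K] Z) : Prop where
  mem : ∀ a z, x a z ∈ typeSpace q T b a
  x_one : ∀ a z, x a (D.one a z) = x a z
  one_f : ∀ a, ∀ v ∈ typeSpace q T b a, D.one a (f a v) = f a v
  f_x : ∀ a z, f a (x a z) = D.one a z
  x_up : ∀ a z, typeProj q T b (a + 1) (x a z) = x (a + 1) (D.up a z)
  x_down : ∀ a z, typeProj q T b a (x (a + 1) z) = x a (D.down a z)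
  x_nil : ∀ a z, typeNil q T b a (x a z) = x a (D.nil a z)
  f_up : ∀ a, ∀ v ∈ typeSpace q T b a, f (a + 1) (typeProj q T b (a + 1) v) = D.up a (f a v)
  f_down : ∀ a, ∀ v ∈ typeSpace q T b (a + 1), f a (typeProj q T b a v) = D.down a (f (a + 1) v)
  f_nil : ∀ a, ∀ v ∈ typeSpace q T b a, f a (typeNil q T b a v) = D.nil a (f a v)

variable {D : TypeModel K Z} {x : ℕ → Z →ₗ[K] V} {f : ℕ → V →ₗ[K] Z}
  {x' : ℕ → Z →ₗ[K] W} {f' : ℕ → W →ₗ[K] Z}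

theorem TypeModel.IsSummand.isTypeFamily_range (hx : D.IsSummand q T b x f) :
    IsTypeFamily q T b fun a => LinearMap.range (x a) where
  le a := by rintro _ ⟨z, rfl⟩; exact hx.mem a z
  succ a := by rintro _ ⟨z, rfl⟩; exact ⟨_, (hx.x_up a z).symm⟩
  pred a := by rintro _ ⟨z, rfl⟩; exact ⟨_, (hx.x_down a z).symm⟩
  nil a := by rintro _ ⟨z, rfl⟩; exact ⟨_, (hx.x_nil a z).symm⟩

theorem TypeModel.IsSummand.isTypeFamily_ker (hx : D.IsSummand q T b x f) :
    IsTypeFamily q T b fun a => typeSpace q T b a ⊓ LinearMap.ker (f a) where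
  le a := inf_le_left
  succ a := by
    rintro v ⟨hv, hk⟩
    refine ⟨typeProj_mem_typeSpace _, ?_⟩
    rw [SetLike.mem_coe, LinearMap.mem_ker] at hk ⊢
    rw [hx.f_up a v hv, hk, map_zero]
  pred a := by
    rintro v ⟨hv, hk⟩
    refine ⟨typeProj_mem_typeSpace _, ?_⟩
    rw [SetLike.mem_coe, LinearMap.mem_ker] at hk ⊢
    rw [hx.f_down a v hv, hk, map_zero]
  nil a := by
    rintro v ⟨hv, hk⟩
    refine ⟨typeNil_mem_typeSpace hv, ?_⟩
    rw [SetLike.mem_coe, LinearMap.mem_ker] at hk ⊢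
    rw [hx.f_nil a v hv, hk, map_zero]

theorem TypeModel.IsSummand.range_eq (hx : D.IsSummand q T b x f) (hG : IsTypeGenerated q T b)
    (h : IsHecke q T b) (hb : b = orderOf q) (hI : IsIndec T b) (hne : ∃ a, D.one a ≠ 0) (a : ℕ) :
    LinearMap.range (x a) = typeSpace q T b a := by
  refine hG.eq_typeSpace h hb hI hx.isTypeFamily_range hx.isTypeFamily_ker ?_ ?_ ?_ a
  · intro c
    rw [disjoint_iff_inf_le]
    rintro _ ⟨⟨z, rfl⟩, -, hk⟩
    rw [SetLike.mem_coe, LinearMap.mem_ker, hx.f_x] at hk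
    rw [← hx.x_one, hk, map_zero]
    exact zero_mem _
  · intro c v hv
    have : v = x c (f c v) + (v - x c (f c v)) := by abel
    rw [this]
    refine Submodule.add_mem_sup ⟨_, rfl⟩ ⟨sub_mem hv (hx.mem c _), ?_⟩
    rw [SetLike.mem_coe, LinearMap.mem_ker, map_sub, hx.f_x, hx.one_f c v hv, sub_self]
  · obtain ⟨c, hc⟩ := hne
    refine ⟨c, fun h0 => hc ?_⟩
    rw [LinearMap.range_eq_bot] at h0
    ext z
    rw [← hx.f_x, h0, LinearMap.zero_apply, map_zero, LinearMap.zero_apply]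

theorem IsHecke.prodMap (h : IsHecke q T b) (h' : IsHecke q T' b) :
    IsHecke q (fun k => (T k).prodMap (T' k)) b where
  quad k hk := by
    have e1 := LinearMap.congr_fun (h.quad k hk)
    have e2 := LinearMap.congr_fun (h'.quad k hk)
    ext v <;> first | (simp; done) | simpa using e1 v | simpa using e2 v
  braid k hk := by
    have e1 := LinearMap.congr_fun (h.braid k hk)
    have e2 := LinearMap.congr_fun (h'.braid k hk)
    ext v <;> first | (simp; done) | simpa using e1 v | simpa using e2 v
  comm i j hij hj := by
    have e1 := LinearMap.congr_fun (h.comm i j hij hj)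
    have e2 := LinearMap.congr_fun (h'.comm i j hij hj)
    ext v <;> first | (simp; done) | simpa using e1 v | simpa using e2 v

theorem typeProj_prodMap (h : IsHecke q T b) (h' : IsHecke q T' b) (hb : b ≤ orderOf q)
    (v : V × W) : typeProj q (fun k => (T k).prodMap (T' k)) b a v =
      (typeProj q T b a v.1, typeProj q T' b a v.2) :=
  Prod.ext (map_typeProj (h.prodMap h') h hb (φ := LinearMap.fst K V W) (fun _ _ _ => rfl) v)
    (map_typeProj (h.prodMap h') h' hb (φ := LinearMap.snd K V W) (fun _ _ _ => rfl) v)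

theorem typeNil_prodMap (h : IsHecke q T b) (h' : IsHecke q T' b) (hb : b ≤ orderOf q)
    (v : V × W) : typeNil q (fun k => (T k).prodMap (T' k)) b a v =
      (typeNil q T b a v.1, typeNil q T' b a v.2) :=
  Prod.ext (map_typeNil (h.prodMap h') h hb (φ := LinearMap.fst K V W) (fun _ _ _ => rfl) v)
    (map_typeNil (h.prodMap h') h' hb (φ := LinearMap.snd K V W) (fun _ _ _ => rfl) v)

theorem TypeModel.IsSummand.isTypeFamily_graph (hx : D.IsSummand q T b x f)
    (hx' : D.IsSummand q T' b x' f') (h : IsHecke q T b) (h' : IsHecke q T' b)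
    (hb : b ≤ orderOf q) : IsTypeFamily q (fun k => (T k).prodMap (T' k)) b
      fun a => LinearMap.range ((x a).prod (x' a)) where
  le a := by
    rintro _ ⟨z, rfl⟩
    refine ⟨(x a z, x' a z), ?_⟩
    rw [typeProj_prodMap h h' hb, typeProj_of_mem_typeSpace h hb (hx.mem a z),
      typeProj_of_mem_typeSpace h' hb (hx'.mem a z)]
    rfl
  succ a := by
    rintro _ ⟨z, rfl⟩
    refine ⟨D.up a z, ?_⟩
    rw [typeProj_prodMap h h' hb]
    exact Prod.ext (hx.x_up a z).symm (hx'.x_up a z).symm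
  pred a := by
    rintro _ ⟨z, rfl⟩
    refine ⟨D.down a z, ?_⟩
    rw [typeProj_prodMap h h' hb]
    exact Prod.ext (hx.x_down a z).symm (hx'.x_down a z).symm
  nil a := by
    rintro _ ⟨z, rfl⟩
    refine ⟨D.nil a z, ?_⟩
    rw [typeNil_prodMap h h' hb]
    exact Prod.ext (hx.x_nil a z).symm (hx'.x_nil a z).symm

theorem TypeModel.IsSummand.exists_hom (hx : D.IsSummand q T b x f)
    (hx' : D.IsSummand q T' b x' f') (h : IsHecke q T b) (h' : IsHecke q T' b)
    (hb : b = orderOf q) (hG : IsTypeGenerated q T b) (hG' : IsTypeGenerated q T' b)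
    (hs : ∀ a, LinearMap.range (x a) = typeSpace q T b a) :
    ∃ φ : V →ₗ[K] W, (∀ k, k + 1 < b → ∀ v, φ (T k v) = T' k (φ v)) ∧
      ∀ a z, φ (x a z) = x' a z := by
  set TT : ℕ → Module.End K (V × W) := fun k => (T k).prodMap (T' k)
  set G : ℕ → Submodule K (V × W) := fun a => LinearMap.range ((x a).prod (x' a))
  have hF : IsTypeFamily q TT b G := hx.isTypeFamily_graph hx' h h' hb.le
  set U := familySpan TT b G
  have hU : IsStable TT b U := isStable_familySpan G
  have hmem (a z) : (x a z, x' a z) ∈ U := le_familySpan G a ⟨z, rfl⟩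
  have hsurj : U.map (LinearMap.fst K V W) = ⊤ := by
    rw [eq_top_iff]
    refine hG _ _ (hU.map fun k _ v => rfl) IsStable.top fun a => inf_le_left.trans ?_
    rw [← hs]
    rintro _ ⟨z, rfl⟩
    exact ⟨_, hmem a z, rfl⟩
  have hinj : U.comap (LinearMap.inr K V W) = ⊥ := by
    rw [eq_bot_iff]
    refine hG' _ _ IsStable.bot
      (hU.comap (T := T') fun k _ v => Prod.ext (map_zero (T k)).symm rfl) ?_
    rintro a w ⟨hw, hwU⟩
    have : LinearMap.inr K V W w ∈ typeSpace q TT b a := ⟨LinearMap.inr K V W w, by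
      rw [typeProj_prodMap h h' hb.le]
      exact Prod.ext (map_zero _) (typeProj_of_mem_typeSpace h' hb.le hw)⟩
    obtain ⟨z, hz⟩ := hF.mem (h.prodMap h') hb hwU this
    have h1 : x a z = 0 := congrArg Prod.fst hz
    have h2 : x' a z = w := congrArg Prod.snd hz
    have h3 := hx.f_x a z
    rw [h1, map_zero] at h3
    rw [← h2, ← hx'.x_one, ← h3, map_zero]
    exact zero_mem _
  have hb1 : Function.Bijective (LinearMap.fst K V W ∘ₗ U.subtype) := by
    constructor
    · rw [← LinearMap.ker_eq_bot, eq_bot_iff]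
      rintro ⟨⟨v, w⟩, hvw⟩ hv
      obtain rfl : v = 0 := hv
      have : w ∈ U.comap (LinearMap.inr K V W) := hvw
      rw [hinj, Submodule.mem_bot] at this
      subst this
      exact zero_mem _
    · intro v
      obtain ⟨u, hu, rfl⟩ : v ∈ U.map (LinearMap.fst K V W) := by rw [hsurj]; trivial
      exact ⟨⟨u, hu⟩, rfl⟩
  set e := LinearEquiv.ofBijective _ hb1
  have he (u : U) : (e.symm u.1.1) = u := e.symm_apply_apply u
  refine ⟨LinearMap.snd K V W ∘ₗ U.subtype ∘ₗ e.symm.toLinearMap, fun k hk v => ?_, fun a z => ?_⟩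
  · obtain ⟨u, rfl⟩ := e.surjective v
    have h1 := he ⟨TT k u.1, hU k hk _ u.2⟩
    have h2 := he u
    simp only [LinearMap.comp_apply, LinearEquiv.coe_coe]
    erw [h1, h2]
    rfl
  · have h1 := he ⟨_, hmem a z⟩
    simp only [LinearMap.comp_apply, LinearEquiv.coe_coe]
    erw [h1]
    rfl

theorem TypeModel.IsSummand.exists_equiv (hx : D.IsSummand q T b x f)
    (hx' : D.IsSummand q T' b x' f') (h : IsHecke q T b) (h' : IsHecke q T' b)
    (hb : b = orderOf q) (hG : IsTypeGenerated q T b) (hG' : IsTypeGenerated q T' b)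
    (hI : IsIndec T b) (hI' : IsIndec T' b) (hne : ∃ a, D.one a ≠ 0) :
    ∃ φ : V ≃ₗ[K] W, ∀ k, k + 1 < b → ∀ v, φ (T k v) = T' k (φ v) := by
  have hs := hx.range_eq hG h hb hI hne
  have hs' := hx'.range_eq hG' h' hb hI' hne
  obtain ⟨φ, hφ, hφx⟩ := hx.exists_hom hx' h h' hb hG hG' hs
  obtain ⟨ψ, hψ, hψx⟩ := hx'.exists_hom hx h' h hb hG' hG hs'
  refine ⟨LinearEquiv.ofLinearMap φ ψ ?_ ?_, hφ⟩
  · rw [← sub_eq_zero, ← LinearMap.ker_eq_top, eq_top_iff]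
    refine hG' _ _ (fun k hk v hv => ?_) IsStable.top fun a => inf_le_left.trans ?_
    · rw [LinearMap.mem_ker, LinearMap.sub_apply, sub_eq_zero] at hv ⊢
      simp only [LinearMap.comp_apply, LinearMap.id_apply] at hv ⊢
      rw [hψ k hk, hφ k hk, hv]
    · rw [← hs']
      rintro _ ⟨z, rfl⟩
      simp [hψx, hφx]
  · rw [← sub_eq_zero, ← LinearMap.ker_eq_top, eq_top_iff]
    refine hG _ _ (fun k hk v hv => ?_) IsStable.top fun a => inf_le_left.trans ?_
    · rw [LinearMap.mem_ker, LinearMap.sub_apply, sub_eq_zero] at hv ⊢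
      simp only [LinearMap.comp_apply, LinearMap.id_apply] at hv ⊢
      rw [hφ k hk, hψ k hk, hv]
    · rw [← hs]
      rintro _ ⟨z, rfl⟩
      simp [hψx, hφx]

end typeModel

section strings

variable {K V : Type} [Field K] [AddCommGroup V] [Module K V]

/-- A string of one-dimensional spaces starting at position `a`, together with a dual string. -/
structure IsString (E : ℕ → Submodule K V) (p : ℕ → Module.End K V) (b a : ℕ) (x : ℕ → V)
    (f : ℕ → V →ₗ[K] K) (ρ u d : ℕ → K) : Prop where
  lt : ∀ c < a, x c = 0 ∧ f c = 0 ∧ ρ c = 0 ∧ u c = 0 ∧ d c = 0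
  ge : ∀ c, b ≤ c → ρ c = 0 ∧ u c = 0 ∧ d c = 0
  bit : ∀ c, (ρ c = 0 ∨ ρ c = 1) ∧ (u c = 0 ∨ u c = 1) ∧ (d c = 0 ∨ d c = 1)
  mem : ∀ c, x c ∈ E c
  f_x : ∀ c, f c (x c) = ρ c
  smul_x : ∀ c, ρ c • x c = x c
  smul_f : ∀ c, ρ c • f c = f c
  x_up : ∀ c ≥ a, p (c + 1) (x c) = u c • x (c + 1)
  x_down : ∀ c ≥ a, p c (x (c + 1)) = d c • x c
  f_up : ∀ c ≥ a, ∀ v ∈ E c, f (c + 1) (p (c + 1) v) = u c * f c v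
  f_down : ∀ c ≥ a, ∀ v ∈ E (c + 1), f c (p c v) = d c * f (c + 1) v
  one : ρ a = 1

theorem exists_functional {L : Submodule K V} {x : V} (hx : x ∉ L) :
    ∃ f : V →ₗ[K] K, f x = 1 ∧ ∀ v ∈ L, f v = 0 := by
  obtain ⟨f, hf, hL⟩ := Submodule.exists_le_ker_of_notMem hx
  exact ⟨(f x)⁻¹ • f, by simp [hf], fun v hv => by simp [LinearMap.mem_ker.mp (hL hv)]⟩

theorem exists_functional_extend {W : Type} [AddCommGroup W] [Module K W] {L : Submodule K W}
    (E : Submodule K V) (g : V →ₗ[K] W) (f : V →ₗ[K] K) (hf : ∀ v ∈ E, g v ∈ L → f v = 0) :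
    ∃ h : W →ₗ[K] K, (∀ v ∈ E, h (g v) = f v) ∧ ∀ w ∈ L, h w = 0 := by
  have : f ∘ₗ E.subtype ∈ LinearMap.range (L.mkQ ∘ₗ g ∘ₗ E.subtype).dualMap := by
    rw [LinearMap.range_dualMap_eq_dualAnnihilator_ker, Submodule.mem_dualAnnihilator]
    rintro ⟨v, hv⟩ hk
    refine hf v hv ?_
    rw [LinearMap.mem_ker] at hk
    exact (Submodule.Quotient.mk_eq_zero L).mp hk
  obtain ⟨h, hh⟩ := this
  refine ⟨h ∘ₗ L.mkQ, fun v hv => ?_, fun w hw => ?_⟩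
  · exact LinearMap.congr_fun hh ⟨v, hv⟩
  · rw [LinearMap.comp_apply, (L.mkQ_apply w), (Submodule.Quotient.mk_eq_zero L).mpr hw, map_zero]

variable {E : ℕ → Submodule K V} {p : ℕ → Module.End K V} {b a : ℕ}

/-- Stopping at `a`. -/
theorem IsString.single (hE : ∀ c, b ≤ c → E c = ⊥) {x : V} {f : V →ₗ[K] K} (hx : x ∈ E a)
    (hf : f x = 1) (hup : p (a + 1) x = 0) (hdown : ∀ v ∈ E (a + 1), f (p a v) = 0) :
    IsString E p b a (Function.update 0 a x) (Function.update 0 a f) (Function.update 0 a 1) 0 0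
      where
  lt c hc := by simp [hc.ne]
  ge c hc := by
    have : c ≠ a := by
      rintro rfl
      rw [hE _ hc, Submodule.mem_bot] at hx
      simp [hx] at hf
    simp [this]
  bit c := by
    by_cases hc : c = a
    · subst hc; simp
    · simp [hc]
  mem c := by
    by_cases hc : c = a
    · subst hc; simpa
    · simp [hc]
  f_x c := by
    by_cases hc : c = a
    · subst hc; simpa
    · simp [hc]
  smul_x c := by
    by_cases hc : c = a
    · subst hc; simp
    · simp [hc]
  smul_f c := by
    by_cases hc : c = a
    · subst hc; simp
    · simp [hc]
  x_up c hc := by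
    rcases hc.eq_or_lt with rfl | hc
    · simpa using hup
    · simp [hc.ne']
  x_down c hc := by simp [show c + 1 ≠ a by omega]
  f_up c hc := by simp [show c + 1 ≠ a by omega]
  f_down c hc v hv := by
    rcases hc.eq_or_lt with rfl | hc
    · simpa using hdown v hv
    · simp [hc.ne']
  one := by simp

/-- Continuing a string to the left. -/
theorem IsString.cons (hE : ∀ c, b ≤ c → E c = ⊥) {x : ℕ → V} {f : ℕ → V →ₗ[K] K} {ρ u d : ℕ → K}
    (h : IsString E p b (a + 1) x f ρ u d) {y : V} {g : V →ₗ[K] K} {s t : K} (hy : y ∈ E a)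
    (hg : g y = 1) (hs : s = 0 ∨ s = 1) (ht : t = 0 ∨ t = 1)
    (h1 : p (a + 1) y = s • x (a + 1)) (h2 : p a (x (a + 1)) = t • y)
    (h3 : ∀ v ∈ E a, f (a + 1) (p (a + 1) v) = s * g v)
    (h4 : ∀ v ∈ E (a + 1), g (p a v) = t * f (a + 1) v) :
    IsString E p b a (Function.update x a y) (Function.update f a g) (Function.update ρ a 1)
      (Function.update u a s) (Function.update d a t) where
  lt c hc := by simpa [hc.ne] using h.lt c (by omega)
  ge c hc := by
    have : c ≠ a := by
      rintro rfl
      rw [hE _ hc, Submodule.mem_bot] at hy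
      simp [hy] at hg
    simpa [this] using h.ge c hc
  bit c := by
    by_cases hc : c = a
    · subst hc; simp [hs, ht]
    · simpa [hc] using h.bit c
  mem c := by
    by_cases hc : c = a
    · subst hc; simpa
    · simpa [hc] using h.mem c
  f_x c := by
    by_cases hc : c = a
    · subst hc; simpa
    · simpa [hc] using h.f_x c
  smul_x c := by
    by_cases hc : c = a
    · subst hc; simp
    · simpa [hc] using h.smul_x c
  smul_f c := by
    by_cases hc : c = a
    · subst hc; simp
    · simpa [hc] using h.smul_f c
  x_up c hc := by
    rcases hc.eq_or_lt with rfl | hc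
    · simpa using h1
    · simpa [hc.ne', show c + 1 ≠ a by omega] using h.x_up c hc
  x_down c hc := by
    rcases hc.eq_or_lt with rfl | hc
    · simpa using h2
    · simpa [hc.ne', show c + 1 ≠ a by omega] using h.x_down c hc
  f_up c hc v hv := by
    rcases hc.eq_or_lt with rfl | hc
    · simpa using h3 v hv
    · simpa [hc.ne', show c + 1 ≠ a by omega] using h.f_up c hc v hv
  f_down c hc v hv := by
    rcases hc.eq_or_lt with rfl | hc
    · simpa using h4 v hv
    · simpa [hc.ne', show c + 1 ≠ a by omega] using h.f_down c hc v hv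
  one := by simp

/-- The string found inside `U / L`; at a source `L` contains the image from the right, at a sink
`U` is killed by the map to the right. -/
theorem exists_string_aux (hE : ∀ c, b ≤ c → E c = ⊥) (hp : ∀ c v, p c v ∈ E c)
    (huu : ∀ c, ∀ v ∈ E c, p (c + 2) (p (c + 1) v) = 0)
    (hdd : ∀ c, ∀ v ∈ E (c + 2), p c (p (c + 1) v) = 0)
    (hud : ∀ c, ∀ v ∈ E c, p c (p (c + 1) v) = 0)
    (hdu : ∀ c, ∀ v ∈ E (c + 1), p (c + 1) (p c v) = 0) (n : ℕ) :
    ∀ a, b ≤ a + n → ∀ L U : Submodule K V, L ≤ U → U ≤ E a → ¬U ≤ L →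
      ((∀ v ∈ E (a + 1), p a v ∈ L) ∨ ∀ v ∈ U, p (a + 1) v = 0) →
      ∃ x f ρ u d, IsString E p b a x f ρ u d ∧ x a ∈ U ∧ ∀ v ∈ L, f a v = 0 := by
  induction n with
  | zero =>
    intro a ha L U hLU hU hne
    rw [hE a (by omega)] at hU
    exact absurd (hU.trans bot_le) hne
  | succ n ih =>
    rintro a ha L U hLU hU hne (hsource | hsink)
    · by_cases hst : U ⊓ LinearMap.ker (p (a + 1)) ≤ L
      · obtain ⟨x, hx, hxL⟩ := SetLike.not_le_iff_exists.mp hne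
        obtain ⟨x, f, ρ, u, d, h, ⟨y, hyU, hyx⟩, hfL⟩ := ih (a + 1) (by omega)
          (L.map (p (a + 1))) (U.map (p (a + 1))) (Submodule.map_mono hLU)
          (by rintro _ ⟨v, -, rfl⟩; exact hp _ _)
          (fun hle => by
            obtain ⟨l, hl, hlx⟩ := hle ⟨x, hx, rfl⟩
            have : x - l ∈ L := hst ⟨sub_mem hx (hLU hl), by
              rw [SetLike.mem_coe, LinearMap.mem_ker, map_sub, hlx, sub_self]⟩
            exact hxL (by simpa using add_mem this hl))
          (Or.inr (by rintro _ ⟨v, hv, rfl⟩; exact huu a v (hU hv)))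
        have h1 : f (a + 1) (p (a + 1) y) = 1 := by rw [hyx, h.f_x, h.one]
        refine ⟨_, _, _, _, _, h.cons hE (y := y) (g := f (a + 1) ∘ₗ p (a + 1)) (s := 1) (t := 0)
          (hU hyU) h1 (Or.inr rfl) (Or.inl rfl) (by rw [hyx, one_smul]) ?_
          (fun v _ => by rw [one_mul]; rfl) (fun v hv => ?_), ?_, ?_⟩
        · rw [← hyx, hud a y (hU hyU), zero_smul]
        · rw [LinearMap.comp_apply, hdu a v hv, map_zero, zero_mul]
        · simpa using hyU
        · intro v hv
          simpa using hfL _ ⟨v, hv, rfl⟩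
      · obtain ⟨x, ⟨hxU, hxk⟩, hxL⟩ := SetLike.not_le_iff_exists.mp hst
        obtain ⟨f, hf, hfL⟩ := exists_functional hxL
        exact ⟨_, _, _, _, _, IsString.single hE (hU hxU) hf hxk
          (fun v hv => hfL _ (hsource v hv)), by simpa using hxU, by simpa using hfL⟩
    · by_cases hst : U ≤ L ⊔ (E (a + 1)).map (p a)
      · obtain ⟨x, hx, hxL⟩ := SetLike.not_le_iff_exists.mp hne
        obtain ⟨l, hl, _, ⟨v, hv, rfl⟩, hlv⟩ := Submodule.mem_sup.mp (hst hx)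
        obtain ⟨x, f, ρ, u, d, h, hxU, hfL⟩ := ih (a + 1) (by omega)
          (E (a + 1) ⊓ L.comap (p a)) (E (a + 1) ⊓ U.comap (p a))
          (inf_le_inf_left _ (Submodule.comap_mono hLU)) inf_le_left
          (fun hle => by
            have h1 : p a v ∈ U := by
              rw [show p a v = x - l by rw [← hlv]; abel]; exact sub_mem hx (hLU hl)
            exact hxL (by rw [← hlv]; exact add_mem hl (hle ⟨hv, h1⟩).2))
          (Or.inl fun v hv => ⟨hp _ _, by
            rw [SetLike.mem_coe, Submodule.mem_comap, hdd a v hv]; exact zero_mem _⟩)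
        obtain ⟨g, hg, hgL⟩ := exists_functional_extend (L := L) (E (a + 1)) (p a) (f (a + 1))
          fun v hv hvL => hfL v ⟨hv, hvL⟩
        have h1 : g (p a (x (a + 1))) = 1 := by rw [hg _ hxU.1, h.f_x, h.one]
        refine ⟨_, _, _, _, _, h.cons hE (y := p a (x (a + 1))) (g := g) (s := 0) (t := 1)
          (hp _ _) h1 (Or.inl rfl) (Or.inr rfl) ?_ (one_smul _ _).symm
          (fun v hv => ?_) (fun v hv => by rw [hg v hv, one_mul]), ?_, ?_⟩
        · rw [hsink _ hxU.2, zero_smul]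
        · rw [zero_mul]
          refine hfL _ ⟨hp _ _, ?_⟩
          rw [SetLike.mem_coe, Submodule.mem_comap, hud a v hv]
          exact zero_mem _
        · simpa using hxU.2
        · intro v hv
          simpa using hgL v hv
      · obtain ⟨x, hxU, hxL⟩ := SetLike.not_le_iff_exists.mp hst
        obtain ⟨f, hf, hfL⟩ := exists_functional hxL
        exact ⟨_, _, _, _, _, IsString.single hE (hU hxU) hf (hsink x hxU)
          (fun v hv => hfL _ (Submodule.mem_sup_right ⟨v, hv, rfl⟩)), by simpa using hxU, by
            simpa using fun v hv => hfL v (Submodule.mem_sup_left hv)⟩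

theorem exists_string (hE : ∀ c, b ≤ c → E c = ⊥) (hp : ∀ c v, p c v ∈ E c)
    (huu : ∀ c, ∀ v ∈ E c, p (c + 2) (p (c + 1) v) = 0)
    (hdd : ∀ c, ∀ v ∈ E (c + 2), p c (p (c + 1) v) = 0)
    (hud : ∀ c, ∀ v ∈ E c, p c (p (c + 1) v) = 0)
    (hdu : ∀ c, ∀ v ∈ E (c + 1), p (c + 1) (p c v) = 0) (hne : ∃ a, E a ≠ ⊥) :
    ∃ a x f ρ u d, IsString E p b a x f ρ u d ∧ ∀ c < a, E c = ⊥ := by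
  classical
  have hs := Nat.find_spec hne
  have hlt (c) (hc : c < Nat.find hne) : E c = ⊥ := not_not.mp (Nat.find_min hne hc)
  set s := Nat.find hne
  have haux := exists_string_aux hE hp huu hdd hud hdu b s (by omega)
  by_cases hW : E s ≤ (E (s + 1)).map (p s)
  · obtain ⟨x, f, ρ, u, d, h, -⟩ := haux ⊥ (E s) bot_le le_rfl (fun h => hs (le_bot_iff.mp h))
      (Or.inr fun v hv => by
        obtain ⟨w, hw, rfl⟩ := hW hv
        exact hdu s w hw)
    exact ⟨s, x, f, ρ, u, d, h, hlt⟩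
  · obtain ⟨x, f, ρ, u, d, h, -⟩ := haux ((E (s + 1)).map (p s)) (E s)
      (by rintro _ ⟨v, -, rfl⟩; exact hp _ _) le_rfl hW (Or.inl fun v hv => ⟨v, hv, rfl⟩)
    exact ⟨s, x, f, ρ, u, d, h, hlt⟩

end strings

section blockModels

variable {K V : Type} [Field K] [AddCommGroup V] [Module K V]
  {q : K} {T : ℕ → Module.End K V} {b a : ℕ}

theorem typeProj_zero_of_typeSpace_bot {i : ℕ} (h : ¬(0 < i ∧ i < b)) {v : V}
    (hv : v ∈ typeSpace q T b i) : v = 0 := by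
  rwa [typeSpace_of_not h, Submodule.mem_bot] at hv

theorem typeProj_typeProj_of_ne (h : IsHecke q T b) (hb : b = orderOf q) {i j k : ℕ}
    (hik : ¬(k = i ∨ k = i + 1 ∨ i = k + 1)) {v : V} (hv : v ∈ typeSpace q T b i) :
    typeProj q T b k (typeProj q T b j v) = 0 := by
  by_cases hi : 0 < i ∧ i < b
  · have := typeProj_apply_mem_span h hb (c := k) hi.1 hi.2 (isTyped_of_mem_typeSpace h hv)
      (typeProj_mem_hecke (q := q) (T := T) (b := b) (a := j))
    rw [show {w | (i = k ∧ (w = v ∨ w = typeNil q T b i v)) ∨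
        ((k = i + 1 ∨ i = k + 1) ∧ w = typeProj q T b k v)} = ∅ by
      ext w
      simp only [Set.mem_ofPred_eq, Set.mem_empty_iff_false, iff_false]
      rintro (⟨e, -⟩ | ⟨e, -⟩) <;> omega] at this
    simpa using this
  · rw [typeProj_zero_of_typeSpace_bot hi hv, map_zero, map_zero]

theorem typeNil_typeProj_of_adj (hq : q ≠ 0) (hq1 : q ≠ 1) (h : IsHecke q T b)
    (hb : b = orderOf q) {i j : ℕ} (hij : j = i + 1 ∨ i = j + 1) {v : V}
    (hv : v ∈ typeSpace q T b i) : typeNil q T b j (typeProj q T b j v) = 0 := by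
  by_cases hi : 0 < i ∧ i < b
  swap
  · rw [typeProj_zero_of_typeSpace_bot hi hv, map_zero, map_zero]
  by_cases hj : 0 < j ∧ j < b
  swap
  · rw [typeProj_of_not hj, LinearMap.zero_apply, map_zero]
  have hv := isTyped_of_mem_typeSpace h hv
  rcases hij with rfl | rfl
  · exact typeNil_typeProj_succ h hb.le hi.1 hj.2 hv
  · exact typeNil_typeProj_pred hq hq1 h hb hj.1 hi.2 hv

theorem typeProj_typeNil_of_adj (hq : q ≠ 0) (hq1 : q ≠ 1) (h : IsHecke q T b)
    (hb : b = orderOf q) {i j : ℕ} (hij : j = i + 1 ∨ i = j + 1) {v : V}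
    (hv : v ∈ typeSpace q T b i) : typeProj q T b j (typeNil q T b i v) = 0 := by
  by_cases hi : 0 < i ∧ i < b
  swap
  · rw [typeProj_zero_of_typeSpace_bot hi hv, map_zero, map_zero]
  by_cases hj : 0 < j ∧ j < b
  swap
  · rw [typeProj_of_not hj, LinearMap.zero_apply]
  have hv := isTyped_of_mem_typeSpace h hv
  rcases hij with rfl | rfl
  · exact typeProj_succ_typeNil hq hq1 h hb hi.1 hj.2 hv
  · exact typeProj_typeNil_succ hq hq1 h hb hj.1 hi.2 hv

/-- The operators of `projModel` from position `i` to an adjacent position `j`. -/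
noncomputable def projStep (q : K) (b a i j : ℕ) : Module.End K (K × K) :=
  if ¬((0 < i ∧ i < b) ∧ 0 < j ∧ j < b) then 0
  else if i = a then LinearMap.inl K K K ∘ₗ LinearMap.fst K K K
  else if j = a then typeConst q b a i • (LinearMap.inr K K K ∘ₗ LinearMap.fst K K K)
  else 0

/-- The model generated by a vector of type `a` not killed by `typeNil`. -/
noncomputable def projModel (q : K) (b a : ℕ) : TypeModel K (K × K) where
  one k := if k = a then 1 else if (k = a + 1 ∨ a = k + 1) ∧ 0 < k ∧ k < b then
    LinearMap.inl K K K ∘ₗ LinearMap.fst K K K else 0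
  up k := projStep q b a k (k + 1)
  down k := projStep q b a (k + 1) k
  nil k := if k = a then LinearMap.inr K K K ∘ₗ LinearMap.fst K K K else 0

/-- The embedding of `projModel` defined by a vector. -/
noncomputable def projIn (q : K) (T : ℕ → Module.End K V) (b a : ℕ) (v : V) (k : ℕ) :
    K × K →ₗ[K] V :=
  if k = a then (LinearMap.fst K K K).smulRight v +
    (LinearMap.snd K K K).smulRight (typeNil q T b a v)
  else if k = a + 1 ∨ a = k + 1 then (LinearMap.fst K K K).smulRight (typeProj q T b k v) else 0

/-- The projection to `projModel` defined by a functional. -/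
noncomputable def projOut (q : K) (T : ℕ → Module.End K V) (b a : ℕ) (f : V →ₗ[K] K) (k : ℕ) :
    V →ₗ[K] K × K :=
  if k = a then (f ∘ₗ typeNil q T b a).prod f
  else if k = a + 1 ∨ a = k + 1 then
    LinearMap.inl K K K ∘ₗ ((typeConst q b a k)⁻¹ • (f ∘ₗ typeProj q T b a)) else 0

theorem projIn_step (hq : q ≠ 0) (hq1 : q ≠ 1) (h : IsHecke q T b)
    (hb : b = orderOf q) {v : V} (hv : v ∈ typeSpace q T b a) {i j : ℕ}
    (hij : j = i + 1 ∨ i = j + 1) (z : K × K) (hmem : projIn q T b a v i z ∈ typeSpace q T b i) :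
    typeProj q T b j (projIn q T b a v i z) = projIn q T b a v j (projStep q b a i j z) := by
  unfold projStep
  split_ifs with h1 h2 h3
  · subst h2
    have hj : ¬j = i := by omega
    have e := typeProj_typeNil_of_adj hq hq1 h hb hij hv
    simp [projIn, hj, hij, e]
  · subst h3
    have hadj : i = j + 1 ∨ j = i + 1 := hij.symm
    have e := typeProj_typeProj_of_adj hq hq1 h hb hadj (by tauto) (by tauto) (by tauto) (by tauto)
      (isTyped_of_mem_typeSpace h hv)
    simp [projIn, h2, hadj, e, smul_smul, mul_comm]
  · by_cases hadj : i = a + 1 ∨ a = i + 1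
    · have e := typeProj_typeProj_of_ne h hb (j := i) (k := j) (by omega) hv
      simp [projIn, h2, hadj, e]
    · simp [projIn, h2, hadj]
  · by_cases hi : 0 < i ∧ i < b
    · rw [typeProj_of_not (a := j) (by tauto), LinearMap.zero_apply, LinearMap.zero_apply, map_zero]
    · rw [typeProj_zero_of_typeSpace_bot hi hmem, map_zero, LinearMap.zero_apply, map_zero]

theorem projOut_step (hq : q ≠ 0) (hq1 : q ≠ 1) (h : IsHecke q T b)
    (hb : b = orderOf q) {f : V →ₗ[K] K} {i j : ℕ}
    (hij : j = i + 1 ∨ i = j + 1) {w : V} (hw : w ∈ typeSpace q T b i) :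
    projOut q T b a f j (typeProj q T b j w) = projStep q b a i j (projOut q T b a f i w) := by
  unfold projStep
  split_ifs with h1 h2 h3
  · subst h2
    have hj : ¬j = i := by omega
    have e := typeProj_typeProj_of_adj hq hq1 h hb hij (by tauto) (by tauto) (by tauto) (by tauto)
      (isTyped_of_mem_typeSpace h hw)
    have hc : typeConst q b i j ≠ 0 := typeConst_ne_zero hq hb (by tauto) (by tauto)
    simp [projOut, hj, hij, e, hc]
  · subst h3
    have hadj : i = j + 1 ∨ j = i + 1 := hij.symm
    have e := typeNil_typeProj_of_adj hq hq1 h hb hij hw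
    have hc : typeConst q b j i ≠ 0 := typeConst_ne_zero hq hb (by tauto) (by tauto)
    simp [projOut, h2, hadj, e, hc]
  · by_cases hadj : j = a + 1 ∨ a = j + 1
    · have e := typeProj_typeProj_of_ne h hb (j := j) (k := a) (by omega) hw
      simp [projOut, h3, hadj, e]
    · simp [projOut, h3, hadj]
  · by_cases hi : 0 < i ∧ i < b
    · rw [typeProj_of_not (a := j) (by tauto), LinearMap.zero_apply, LinearMap.zero_apply, map_zero]
    · rw [typeProj_zero_of_typeSpace_bot hi hw, map_zero, map_zero, LinearMap.zero_apply]

theorem projModel_isSummand (hq : q ≠ 0) (hq1 : q ≠ 1) (h : IsHecke q T b)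
    (hb : b = orderOf q) (ha : 0 < a) (hab : a < b) {v : V} (hv : v ∈ typeSpace q T b a)
    {f : V →ₗ[K] K} (hf : f v = 0) (hf1 : f (typeNil q T b a v) = 1) :
    (projModel q b a).IsSummand q T b (projIn q T b a v) (projOut q T b a f) := by
  have hyy {w : V} (hw : w ∈ typeSpace q T b a) : typeNil q T b a (typeNil q T b a w) = 0 :=
    typeNil_typeNil hq hq1 h hb ha hab (isTyped_of_mem_typeSpace h hw)
  have hmem (k : ℕ) (z : K × K) : projIn q T b a v k z ∈ typeSpace q T b k := by
    unfold projIn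
    split_ifs with h1 h2
    · subst h1
      exact add_mem (Submodule.smul_mem _ _ hv) (Submodule.smul_mem _ _ (typeNil_mem_typeSpace hv))
    · exact Submodule.smul_mem _ _ (typeProj_mem_typeSpace _)
    · exact zero_mem _
  refine ⟨hmem, ?_, ?_, ?_, fun k z => projIn_step hq hq1 h hb hv (Or.inl rfl) z (hmem _ _),
    fun k z => projIn_step hq hq1 h hb hv (Or.inr rfl) z (hmem _ _), ?_,
    fun k w hw => projOut_step hq hq1 h hb (Or.inl rfl) hw,
    fun k w hw => projOut_step hq hq1 h hb (Or.inr rfl) hw, ?_⟩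
  · intro k z
    by_cases h1 : k = a
    · simp [projModel, h1]
    by_cases h2 : k = a + 1 ∨ a = k + 1
    · by_cases h3 : 0 < k ∧ k < b
      · simp [projModel, projIn, h1, h2, h3]
      · simp [projModel, projIn, h1, h2, h3, typeProj_of_not h3]
    · simp [projModel, projIn, h1, h2]
  · intro k w hw
    by_cases h1 : k = a
    · simp [projModel, h1]
    by_cases h2 : k = a + 1 ∨ a = k + 1
    · by_cases h3 : 0 < k ∧ k < b
      · simp [projModel, projOut, h1, h2, h3]
      · simp [typeProj_zero_of_typeSpace_bot h3 hw]
    · simp [projModel, projOut, h1, h2]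
  · rintro k ⟨s, t⟩
    by_cases h1 : k = a
    · subst h1
      simp [projModel, projOut, projIn, hf, hf1, hyy hv]
    by_cases h2 : k = a + 1 ∨ a = k + 1
    · by_cases h3 : 0 < k ∧ k < b
      · have e := typeProj_typeProj_of_adj hq hq1 h hb h2 ha hab h3.1 h3.2
          (isTyped_of_mem_typeSpace h hv)
        have hc : typeConst q b a k ≠ 0 := typeConst_ne_zero hq hb h3.1 h3.2
        simp [projModel, projOut, projIn, h1, h2, h3, e, hf1, hc]
      · simp [projModel, projOut, projIn, h1, h2, h3, typeProj_of_not h3]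
    · simp [projModel, projOut, projIn, h1, h2]
  · rintro k ⟨s, t⟩
    by_cases h1 : k = a
    · subst h1
      simp [projModel, projIn, hyy hv]
    by_cases h2 : k = a + 1 ∨ a = k + 1
    · have e := typeNil_typeProj_of_adj hq hq1 h hb h2 hv
      simp [projModel, projIn, h1, h2, e]
    · simp [projModel, projIn, h1, h2]
  · intro k w hw
    by_cases h1 : k = a
    · subst h1
      simp [projModel, projOut, hyy hw]
    by_cases h2 : k = a + 1 ∨ a = k + 1
    · have e := typeProj_typeNil_of_adj hq hq1 h hb h2.symm hw
      simp [projModel, projOut, h1, h2, e]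
    · simp [projModel, projOut, h1, h2]

/-- The model of a string with prescribed arrows. -/
noncomputable def stringModel (K : Type) [Field K] (b : ℕ) (s : Fin b → Bool × Bool × Bool) :
    TypeModel K K where
  one k := if ∃ h : k < b, (s ⟨k, h⟩).1 then 1 else 0
  up k := if ∃ h : k < b, (s ⟨k, h⟩).2.1 then 1 else 0
  down k := if ∃ h : k < b, (s ⟨k, h⟩).2.2 then 1 else 0
  nil _ := 0

/-- The colours of the representations of a block. -/
def HasTypeColour (q : K) (T : ℕ → Module.End K V) (b : ℕ) :
    Fin b ⊕ (Fin b → Bool × Bool × Bool) → Prop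
  | .inl a => ∃ x f, (projModel q b a).IsSummand q T b x f
  | .inr s => (∃ a, (stringModel K b s).one a ≠ 0) ∧ ∃ x f, (stringModel K b s).IsSummand q T b x f

theorem exists_hasTypeColour (hq : q ≠ 0) (hq1 : q ≠ 1) (h : IsHecke q T b)
    (hb : b = orderOf q) (hne : ∃ a, typeSpace q T b a ≠ ⊥) : ∃ s, HasTypeColour q T b s := by
  classical
  by_cases hy : ∃ a, ∃ v ∈ typeSpace q T b a, typeNil q T b a v ≠ 0
  · obtain ⟨a, v, hv, hv0⟩ := hy
    by_cases ha : 0 < a ∧ a < b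
    swap
    · rw [typeProj_zero_of_typeSpace_bot ha hv, map_zero] at hv0
      exact absurd rfl hv0
    have hyy := typeNil_typeNil hq hq1 h hb ha.1 ha.2 (isTyped_of_mem_typeSpace h hv)
    obtain ⟨f, hf, hfL⟩ := exists_functional (L := K ∙ v) (x := typeNil q T b a v) (by
      intro hmem
      obtain ⟨c, hc⟩ := Submodule.mem_span_singleton.mp hmem
      rw [← hc, map_smul, smul_eq_zero] at hyy
      rcases hyy with rfl | h1
      · exact hv0 (by rw [← hc, zero_smul])
      · exact hv0 h1)
    exact ⟨.inl ⟨a, ha.2⟩, _, _, projModel_isSummand hq hq1 h hb ha.1 ha.2 hv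
      (hfL v (Submodule.mem_span_singleton_self v)) hf⟩
  push Not at hy
  have hback {i j : ℕ} (hij : j = i + 1 ∨ i = j + 1) {v : V} (hv : v ∈ typeSpace q T b i) :
      typeProj q T b i (typeProj q T b j v) = 0 := by
    by_cases hi : 0 < i ∧ i < b
    swap
    · rw [typeProj_of_not hi, LinearMap.zero_apply]
    by_cases hj : 0 < j ∧ j < b
    swap
    · rw [typeProj_of_not hj, LinearMap.zero_apply, map_zero]
    rw [typeProj_typeProj_of_adj hq hq1 h hb hij hi.1 hi.2 hj.1 hj.2 (isTyped_of_mem_typeSpace h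
        hv),
      hy i v hv, smul_zero]
  obtain ⟨a, x, f, ρ, u, d, hs, hlt⟩ := exists_string (E := typeSpace q T b)
    (p := typeProj q T b) (b := b) (fun c hc => typeSpace_of_not (by omega))
    (fun c v => typeProj_mem_typeSpace v)
    (fun c v hv => typeProj_typeProj_of_ne h hb (by omega) hv)
    (fun c v hv => typeProj_typeProj_of_ne h hb (by omega) hv)
    (fun c v hv => hback (Or.inl rfl) hv) (fun c v hv => hback (Or.inr rfl) hv) hne
  have hbit {r : ℕ → K} (hr : ∀ c, b ≤ c → r c = 0) (hr1 : ∀ c, r c = 0 ∨ r c = 1) (k : ℕ) :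
      (if ∃ _ : k < b, decide (r k = 1) then 1 else 0 : Module.End K K) = r k • 1 := by
    rcases Nat.lt_or_ge k b with hk | hk
    · rcases hr1 k with h1 | h1 <;> simp [h1, hk]
    · simp [hr k hk]
  have e1 := hbit (fun c hc => (hs.ge c hc).1) fun c => (hs.bit c).1
  have e2 := hbit (fun c hc => (hs.ge c hc).2.1) fun c => (hs.bit c).2.1
  have e3 := hbit (fun c hc => (hs.ge c hc).2.2) fun c => (hs.bit c).2.2
  set s : Fin b → Bool × Bool × Bool :=
    fun k => (decide (ρ k = 1), decide (u k = 1), decide (d k = 1))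
  have e1 (k) : (stringModel K b s).one k = ρ k • 1 := e1 k
  have e2 (k) : (stringModel K b s).up k = u k • 1 := e2 k
  have e3 (k) : (stringModel K b s).down k = d k • 1 := e3 k
  refine ⟨.inr s, ⟨a, by rw [e1, hs.one, one_smul]; exact one_ne_zero⟩,
    fun k => LinearMap.toSpanSingleton K V (x k), f, ?_⟩
  constructor
  · exact fun k z => Submodule.smul_mem _ _ (hs.mem k)
  · intro k z
    rw [e1]
    simp [mul_comm (ρ k) z, mul_smul, hs.smul_x]
  · intro k v hv
    rw [e1]
    exact LinearMap.congr_fun (hs.smul_f k) v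
  · intro k z
    rw [e1]
    simp [hs.f_x, mul_comm]
  · intro k z
    rw [e2]
    rcases Nat.lt_or_ge k a with hk | hk
    · simp [hs.lt k hk]
    · simp [hs.x_up k hk, mul_comm (u k) z, mul_smul]
  · intro k z
    rw [e3]
    rcases Nat.lt_or_ge k a with hk | hk
    · have := typeProj_mem_typeSpace (q := q) (T := T) (b := b) (a := k) (x (k + 1))
      rw [hlt k hk, Submodule.mem_bot] at this
      simp [hs.lt k hk, this]
    · simp [hs.x_down k hk, mul_comm (d k) z, mul_smul]
  · intro k z
    simp [hy k _ (hs.mem k), stringModel]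
  · intro k v hv
    rw [e2]
    rcases Nat.lt_or_ge k a with hk | hk
    · rw [hlt k hk, Submodule.mem_bot] at hv
      simp [hv]
    · simp [hs.f_up k hk v hv]
  · intro k v hv
    rw [e3]
    rcases Nat.lt_or_ge k a with hk | hk
    · have := typeProj_mem_typeSpace (q := q) (T := T) (b := b) (a := k) v
      rw [hlt k hk, Submodule.mem_bot] at this
      simp [hs.lt k hk, this]
    · simp [hs.f_down k hk v hv]
  · intro k v hv
    simp [hy k v hv, stringModel]

end blockModels

section weightSystem

/-- Cyclic adjacency of residues modulo `b`. -/
def CyclicAdj (b i j : ℕ) : Prop :=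
  j = i + 1 ∨ i = j + 1 ∨ (i = 0 ∧ j + 1 = b) ∨ (j = 0 ∧ i + 1 = b)

/-- A set of bijective sequences of residues starting at `0`, closed under exchange of
neighbouring non-adjacent residues. -/
structure WeightSystem (b : ℕ) (Wt : (ℕ → ℕ) → Prop) : Prop where
  lt : ∀ m, Wt m → ∀ k < b, m k < b
  inj : ∀ m, Wt m → ∀ k < b, ∀ l < b, m k = m l → k = l
  zero : ∀ m, Wt m → m 0 = 0
  swap : ∀ m, Wt m → ∀ k, k + 1 < b → ¬CyclicAdj b (m k) (m (k + 1)) →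
    Wt fun j => m (Equiv.swap k (k + 1) j)

namespace WeightSystem

variable {b t : ℕ} {Wt : (ℕ → ℕ) → Prop} {m : ℕ → ℕ}

theorem exists_move (hW : WeightSystem b Wt) (hm : Wt m) {r p : ℕ} (hrp : r ≤ p) (hp : p < b)
    (h : ∀ j, r ≤ j → j < p → ¬CyclicAdj b (m j) (m p)) :
    ∃ m', Wt m' ∧ m' r = m p ∧ ∀ j < r, m' j = m j := by
  induction p, hrp using Nat.le_induction generalizing m with
  | base => exact ⟨m, hm, rfl, fun _ _ => rfl⟩
  | succ p hrp ih =>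
    have e : ∀ j < p, Equiv.swap p (p + 1) j = j := fun j hj =>
      Equiv.swap_apply_of_ne_of_ne (by omega) (by omega)
    obtain ⟨m', h1, h2, h3⟩ := ih (hW.swap m hm p hp (h p hrp (by omega))) (by omega)
      (fun j hj hj' => by
        simp only [e j hj', Equiv.swap_apply_left]
        exact h j hj (by omega))
    refine ⟨m', h1, by simpa using h2, fun j hj => ?_⟩
    rw [h3 j hj, e j (by omega)]

theorem exists_position (hW : WeightSystem b Wt) (hm : Wt m) {s : ℕ} (hs : s < b) :
    ∃ p < b, m p = s := by
  have hi : Function.Injective fun k : Fin b => (⟨m k, hW.lt m hm k k.2⟩ : Fin b) := by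
    intro k l hkl
    exact Fin.ext (hW.inj m hm k k.2 l l.2 (by simpa using hkl))
  obtain ⟨p, hp⟩ := Finite.surjective_of_injective hi ⟨s, hs⟩
  exact ⟨p, p.2, by simpa using hp⟩

theorem position_lt (hW : WeightSystem b Wt) (ht : 0 < t)
    (hmax : ∀ m, Wt m → t + 1 < b → ¬∀ j < t + 1, m j = j)
    (hm : Wt m) (hpre : ∀ j < t, m j = j) {p p' : ℕ} (hp : p < b) (hp' : p' < b)
    (h1 : t ≤ m p) (h2 : m p < m p') : p' < p := by
  have step : ∀ s, t ≤ s → s + 1 < b → ∀ p < b, ∀ p' < b, m p = s → m p' = s + 1 → p' < p := by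
    intro s hs
    induction s, hs using Nat.le_induction with
    | base =>
      intro hsb p hp p' hp' e e'
      by_contra hlt
      have hne : p ≠ p' := by rintro rfl; omega
      have htp : t ≤ p := by
        by_contra hc
        have := hpre p (by omega)
        omega
      obtain ⟨m', h1, h2, h3⟩ := hW.exists_move hm htp hp (fun j hj hj' => by
        rintro (h | h | h | h)
        · have := hW.inj m hm j (by omega) (t - 1) (by omega) (by
            rw [hpre (t - 1) (by omega)]; omega)
          omega
        · have := hW.inj m hm j (by omega) p' hp' (by omega)
          omega
        · omega
        · omega)
      refine hmax m' h1 hsb fun j hj => ?_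
      rcases Nat.lt_succ_iff_lt_or_eq.mp hj with h | rfl
      · rw [h3 j h, hpre j h]
      · rw [h2, e]
    | succ s hs ih =>
      intro hsb p hp p' hp' e e'
      by_contra hlt
      have hne : p ≠ p' := by rintro rfl; omega
      obtain ⟨l, hl, hl'⟩ := hW.exists_position hm (show s < b by omega)
      have hpl := ih (by omega) l hl p hp hl' e
      obtain ⟨m', h1, h2, -⟩ := hW.exists_move hm (Nat.zero_le p) hp (fun j _ hj' => by
        rintro (h | h | h | h)
        · have := hW.inj m hm j (by omega) l hl (by omega)
          omega
        · have := hW.inj m hm j (by omega) p' hp' (by omega)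
          omega
        · omega
        · omega)
      have := hW.zero m' h1
      omega
  have main : ∀ s s', t ≤ s → s + 1 ≤ s' → s' < b → ∀ p < b, ∀ p' < b, m p = s → m p' = s' →
      p' < p := by
    intro s s' hs hss'
    induction s', hss' using Nat.le_induction with
    | base => exact fun hb => step s hs hb
    | succ s' hs' ih =>
      intro hb p hp p' hp' e e'
      obtain ⟨l, hl, hl'⟩ := hW.exists_position hm (show s' < b by omega)
      have h1 := ih (by omega) p hp l hl e hl'
      have h2 := step s' (by omega) hb l hl p' hp' hl' e'
      omega
  exact main _ _ h1 h2 (hW.lt m hm _ hp') p hp p' hp' rfl rfl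

/-- Some sequence consists of `0, …, t - 1` followed by a rigid decreasing part. -/
theorem exists_rigid (hW : WeightSystem b Wt) (hb : 1 < b) (hne : ∃ m, Wt m) :
    ∃ t m, 0 < t ∧ t < b ∧ Wt m ∧
      (∀ i, i + 1 < t → m (i + 1) = m i + 1 ∧ i + 2 < b ∧ m i = i ∧
        ¬Wt fun j => m (Equiv.swap i (i + 1) j)) ∧
      (∀ i, t ≤ i → i + 1 < b → m (i + 1) < m i ∧ 0 < m (i + 1) ∧
        ¬Wt fun j => m (Equiv.swap i (i + 1) j)) := by
  classical
  set P : ℕ → Prop := fun t => ∃ m, Wt m ∧ ∀ j < t, m j = j with hP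
  obtain ⟨m₀, hm₀⟩ := hne
  have hP1 : P 1 := ⟨m₀, hm₀, fun j hj => by
    obtain rfl : j = 0 := by omega
    exact hW.zero _ hm₀⟩
  set t := Nat.findGreatest P (b - 1) with ht
  have htb : t ≤ b - 1 := Nat.findGreatest_le _
  have ht0 : 1 ≤ t := Nat.le_findGreatest (by omega) hP1
  obtain ⟨m, hm, hpre⟩ : P t := Nat.findGreatest_spec (by omega : 1 ≤ b - 1) hP1
  have hmax : ∀ m, Wt m → t + 1 < b → ¬∀ j < t + 1, m j = j := fun m hm htb' hc =>
    Nat.findGreatest_is_greatest (P := P) (n := b - 1) (k := t + 1) (by omega) (by omega) ⟨m, hm,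
        hc⟩
  have hpos : ∀ {m}, Wt m → (∀ j < t, m j = j) → ∀ {p p' : ℕ}, p < b → p' < b → t ≤ m p →
      m p < m p' → p' < p := fun hm hpre _ _ hp hp' => hW.position_lt ht0 hmax hm hpre hp hp'
  have hge : ∀ i < b, t ≤ i → t ≤ m i := fun i hi hti => by
    by_contra hc
    have := hW.inj m hm (m i) (by omega) i hi (hpre _ (by omega))
    omega
  refine ⟨t, m, ht0, by omega, hm, fun i hi => ⟨?_, by omega, hpre i (by omega), fun hs => ?_⟩,
    fun i hi hib => ?_⟩
  · rw [hpre _ hi, hpre i (by omega)]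
  · obtain ⟨m', h1, h2, -⟩ := hW.exists_move hs (Nat.zero_le i) (by omega) (fun j _ hj => by
      rw [Equiv.swap_apply_left, Equiv.swap_apply_of_ne_of_ne (by omega) (by omega),
          hpre j (by omega),
        hpre _ hi]
      rintro (h | h | h | h) <;> omega)
    rw [Equiv.swap_apply_left, hpre _ hi] at h2
    have := hW.zero m' h1
    omega
  · have h1 : m (i + 1) < m i := by
      rcases lt_trichotomy (m (i + 1)) (m i) with h | h | h
      · exact h
      · have := hW.inj m hm _ hib i (by omega) h
        omega
      · have := hpos hm hpre (by omega) hib (hge i (by omega) hi) h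
        omega
    have h2 := hge (i + 1) hib (by omega)
    refine ⟨h1, by omega, fun hs => ?_⟩
    have := hpos hs (fun j hj => by
      rw [Equiv.swap_apply_of_ne_of_ne (by omega) (by omega), hpre j hj]) (p := i) (p' := i + 1)
      (by omega) hib (by simpa using h2) (by simpa using h1)
    omega

end WeightSystem

end weightSystem

section weights

variable {K V W : Type} [Field K] [AddCommGroup V] [Module K V] [AddCommGroup W] [Module K W]
  {q : K} {T : ℕ → Module.End K V} {T' : ℕ → Module.End K W} {b : ℕ}

theorem jm_apply_mem {x : Module.End K V} {P : Submodule K V} (hP : IsStable T b P)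
    (hx : ∀ v ∈ P, x v ∈ P) {k : ℕ} (hk : k < b) {v : V} (hv : v ∈ P) : jm q x T k v ∈ P := by
  induction k generalizing v with
  | zero => exact hx v hv
  | succ k ih =>
    exact P.smul_mem _ (hP k hk _ (ih (by omega) (hP k hk v hv)))

/-- The relative traces of all powers of the last Jucys-Murphy element are nilpotent. -/
def HasNilpotentTraces (q : K) (T : ℕ → Module.End K V) (b : ℕ) : Prop :=
  ∀ m : ℕ, IsNilpotent (relTrace q T b (jm q 1 T (b - 1) ^ m))

theorem exists_jm_weight (hq : q ≠ 0) (h : IsHecke q T b) {P : Submodule K V}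
    (hP : IsStable T b P) (h0 : P ≠ ⊥) :
    ∃ v ∈ P, v ≠ 0 ∧ ∃ i : ℕ → K, ∀ k < b, (∃ m : ℤ, i k = q ^ m) ∧ jm q 1 T k v = i k • v := by
  have hR : ∀ r ∈ {r : K | ∃ m : ℤ, r = q ^ m}, q * r ∈ {r : K | ∃ m : ℤ, r = q ^ m} ∧
      q⁻¹ * r ∈ {r : K | ∃ m : ℤ, r = q ^ m} := by
    rintro _ ⟨m, rfl⟩
    exact ⟨⟨1 + m, by rw [zpow_add₀ hq, zpow_one]⟩, ⟨-1 + m, by rw [zpow_add₀ hq, zpow_neg_one]⟩⟩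
  refine exists_weight_vector (L := jm q 1 T)
    (fun i hi j hj => h.commute_jm_jm IsJMStart.one hi hj)
    (fun k hk => h.specIn_jm hq IsJMStart.one hR
      ⟨[1], by simpa using ⟨0, (zpow_zero q).symm⟩, by simp⟩ hk)
    (fun k hk v hv => jm_apply_mem hP (fun v hv => hv) hk hv) h0

theorem HasNilpotentTraces.orderOf_dvd (hq : q ≠ 0) (hq1 : q ≠ 1) (h : IsHecke q T b) (hb : 0 < b)
    (hnil : HasNilpotentTraces q T b) [Nontrivial V] : 0 < orderOf q ∧ orderOf q ∣ b := by
  obtain ⟨v, -, hv, i, hi⟩ := exists_jm_weight hq h (P := ⊤) IsStable.top top_ne_bot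
  have h0 : i 0 = 1 := by
    have := (hi 0 hb).2
    rw [jm, Module.End.one_apply] at this
    exact smul_left_injective K hv (by simpa using this.symm)
  have := orderOf_dvd_of_prod_weights hq hb h0 (fun k hk => (hi k hk).1)
    (prod_weights_eq hq hq1 h hb hv (fun k hk => (hi k hk).2) hnil)
  exact ⟨this.1, this.2.1⟩

/-- `v` is a nonzero vector of `P` of Jucys-Murphy weight `q ^ m`. -/
def IsPowWeight (q : K) (T : ℕ → Module.End K V) (b : ℕ) (P : Submodule K V) (v : V)
    (m : ℕ → ℕ) : Prop :=
  v ∈ P ∧ v ≠ 0 ∧ ∀ k < b, m k < b ∧ jm q 1 T k v = q ^ m k • v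

theorem IsPowWeight.exchange {P : Submodule K V} {m : ℕ → ℕ} {v : V} (hq : q ≠ 0)
    (h : IsHecke q T b) (hP : IsStable T b P) (hw : IsPowWeight q T b P v m) {k : ℕ}
    (hk : k + 1 < b) (hne : q ^ m k ≠ q ^ m (k + 1)) :
    (∃ w, IsPowWeight q T b P w fun j => m (Equiv.swap k (k + 1) j)) ∨
      (T k v = q • v ∧ q ^ m (k + 1) = q ^ (m k + 1)) ∨
      (T k v = -v ∧ q ^ m k = q ^ (m (k + 1) + 1)) := by
  obtain ⟨hv, hv0, hm⟩ := hw
  rcases h.exchange hq IsJMStart.one hk (hm k (by omega)).2 (hm (k + 1) hk).2 hne hv0 with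
    ⟨w, c, hwc, hw0, h1, h2, h3⟩ | h2 | h3
  · refine Or.inl ⟨w, ?_, hw0, fun j hj => ?_⟩
    · rw [hwc]
      exact P.sub_mem (hP k hk v hv) (P.smul_mem c hv)
    · beta_reduce
      by_cases e : j = k
      · subst e
        rw [Equiv.swap_apply_left]
        exact ⟨(hm (j + 1) hk).1, h1⟩
      · by_cases e' : j = k + 1
        · subst e'
          rw [Equiv.swap_apply_right]
          exact ⟨(hm k (by omega)).1, h2⟩
        · rw [Equiv.swap_apply_of_ne_of_ne e e']
          exact ⟨(hm j hj).1, h3 j hj e e' _ (hm j hj).2⟩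
  · exact Or.inr (Or.inl ⟨h2.1, by rw [h2.2, pow_succ']⟩)
  · exact Or.inr (Or.inr ⟨h3.1, by rw [h3.2, pow_succ']⟩)

theorem eq_succ_of_pow_eq (hb : b = orderOf q) {i j : ℕ} (hi : i < b) (hj : j < b)
    (h : q ^ i = q ^ (j + 1)) : i = j + 1 ∨ (i = 0 ∧ j + 1 = b) := by
  rcases Nat.lt_or_ge (j + 1) b with h1 | h1
  · exact Or.inl (pow_injOn_Iio_orderOf (x := q) (by simpa [← hb] using hi) (by simpa [← hb] using
      h1) h)
  · have e : j + 1 = b := by omega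
    refine Or.inr ⟨?_, e⟩
    rw [e, hb, pow_orderOf_eq_one] at h
    exact pow_injOn_Iio_orderOf (x := q) (by simpa [← hb] using hi)
      (by simp only [Set.mem_Iio, ← hb]; omega) (by simpa using h)

theorem weightSystem_isPowWeight (hq : q ≠ 0) (hq1 : q ≠ 1) (h : IsHecke q T b)
    (hb : b = orderOf q) (hb0 : 0 < b) (hnil : HasNilpotentTraces q T b) {P : Submodule K V}
    (hP : IsStable T b P) : WeightSystem b fun m => ∃ v, IsPowWeight q T b P v m := by
  have h0 : ∀ v m, IsPowWeight q T b P v m → m 0 = 0 := by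
    rintro v m ⟨-, hv, hm⟩
    have h1 := (hm 0 hb0).2
    rw [jm, Module.End.one_apply] at h1
    have h2 : q ^ m 0 = q ^ 0 := by
      rw [pow_zero]
      exact smul_left_injective K hv (by simpa using h1.symm)
    exact pow_injOn_Iio_orderOf (x := q) (by simpa [← hb] using (hm 0 hb0).1) (by simpa [← hb]
        using hb0) h2
  have hinj : ∀ v m, IsPowWeight q T b P v m → ∀ k < b, ∀ l < b, m k = m l → k = l := by
    intro v m hw k hk l hl hkl
    have h00 := h0 v m hw
    obtain ⟨-, hv, hm⟩ := hw
    refine (orderOf_dvd_of_prod_weights (i := fun k => q ^ m k) hq hb0 (by simp [h00])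
      (fun k hk => ⟨m k, by simp⟩)
      (prod_weights_eq hq hq1 h hb0 hv (fun k hk => (hm k hk).2) hnil)).2.2 hb k hk l hl ?_
    simp [hkl]
  refine ⟨fun m ⟨v, hw⟩ k hk => (hw.2.2 k hk).1, fun m ⟨v, hw⟩ => hinj v m hw,
    fun m ⟨v, hw⟩ => h0 v m hw, ?_⟩
  rintro m ⟨v, hw⟩ k hk hadj
  have hlt := fun k hk => (hw.2.2 k hk).1
  have hne : q ^ m k ≠ q ^ m (k + 1) := fun e => by
    have := hinj v m hw k (by omega) (k + 1) hk
      (pow_injOn_Iio_orderOf (x := q) (by simpa [← hb] using hlt k (by omega))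
        (by simpa [← hb] using hlt (k + 1) hk) e)
    omega
  rcases hw.exchange hq h hP hk hne with hw' | ⟨-, e⟩ | ⟨-, e⟩
  · exact hw'
  · refine absurd ?_ hadj
    rcases eq_succ_of_pow_eq hb (hlt _ hk) (hlt k (by omega)) e with h | h
    · exact Or.inl h
    · exact Or.inr (Or.inr (Or.inr h))
  · refine absurd ?_ hadj
    rcases eq_succ_of_pow_eq hb (hlt k (by omega)) (hlt _ hk) e with h | h
    · exact Or.inr (Or.inl h)
    · exact Or.inr (Or.inr (Or.inl h))

theorem exists_isTyped (hq : q ≠ 0) (hq1 : q ≠ 1) (h : IsHecke q T b)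
    (hb : b = orderOf q) (hb0 : 0 < b) (hnil : HasNilpotentTraces q T b) {P : Submodule K V}
    (hP : IsStable T b P) (hP0 : P ≠ ⊥) :
    ∃ a v, 0 < a ∧ a < b ∧ v ∈ P ∧ v ≠ 0 ∧ IsTyped q T b a v := by
  have hW := weightSystem_isPowWeight hq hq1 h hb hb0 hnil hP
  have hb1 : 1 < b := by
    by_contra hc
    have e : orderOf q = 1 := by omega
    exact hq1 (orderOf_eq_one_iff.mp e)
  have hne : ∃ m v, IsPowWeight q T b P v m := by
    obtain ⟨v, hv, hv0, i, hi⟩ := exists_jm_weight hq h hP hP0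
    have hred : ∀ m : ℤ, ∃ n < b, q ^ m = q ^ n := by
      intro m
      have hbz : (0 : ℤ) < b := by exact_mod_cast hb0
      refine ⟨(m % b).toNat, ?_, ?_⟩
      · have := Int.emod_lt_of_pos m hbz
        have := Int.emod_nonneg m hbz.ne'
        omega
      · rw [← zpow_natCast, Int.toNat_of_nonneg (Int.emod_nonneg m hbz.ne')]
        conv_lhs => rw [← Int.emod_add_mul_ediv m b, zpow_add₀ hq, zpow_mul, zpow_natCast, hb,
          pow_orderOf_eq_one, one_zpow, mul_one]
        rw [hb]
    have hch : ∀ k, ∃ n, k < b → n < b ∧ i k = q ^ n := by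
      intro k
      by_cases hk : k < b
      · obtain ⟨m, hm⟩ := (hi k hk).1
        obtain ⟨n, hn, e⟩ := hred m
        exact ⟨n, fun _ => ⟨hn, hm.trans e⟩⟩
      · exact ⟨0, fun hk' => absurd hk' hk⟩
    choose n hn using hch
    exact ⟨n, v, hv, hv0, fun k hk => ⟨(hn k hk).1, by rw [(hi k hk).2, (hn k hk).2]⟩⟩
  obtain ⟨t, m, ht0, htb, ⟨v, hw⟩, hlow, hhigh⟩ := hW.exists_rigid hb1 hne
  have hlt := fun k hk => (hw.2.2 k hk).1
  have hpow : ∀ k, k + 1 < b → q ^ m k ≠ q ^ m (k + 1) := fun k hk e => by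
    have := hW.inj m ⟨v, hw⟩ k (by omega) (k + 1) hk
      (pow_injOn_Iio_orderOf (x := q) (by simpa [← hb] using hlt k (by omega))
        (by simpa [← hb] using hlt (k + 1) hk) e)
    omega
  refine ⟨t, v, ht0, htb, hw.1, hw.2.1, fun i hib hit => ?_⟩
  rcases Nat.lt_or_ge (i + 1) t with hi | hi
  · rw [typeChar_of_lt hi]
    obtain ⟨h1, h2, h3, h4⟩ := hlow i hi
    rcases hw.exchange hq h hP hib (hpow i hib) with hw' | ⟨e, -⟩ | ⟨-, e⟩
    · exact absurd hw' h4
    · exact e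
    · rcases eq_succ_of_pow_eq hb (hlt i (by omega)) (hlt _ hib) e with h | h <;> omega
  · obtain ⟨h1, h2, h3⟩ := hhigh i (by omega) hib
    rw [typeChar_of_le (by omega), neg_one_smul]
    rcases hw.exchange hq h hP hib (hpow i hib) with hw' | ⟨-, e⟩ | ⟨e, -⟩
    · exact absurd hw' h3
    · rcases eq_succ_of_pow_eq hb (hlt _ hib) (hlt i (by omega)) e with h | h <;> omega
    · exact e

theorem map_jm {φ : V →ₗ[K] W} (hφ : ∀ k, k + 1 < b → ∀ v, φ (T k v) = T' k (φ v)) {k : ℕ}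
    (hk : k < b) (v : V) : φ (jm q 1 T k v) = jm q 1 T' k (φ v) := by
  induction k generalizing v with
  | zero => rfl
  | succ k ih =>
    simp only [jm, LinearMap.smul_apply, Module.End.mul_apply, map_smul]
    rw [hφ k hk, ih (by omega), hφ k hk]

theorem map_pow_apply {φ : V →ₗ[K] W} {y : Module.End K V} {y' : Module.End K W}
    (hy : ∀ v, φ (y v) = y' (φ v)) (m : ℕ) (v : V) : φ ((y ^ m) v) = (y' ^ m) (φ v) := by
  induction m generalizing v with
  | zero => rfl
  | succ m ih => rw [pow_succ, pow_succ, Module.End.mul_apply, Module.End.mul_apply, ih, hy]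

theorem map_relTrace {φ : V →ₗ[K] W} (hφ : ∀ k, k + 1 < b → ∀ v, φ (T k v) = T' k (φ v))
    {y : Module.End K V} {y' : Module.End K W} (hy : ∀ v, φ (y v) = y' (φ v)) (v : V) :
    φ (relTrace q T b y v) = relTrace q T' b y' (φ v) := by
  induction b generalizing y y' with
  | zero => simp [relTrace]
  | succ b ih =>
    rcases Nat.eq_zero_or_pos b with rfl | hb
    · simp [relTrace, hy]
    · simp only [relTrace, LinearMap.add_apply, LinearMap.smul_apply, map_add, map_smul]
      rw [hy, ih (fun k hk => hφ k (by omega))]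
      intro v
      simp only [Module.End.mul_apply]
      rw [hφ _ (by omega), hy, hφ _ (by omega)]

theorem IsHecke.of_surjective (h : IsHecke q T b) {φ : V →ₗ[K] W} (hs : Function.Surjective φ)
    (hφ : ∀ k, k + 1 < b → ∀ v, φ (T k v) = T' k (φ v)) : IsHecke q T' b := by
  constructor
  · intro k hk
    refine LinearMap.ext fun w => ?_
    obtain ⟨v, rfl⟩ := hs w
    have := congrArg φ (LinearMap.congr_fun (h.quad k hk) v)
    simpa [hφ k hk] using this
  · intro k hk
    refine LinearMap.ext fun w => ?_
    obtain ⟨v, rfl⟩ := hs w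
    have := congrArg φ (LinearMap.congr_fun (h.braid k hk) v)
    simpa [hφ k (by omega), hφ (k + 1) hk] using this
  · intro i j hij hj
    refine LinearMap.ext fun w => ?_
    obtain ⟨v, rfl⟩ := hs w
    have := congrArg φ (LinearMap.congr_fun (h.comm i j hij hj) v)
    simpa [hφ i (by omega), hφ j hj] using this

theorem HasNilpotentTraces.of_surjective (hb : 0 < b) (hnil : HasNilpotentTraces q T b)
    {φ : V →ₗ[K] W} (hs : Function.Surjective φ)
    (hφ : ∀ k, k + 1 < b → ∀ v, φ (T k v) = T' k (φ v)) : HasNilpotentTraces q T' b := by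
  intro m
  obtain ⟨s, hs'⟩ := hnil m
  refine ⟨s, LinearMap.ext fun w => ?_⟩
  obtain ⟨v, rfl⟩ := hs w
  rw [← map_pow_apply (map_relTrace hφ (map_pow_apply (map_jm hφ (by omega)) m)) s, hs',
    LinearMap.zero_apply, map_zero, LinearMap.zero_apply]

theorem IsStable.hecke_apply_mem {P : Submodule K V} (hP : IsStable T b P) {x : Module.End K V}
    (hx : x ∈ hecke K T (b - 1)) {v : V} (hv : v ∈ P) : x v ∈ P := by
  induction hx using Algebra.adjoin_induction generalizing v with
  | mem x hx =>
    obtain ⟨k, hk, rfl⟩ := hx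
    simp only [Set.mem_Iio] at hk
    exact hP k (by omega) v hv
  | algebraMap r => exact P.smul_mem r hv
  | add x y _ _ hx hy => exact P.add_mem (hx hv) (hy hv)
  | mul x y _ _ hx hy => exact hx (hy hv)

theorem isTypeGenerated_of_hasNilpotentTraces (hq : q ≠ 0) (hq1 : q ≠ 1) (h : IsHecke q T b)
    (hb : b = orderOf q) (hb0 : 0 < b) (hnil : HasNilpotentTraces q T b) :
    IsTypeGenerated q T b := by
  classical
  intro P Q hP hQ hPQ
  set T' : ℕ → Module.End K (V ⧸ P) := fun k =>
    if hk : P ≤ P.comap (T k) then P.mapQ P (T k) hk else 0 with hT'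
  have hφ : ∀ k, k + 1 < b → ∀ v, P.mkQ (T k v) = T' k (P.mkQ v) := by
    intro k hk v
    have : P ≤ P.comap (T k) := fun v hv => hP k hk v hv
    simp [hT', this]
  have h' : IsHecke q T' b := h.of_surjective P.mkQ_surjective hφ
  by_contra hle
  obtain ⟨a, w, ha, hab, hw, hw0, ht⟩ := exists_isTyped hq hq1 h' hb hb0
    (hnil.of_surjective hb0 P.mkQ_surjective hφ) (hQ.map hφ) (fun e => hle (by
      rwa [← le_bot_iff, Submodule.map_le_iff_le_comap, Submodule.comap_bot,
        Submodule.ker_mkQ] at e))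
  obtain ⟨u, hu, rfl⟩ := hw
  have h1 := map_typeProj h h' hb.le hφ (a := a) u
  rw [typeProj_fix hb.le ha hab ht] at h1
  have h2 : typeProj q T b a u ∈ P :=
    hPQ a ⟨typeProj_mem_typeSpace u, hQ.hecke_apply_mem typeProj_mem_hecke hu⟩
  rw [← Submodule.ker_mkQ P, LinearMap.mem_ker, h1] at h2
  exact hw0 h2

end weights

namespace OpRep

variable {K : Type} [Field K] {q : K} {b c : ℕ}

theorem IsYoung.trace_cases (hq : q ≠ 0) {M : OpRep K (ℕ ⊕ ℕ)} (hM : IsYoung q b c M)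
    (hI : Indec (youngGens b c) M) :
    (∃ m : ℕ, Function.Bijective (relTrace q (fun k => M.T (.inl k)) b
      (jm q 1 (fun k => M.T (.inl k)) (b - 1) ^ m) : Module.End K M.V)) ∨
      HasNilpotentTraces q (fun k => M.T (.inl k)) b := by
  by_contra! h
  refine h.2 fun m => ?_
  exact (hI.nilpotent_or_bijective (hM.isHom_relTrace hq m)).resolve_right (h.1 m)

theorem finType_step (hq : q ≠ 0) (hq1 : q ≠ 1) (hdvd : 0 < orderOf q → ¬orderOf q ∣ b + 1)
    (h : FinType (youngGens b c) (IsYoung q b c)) :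
    FinType (youngGens (b + 1) c) (IsYoung q (b + 1) c) := by
  obtain ⟨n, X, hX⟩ := finType_of_trace_bijective hq (b := b + 1) (c := c) h
  refine ⟨n, X, fun M hM hI => hX M ⟨hM, (hM.trace_cases hq hI).resolve_right fun hnil => ?_⟩ hI⟩
  have := hI.1
  obtain ⟨h1, h2⟩ := hnil.orderOf_dvd hq hq1 hM.left (by omega)
  exact hdvd h1 h2

theorem isIndec_of_indec {M : OpRep K (ℕ ⊕ ℕ)} (hI : Indec (youngGens b 0) M) :
    IsIndec (fun k => M.T (.inl k)) b := by
  intro P Q hP hQ hPQ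
  refine hI.2 P Q ?_ ?_ hPQ
  · rintro (k | k) hk v hv
    · exact hP k hk v hv
    · exact absurd hk (by simp [youngGens])
  · rintro (k | k) hk v hv
    · exact hQ k hk v hv
    · exact absurd hk (by simp [youngGens])

theorem finType_hasNilpotentTraces (hq : q ≠ 0) (hq1 : q ≠ 1) (hb : b = orderOf q) (hb0 : 0 < b) :
    FinType (youngGens b 0) fun M : OpRep K (ℕ ⊕ ℕ) =>
      IsYoung q b 0 M ∧ HasNilpotentTraces q (fun k => M.T (.inl k)) b := by
  refine finType_of_colour (α := Fin b ⊕ (Fin b → Bool × Bool × Bool))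
    (fun s M => HasTypeColour q (fun k => M.T (.inl k)) b s) (fun M hM hI => ?_)
    (fun s M N hM hI hN hJ hs ht => ?_)
  · refine exists_hasTypeColour hq hq1 hM.1.left hb ?_
    by_contra! hc
    have := hI.1
    have hG := isTypeGenerated_of_hasNilpotentTraces hq hq1 hM.1.left hb hb0 hM.2
    exact top_ne_bot (le_bot_iff.mp (hG ⊥ ⊤ IsStable.bot IsStable.top (fun a => by simp [hc a])))
  · have hG := isTypeGenerated_of_hasNilpotentTraces hq hq1 hM.1.left hb hb0 hM.2
    have hG' := isTypeGenerated_of_hasNilpotentTraces hq hq1 hN.1.left hb hb0 hN.2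
    suffices ∃ φ : M.V ≃ₗ[K] N.V, ∀ k, k + 1 < b → ∀ v,
        φ (M.T (.inl k) v) = N.T (.inl k) (φ v) by
      obtain ⟨φ, hφ⟩ := this
      refine ⟨φ, ?_⟩
      rintro (k | k) hk v
      · exact hφ k hk v
      · exact absurd hk (by simp [youngGens])
    rcases s with a | s
    · obtain ⟨x, f, hx⟩ := hs
      obtain ⟨x', f', hx'⟩ := ht
      exact hx.exists_equiv hx' hM.1.left hN.1.left hb hG hG' (isIndec_of_indec hI)
        (isIndec_of_indec hJ) ⟨a, by simp [projModel]⟩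
    · obtain ⟨hne, x, f, hx⟩ := hs
      obtain ⟨-, x', f', hx'⟩ := ht
      exact hx.exists_equiv hx' hM.1.left hN.1.left hb hG hG' (isIndec_of_indec hI)
        (isIndec_of_indec hJ) hne

theorem finType_empty {ι : Type} (C : OpRep K ι → Prop) : FinType ∅ C := by
  have key : ∀ M : OpRep K ι, Indec ∅ M → Module.finrank K M.V = 1 := by
    intro M hI
    have := hI.1
    obtain ⟨v, hv⟩ := exists_ne (0 : M.V)
    obtain ⟨Q, hQ⟩ := Submodule.exists_isCompl (K ∙ v)
    rcases hI.2 _ _ (fun i hi => absurd hi (by simp)) (fun i hi => absurd hi (by simp)) hQ with h |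
        h
    · exact absurd (Submodule.span_singleton_eq_bot.mp h) hv
    · subst h
      have h1 : K ∙ v = ⊤ := by simpa using hQ.sup_eq_top
      rw [← finrank_top, ← h1, finrank_span_singleton hv]
  refine finType_of_colour (α := Unit) (fun _ _ => True) (fun _ _ _ => ⟨(), trivial⟩)
    fun _ M N _ hI _ hJ _ _ => ?_
  exact ⟨LinearEquiv.ofFinrankEq _ _ ((key M hI).trans (key N hJ).symm),
    fun i hi => absurd hi (by simp)⟩

theorem finType_youngGens_zero (hq : q ≠ 0) (hq1 : q ≠ 1)
    (hb : 0 < orderOf q → b < 2 * orderOf q) :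
    FinType (youngGens b 0) (IsYoung (K := K) q b 0) := by
  induction b with
  | zero =>
    have : youngGens 0 0 = ∅ := by
      ext (k | k) <;> simp [youngGens]
    rw [this]
    exact finType_empty _
  | succ b ih =>
    have ih := ih fun h => by have := hb h; omega
    by_cases he : b + 1 = orderOf q
    · obtain ⟨n, X, hX⟩ := (finType_of_trace_bijective hq (b := b + 1) (c := 0) ih).or
        (finType_hasNilpotentTraces hq hq1 he (by omega))
      exact ⟨n, X, fun M hM hI => hX M ((hM.trace_cases hq hI).imp (⟨hM, ·⟩) (⟨hM, ·⟩)) hI⟩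
    · refine finType_step hq hq1 (fun h hd => ?_) ih
      obtain ⟨k, hk⟩ := hd
      have := hb h
      have h2 : k < 2 := by
        by_contra! hc
        have := Nat.mul_le_mul_left (orderOf q) hc
        omega
      interval_cases k <;> omega

theorem FinType.swap (h : FinType (youngGens b c) (IsYoung (K := K) q b c)) :
    FinType (youngGens c b) (IsYoung (K := K) q c b) := by
  obtain ⟨n, X, hX⟩ := h
  have hS : ∀ i, i ∈ youngGens b c ↔ i.swap ∈ youngGens c b := by
    rintro (k | k) <;> simp [youngGens]
  refine ⟨n, fun j => ⟨(X j).V, fun i => (X j).T i.swap⟩, fun M hM hI => ?_⟩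
  obtain ⟨j, e, he⟩ := hX ⟨M.V, fun i => M.T i.swap⟩
    ⟨hM.right, hM.left, fun i j hi hj => (hM.comm j i hj hi).symm⟩
    ⟨hI.1, fun P Q hP hQ => hI.2 P Q
      (fun i hi v hv => by simpa using hP i.swap (by simpa [hS] using hi) v hv)
      (fun i hi v hv => by simpa using hQ i.swap (by simpa [hS] using hi) v hv)⟩
  refine ⟨j, e, fun i hi v => ?_⟩
  simpa using he i.swap (by simpa [hS] using hi) v

theorem finType_youngGens (hq : q ≠ 0) (hq1 : q ≠ 1)
    (hbc : 0 < orderOf q → b + c < 2 * orderOf q) :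
    FinType (youngGens b c) (IsYoung (K := K) q b c) := by
  have key : ∀ b c, (0 < orderOf q → c < 2 * orderOf q) → (0 < orderOf q → b < orderOf q) →
      FinType (youngGens b c) (IsYoung (K := K) q b c) := by
    intro b c hc hb
    induction b with
    | zero => exact (finType_youngGens_zero hq hq1 hc).swap
    | succ b ih =>
      refine finType_step hq hq1 (fun h hd => ?_) (ih fun h => by have := hb h; omega)
      have := Nat.le_of_dvd (by omega) hd
      have := hb h
      omega
  by_cases h : 0 < orderOf q → b < orderOf q
  · exact key b c (fun h => by have := hbc h; omega) h
  · push Not at h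
    obtain ⟨h0, h⟩ := h
    have := hbc h0
    exact (key c b (fun h => by omega) (fun h => by omega)).swap

end OpRep

section specSpace

open Polynomial

variable {K V W : Type*} [Field K] [AddCommGroup V] [Module K V] [AddCommGroup W] [Module K W]
  {R R' : Set K}

/-- The sum of the generalized eigenspaces of `y` with eigenvalues in `R`. -/
def specSpace (R : Set K) (y : Module.End K V) : Submodule K V where
  carrier := {v | ∃ l : List K, (∀ r ∈ l, r ∈ R) ∧ aeval y (l.map fun r => X - C r).prod v = 0}
  zero_mem' := ⟨[], by simp, by simp⟩
  add_mem' := by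
    rintro v w ⟨l, hl, h⟩ ⟨m, hm, h'⟩
    refine ⟨l ++ m, fun r hr => ?_, ?_⟩
    · rcases List.mem_append.mp hr with hr | hr
      exacts [hl r hr, hm r hr]
    · rw [List.map_append, List.prod_append, map_mul, map_add, Module.End.mul_apply,
        Module.End.mul_apply, h', map_zero, add_zero, ← Module.End.mul_apply, ← map_mul, mul_comm,
        map_mul, Module.End.mul_apply, h, map_zero]
  smul_mem' := by
    rintro c v ⟨l, hl, h⟩
    exact ⟨l, hl, by rw [map_smul, h, smul_zero]⟩

theorem map_aeval_apply {φ : V →ₗ[K] W} {y : Module.End K V} {z : Module.End K W}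
    (h : ∀ v, φ (y v) = z (φ v)) (g : K[X]) (v : V) : φ (aeval y g v) = aeval z g (φ v) := by
  induction g using Polynomial.induction_on' with
  | add p q hp hq => simp only [map_add, LinearMap.add_apply, hp, hq]
  | monomial n c =>
    rw [aeval_monomial, aeval_monomial, Module.End.mul_apply, Module.End.mul_apply,
      Module.algebraMap_end_apply, Module.algebraMap_end_apply, map_smul]
    congr 1
    induction n generalizing v with
    | zero => rfl
    | succ n ih => rw [pow_succ, pow_succ, Module.End.mul_apply, Module.End.mul_apply, ih, h]

theorem map_mem_specSpace {φ : V →ₗ[K] W} {y : Module.End K V} {z : Module.End K W}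
    (h : ∀ v, φ (y v) = z (φ v)) {v : V} (hv : v ∈ specSpace R y) : φ v ∈ specSpace R z := by
  obtain ⟨l, hl, h0⟩ := hv
  exact ⟨l, hl, by rw [← map_aeval_apply h, h0, map_zero]⟩

theorem Commute.apply_mem_specSpace {u y : Module.End K V} (h : Commute u y) {v : V}
    (hv : v ∈ specSpace R y) : u v ∈ specSpace R y :=
  map_mem_specSpace (φ := u) (fun v => LinearMap.congr_fun h.eq v) hv

theorem self_apply_mem_specSpace {y : Module.End K V} {v : V} (hv : v ∈ specSpace R y) :
    y v ∈ specSpace R y := (Commute.refl y).apply_mem_specSpace hv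

theorem aeval_apply_eigenvector {y : Module.End K V} {v : V} {r : K} (h : y v = r • v) (g : K[X]) :
    aeval y g v = g.eval r • v := by
  induction g using Polynomial.induction_on' with
  | add p q hp hq => simp only [map_add, LinearMap.add_apply, hp, hq, eval_add, add_smul]
  | monomial n c =>
    rw [aeval_monomial, Module.End.mul_apply, Module.algebraMap_end_apply, eval_monomial, mul_smul]
    congr 1
    induction n with
    | zero => simp
    | succ n ih => rw [pow_succ', Module.End.mul_apply, ih, map_smul, h, smul_smul, pow_succ]

theorem mem_of_eigenvector_mem_specSpace {y : Module.End K V} {v : V} {r : K} (h : y v = r • v)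
    (hv : v ≠ 0) (hs : v ∈ specSpace R y) : r ∈ R := by
  obtain ⟨l, hl, h0⟩ := hs
  rw [aeval_apply_eigenvector h, smul_eq_zero] at h0
  have h1 := h0.resolve_right hv
  rw [eval_list_prod, List.prod_eq_zero_iff] at h1
  simp only [List.map_map, List.mem_map, Function.comp_apply, eval_sub, eval_X, eval_C,
    sub_eq_zero] at h1
  obtain ⟨s, hs, rfl⟩ := h1
  exact hl _ hs

theorem eigenvector_mem_specSpace {y : Module.End K V} {v : V} {r : K} (h : y v = r • v)
    (hr : r ∈ R) : v ∈ specSpace R y :=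
  ⟨[r], by simpa using hr, by simp [h, Module.algebraMap_end_apply]⟩

theorem exists_eigenvector_of_mem_specSpace {y : Module.End K V} {v : V} (h : v ∈ specSpace R y)
    (hv : v ≠ 0) : ∃ g : K[X], ∃ r ∈ R, aeval y g v ≠ 0 ∧ y (aeval y g v) = r • aeval y g v := by
  obtain ⟨l, hl, h0⟩ := h
  induction l generalizing v with
  | nil => simp at h0; exact absurd h0 hv
  | cons r l ih =>
    by_cases hr : y v = r • v
    · exact ⟨1, r, hl r (by simp), by simpa using hv, by simpa using hr⟩
    · obtain ⟨g, s, hs, hg, hg'⟩ := ih (v := aeval y (X - C r) v)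
        (by simpa [sub_eq_zero, Module.algebraMap_end_apply] using hr)
        (fun s hs => hl s (by simp [hs])) (by
          rw [← Module.End.mul_apply, ← map_mul, mul_comm]
          simpa using h0)
      refine ⟨g * (X - C r), s, hs, ?_⟩
      rw [map_mul, Module.End.mul_apply]
      exact ⟨hg, hg'⟩

theorem isCoprime_prod_X_sub_C {l m : List K} (h : ∀ r ∈ l, ∀ s ∈ m, r ≠ s) :
    IsCoprime (l.map fun r => X - C r).prod (m.map fun r => X - C r).prod := by
  induction l with
  | nil => simpa using isCoprime_one_left
  | cons r l ih =>
    rw [List.map_cons, List.prod_cons]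
    refine IsCoprime.mul_left ?_ (ih fun s hs => h s (by simp [hs]))
    have h' := h r (by simp)
    clear ih h
    induction m with
    | nil => simpa using isCoprime_one_right
    | cons s m ih =>
      rw [List.map_cons, List.prod_cons]
      exact IsCoprime.mul_right (isCoprime_X_sub_C_of_isUnit_sub
        (sub_ne_zero.mpr (h' s (by simp))).isUnit) (ih fun t ht => h' t (by simp [ht]))

theorem mem_of_aeval_mem (hd : Disjoint R R') {y : Module.End K V} {N : Submodule K V}
    (hN : ∀ v ∈ N, y v ∈ N) {w : V} (hw : w ∈ specSpace R' y) {l : List K} (hl : ∀ r ∈ l, r ∈ R)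
    (h : aeval y (l.map fun r => X - C r).prod w ∈ N) : w ∈ N := by
  obtain ⟨m, hm, h0⟩ := hw
  obtain ⟨s, t, hst⟩ := isCoprime_prod_X_sub_C (l := l) (m := m) fun r hr s hs =>
    fun e => Set.disjoint_left.mp hd (hl r hr) (e ▸ hm s hs)
  have h1 := LinearMap.congr_fun (congrArg (aeval y) hst) w
  rw [map_add, map_mul, map_mul, LinearMap.add_apply, Module.End.mul_apply, Module.End.mul_apply,
    h0, map_zero, add_zero, map_one, Module.End.one_apply] at h1
  rw [← h1]
  exact aeval_apply_mem hN s h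

theorem eq_zero_of_mem_specSpace (hd : Disjoint R R') {y : Module.End K V} {w : V}
    (hw : w ∈ specSpace R y) (hw' : w ∈ specSpace R' y) : w = 0 := by
  obtain ⟨l, hl, h0⟩ := hw
  have := mem_of_aeval_mem hd (N := ⊥) (y := y) (by simp) hw' hl (by simp [h0])
  simpa using this

/-- The projector onto one of two complementary spectral subspaces. -/
theorem SpecIn.exists_projector {y : Module.End K V} (h : SpecIn (R ∪ R') y)
    (hd : Disjoint R R') : ∃ g : K[X], ∀ v, aeval y g v ∈ specSpace R y ∧
      v - aeval y g v ∈ specSpace R' y := by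
  classical
  obtain ⟨l, hl, h0⟩ := h
  have hperm : ∃ l₀ l₁ : List K, (∀ r ∈ l₀, r ∈ R) ∧ (∀ r ∈ l₁, r ∈ R') ∧
      aeval y ((l₀.map fun r => X - C r).prod * (l₁.map fun r => X - C r).prod) = 0 := by
    refine ⟨l.filter (· ∈ R), l.filter (· ∉ R), fun r hr => by simpa using (List.mem_filter.mp
        hr).2,
      fun r hr => ?_, ?_⟩
    · have := List.mem_filter.mp hr
      exact (hl r this.1).resolve_left (by simpa using this.2)
    · rw [← h0]
      congr 1
      clear h0 hl
      induction l with
      | nil => simp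
      | cons r l ih =>
        by_cases hr : r ∈ R
        · simp only [List.filter_cons, hr, decide_true, ↓reduceIte, List.map_cons, List.prod_cons,
            ← ih, not_true_eq_false, decide_false, mul_assoc, Bool.false_eq_true]
        · simp only [List.filter_cons, hr, decide_true, ↓reduceIte, List.map_cons, List.prod_cons,
            ← ih, not_false_eq_true, decide_false, mul_left_comm, Bool.false_eq_true]
  obtain ⟨l₀, l₁, hl₀, hl₁, h01⟩ := hperm
  obtain ⟨s, t, hst⟩ := isCoprime_prod_X_sub_C (l := l₀) (m := l₁) fun r hr s hs =>
    fun e => Set.disjoint_left.mp hd (hl₀ r hr) (e ▸ hl₁ s hs)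
  set f₀ := (l₀.map fun r => X - C r).prod
  set f₁ := (l₁.map fun r => X - C r).prod
  refine ⟨t * f₁, fun v => ⟨⟨l₀, hl₀, ?_⟩, l₁, hl₁, ?_⟩⟩
  · rw [← Module.End.mul_apply, ← map_mul, mul_left_comm, map_mul, h01, mul_zero,
      LinearMap.zero_apply]
  · have h1 : v - aeval y (t * f₁) v = aeval y (s * f₀) v := by
      have := LinearMap.congr_fun (congrArg (aeval y) hst) v
      rw [map_add, LinearMap.add_apply, map_one, Module.End.one_apply] at this
      exact sub_eq_of_eq_add this.symm
    rw [h1, ← Module.End.mul_apply, ← map_mul, mul_left_comm, mul_comm _ f₀, map_mul, h01,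
      mul_zero, LinearMap.zero_apply]

theorem aeval_apply_sub_mem {y z t : Module.End K V} {U N : Submodule K V}
    (hU : ∀ v ∈ U, y v ∈ U) (hN : ∀ v ∈ N, z v ∈ N) (h : ∀ v ∈ N, y (t v) - t (z v) ∈ U)
    (g : K[X]) {v : V} (hv : v ∈ N) : aeval y g (t v) - t (aeval z g v) ∈ U := by
  induction g using Polynomial.induction_on' with
  | add p q hp hq =>
    simp only [map_add, LinearMap.add_apply, add_sub_add_comm]
    exact U.add_mem hp hq
  | monomial n c =>
    rw [aeval_monomial, aeval_monomial, Module.End.mul_apply, Module.End.mul_apply,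
      Module.algebraMap_end_apply, Module.algebraMap_end_apply, map_smul, ← smul_sub]
    refine U.smul_mem c ?_
    induction n with
    | zero => simp
    | succ n ih =>
      rw [pow_succ', pow_succ', Module.End.mul_apply, Module.End.mul_apply]
      have hz : ∀ n, (z ^ n) v ∈ N := by
        intro n
        induction n with
        | zero => exact hv
        | succ n ih => rw [pow_succ', Module.End.mul_apply]; exact hN _ ih
      have := U.add_mem (hU _ ih) (h _ (hz n))
      rwa [map_sub, sub_add_sub_cancel] at this

theorem apply_mem_specSpace_of_sub_mem {y z t : Module.End K V} {U : Submodule K V}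
    (hy : ∀ v ∈ U, y v ∈ U) (hz : ∀ v ∈ U, z v ∈ U) (h : ∀ v ∈ U, y (t v) - t (z v) ∈ U)
    (hUy : U ≤ specSpace R y) (hUz : U ≤ specSpace R z) {v : V} (hv : v ∈ U) :
    t v ∈ specSpace R y := by
  obtain ⟨l, hl, h0⟩ := hUz hv
  have h1 := aeval_apply_sub_mem hy hz h (l.map fun r => X - C r).prod hv
  rw [h0, map_zero, sub_zero] at h1
  obtain ⟨m, hm, h2⟩ := hUy h1
  refine ⟨m ++ l, fun r hr => ?_, ?_⟩
  · rcases List.mem_append.mp hr with hr | hr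
    exacts [hm r hr, hl r hr]
  · rw [List.map_append, List.prod_append, map_mul, Module.End.mul_apply, h2]

theorem eq_zero_of_smul_eq (hd : Disjoint R R') {c : K} (hR : ∀ r ∈ R, c * r ∈ R)
    {y z : Module.End K V} (hyz : Commute y z) {v : V} (hy : v ∈ specSpace R y)
    (hz : v ∈ specSpace R' z) (h : c • y v = z v) : v = 0 := by
  by_contra hv
  obtain ⟨g, r, hr, hg, he⟩ := exists_eigenvector_of_mem_specSpace hy hv
  have h1 : z (aeval y g v) = (c * r) • aeval y g v := by
    rw [mul_smul, ← he, ← Module.End.mul_apply, (hyz.symm.aeval_right g).eq, Module.End.mul_apply,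
      ← h, map_smul, ← Module.End.mul_apply, ← ((Commute.refl y).aeval_right g).eq,
      Module.End.mul_apply]
  exact Set.disjoint_left.mp hd (hR r hr) (mem_of_eigenvector_mem_specSpace h1 hg
    ((hyz.symm.aeval_right g).symm.apply_mem_specSpace hz))

end specSpace

/-- The relations of type `B` for a starting operator `x` and operators `T k`, `k + 1 < n`. -/
structure IsTypeB {K A : Type*} [Field K] [Ring A] [Algebra K A] (q Q : K) (x : A) (T : ℕ → A)
    (n : ℕ) : Prop where
  hecke : IsHecke q T n
  start : IsJMStart x T n
  quad : (x + 1) * (x - Q • 1) = 0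

/-- Two disjoint sets of scalars, closed under multiplication by `q` and `q⁻¹` and containing the
two eigenvalues of the starting operator. -/
structure IsSeparated {K : Type*} [Field K] (q Q : K) (R R' : Set K) : Prop where
  disj : Disjoint R R'
  mem : Q ∈ R
  mem' : -1 ∈ R'
  shift : ∀ r ∈ R, q * r ∈ R ∧ q⁻¹ * r ∈ R
  shift' : ∀ r ∈ R', q * r ∈ R' ∧ q⁻¹ * r ∈ R'

namespace IsTypeB

variable {K V : Type*} [Field K] [AddCommGroup V] [Module K V] {q Q : K} {x : Module.End K V}
  {T : ℕ → Module.End K V} {n : ℕ} {R R' : Set K}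

theorem specIn_jm (h : IsTypeB q Q x T n) (hq : q ≠ 0) (hR : IsSeparated q Q R R') {k : ℕ}
    (hk : k < n) : SpecIn (R ∪ R') (jm q x T k) := by
  refine h.hecke.specIn_jm hq h.start ?_ ⟨[-1, Q], ?_, ?_⟩ hk
  · rintro r (hr | hr)
    · exact ⟨Or.inl (hR.shift r hr).1, Or.inl (hR.shift r hr).2⟩
    · exact ⟨Or.inr (hR.shift' r hr).1, Or.inr (hR.shift' r hr).2⟩
  · simpa using ⟨Or.inr hR.mem', Or.inl hR.mem⟩
  · simpa [Algebra.algebraMap_eq_smul_one] using h.quad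

theorem start_apply (h : IsTypeB q Q x T n) (hR : IsSeparated q Q R R') {v : V}
    (hv : v ∈ specSpace R x) : x v = Q • v := by
  have h1 := LinearMap.congr_fun h.quad v
  simp only [Module.End.mul_apply, LinearMap.add_apply, LinearMap.sub_apply, LinearMap.smul_apply,
    Module.End.one_apply, LinearMap.zero_apply] at h1
  refine sub_eq_zero.mp (eq_zero_of_mem_specSpace hR.disj (y := x)
    (Submodule.sub_mem _ (self_apply_mem_specSpace hv) (Submodule.smul_mem _ Q hv))
    (eigenvector_mem_specSpace (r := -1) ?_ hR.mem'))
  rw [neg_one_smul]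
  exact eq_neg_of_add_eq_zero_left h1

theorem start_apply' (h : IsTypeB q Q x T n) (hR : IsSeparated q Q R R') {v : V}
    (hv : v ∈ specSpace R' x) : x v = -v := by
  have h1 := LinearMap.congr_fun h.quad v
  simp only [Module.End.mul_apply, LinearMap.add_apply, LinearMap.sub_apply, LinearMap.smul_apply,
    Module.End.one_apply, LinearMap.zero_apply, map_sub, map_smul] at h1
  refine eq_neg_of_add_eq_zero_left (eq_zero_of_mem_specSpace hR.disj (y := x)
    (eigenvector_mem_specSpace (r := Q) ?_ hR.mem)
    (Submodule.add_mem _ (self_apply_mem_specSpace hv) hv))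
  rw [map_add, ← sub_eq_zero, ← h1]

theorem intertwiner_eq_zero (h : IsTypeB q Q x T n) (hq : q ≠ 0) (hR : IsSeparated q Q R R') {k : ℕ}
    (hk : k + 1 < n) {v : V} (hv : v ∈ specSpace R (jm q x T k))
    (hv' : v ∈ specSpace R' (jm q x T (k + 1))) (h0 : intertwiner q x T k v = 0) : v = 0 := by
  have h1 := LinearMap.congr_fun (h.hecke.intertwiner_mul_self hq h.start hk) v
  have hc := h.hecke.commute_jm_jm h.start (show k < n by omega) hk
  rw [Module.End.mul_apply, h0, map_zero, Module.End.mul_apply] at h1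
  set L := jm q x T k
  set M := jm q x T (k + 1)
  have hw : (q • M - L) v = 0 := by
    have e1 : Commute (q • M - L) L := (hc.symm.smul_left q).sub_left (Commute.refl L)
    have e2 : Commute (q • M - L) M := ((Commute.refl M).smul_left q).sub_left hc
    refine eq_zero_of_smul_eq hR.disj (fun r hr => (hR.shift r hr).1) hc
      (e1.apply_mem_specSpace hv) (e2.apply_mem_specSpace hv') ?_
    simpa [sub_eq_zero] using h1.symm
  refine eq_zero_of_smul_eq hR.disj.symm (fun r hr => (hR.shift' r hr).1) hc.symm hv' hv ?_
  simpa [sub_eq_zero] using hw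

theorem commute_intertwiner_of_lt (h : IsTypeB q Q x T n) {j k : ℕ} (hj : j < k) (hk : k + 1 < n) :
    Commute (intertwiner q x T k) (jm q x T j) := by
  have h1 := h.hecke.commute_jm_of_lt h.start hj hk
  have h2 := h.hecke.commute_jm_jm h.start (show k < n by omega) (show j < n by omega)
  exact (h1.mul_left h2).sub_left (h2.mul_left h1)

theorem jm_apply_eq_neg (h : IsTypeB q Q x T n) (hq : q ≠ 0) (hR : IsSeparated q Q R R') {k : ℕ}
    (hk : k < n) {v : V} (hv : ∀ j < k, v ∈ specSpace R (jm q x T j))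
    (hv' : v ∈ specSpace R' (jm q x T k)) : jm q x T k v = -v := by
  induction k generalizing v with
  | zero => exact h.start_apply' hR hv'
  | succ k ih =>
    have h1 := h.hecke.semiconjBy_intertwiner_succ hq h.start hk
    have h2 := h.hecke.commute_jm_jm h.start (show k < n by omega) hk
    have h3 := ih (by omega) (v := intertwiner q x T k v)
      (fun j hj => (h.commute_intertwiner_of_lt hj hk).apply_mem_specSpace (hv j (by omega)))
      (map_mem_specSpace (fun v => LinearMap.congr_fun h1.eq v) hv')
    refine eq_neg_of_add_eq_zero_left (h.intertwiner_eq_zero hq hR hk ?_ ?_ ?_)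
    · exact Submodule.add_mem _ (h2.symm.apply_mem_specSpace (hv k (by omega))) (hv k (by omega))
    · exact Submodule.add_mem _ (self_apply_mem_specSpace hv') hv'
    · have h4 := LinearMap.congr_fun h1.eq v
      rw [Module.End.mul_apply, Module.End.mul_apply] at h4
      rw [map_add, h4, h3, neg_add_cancel]

theorem apply_mem_specSpace_of_same (h : IsTypeB q Q x T n) (hq : q ≠ 0) {k : ℕ}
    (hk : k + 1 < n) {S : Set K} {v : V} (hv : v ∈ specSpace S (jm q x T k))
    (hv' : v ∈ specSpace S (jm q x T (k + 1))) :
    T k v ∈ specSpace S (jm q x T k) ∧ T k v ∈ specSpace S (jm q x T (k + 1)) := by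
  have hc := h.hecke.commute_jm_jm h.start (show k < n by omega) hk
  have e1 := h.hecke.jm_succ_mul (x := x) hq hk
  have e2 := h.hecke.mul_jm_succ (x := x) hq hk
  set L := jm q x T k
  set M := jm q x T (k + 1)
  set U := specSpace S L ⊓ specSpace S M
  have hL : ∀ v ∈ U, L v ∈ U := fun v hv =>
    ⟨self_apply_mem_specSpace hv.1, hc.apply_mem_specSpace hv.2⟩
  have hM : ∀ v ∈ U, M v ∈ U := fun v hv =>
    ⟨hc.symm.apply_mem_specSpace hv.1, self_apply_mem_specSpace hv.2⟩
  constructor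
  · refine apply_mem_specSpace_of_sub_mem hL hM (fun v hv => ?_) inf_le_left inf_le_right ⟨hv, hv'⟩
    have := LinearMap.congr_fun e2 v
    simp only [Module.End.mul_apply, LinearMap.add_apply, LinearMap.smul_apply] at this
    rw [this, sub_add_cancel_left]
    exact U.neg_mem (U.smul_mem _ (hM v hv))
  · refine apply_mem_specSpace_of_sub_mem hM hL (fun v hv => ?_) inf_le_right inf_le_left ⟨hv, hv'⟩
    have := LinearMap.congr_fun e1 v
    simp only [Module.End.mul_apply, LinearMap.add_apply, LinearMap.smul_apply] at this
    rw [this, add_sub_cancel_left]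
    exact U.smul_mem _ (hM v hv)

end IsTypeB

/-- The joint spectral subspace where the first `a` Jucys-Murphy elements have eigenvalues in `R`
and the others have eigenvalues in `R'`. -/
def classSpace {K V : Type*} [Field K] [AddCommGroup V] [Module K V] (q : K) (x : Module.End K V)
    (T : ℕ → Module.End K V) (n : ℕ) (R R' : Set K) (a : ℕ) : Submodule K V :=
  ⨅ k ∈ Finset.range n, specSpace (if k < a then R else R') (jm q x T k)

theorem mem_classSpace {K V : Type*} [Field K] [AddCommGroup V] [Module K V] {q : K}
    {x : Module.End K V} {T : ℕ → Module.End K V} {n : ℕ} {R R' : Set K} {a : ℕ} {v : V} :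
    v ∈ classSpace q x T n R R' a ↔
      ∀ k < n, v ∈ specSpace (if k < a then R else R') (jm q x T k) := by
  simp [classSpace, Submodule.mem_iInf]

namespace IsTypeB

variable {K V : Type*} [Field K] [AddCommGroup V] [Module K V] {q Q : K} {x : Module.End K V}
  {T : ℕ → Module.End K V} {n : ℕ} {R R' : Set K} {a : ℕ}

theorem apply_mem_classSpace (h : IsTypeB q Q x T n) (hq : q ≠ 0) {k : ℕ} (hk : k + 1 < n)
    (hka : k + 1 ≠ a) {v : V} (hv : v ∈ classSpace q x T n R R' a) :
    T k v ∈ classSpace q x T n R R' a := by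
  rw [mem_classSpace] at *
  have h1 := hv k (by omega)
  have h2 := hv (k + 1) hk
  have e : (if k + 1 < a then R else R') = if k < a then R else R' := by
    by_cases hc : k < a
    · rw [if_pos hc, if_pos (by omega)]
    · rw [if_neg hc, if_neg (by omega)]
  rw [e] at h2
  have h3 := h.apply_mem_specSpace_of_same hq hk h1 h2
  intro j hj
  rcases lt_trichotomy j k with hjk | rfl | hjk
  · exact (h.hecke.commute_jm_of_lt h.start hjk hk).apply_mem_specSpace (hv j hj)
  · exact h3.1
  · rcases Nat.lt_or_ge (k + 1) j with hjk' | hjk'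
    · exact (h.hecke.commute_jm_of_gt h.start hjk' hj).apply_mem_specSpace (hv j hj)
    · obtain rfl : j = k + 1 := by omega
      rw [e]
      exact h3.2

/-- Subspaces of the class space stable under the admissible operators are stable under the
Jucys-Murphy elements. -/
theorem jm_apply_mem_of_le (h : IsTypeB q Q x T n) (hq : q ≠ 0) (hR : IsSeparated q Q R R')
    {N : Submodule K V} (hN : N ≤ classSpace q x T n R R' a)
    (hT : ∀ k, k + 1 < n → k + 1 ≠ a → ∀ v ∈ N, T k v ∈ N) {i : ℕ} (hi : i < n) {v : V}
    (hv : v ∈ N) : jm q x T i v ∈ N := by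
  induction i generalizing v with
  | zero =>
    have h1 := mem_classSpace.mp (hN hv) 0 hi
    by_cases ha : 0 < a
    · rw [if_pos ha] at h1
      rw [jm, h.start_apply hR h1]
      exact N.smul_mem _ hv
    · rw [if_neg ha] at h1
      rw [jm, h.start_apply' hR h1]
      exact N.neg_mem hv
  | succ i ih =>
    by_cases ha : i + 1 = a
    · have h1 := mem_classSpace.mp (hN hv)
      have h2 := h1 (i + 1) hi
      rw [if_neg (by omega)] at h2
      rw [h.jm_apply_eq_neg hq hR hi (fun j hj => ?_) h2]
      · exact N.neg_mem hv
      · have h3 := h1 j (by omega)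
        rwa [if_pos (by omega)] at h3
    · rw [jm]
      exact N.smul_mem _ (hT i hi ha _ (ih (by omega) (hT i hi ha v hv)))

/-- The projector onto a class space. -/
theorem exists_classProj {V : Type} [AddCommGroup V] [Module K V] {x : Module.End K V}
    {T : ℕ → Module.End K V} (h : IsTypeB q Q x T n) (hq : q ≠ 0) (hR : IsSeparated q Q R R')
    (a : ℕ) : ∃ e : Module.End K V, (∀ v, e v ∈ classSpace q x T n R R' a) ∧
      (∀ (W : Type) [AddCommGroup W] [Module K W] (φ : V →ₗ[K] W) (x' : Module.End K W)
        (T' : ℕ → Module.End K W), (∀ k < n, ∀ v, φ (jm q x T k v) = jm q x' T' k (φ v)) →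
        ∀ v, φ v ∈ classSpace q x' T' n R R' a → φ (e v) = φ v) ∧
      (∀ P : Submodule K V, (∀ k < n, ∀ v ∈ P, jm q x T k v ∈ P) → ∀ v ∈ P, e v ∈ P) ∧
      ∀ k < n, Commute e (jm q x T k) := by
  have key : ∀ m ≤ n, ∃ e : Module.End K V,
      (∀ v, ∀ k < m, e v ∈ specSpace (if k < a then R else R') (jm q x T k)) ∧
      (∀ (W : Type) [AddCommGroup W] [Module K W] (φ : V →ₗ[K] W) (x' : Module.End K W)
        (T' : ℕ → Module.End K W), (∀ k < n, ∀ v, φ (jm q x T k v) = jm q x' T' k (φ v)) →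
        ∀ v, (∀ k < m, φ v ∈ specSpace (if k < a then R else R') (jm q x' T' k)) →
          φ (e v) = φ v) ∧
      (∀ P : Submodule K V, (∀ k < n, ∀ v ∈ P, jm q x T k v ∈ P) → ∀ v ∈ P, e v ∈ P) ∧
      ∀ k < n, Commute e (jm q x T k) := by
    intro m
    induction m with
    | zero => exact fun _ => ⟨1, by simp, by simp, by simp, fun _ _ => Commute.one_left _⟩
    | succ m ih =>
      intro hm
      obtain ⟨e, h1, h2, h3, h4⟩ := ih (by omega)
      obtain ⟨S, S', hS, hd, hu⟩ : ∃ S S' : Set K, S = (if m < a then R else R') ∧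
          Disjoint S S' ∧ SpecIn (S ∪ S') (jm q x T m) := by
        by_cases hma : m < a
        · exact ⟨R, R', (if_pos hma).symm, hR.disj, h.specIn_jm hq hR hm⟩
        · exact ⟨R', R, (if_neg hma).symm, hR.disj.symm, Set.union_comm R R' ▸ h.specIn_jm hq hR hm⟩
      obtain ⟨g, hg⟩ := hu.exists_projector hd
      have hcg : ∀ k < n, Commute (jm q x T k) (Polynomial.aeval (jm q x T m) g) := fun k hk =>
        (h.hecke.commute_jm_jm h.start hk hm).aeval_right g
      refine ⟨e * Polynomial.aeval (jm q x T m) g, fun v k hk => ?_, ?_, fun P hP v hv => ?_,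
        fun k hk => (h4 k hk).mul_left (hcg k hk).symm⟩
      · rw [Module.End.mul_apply]
        rcases Nat.lt_succ_iff_lt_or_eq.mp hk with hk | rfl
        · exact h1 _ k hk
        · rw [← hS]
          exact (h4 k hm).apply_mem_specSpace (hg v).1
      · intro W _ _ φ x' T' hφ v hv
        have h5 : φ (Polynomial.aeval (jm q x T m) g v) = φ v := by
          rw [← sub_eq_zero, ← neg_eq_zero, neg_sub, ← map_sub]
          refine eq_zero_of_mem_specSpace hd (y := jm q x' T' m) ?_
            (map_mem_specSpace (hφ m hm) (hg v).2)
          rw [map_sub]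
          have := hv m (by omega)
          rw [← hS] at this
          exact Submodule.sub_mem _ this (map_mem_specSpace (hφ m hm) (hg v).1)
        rw [Module.End.mul_apply, h2 W φ x' T' hφ _ (fun k hk => ?_), h5]
        rw [h5]
        exact hv k (by omega)
      · exact h3 P hP _ (aeval_apply_mem (hP m hm) g hv)
  obtain ⟨e, h1, h2, h3, h4⟩ := key n le_rfl
  refine ⟨e, fun v => mem_classSpace.mpr (h1 v), fun W _ _ φ x' T' hφ v hv => ?_, h3, h4⟩
  exact h2 W φ x' T' hφ v (mem_classSpace.mp hv)

end IsTypeB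

section heckeSpan

variable {K V : Type} [Field K] [AddCommGroup V] [Module K V] {q Q : K} {x : Module.End K V}
  {T : ℕ → Module.End K V} {n k : ℕ} {N : Submodule K V}

/-- The span of the images of `N` under the subalgebra generated by the first `k` generators. -/
def heckeSpan (T : ℕ → Module.End K V) (k : ℕ) (N : Submodule K V) : Submodule K V :=
  Submodule.span K {u | ∃ y ∈ hecke K T k, ∃ v ∈ N, u = y v}

theorem apply_mem_heckeSpan {y : Module.End K V} (hy : y ∈ hecke K T k) {v : V} (hv : v ∈ N) :
    y v ∈ heckeSpan T k N := Submodule.subset_span ⟨y, hy, v, hv, rfl⟩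

theorem le_heckeSpan : N ≤ heckeSpan T k N := fun _ hv =>
  apply_mem_heckeSpan (y := 1) (one_mem _) hv

theorem heckeSpan_mono {l : ℕ} (h : k ≤ l) : heckeSpan T k N ≤ heckeSpan T l N :=
  Submodule.span_mono fun _ ⟨y, hy, v, hv, e⟩ => ⟨y, hecke_mono h hy, v, hv, e⟩

theorem heckeSpan_le {P : Submodule K V}
    (h : ∀ y ∈ hecke K T k, ∀ v ∈ N, y v ∈ P) : heckeSpan T k N ≤ P :=
  Submodule.span_le.mpr fun _ ⟨y, hy, v, hv, e⟩ => e ▸ h y hy v hv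

theorem hecke_apply_mem_heckeSpan {y : Module.End K V} (hy : y ∈ hecke K T k) {v : V}
    (hv : v ∈ heckeSpan T k N) : y v ∈ heckeSpan T k N := by
  have : heckeSpan T k N ≤ (heckeSpan T k N).comap y := heckeSpan_le fun z hz v hv => by
    rw [Submodule.mem_comap, ← Module.End.mul_apply]
    exact apply_mem_heckeSpan (mul_mem hy hz) hv
  exact this hv

theorem apply_mem_heckeSpan_of_commute {y : Module.End K V} (hy : ∀ j < k, Commute y (T j))
    (hN : ∀ v ∈ N, y v ∈ N) {v : V} (hv : v ∈ heckeSpan T k N) : y v ∈ heckeSpan T k N := by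
  have : heckeSpan T k N ≤ (heckeSpan T k N).comap y := heckeSpan_le fun z hz v hv => by
    rw [Submodule.mem_comap, ← Module.End.mul_apply, (commute_of_mem_hecke hy hz).eq,
      Module.End.mul_apply]
    exact apply_mem_heckeSpan hz (hN v hv)
  exact this hv

theorem isStable_heckeSpan : IsStable T n (heckeSpan T (n - 1) N) := fun k hk _ hv =>
  hecke_apply_mem_heckeSpan (gen_mem_hecke (by omega)) hv

theorem downProd_apply_mem {j m : ℕ} (h : ∀ i, j ≤ i → i < j + m → ∀ v ∈ N, T i v ∈ N) {v : V}
    (hv : v ∈ N) : downProd T j m v ∈ N := by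
  induction m with
  | zero => exact hv
  | succ m ih =>
    exact h _ (by omega) (by omega) _ (ih fun i h1 h2 => h i h1 (by omega))

theorem IsHecke.jm_apply_mem_heckeSpan (h : IsHecke q T n) (hx : IsJMStart x T n) (hq : q ≠ 0)
    (hN : ∀ i < n, ∀ v ∈ N, jm q x T i v ∈ N) {i : ℕ} (hi : i < n) {v : V}
    (hv : v ∈ heckeSpan T (n - 1) N) : jm q x T i v ∈ heckeSpan T (n - 1) N := by
  set P := heckeSpan T (n - 1) N
  let P' : Submodule K V := P ⊓ ⨅ i ∈ Finset.range n, P.comap (jm q x T i)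
  have hP' : ∀ v, v ∈ P' ↔ v ∈ P ∧ ∀ i < n, jm q x T i v ∈ P := fun v => by
    simp [P', Submodule.mem_iInf]
  have hst : ∀ k < n - 1, ∀ v ∈ P', T k v ∈ P' := by
    intro k hk v hv
    rw [hP'] at hv ⊢
    have hT : ∀ v ∈ P, T k v ∈ P := fun v hv =>
      hecke_apply_mem_heckeSpan (gen_mem_hecke hk) hv
    refine ⟨hT v hv.1, fun i hi => ?_⟩
    have hcom (hc : Commute (T k) (jm q x T i)) : jm q x T i (T k v) ∈ P := by
      rw [← Module.End.mul_apply, ← hc.eq]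
      exact hT _ (hv.2 i hi)
    rcases lt_trichotomy i k with hik | rfl | hik
    · exact hcom (h.commute_jm_of_lt hx hik (by omega))
    · have := LinearMap.congr_fun (h.mul_jm_succ (x := x) hq (show i + 1 < n by omega)) v
      simp only [Module.End.mul_apply, LinearMap.add_apply, LinearMap.smul_apply] at this
      rw [← sub_eq_iff_eq_add] at this
      rw [← this]
      exact P.sub_mem (hT _ (hv.2 _ (by omega))) (P.smul_mem _ (hv.2 _ (by omega)))
    · rcases Nat.lt_or_ge (k + 1) i with hik' | hik'
      · exact hcom (h.commute_jm_of_gt hx hik' hi)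
      · obtain rfl : i = k + 1 := by omega
        have := LinearMap.congr_fun (h.jm_succ_mul (x := x) hq hi) v
        simp only [Module.End.mul_apply, LinearMap.add_apply, LinearMap.smul_apply] at this
        rw [this]
        exact P.add_mem (hT _ (hv.2 _ (by omega))) (P.smul_mem _ (hv.2 _ (by omega)))
  have hle : P ≤ P' := heckeSpan_le fun y hy => by
    induction hy using Algebra.adjoin_induction with
    | mem y hy =>
      obtain ⟨k, hk, rfl⟩ := hy
      exact fun v hv => hst k hk v ((hP' v).mpr
        ⟨le_heckeSpan hv, fun i hi => le_heckeSpan (hN i hi v hv)⟩)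
    | algebraMap r => exact fun v hv => P'.smul_mem r ((hP' v).mpr
        ⟨le_heckeSpan hv, fun i hi => le_heckeSpan (hN i hi v hv)⟩)
    | add y z _ _ hy hz => exact fun v hv => P'.add_mem (hy v hv) (hz v hv)
    | mul y z hy' hz' hy hz =>
      have hst' : ∀ y ∈ hecke K T (n - 1), ∀ v ∈ P', y v ∈ P' := fun y hy => by
        induction hy using Algebra.adjoin_induction with
        | mem y hy => obtain ⟨k, hk, rfl⟩ := hy; exact hst k hk
        | algebraMap r => exact fun v hv => P'.smul_mem r hv
        | add y z _ _ hy hz => exact fun v hv => P'.add_mem (hy v hv) (hz v hv)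
        | mul y z _ _ hy hz => exact fun v hv => hy _ (hz v hv)
      exact fun v hv => hst' y hy' _ (hz v hv)
  exact ((hP' v).mp (hle hv)).2 i hi

namespace IsTypeB

variable {R R' : Set K} {a : ℕ}

theorem jm_downProd_sub_mem (h : IsTypeB q Q x T n) (hq : q ≠ 0)
    (hT : ∀ k, k + 1 < n → k + 1 ≠ a → ∀ v ∈ N, T k v ∈ N)
    (hL : ∀ i < n, ∀ v ∈ N, jm q x T i v ∈ N) (ha : 0 < a) {m : ℕ} (hm : a + m < n) {v : V}
    (hv : v ∈ N) : jm q x T (a + m) (downProd T (a - 1) (m + 1) v) -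
      downProd T (a - 1) (m + 1) (jm q x T (a - 1) v) ∈ heckeSpan T (a - 1 + m) N := by
  obtain ⟨a, rfl⟩ : ∃ a', a = a' + 1 := ⟨a - 1, by omega⟩
  simp only [Nat.add_sub_cancel] at *
  induction m with
  | zero =>
    have := LinearMap.congr_fun (h.hecke.jm_succ_mul (x := x) hq hm) v
    simp only [Module.End.mul_apply, LinearMap.add_apply, LinearMap.smul_apply] at this
    simp only [downProd, mul_one, add_zero, this, add_sub_cancel_left]
    exact le_heckeSpan (N.smul_mem _ (hL _ hm v hv))
  | succ m ih =>
    have ih := ih (by omega)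
    have hm' : a + 1 + m + 1 < n := hm
    have e := LinearMap.congr_fun (h.hecke.jm_succ_mul (x := x) hq hm')
      (downProd T a (m + 1) v)
    simp only [Module.End.mul_apply, LinearMap.add_apply, LinearMap.smul_apply] at e
    have e' : downProd T a (m + 1 + 1) = T (a + 1 + m) * downProd T a (m + 1) := by
      rw [downProd]
      congr 2
      omega
    rw [e']
    simp only [Module.End.mul_apply]
    rw [show a + 1 + (m + 1) = a + 1 + m + 1 by omega, e, add_sub_right_comm, ← map_sub]
    refine Submodule.add_mem _ (heckeSpan_mono (by omega) (apply_mem_heckeSpan_of_commute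
      (fun j hj => ?_) (hT (a + 1 + m) hm (by omega)) ih)) (Submodule.smul_mem _ _ ?_)
    · exact (h.hecke.comm j (a + 1 + m) (by omega) hm).symm
    · refine apply_mem_heckeSpan_of_commute (fun j hj => ?_) (hL _ hm)
        (apply_mem_heckeSpan (downProd_mem_hecke (by omega)) hv)
      exact (h.hecke.commute_jm_of_gt h.start (by omega) hm).symm

theorem proj_hecke_apply_mem (h : IsTypeB q Q x T n) (hq : q ≠ 0) (hR : IsSeparated q Q R R')
    (hN : N ≤ classSpace q x T n R R' a)
    (hT : ∀ k, k + 1 < n → k + 1 ≠ a → ∀ v ∈ N, T k v ∈ N) {e : Module.End K V}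
    (he : ∀ v, e v ∈ classSpace q x T n R R' a)
    (heN : ∀ v ∈ N, e v ∈ N) (heL : ∀ k < n, Commute e (jm q x T k)) {k : ℕ}
    (hk : k < n) {c : Module.End K V} (hc : c ∈ _root_.hecke K T k) {v : V} (hv : v ∈ N) :
    e (c v) ∈ N := by
  have hL : ∀ i < n, ∀ v ∈ N, jm q x T i v ∈ N := fun i hi v hv =>
    h.jm_apply_mem_of_le hq hR hN hT hi hv
  induction k generalizing c v with
  | zero =>
    obtain ⟨r, rfl⟩ := hecke_zero hc
    rw [Module.algebraMap_end_apply]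
    exact heN _ (N.smul_mem _ hv)
  | succ k ih =>
    have ih := fun {c} hc {v} hv => ih (by omega) (c := c) hc (v := v) hv
    rcases Nat.lt_or_ge (k + 1) a with hka | hka
    · have : c v ∈ N := by
        clear ih
        induction hc using Algebra.adjoin_induction generalizing v with
        | mem y hy =>
          obtain ⟨j, hj, rfl⟩ := hy
          simp only [Set.mem_Iio] at hj
          exact hT j (by omega) (by omega) v hv
        | algebraMap r => exact N.smul_mem r hv
        | add y z _ _ hy hz => exact N.add_mem (hy hv) (hz hv)
        | mul y z _ _ hy hz => exact hy (hz hv)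
      exact heN _ this
    have ihspan : ∀ u ∈ heckeSpan T k N, e u ∈ N := fun u hu => by
      have : heckeSpan T k N ≤ N.comap e := heckeSpan_le fun y hy v hv => ih hy hv
      exact this hu
    have hLP : ∀ u ∈ heckeSpan T k N, jm q x T (k + 1) u ∈ heckeSpan T k N := fun u hu =>
      apply_mem_heckeSpan_of_commute (fun j hj =>
        (h.hecke.commute_jm_of_gt h.start (by omega) hk).symm) (hL _ hk) hu
    have hspan := (h.hecke.mono (show k + 2 ≤ n by omega)).hecke_succ_le_span hc
    clear hc
    induction hspan using Submodule.span_induction with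
    | zero => simp
    | add y z _ _ hy hz => simpa using N.add_mem hy hz
    | smul r y _ hy => simpa using N.smul_mem r hy
    | mem y hy =>
      obtain ⟨c, hc, p, hp, rfl⟩ := hy
      rw [Module.End.mul_apply]
      rcases Nat.lt_or_ge p a with hpa | hpa
      swap
      · exact ih hc (downProd_apply_mem (fun i h1 h2 => hT i (by omega) (by omega)) hv)
      have e1 : downProd T p (k + 1 - p) =
          downProd T (a - 1) (k + 1 - a + 1) * downProd T p (a - 1 - p) := by
        have := downProd_add T p (a - 1 - p) (k + 1 - a + 1)
        rwa [show a - 1 - p + (k + 1 - a + 1) = k + 1 - p by omega,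
          show p + (a - 1 - p) = a - 1 by omega] at this
      have hv' : downProd T p (a - 1 - p) v ∈ N :=
        downProd_apply_mem (fun i h1 h2 => hT i (by omega) (by omega)) hv
      rw [e1, Module.End.mul_apply]
      set w := downProd T p (a - 1 - p) v
      set D := downProd T (a - 1) (k + 1 - a + 1)
      have hsub : ∀ w ∈ N, jm q x T (k + 1) (D w) - D (jm q x T (a - 1) w) ∈
          heckeSpan T k N := by
        intro w hw
        have := h.jm_downProd_sub_mem hq hT hL (by omega) (m := k + 1 - a) (by omega) hw
        rwa [show a + (k + 1 - a) = k + 1 by omega, show a - 1 + (k + 1 - a) = k by omega] at this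
      have hw1 := mem_classSpace.mp (hN hv') (a - 1) (by omega)
      rw [if_pos (by omega)] at hw1
      obtain ⟨l, hl, hl0⟩ := hw1
      have h2 := aeval_apply_sub_mem hLP (hL (a - 1) (by omega)) hsub
        (l.map fun r => Polynomial.X - Polynomial.C r).prod hv'
      rw [hl0, map_zero, sub_zero] at h2
      have hcL : Commute (jm q x T (k + 1)) c := commute_of_mem_hecke (K := K) (k := k) (T := T)
        (fun j hj => (h.hecke.commute_jm_of_gt h.start (by omega) hk).symm) hc
      have h3 := mem_classSpace.mp (he (c (D w))) (k + 1) hk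
      rw [if_neg (by omega)] at h3
      refine mem_of_aeval_mem hR.disj (hL _ hk) h3 hl ?_
      have e2 := LinearMap.congr_fun ((heL _ hk).aeval_right
        (l.map fun r => Polynomial.X - Polynomial.C r).prod).eq (c (D w))
      have e3 := LinearMap.congr_fun (hcL.symm.aeval_right
        (l.map fun r => Polynomial.X - Polynomial.C r).prod).eq (D w)
      rw [Module.End.mul_apply, Module.End.mul_apply] at e2 e3
      rw [← e2, ← e3]
      exact ihspan _ (hecke_apply_mem_heckeSpan hc h2)

/-- Every admissible subspace of a class space is cut out by a stable subspace. -/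
theorem exists_stable_inf_eq (h : IsTypeB q Q x T n) (hq : q ≠ 0) (hR : IsSeparated q Q R R')
    (hn : 0 < n) (hN : N ≤ classSpace q x T n R R' a)
    (hT : ∀ k, k + 1 < n → k + 1 ≠ a → ∀ v ∈ N, T k v ∈ N) :
    ∃ P : Submodule K V, IsStable T n P ∧ (∀ v ∈ P, x v ∈ P) ∧ N ≤ P ∧
      P ⊓ classSpace q x T n R R' a ≤ N := by
  have hL : ∀ i < n, ∀ v ∈ N, jm q x T i v ∈ N := fun i hi v hv =>
    h.jm_apply_mem_of_le hq hR hN hT hi hv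
  obtain ⟨e, he, he1, he2, he3⟩ := h.exists_classProj hq hR a
  refine ⟨heckeSpan T (n - 1) N, isStable_heckeSpan,
    fun v hv => h.hecke.jm_apply_mem_heckeSpan h.start hq hL hn hv, le_heckeSpan, ?_⟩
  rintro v ⟨hv, hv'⟩
  have h1 : e v = v := he1 V LinearMap.id x T (fun _ _ _ => rfl) v hv'
  rw [← h1]
  have : heckeSpan T (n - 1) N ≤ N.comap e := heckeSpan_le fun y hy v hv =>
    h.proj_hecke_apply_mem hq hR hN hT he (he2 N hL) he3 (by omega) hy hv
  exact this hv

end IsTypeB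

end heckeSpan

section centralPolynomial

open Polynomial

/-- The product of the factors `X - L k` for `k < m`. -/
noncomputable def factorProd {A : Type*} [Ring A] (L : ℕ → A) : ℕ → A[X]
  | 0 => 1
  | m + 1 => factorProd L m * (X - C (L m))

section ring

variable {A : Type*} [Ring A] {L : ℕ → A} {t : A}

theorem commute_C_X_sub_C {y : A} (h : Commute t y) : Commute (C t) (X - C y) :=
  (commute_X (C t)).symm.sub_right (h.map C)

theorem commute_C_factorProd {m : ℕ} (h : ∀ k < m, Commute t (L k)) :
    Commute (C t) (factorProd L m) := by
  induction m with
  | zero => exact Commute.one_right _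
  | succ m ih =>
    exact (ih fun k hk => h k (by omega)).mul_right (commute_C_X_sub_C (h m (by omega)))

theorem commute_C_factorProd_of_swap {i n : ℕ} (hi : i + 1 < n)
    (h : ∀ k < n, k ≠ i → k ≠ i + 1 → Commute t (L k)) (hadd : Commute t (L i + L (i + 1)))
    (hmul : Commute t (L i * L (i + 1))) : Commute (C t) (factorProd L n) := by
  obtain ⟨m, rfl⟩ := Nat.exists_eq_add_of_le (show i + 2 ≤ n by omega)
  clear hi
  induction m with
  | zero =>
    have e : factorProd L (i + 2 + 0) =
        factorProd L i * (X * X - C (L i + L (i + 1)) * X + C (L i * L (i + 1))) := by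
      change factorProd L i * (X - C (L i)) * (X - C (L (i + 1))) = _
      rw [mul_assoc, C_add, C_mul, sub_mul, mul_sub, mul_sub, X_mul_C (L (i + 1))]
      noncomm_ring
    rw [e]
    have hX : Commute (C t) X := (commute_X (C t)).symm
    exact (commute_C_factorProd fun k hk => h k (by omega) (by omega) (by omega)).mul_right
      (((hX.mul_right hX).sub_right ((hadd.map C).mul_right hX)).add_right (hmul.map C))
  | succ m ih =>
    exact (ih fun k hk h1 h2 => h k (by omega) h1 h2).mul_right
      (commute_C_X_sub_C (h (i + 2 + m) (by omega) (by omega) (by omega)))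

theorem commute_coeff {p : A[X]} (h : Commute (C t) p) (j : ℕ) : Commute t (p.coeff j) := by
  have := congrArg (fun p => p.coeff j) h.eq
  rw [commute_iff_eq]
  simpa only [coeff_C_mul, coeff_mul_C] using this

end ring

variable {K V W : Type*} [Field K] [AddCommGroup V] [Module K V] [AddCommGroup W] [Module K W]

theorem factorProd_coeff_apply {L : ℕ → Module.End K V} {n : ℕ} {v : V} {i : ℕ → K}
    (h : ∀ k < n, L k v = i k • v) (j : ℕ) :
    (factorProd L n).coeff j v = (∏ k ∈ Finset.range n, (X - C (i k))).coeff j • v := by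
  induction n generalizing j with
  | zero => by_cases hj : j = 0 <;> simp [factorProd, coeff_one, hj]
  | succ n ih =>
    have ih := fun j => ih (fun k hk => h k (by omega)) j
    rw [factorProd, Finset.prod_range_succ]
    cases j with
    | zero =>
      rw [mul_coeff_zero, mul_coeff_zero]
      simp only [coeff_sub, coeff_X_zero, coeff_C_zero, zero_sub, Module.End.mul_apply,
        LinearMap.neg_apply, h n (by omega), map_neg, map_smul, ih]
      module
    | succ j =>
      rw [coeff_mul_X_sub_C, coeff_mul_X_sub_C]
      simp only [LinearMap.sub_apply, Module.End.mul_apply, h n (by omega), map_smul, ih]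
      module

theorem map_factorProd_coeff {L : ℕ → Module.End K V} {L' : ℕ → Module.End K W} {n : ℕ}
    {φ : V →ₗ[K] W} (h : ∀ k < n, ∀ v, φ (L k v) = L' k (φ v)) (j : ℕ) (v : V) :
    φ ((factorProd L n).coeff j v) = (factorProd L' n).coeff j (φ v) := by
  induction n generalizing j v with
  | zero => by_cases hj : j = 0 <;> simp [factorProd, coeff_one, hj]
  | succ n ih =>
    have ih := fun j v => ih (fun k hk => h k (by omega)) j v
    rw [factorProd, factorProd]
    cases j with
    | zero =>
      rw [mul_coeff_zero, mul_coeff_zero]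
      simp only [coeff_sub, coeff_X_zero, coeff_C_zero, zero_sub, Module.End.mul_apply,
        LinearMap.neg_apply, h n (by omega), map_neg, ih]
    | succ j =>
      rw [coeff_mul_X_sub_C, coeff_mul_X_sub_C]
      simp only [LinearMap.sub_apply, Module.End.mul_apply, h n (by omega), map_sub, ih]

namespace IsHecke

variable {A : Type*} [Ring A] [Algebra K A] {q : K} {x : A} {T : ℕ → A} {n : ℕ}

theorem commute_gen_factorProd (hq : q ≠ 0) (h : IsHecke q T n) (hx : IsJMStart x T n) {i : ℕ}
    (hi : i + 1 < n) (j : ℕ) : Commute (T i) ((factorProd (jm q x T) n).coeff j) := by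
  have e1 := h.jm_succ_mul (x := x) hq hi
  have e2 := h.mul_jm_succ (x := x) hq hi
  have e3 := h.commute_jm_jm hx (show i < n by omega) hi
  refine commute_coeff (commute_C_factorProd_of_swap hi (fun k hk h1 h2 => ?_) ?_ ?_) j
  · rcases lt_trichotomy k i with hki | hki | hki
    · exact h.commute_jm_of_lt hx hki hi
    · exact absurd hki h1
    · exact h.commute_jm_of_gt hx (by omega) hk
  · rw [commute_iff_eq, mul_add, add_mul, e1, e2]
    abel
  · rw [commute_iff_eq, ← mul_assoc]
    have e4 : T i * jm q x T i = jm q x T (i + 1) * T i - (q - 1) • jm q x T (i + 1) := by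
      rw [e1]; abel
    have e5 : jm q x T i * T i = T i * jm q x T (i + 1) - (q - 1) • jm q x T (i + 1) := by
      rw [e2]; abel
    rw [e4, e3.eq, sub_mul, mul_assoc, e2, mul_assoc (jm q x T (i + 1)), mul_add, smul_mul_assoc,
      mul_smul_comm]
    abel

theorem commute_start_factorProd (h : IsHecke q T n) (hx : IsJMStart x T n) (hn : 0 < n) (j : ℕ) :
    Commute x ((factorProd (jm q x T) n).coeff j) :=
  commute_coeff (commute_C_factorProd fun _ hk => h.commute_jm_jm hx hn hk) j

end IsHecke

open scoped Classical in
theorem card_filter_eq_countP (n : ℕ) (i : ℕ → K) (R : Set K) :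
    ((Finset.range n).filter fun k => i k ∈ R).card =
      (∏ k ∈ Finset.range n, (X - C (i k))).roots.countP (· ∈ R) := by
  have : (∏ k ∈ Finset.range n, (X - C (i k))) =
      (((Finset.range n).val.map i).map fun r => X - C r).prod := by
    rw [Multiset.map_map]; rfl
  rw [this, roots_multiset_prod_X_sub_C, Multiset.countP_map]
  rfl

end centralPolynomial

section typeB

variable {K V W : Type} [Field K] [AddCommGroup V] [Module K V] [AddCommGroup W] [Module K W]
  {q Q : K} {x : Module.End K V} {x' : Module.End K W} {T : ℕ → Module.End K V}
  {T' : ℕ → Module.End K W} {n a : ℕ} {R R' : Set K}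

/-- A linear map intertwining two type `B` families. -/
structure IsBHom (n : ℕ) (x : Module.End K V) (T : ℕ → Module.End K V) (x' : Module.End K W)
    (T' : ℕ → Module.End K W) (φ : V →ₗ[K] W) : Prop where
  start : ∀ v, φ (x v) = x' (φ v)
  gen : ∀ k, k + 1 < n → ∀ v, φ (T k v) = T' k (φ v)

/-- Subspaces stable under a type `B` family. -/
structure IsBStable (n : ℕ) (x : Module.End K V) (T : ℕ → Module.End K V) (P : Submodule K V) :
    Prop where
  start : ∀ v ∈ P, x v ∈ P
  gen : IsStable T n P

theorem IsBHom.jm {φ : V →ₗ[K] W} (h : IsBHom n x T x' T' φ) {k : ℕ} (hk : k < n) (v : V) :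
    φ (jm q x T k v) = _root_.jm q x' T' k (φ v) := by
  induction k generalizing v with
  | zero => exact h.start v
  | succ k ih =>
    simp only [_root_.jm, LinearMap.smul_apply, Module.End.mul_apply, map_smul]
    rw [h.gen k hk, ih (by omega), h.gen k hk]

theorem IsBHom.map_mem_classSpace {φ : V →ₗ[K] W} (h : IsBHom n x T x' T' φ) {v : V}
    (hv : v ∈ classSpace q x T n R R' a) : φ v ∈ classSpace q x' T' n R R' a :=
  mem_classSpace.mpr fun k hk =>
    map_mem_specSpace (fun v => h.jm hk v) (mem_classSpace.mp hv k hk)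

theorem IsBStable.map {P : Submodule K V} (hP : IsBStable n x T P) {φ : V →ₗ[K] W}
    (h : IsBHom n x T x' T' φ) : IsBStable n x' T' (P.map φ) where
  start := by
    rintro _ ⟨v, hv, rfl⟩
    exact ⟨x v, hP.start v hv, h.start v⟩
  gen := hP.gen.map h.gen

theorem IsBStable.top : IsBStable n x T ⊤ := ⟨fun _ _ => trivial, IsStable.top⟩

theorem IsTypeB.of_surjective (h : IsTypeB q Q x T n) {φ : V →ₗ[K] W}
    (hs : Function.Surjective φ) (hφ : IsBHom n x T x' T' φ) : IsTypeB q Q x' T' n where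
  hecke := h.hecke.of_surjective hs hφ.gen
  start := by
    constructor
    · intro k h0 hk
      refine LinearMap.ext fun w => ?_
      obtain ⟨v, rfl⟩ := hs w
      have := congrArg φ (LinearMap.congr_fun (h.start.comm k h0 hk) v)
      simpa [hφ.gen k hk, hφ.start] using this
    · intro hn
      refine LinearMap.ext fun w => ?_
      obtain ⟨v, rfl⟩ := hs w
      have := congrArg φ (LinearMap.congr_fun (h.start.braid hn) v)
      simpa [hφ.gen 0 hn, hφ.start] using this
  quad := by
    refine LinearMap.ext fun w => ?_
    obtain ⟨v, rfl⟩ := hs w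
    have := congrArg φ (LinearMap.congr_fun h.quad v)
    simpa [hφ.start] using this

/-- The quotient of a type `B` family by a stable subspace. -/
theorem IsBStable.exists_quotient {P : Submodule K V} (hP : IsBStable n x T P) :
    ∃ (x' : Module.End K (V ⧸ P)) (T' : ℕ → Module.End K (V ⧸ P)), IsBHom n x T x' T' P.mkQ := by
  classical
  refine ⟨P.mapQ P x hP.start, fun k =>
    if hk : P ≤ P.comap (T k) then P.mapQ P (T k) hk else 0, fun v => rfl, fun k hk v => ?_⟩
  have : P ≤ P.comap (T k) := fun v hv => hP.gen k hk v hv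
  simp [this]

namespace IsTypeB

theorem jm_apply_mem {P : Submodule K V} (hP : IsBStable n x T P) {k : ℕ} (hk : k < n) {v : V}
    (hv : v ∈ P) : jm q x T k v ∈ P := _root_.jm_apply_mem hP.gen hP.start hk hv

theorem exists_weight (h : IsTypeB q Q x T n) (hq : q ≠ 0) (hR : IsSeparated q Q R R')
    {P : Submodule K V} (hP : IsBStable n x T P) (h0 : P ≠ ⊥) :
    ∃ v ∈ P, v ≠ 0 ∧ ∃ i : ℕ → K, ∀ k < n, i k ∈ R ∪ R' ∧ jm q x T k v = i k • v :=
  exists_weight_vector (fun _ hi _ hj => h.hecke.commute_jm_jm h.start hi hj)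
    (fun _ hk => h.specIn_jm hq hR hk) (fun _ hk _ hv => jm_apply_mem hP hk hv) h0

open scoped Classical in
theorem exists_mem_classSpace (h : IsTypeB q Q x T n) (hq : q ≠ 0) (hR : IsSeparated q Q R R')
    {P : Submodule K V} (hP : IsBStable n x T P) (h0 : P ≠ ⊥)
    (ha : ∀ v ≠ 0, ∀ i : ℕ → K, (∀ k < n, jm q x T k v = i k • v) →
      ((Finset.range n).filter fun k => i k ∈ R).card = a) :
    ∃ v ∈ P, v ≠ 0 ∧ v ∈ classSpace q x T n R R' a := by
  let good (m : ℕ) : Prop := ∃ v ∈ P, v ≠ 0 ∧ ∃ i : ℕ → K,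
    (∀ k < n, i k ∈ R ∪ R' ∧ jm q x T k v = i k • v) ∧
      ∑ k ∈ Finset.range n, (if i k ∈ R then k else 0) = m
  have hgood : ∃ m, good m := by
    obtain ⟨v, hv, hv0, i, hi⟩ := h.exists_weight hq hR hP h0
    exact ⟨_, v, hv, hv0, i, hi, rfl⟩
  obtain ⟨v, hv, hv0, i, hi, hm⟩ := Nat.find_spec hgood
  have hnot : ∀ r, r ∈ R → r ∈ R' → False := fun r h1 h2 =>
    Set.disjoint_left.mp hR.disj h1 h2
  have hsort : ∀ k, k + 1 < n → i (k + 1) ∈ R → i k ∈ R := by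
    intro k hk hkR
    by_contra hkR'
    have hkR' : i k ∈ R' := (hi k (by omega)).1.resolve_left hkR'
    have hne : i k ≠ i (k + 1) := fun e => hnot _ hkR (e ▸ hkR')
    rcases h.hecke.exchange hq h.start hk (hi k (by omega)).2 (hi (k + 1) hk).2 hne hv0 with
      ⟨w, c, hw, hw0, hw1, hw2, hw3⟩ | ⟨-, e⟩ | ⟨-, e⟩
    · have hwP : w ∈ P := hw ▸ P.sub_mem (hP.gen k hk v hv) (P.smul_mem c hv)
      have hlt : ∑ j ∈ Finset.range n,
          (if (Function.update (Function.update i k (i (k + 1))) (k + 1) (i k)) j ∈ R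
            then j else 0) < Nat.find hgood := by
        rw [← hm]
        have m1 : k ∈ Finset.range n := by simp; omega
        have m2 : k + 1 ∈ (Finset.range n).erase k := by simp; omega
        rw [← Finset.add_sum_erase _ _ m1, ← Finset.add_sum_erase _ _ m1,
          ← Finset.add_sum_erase _ _ m2, ← Finset.add_sum_erase _ _ m2]
        have e1 : ∀ j ∈ ((Finset.range n).erase k).erase (k + 1),
            (if (Function.update (Function.update i k (i (k + 1))) (k + 1) (i k)) j ∈ R
              then j else 0) = if i j ∈ R then j else 0 := by
          intro j hj
          simp only [Finset.mem_erase] at hj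
          rw [Function.update_of_ne hj.1, Function.update_of_ne hj.2.1]
        rw [Finset.sum_congr rfl e1, Function.update_of_ne (by omega), Function.update_self,
          Function.update_self, if_pos hkR, if_pos hkR, if_neg (fun e => hnot _ e hkR')]
        omega
      refine Nat.find_min hgood hlt ⟨w, hwP, hw0, _, fun j hj => ?_, rfl⟩
      by_cases hj1 : j = k + 1
      · subst hj1
        rw [Function.update_self]
        exact ⟨(hi k (by omega)).1, hw2⟩
      · rw [Function.update_of_ne hj1]
        by_cases hj2 : j = k
        · subst hj2
          rw [Function.update_self]
          exact ⟨(hi (j + 1) hk).1, hw1⟩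
        · rw [Function.update_of_ne hj2]
          exact ⟨(hi j hj).1, hw3 j hj hj2 hj1 _ (hi j hj).2⟩
    · exact hnot _ hkR (e ▸ (hR.shift' _ hkR').1)
    · exact hnot _ (e ▸ (hR.shift _ hkR).1) hkR'
  have hdown : ∀ j k, j ≤ k → k < n → i k ∈ R → i j ∈ R := by
    intro j k hjk
    induction k, hjk using Nat.le_induction with
    | base => exact fun _ h => h
    | succ k _ ih => exact fun hk hkR => ih (by omega) (hsort k hk hkR)
  have hcard := ha v hv0 i fun k hk => (hi k hk).2
  have hiff : ∀ k < n, i k ∈ R ↔ k < a := by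
    intro k hk
    constructor
    · intro hkR
      have : Finset.range (k + 1) ⊆ (Finset.range n).filter fun k => i k ∈ R := fun j hj => by
        simp only [Finset.mem_range, Finset.mem_filter] at hj ⊢
        exact ⟨by omega, hdown j k (by omega) hk hkR⟩
      have := Finset.card_le_card this
      rw [Finset.card_range, hcard] at this
      omega
    · intro hka
      by_contra hkR
      have : ((Finset.range n).filter fun k => i k ∈ R) ⊆ Finset.range k := fun j hj => by
        simp only [Finset.mem_range, Finset.mem_filter] at hj ⊢
        by_contra hjk
        exact hkR (hdown k j (by omega) hj.1 hj.2)
      have := Finset.card_le_card this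
      rw [Finset.card_range, hcard] at this
      omega
  refine ⟨v, hv, hv0, mem_classSpace.mpr fun k hk => eigenvector_mem_specSpace (hi k hk).2 ?_⟩
  split_ifs with hka
  · exact (hiff k hk).mpr hka
  · exact (hi k hk).1.resolve_left fun e => hka ((hiff k hk).mp e)

end IsTypeB

end typeB

namespace OpRep

open Polynomial

variable {K : Type} [Field K] {q Q : K} {n a : ℕ} {R R' : Set K} {M N : OpRep K ℕ}

/-- Representations of the Hecke algebra of type `B`. -/
def IsB (q Q : K) (n : ℕ) (M : OpRep K ℕ) : Prop :=
  IsTypeB q Q (M.T 0) (fun k => M.T (k + 1)) n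

theorem isBHom_iff (hn : 0 < n) {f : M.V →ₗ[K] N.V} : IsBHom n (M.T 0) (fun k => M.T (k + 1))
    (N.T 0) (fun k => N.T (k + 1)) f ↔ IsHom (Set.Iio n) M N f := by
  refine ⟨fun h i hi => ?_, fun h => ⟨h 0 hn, fun k hk => h (k + 1) hk⟩⟩
  cases i with
  | zero => exact h.start
  | succ i => exact h.gen i hi

theorem isBStable_iff (hn : 0 < n) {P : Submodule K M.V} :
    IsBStable n (M.T 0) (fun k => M.T (k + 1)) P ↔ M.Stable (Set.Iio n) P := by
  refine ⟨fun h i hi => ?_, fun h => ⟨h 0 hn, fun k hk => h (k + 1) hk⟩⟩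
  cases i with
  | zero => exact h.start
  | succ i => exact h.gen i hi

/-- The class space of a representation of type `B`. -/
def cls (q : K) (R R' : Set K) (n a : ℕ) (M : OpRep K ℕ) : Submodule K M.V :=
  (classSpace q (M.T 0) (fun k => M.T (k + 1)) n R R' a : Submodule K M.V)

/-- Stable subspaces are determined by their intersection with the class space. -/
def IsClassGenerated (q : K) (R R' : Set K) (n a : ℕ) (M : OpRep K ℕ) : Prop :=
  ∀ P P' : Submodule K M.V, M.Stable (Set.Iio n) P → M.Stable (Set.Iio n) P' →
    P' ⊓ M.cls q R R' n a ≤ P → P' ≤ P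

theorem Indec.exists_prod_weights_eq (hM : Indec (Set.Iio n) M) (h : IsB q Q n M) (hq : q ≠ 0)
    (hR : IsSeparated q Q R R') (hn : 0 < n) : ∃ (i₀ : ℕ → K),
    ∀ (W : Type) [AddCommGroup W] [Module K W] (φ : M.V →ₗ[K] W) (x' : Module.End K W)
      (T' : ℕ → Module.End K W), Function.Surjective φ →
      IsBHom n (M.T 0) (fun k => M.T (k + 1)) x' T' φ → ∀ w ≠ 0, ∀ i : ℕ → K,
      (∀ k < n, jm q x' T' k w = i k • w) →
      ∏ k ∈ Finset.range n, (X - C (i k)) = ∏ k ∈ Finset.range n, (X - C (i₀ k)) := by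
  have := hM.1
  obtain ⟨v, -, hv0, i₀, hi₀⟩ := IsTypeB.exists_weight h hq hR IsBStable.top top_ne_bot
  refine ⟨i₀, fun W _ _ φ x' T' hs hφ w hw i hi => Polynomial.ext fun j => ?_⟩
  set L := jm q (M.T 0) (fun k => M.T (k + 1))
  set c := (∏ k ∈ Finset.range n, (X - C (i₀ k))).coeff j
  set f : Module.End K M.V := (factorProd L n).coeff j - c • 1 with hf
  have hfv : f v = 0 := by
    rw [hf, LinearMap.sub_apply, factorProd_coeff_apply fun k hk => (hi₀ k hk).2]
    exact sub_self _
  have hom : IsHom (Set.Iio n) M M f := by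
    rw [← isBHom_iff hn]
    have hc1 : ∀ t : Module.End K M.V, Commute t ((factorProd L n).coeff j) → ∀ v,
        f (t v) = t (f v) := fun t ht v => by
      have : Commute t f := ht.sub_right ((Commute.one_right t).smul_right c)
      exact (LinearMap.congr_fun this.eq v).symm
    exact ⟨hc1 _ (h.hecke.commute_start_factorProd h.start hn j),
      fun k hk => hc1 _ (h.hecke.commute_gen_factorProd hq h.start hk j)⟩
  obtain ⟨m, hm⟩ : IsNilpotent f := (hM.nilpotent_or_bijective hom).resolve_right fun hb =>
    hv0 (hb.1 (by rw [hfv, map_zero]))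
  set c' := (∏ k ∈ Finset.range n, (X - C (i k))).coeff j
  set f' : Module.End K W := (factorProd (jm q x' T') n).coeff j - c • 1 with hf'
  have hff' : ∀ v, φ (f v) = f' (φ v) := fun v => by
    simp only [hf, hf', LinearMap.sub_apply, LinearMap.smul_apply, Module.End.one_apply, map_sub,
      map_smul]
    rw [map_factorProd_coeff fun k hk => hφ.jm hk]
  have hw' : f' w = (c' - c) • w := by
    rw [hf', LinearMap.sub_apply, factorProd_coeff_apply hi, sub_smul]
    rfl
  have hpow : ∀ m : ℕ, (f' ^ m) w = (c' - c) ^ m • w := fun m => by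
    induction m with
    | zero => simp
    | succ m ih => rw [pow_succ', Module.End.mul_apply, ih, map_smul, hw', smul_smul, pow_succ]
  obtain ⟨u, rfl⟩ := hs w
  have h0 := map_pow_apply hff' m u
  rw [hm, LinearMap.zero_apply, map_zero, hpow] at h0
  rcases smul_eq_zero.mp h0.symm with h1 | h1
  · exact sub_eq_zero.mp (eq_zero_of_pow_eq_zero h1)
  · exact absurd h1 hw

theorem Indec.exists_isClassGenerated (hM : Indec (Set.Iio n) M) (h : IsB q Q n M) (hq : q ≠ 0)
    (hR : IsSeparated q Q R R') (hn : 0 < n) : ∃ a ≤ n, M.IsClassGenerated q R R' n a := by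
  classical
  obtain ⟨i₀, hi₀⟩ := hM.exists_prod_weights_eq h hq hR hn
  refine ⟨((Finset.range n).filter fun k => i₀ k ∈ R).card, ?_, fun P P' hP hP' hle => ?_⟩
  · simpa using Finset.card_filter_le (Finset.range n) fun k => i₀ k ∈ R
  rw [← isBStable_iff hn] at hP hP'
  by_contra hPP
  obtain ⟨x', T', hφ⟩ := hP.exists_quotient
  obtain ⟨w, hw, hw0, hwa⟩ := (IsTypeB.of_surjective h P.mkQ_surjective hφ).exists_mem_classSpace
    (a := ((Finset.range n).filter fun k => i₀ k ∈ R).card) hq hR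
    (hP'.map hφ) (fun e => hPP (by
      rwa [← le_bot_iff, Submodule.map_le_iff_le_comap, Submodule.comap_bot,
        Submodule.ker_mkQ] at e)) (fun w hw i hi => by
      rw [card_filter_eq_countP, card_filter_eq_countP,
        hi₀ _ P.mkQ x' T' P.mkQ_surjective hφ w hw i hi])
  obtain ⟨u, hu, rfl⟩ := hw
  obtain ⟨e, he, he1, he2, -⟩ := IsTypeB.exists_classProj h hq hR
    ((Finset.range n).filter fun k => i₀ k ∈ R).card
  refine hw0 ?_
  rw [← he1 _ P.mkQ x' T' (fun k hk => hφ.jm hk) u hwa]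
  have := hle ⟨he2 P' (fun k hk v hv => IsTypeB.jm_apply_mem hP' hk hv) u hu, he u⟩
  rwa [← Submodule.ker_mkQ P, LinearMap.mem_ker] at this

end OpRep

namespace OpRep

variable {K : Type} [Field K] {q Q : K} {n a : ℕ} {R R' : Set K} {M N : OpRep K ℕ}

/-- The operators of a type `B` representation generating a Young subalgebra, ignoring the
starting operator. -/
def youngBase (a : ℕ) (M : OpRep K ℕ) : OpRep K (ℕ ⊕ ℕ) where
  V := M.V
  T := Sum.elim (fun k => M.T (k + 1)) (fun k => M.T (a + k + 1))

/-- The class space as a representation of a Young subalgebra. -/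
noncomputable def young (q : K) (R R' : Set K) (n a : ℕ) (M : OpRep K ℕ) : OpRep K (ℕ ⊕ ℕ) :=
  (M.youngBase a).sub (M.cls q R R' n a)

theorem IsB.isYoung_youngBase (h : IsB q Q n M) (ha : a ≤ n) :
    IsYoung q a (n - a) (M.youngBase a) where
  left := h.hecke.mono ha
  right := ⟨fun k hk => h.hecke.quad (a + k) (by omega), fun k hk => h.hecke.braid (a + k) (by
      omega),
    fun i j hi hj => h.hecke.comm (a + i) (a + j) (by omega) (by omega)⟩
  comm i j hi hj := h.hecke.comm i (a + j) (by omega) (by omega)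

theorem stable_youngBase_iff {P : Submodule K M.V} (ha : a ≤ n) :
    (M.youngBase a).Stable (youngGens a (n - a)) P ↔
      ∀ k, k + 1 < n → k + 1 ≠ a → ∀ v ∈ P, M.T (k + 1) v ∈ P := by
  constructor
  · intro h k hk hka
    rcases Nat.lt_or_ge (k + 1) a with hka' | hka'
    · exact h (.inl k) hka'
    · have := h (.inr (k - a)) (show k - a + 1 < n - a by omega)
      simp only [youngBase, Sum.elim_inr] at this
      rwa [show a + (k - a) + 1 = k + 1 by omega] at this
  · rintro h (k | k) hk
    · have hk : k + 1 < a := hk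
      exact h k (by omega) (by omega)
    · have hk : k + 1 < n - a := hk
      exact h (a + k) (by omega) (by omega)

theorem IsB.stable_cls (h : IsB q Q n M) (hq : q ≠ 0) (ha : a ≤ n) :
    (M.youngBase a).Stable (youngGens a (n - a)) (M.cls q R R' n a) :=
  (stable_youngBase_iff ha).mpr fun _ hk hka _ hv => IsTypeB.apply_mem_classSpace h hq hk hka hv

/-- The inclusion of the class space. -/
noncomputable def youngEmb (q : K) (R R' : Set K) (n a : ℕ) (M : OpRep K ℕ) :
    (M.young q R R' n a).V →ₗ[K] M.V := (M.cls q R R' n a).subtype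

theorem youngEmb_injective : Function.Injective (M.youngEmb q R R' n a) := Subtype.val_injective

theorem youngEmb_mem (v : (M.young q R R' n a).V) : M.youngEmb q R R' n a v ∈ M.cls q R R' n a :=
  v.2

theorem exists_youngEmb_eq {v : M.V} (hv : v ∈ M.cls q R R' n a) :
    ∃ u, M.youngEmb q R R' n a u = v := ⟨⟨v, hv⟩, rfl⟩

theorem map_youngEmb_le (P : Submodule K (M.young q R R' n a).V) :
    P.map (M.youngEmb q R R' n a) ≤ M.cls q R R' n a := by
  rintro _ ⟨u, -, rfl⟩
  exact youngEmb_mem u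

theorem IsB.isHom_youngEmb (h : IsB q Q n M) (hq : q ≠ 0) (ha : a ≤ n) :
    IsHom (youngGens a (n - a)) (M.young q R R' n a) (M.youngBase a)
      (M.youngEmb q R R' n a) :=
  (h.stable_cls hq ha).isHom_subtype

theorem IsB.isYoung_young (h : IsB q Q n M) (hq : q ≠ 0) (ha : a ≤ n) :
    IsYoung q a (n - a) (M.young q R R' n a) :=
  (h.isYoung_youngBase ha).of_injective (h.isHom_youngEmb hq ha) youngEmb_injective

theorem IsHom.stable_map {ι : Type} {S : Set ι} {M N : OpRep K ι} {f : M.V →ₗ[K] N.V}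
    (hf : IsHom S M N f) {P : Submodule K M.V} (hP : M.Stable S P) : N.Stable S (P.map f) := by
  rintro i hi _ ⟨v, hv, rfl⟩
  exact ⟨M.T i v, hP i hi v hv, hf i hi v⟩

theorem IsHom.stable_comap {ι : Type} {S : Set ι} {M N : OpRep K ι} {f : M.V →ₗ[K] N.V}
    (hf : IsHom S M N f) {P : Submodule K N.V} (hP : N.Stable S P) : M.Stable S (P.comap f) := by
  intro i hi v hv
  rw [Submodule.mem_comap, hf i hi]
  exact hP i hi _ hv

theorem IsB.exists_stable (h : IsB q Q n M) (hq : q ≠ 0) (hR : IsSeparated q Q R R') (hn : 0 < n)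
    (ha : a ≤ n) {P : Submodule K M.V} (hP : P ≤ M.cls q R R' n a)
    (hs : (M.youngBase a).Stable (youngGens a (n - a)) P) :
    ∃ P' : Submodule K M.V, M.Stable (Set.Iio n) P' ∧ P ≤ P' ∧ P' ⊓ M.cls q R R' n a ≤ P := by
  obtain ⟨P', h1, h2, h3, h4⟩ := IsTypeB.exists_stable_inf_eq h hq hR hn hP
    ((stable_youngBase_iff ha).mp hs)
  exact ⟨P', (isBStable_iff hn).mp ⟨h2, h1⟩, h3, h4⟩

theorem IsClassGenerated.eq_bot (hM : M.IsClassGenerated q R R' n a) {P : Submodule K M.V}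
    (hP : M.Stable (Set.Iio n) P) (h : P ⊓ M.cls q R R' n a ≤ ⊥) : P = ⊥ :=
  le_bot_iff.mp (hM ⊥ P (fun i _ v hv => by
    rw [(Submodule.mem_bot K).mp hv, map_zero]; exact zero_mem _) hP h)

theorem IsClassGenerated.eq_top (hM : M.IsClassGenerated q R R' n a) {P : Submodule K M.V}
    (hP : M.Stable (Set.Iio n) P) (h : M.cls q R R' n a ≤ P) : P = ⊤ :=
  top_le_iff.mp (hM P ⊤ hP (fun _ _ _ _ => trivial) (inf_le_right.trans h))

theorem Indec.young (hM : Indec (Set.Iio n) M) (h : IsB q Q n M) (hq : q ≠ 0)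
    (hR : IsSeparated q Q R R') (hn : 0 < n) (ha : a ≤ n) (hg : M.IsClassGenerated q R R' n a) :
    Indec (youngGens a (n - a)) (M.young q R R' n a) := by
  have := hM.1
  set ι := M.youngEmb q R R' n a
  constructor
  · by_contra hN
    rw [not_nontrivial_iff_subsingleton] at hN
    refine top_ne_bot (α := Submodule K M.V) (hg.eq_bot (fun _ _ _ _ => trivial) ?_)
    rintro v ⟨-, hv⟩
    obtain ⟨u, rfl⟩ := exists_youngEmb_eq hv
    rw [Subsingleton.elim u 0, map_zero]
    exact zero_mem _
  intro N₁ N₂ h₁ h₂ hc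
  obtain ⟨P₁, hP₁, hle₁, hinf₁⟩ := h.exists_stable hq hR hn ha
    (P := N₁.map ι) (map_youngEmb_le _) ((h.isHom_youngEmb hq ha).stable_map h₁)
  obtain ⟨P₂, hP₂, hle₂, hinf₂⟩ := h.exists_stable hq hR hn ha
    (P := N₂.map ι) (map_youngEmb_le _) ((h.isHom_youngEmb hq ha).stable_map h₂)
  have hinf : P₁ ⊓ P₂ = ⊥ := by
    refine hg.eq_bot (fun i hi v hv => ⟨hP₁ i hi v hv.1, hP₂ i hi v hv.2⟩) ?_
    rintro v ⟨⟨hv1, hv2⟩, hv3⟩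
    obtain ⟨u₁, hu₁, e₁⟩ := hinf₁ ⟨hv1, hv3⟩
    obtain ⟨u₂, hu₂, e₂⟩ := hinf₂ ⟨hv2, hv3⟩
    obtain rfl : u₁ = u₂ := youngEmb_injective (e₁.trans e₂.symm)
    have h0 : u₁ = 0 := by
      have : u₁ ∈ N₁ ⊓ N₂ := ⟨hu₁, hu₂⟩
      rwa [hc.inf_eq_bot, Submodule.mem_bot] at this
    rw [← e₁, h0, map_zero]
    exact zero_mem _
  have hsup : P₁ ⊔ P₂ = ⊤ := by
    refine hg.eq_top (fun i hi v hv => ?_) fun v hv => ?_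
    · obtain ⟨u, hu, w, hw, rfl⟩ := Submodule.mem_sup.mp hv
      rw [map_add]
      exact Submodule.add_mem_sup (hP₁ i hi u hu) (hP₂ i hi w hw)
    · obtain ⟨v, rfl⟩ := exists_youngEmb_eq hv
      have : v ∈ N₁ ⊔ N₂ := by rw [hc.sup_eq_top]; trivial
      obtain ⟨u, hu, w, hw, rfl⟩ := Submodule.mem_sup.mp this
      rw [map_add]
      exact Submodule.add_mem_sup (hle₁ ⟨u, hu, rfl⟩) (hle₂ ⟨w, hw, rfl⟩)
  have hbot : ∀ {L : Submodule K (M.young q R R' n a).V} {P : Submodule K M.V},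
      L.map ι ≤ P → P = ⊥ → L = ⊥ := by
    rintro L P hLP rfl
    refine le_bot_iff.mp fun u hu => youngEmb_injective ?_
    exact hLP ⟨u, hu, rfl⟩
  rcases hM.2 P₁ P₂ hP₁ hP₂ (IsCompl.of_eq hinf hsup) with e | e
  · exact Or.inl (hbot hle₁ e)
  · exact Or.inr (hbot hle₂ e)

/-- The direct sum of two representations. -/
def prod {ι : Type} (M N : OpRep K ι) : OpRep K ι where
  V := M.V × N.V
  T i := (M.T i).prodMap (N.T i)

theorem IsB.prod (hM : IsB q Q n M) (hN : IsB q Q n N) : IsB q Q n (M.prod N) where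
  hecke := by
    constructor
    · exact fun k hk => LinearMap.ext fun v => Prod.ext
        (LinearMap.congr_fun (hM.hecke.quad k hk) v.1) (LinearMap.congr_fun (hN.hecke.quad k hk)
            v.2)
    · exact fun k hk => LinearMap.ext fun v => Prod.ext
        (LinearMap.congr_fun (hM.hecke.braid k hk) v.1)
        (LinearMap.congr_fun (hN.hecke.braid k hk) v.2)
    · exact fun i j hi hj => LinearMap.ext fun v => Prod.ext
        (LinearMap.congr_fun (hM.hecke.comm i j hi hj) v.1)
        (LinearMap.congr_fun (hN.hecke.comm i j hi hj) v.2)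
  start := by
    constructor
    · exact fun k h0 hk => LinearMap.ext fun v => Prod.ext
        (LinearMap.congr_fun (hM.start.comm k h0 hk) v.1)
        (LinearMap.congr_fun (hN.start.comm k h0 hk) v.2)
    · exact fun h1 => LinearMap.ext fun v => Prod.ext
        (LinearMap.congr_fun (hM.start.braid h1) v.1)
        (LinearMap.congr_fun (hN.start.braid h1) v.2)
  quad := LinearMap.ext fun v => Prod.ext
    (LinearMap.congr_fun hM.quad v.1) (LinearMap.congr_fun hN.quad v.2)

section prod

variable {ι : Type} {S : Set ι} (M N : OpRep K ι)

/-- The first inclusion. -/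
def prodInl : M.V →ₗ[K] (M.prod N).V := LinearMap.inl K M.V N.V

/-- The second inclusion. -/
def prodInr : N.V →ₗ[K] (M.prod N).V := LinearMap.inr K M.V N.V

/-- The first projection. -/
def prodFst : (M.prod N).V →ₗ[K] M.V := LinearMap.fst K M.V N.V

/-- The second projection. -/
def prodSnd : (M.prod N).V →ₗ[K] N.V := LinearMap.snd K M.V N.V

theorem isHom_prodInl : IsHom S M (M.prod N) (M.prodInl N) := fun i _ _ =>
  Prod.ext rfl (map_zero (N.T i)).symm

theorem isHom_prodInr : IsHom S N (M.prod N) (M.prodInr N) := fun i _ _ =>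
  Prod.ext (map_zero (M.T i)).symm rfl

theorem isHom_prodFst : IsHom S (M.prod N) M (M.prodFst N) := fun _ _ _ => rfl

theorem isHom_prodSnd : IsHom S (M.prod N) N (M.prodSnd N) := fun _ _ _ => rfl

end prod

theorem IsHom.map_mem_cls (hn : 0 < n) {f : M.V →ₗ[K] N.V} (hf : IsHom (Set.Iio n) M N f) {v : M.V}
    (hv : v ∈ M.cls q R R' n a) : f v ∈ N.cls q R R' n a :=
  ((isBHom_iff hn).mpr hf).map_mem_classSpace hv

theorem iso_of_iso_young (hM : IsB q Q n M) (hN : IsB q Q n N) (hq : q ≠ 0)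
    (hR : IsSeparated q Q R R') (hn : 0 < n) (ha : a ≤ n) (hgM : M.IsClassGenerated q R R' n a)
    (hgN : N.IsClassGenerated q R R' n a)
    (h : Iso (youngGens a (n - a)) (M.young q R R' n a) (N.young q R R' n a)) :
    Iso (Set.Iio n) M N := by
  obtain ⟨φ, hφ⟩ := h
  have hB := hM.prod hN
  let g : (M.young q R R' n a).V →ₗ[K] (M.prod N).V :=
    (M.youngEmb q R R' n a).prod (N.youngEmb q R R' n a ∘ₗ φ.toLinearMap)
  have hg : IsHom (youngGens a (n - a)) (M.young q R R' n a) ((M.prod N).youngBase a) g := by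
    intro i hi v
    have h1 := hM.isHom_youngEmb (R := R) (R' := R') hq ha i hi v
    have h2 := (hN.isHom_youngEmb (R := R) (R' := R') hq ha).comp hφ i hi v
    cases i <;> exact Prod.ext h1 h2
  have hle : LinearMap.range g ≤ (M.prod N).cls q R R' n a := by
    rintro _ ⟨v, rfl⟩
    have e : g v = M.prodInl N (M.youngEmb q R R' n a v) +
        M.prodInr N (N.youngEmb q R R' n a (φ v)) := Prod.ext (add_zero _).symm (zero_add _).symm
    rw [e]
    exact Submodule.add_mem _ ((isHom_prodInl M N).map_mem_cls hn (youngEmb_mem v))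
      ((isHom_prodInr M N).map_mem_cls hn (youngEmb_mem (φ v)))
  obtain ⟨P, hP, hgP, hPg⟩ := hB.exists_stable hq hR hn ha hle hg.stable_range
  have hzero : ∀ u : (M.prod N).V, u ∈ P → u ∈ (M.prod N).cls q R R' n a →
      (u.1 = 0 ∨ u.2 = 0) → u = 0 := by
    intro u hu hu' h0
    obtain ⟨v, rfl⟩ := hPg ⟨hu, hu'⟩
    have : v = 0 := by
      rcases h0 with h0 | h0
      · exact youngEmb_injective (h0.trans (map_zero _).symm)
      · exact φ.injective (youngEmb_injective (h0.trans (by rw [map_zero, map_zero])))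
    rw [this, map_zero]
  have hl : P.comap (M.prodInl N) = ⊥ := hgM.eq_bot ((isHom_prodInl M N).stable_comap hP) (by
    rintro v ⟨hv, hv'⟩
    have := hzero _ hv ((isHom_prodInl M N).map_mem_cls hn hv') (Or.inr rfl)
    exact congrArg Prod.fst this)
  have hr : P.comap (M.prodInr N) = ⊥ := hgN.eq_bot ((isHom_prodInr M N).stable_comap hP) (by
    rintro v ⟨hv, hv'⟩
    have := hzero _ hv ((isHom_prodInr M N).map_mem_cls hn hv') (Or.inl rfl)
    exact congrArg Prod.snd this)
  have hl' : P.map (M.prodFst N) = ⊤ :=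
    hgM.eq_top ((isHom_prodFst M N).stable_map hP) fun v hv => by
      obtain ⟨v, rfl⟩ := exists_youngEmb_eq hv
      exact ⟨g v, hgP ⟨_, rfl⟩, rfl⟩
  have hr' : P.map (M.prodSnd N) = ⊤ :=
    hgN.eq_top ((isHom_prodSnd M N).stable_map hP) fun v hv => by
      obtain ⟨v, rfl⟩ := exists_youngEmb_eq hv
      exact ⟨g (φ.symm v), hgP ⟨_, rfl⟩, congrArg (N.youngEmb q R R' n a) (φ.apply_symm_apply v)⟩
  have i1 := (isHom_prodFst M N).comp hP.isHom_subtype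
  have i2 := (isHom_prodSnd M N).comp hP.isHom_subtype
  have b1 : Function.Bijective (M.prodFst N ∘ₗ P.subtype) := by
    constructor
    · rw [injective_iff_map_eq_zero]
      rintro ⟨⟨v, w⟩, hu⟩ (hv : v = 0)
      subst hv
      have : w ∈ P.comap (M.prodInr N) := hu
      rw [hr, Submodule.mem_bot] at this
      subst this
      rfl
    · intro v
      have : v ∈ P.map (M.prodFst N) := by rw [hl']; trivial
      obtain ⟨u, hu, e⟩ := this
      exact ⟨⟨u, hu⟩, e⟩
  have b2 : Function.Bijective (M.prodSnd N ∘ₗ P.subtype) := by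
    constructor
    · rw [injective_iff_map_eq_zero]
      rintro ⟨⟨v, w⟩, hu⟩ (hv : w = 0)
      subst hv
      have : v ∈ P.comap (M.prodInl N) := hu
      rw [hl, Submodule.mem_bot] at this
      subst this
      rfl
    · intro v
      have : v ∈ P.map (M.prodSnd N) := by rw [hr']; trivial
      obtain ⟨u, hu, e⟩ := this
      exact ⟨⟨u, hu⟩, e⟩
  have iso1 : Iso (Set.Iio n) ((M.prod N).sub P) M := ⟨LinearEquiv.ofBijective _ b1, i1⟩
  have iso2 : Iso (Set.Iio n) ((M.prod N).sub P) N := ⟨LinearEquiv.ofBijective _ b2, i2⟩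
  exact iso1.symm.trans iso2

/-- Finite representation type for the Hecke algebra of type `B` with separated parameters. -/
theorem finType_isB (hq : q ≠ 0) (hq1 : q ≠ 1) (hR : IsSeparated q Q R R') (hn : 0 < n)
    (he : 0 < orderOf q → n < 2 * orderOf q) : FinType (Set.Iio n) (IsB (K := K) q Q n) := by
  have hY : ∀ a : Fin (n + 1), ∃ (m : ℕ) (X : Fin m → OpRep K (ℕ ⊕ ℕ)), ∀ M, IsYoung q a (n - a) M →
      Indec (youngGens a (n - a)) M → ∃ j, Iso (youngGens a (n - a)) M (X j) := fun a =>
    finType_youngGens hq hq1 fun h0 => by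
      have := he h0
      omega
  choose m X hX using hY
  refine finType_of_colour (α := Σ a : Fin (n + 1), Fin (m a)) (fun c M =>
    M.IsClassGenerated q R R' n c.1 ∧
      Iso (youngGens c.1 (n - c.1)) (M.young q R R' n c.1) (X c.1 c.2)) ?_ ?_
  · intro M hM hI
    obtain ⟨a, ha, hg⟩ := hI.exists_isClassGenerated hM hq hR hn
    obtain ⟨j, hj⟩ := hX ⟨a, by omega⟩ _ (hM.isYoung_young (R := R) (R' := R') hq ha)
      (hI.young hM hq hR hn ha hg)
    exact ⟨⟨⟨a, by omega⟩, j⟩, hg, hj⟩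
  · rintro ⟨a, j⟩ M N hM - hN - ⟨hgM, hiM⟩ ⟨hgN, hiN⟩
    exact iso_of_iso_young hM hN hq hR hn (by omega) hgM hgN (hiM.trans hiN.symm)

end OpRep

section permOp

variable {K N I L : Type} [Field K] [AddCommGroup N] [Module K N] [DecidableEq I]

/-- Exchanging two letters of a word. -/
def swp (a b : I) (w : I → L) : I → L := w ∘ Equiv.swap a b

theorem swp_left (a b : I) (w : I → L) : swp a b w a = w b := by simp [swp]

theorem swp_right (a b : I) (w : I → L) : swp a b w b = w a := by simp [swp]

theorem swp_of_ne {a b c : I} (h : c ≠ a) (h' : c ≠ b) (w : I → L) : swp a b w c = w c := by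
  simp [swp, Equiv.swap_apply_of_ne_of_ne h h']

theorem swp_swp (a b : I) (w : I → L) : swp a b (swp a b w) = w := by
  funext c; simp [swp]

theorem swp_of_eq {a b : I} {w : I → L} (h : w a = w b) : swp a b w = w := by
  funext c
  simp only [swp, Function.comp_apply, Equiv.swap_apply_def]
  split_ifs with h1 h2
  · rw [h1, h]
  · rw [h2, h]
  · rfl

theorem swp_comm {a b c d : I} (hac : a ≠ c) (had : a ≠ d) (hbc : b ≠ c) (hbd : b ≠ d)
    (w : I → L) : swp a b (swp c d w) = swp c d (swp a b w) := by
  funext x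
  simp only [swp, Function.comp_apply, Equiv.swap_apply_def]
  grind

theorem swp_braid {a b c : I} (hab : a ≠ b) (hac : a ≠ c) (hbc : b ≠ c) (w : I → L) :
    swp a b (swp b c (swp a b w)) = swp b c (swp a b (swp b c w)) := by
  funext x
  simp only [swp, Function.comp_apply, Equiv.swap_apply_def]
  grind

theorem exists_swp_eq_iff {a b : I} {hi : L} (w : I → L) :
    (∃ i, ∀ j, swp a b w j = hi ↔ j = i) ↔ ∃ i, ∀ j, w j = hi ↔ j = i := by
  have key : ∀ w : I → L, (∃ i, ∀ j, w j = hi ↔ j = i) → ∃ i, ∀ j, swp a b w j = hi ↔ j = i := by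
    rintro w ⟨i, hi⟩
    refine ⟨Equiv.swap a b i, fun j => ?_⟩
    rw [swp, Function.comp_apply, hi, ← Equiv.swap_apply_eq_iff]
  exact ⟨fun h => by simpa only [swp_swp] using key _ h, key w⟩

variable [LinearOrder L]

/-- The action of a generator of the Hecke algebra on functions on words. -/
def permOp (q : K) (a b : I) : Module.End K ((I → L) → N) where
  toFun m w := if w a = w b then q • m w else
    if w a < w b then m (swp a b w) else q • m (swp a b w) + (q - 1) • m w
  map_add' m m' := by
    funext w
    simp only [Pi.add_apply]
    split_ifs <;> module
  map_smul' r m := by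
    funext w
    simp only [Pi.smul_apply, RingHom.id_apply]
    split_ifs <;> module

theorem permOp_of_eq {q : K} {a b : I} {w : I → L} (h : w a = w b) (m : (I → L) → N) :
    permOp q a b m w = q • m w := if_pos h

theorem permOp_of_lt {q : K} {a b : I} {w : I → L} (h : w a < w b) (m : (I → L) → N) :
    permOp q a b m w = m (swp a b w) := by
  simp [permOp, h, h.ne]

theorem permOp_of_gt {q : K} {a b : I} {w : I → L} (h : w b < w a) (m : (I → L) → N) :
    permOp q a b m w = q • m (swp a b w) + (q - 1) • m w := by
  simp [permOp, h.ne', h.not_gt]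

theorem permOp_quad (q : K) {a b : I} :
    (permOp q a b : Module.End K ((I → L) → N)) * permOp q a b = (q - 1) • permOp q a b + q • 1 :=
        by
  ext m w
  simp only [Module.End.mul_apply, LinearMap.add_apply, LinearMap.smul_apply, Module.End.one_apply,
    Pi.add_apply, Pi.smul_apply]
  rcases lt_trichotomy (w a) (w b) with h | h | h
  · have h' : swp a b w b < swp a b w a := by rwa [swp_left, swp_right]
    simp only [permOp_of_lt h, permOp_of_gt h', swp_swp]
    module
  · simp only [permOp_of_eq h]
    module
  · have h' : swp a b w a < swp a b w b := by rwa [swp_left, swp_right]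
    simp only [permOp_of_gt h, permOp_of_lt h', swp_swp]
    module

theorem permOp_comm (q : K) {a b c d : I} (hac : a ≠ c) (had : a ≠ d) (hbc : b ≠ c) (hbd : b ≠ d) :
    (permOp q a b : Module.End K ((I → L) → N)) * permOp q c d = permOp q c d * permOp q a b := by
  ext m w
  simp only [Module.End.mul_apply, permOp, LinearMap.coe_mk, AddHom.coe_mk,
    swp_of_ne hac had, swp_of_ne hbc hbd, swp_of_ne hac.symm hbc.symm, swp_of_ne had.symm hbd.symm,
    swp_comm hac had hbc hbd]
  split_ifs <;> module

theorem swp_trichotomy (a b : I) (w : I → L) :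
    (w a = w b ∧ swp a b w = w) ∨ (w a < w b ∧ w a ≠ w b ∧ w b ≠ w a ∧ ¬ w b < w a) ∨
      (w b < w a ∧ w a ≠ w b ∧ w b ≠ w a ∧ ¬ w a < w b) := by
  rcases lt_trichotomy (w a) (w b) with h | h | h
  · exact Or.inr (Or.inl ⟨h, h.ne, h.ne', h.not_gt⟩)
  · exact Or.inl ⟨h, swp_of_eq h⟩
  · exact Or.inr (Or.inr ⟨h, h.ne', h.ne, h.not_gt⟩)

theorem permOp_braid (q : K) {a b c : I} (hab : a ≠ b) (hac : a ≠ c) (hbc : b ≠ c) :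
    (permOp q a b : Module.End K ((I → L) → N)) * permOp q b c * permOp q a b =
      permOp q b c * permOp q a b * permOp q b c := by
  ext m w
  have e3 := swp_braid hab hac hbc w
  have e4 : swp b c (swp a b (swp b c (swp a b w))) = swp a b (swp b c w) := by
    rw [swp_braid hab hac hbc, swp_swp]
  rcases swp_trichotomy a b w with ⟨h1, h1'⟩ | ⟨h1, h1a, h1b, h1c⟩ | ⟨h1, h1a, h1b, h1c⟩ <;>
  rcases swp_trichotomy b c w with ⟨h2, h2'⟩ | ⟨h2, h2a, h2b, h2c⟩ | ⟨h2, h2a, h2b, h2c⟩ <;>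
  rcases swp_trichotomy a c w with ⟨h3, h3'⟩ | ⟨h3, h3a, h3b, h3c⟩ | ⟨h3, h3a, h3b, h3c⟩ <;>
  first
  | (exfalso; order)
  | (simp only [Module.End.mul_apply, permOp, LinearMap.coe_mk, AddHom.coe_mk, swp_left, swp_right,
      swp_of_ne hac.symm hbc.symm, swp_of_ne hab hac, if_true, if_false, swp_swp,
      lt_self_iff_false, *] <;> module)

end permOp

section mergeOp

variable {K N I L : Type} [Field K] [AddCommGroup N] [Module K N] [LinearOrder I]
  [LinearOrder L] {q : K} {a b : I} {lo hi : L}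

/-- Weighted sums of a function over finite sets of words. -/
def fiberSum (ψ : (I → L) → K) (F : (I → L) → Finset (I → L)) : Module.End K ((I → L) → N) where
  toFun m w := ψ w • ∑ w' ∈ F w, m w'
  map_add' m m' := by
    funext w
    simp [Finset.sum_add_distrib]
  map_smul' r m := by
    funext w
    simp [← Finset.smul_sum, smul_comm r]

theorem lt_iff_of_covBy {x c d : L} (h : c ⋖ d) (hc : x ≠ c) (hd : x ≠ d) :
    (c < x ↔ d < x) ∧ (x < c ↔ x < d) := by
  have h1 := h.1
  have h2 : c < x → ¬ x < d := fun h3 => h.2 h3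
  constructor <;> constructor <;> intro h4 <;> by_contra h5 <;> first | order | skip
  · exact h2 h4 (lt_of_le_of_ne (not_lt.mp h5) hd)
  · exact h2 (lt_of_le_of_ne (not_lt.mp h5) hc.symm) h4

theorem sum_permOp_of_mapsTo {F : Finset (I → L)} (hF : ∀ w ∈ F, swp a b w ∈ F)
    (m : (I → L) → N) : ∑ w ∈ F, permOp q a b m w = q • ∑ w ∈ F, m w := by
  rw [Finset.smul_sum, ← sub_eq_zero, ← Finset.sum_sub_distrib]
  refine Finset.sum_involution (fun w _ => swp a b w) ?_ ?_ hF (fun w _ => swp_swp a b w)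
  · intro w _
    rcases lt_trichotomy (w a) (w b) with h | h | h
    · have h' : swp a b w b < swp a b w a := by rwa [swp_left, swp_right]
      rw [permOp_of_lt h, permOp_of_gt h', swp_swp]
      module
    · rw [swp_of_eq h, permOp_of_eq h]
      module
    · have h' : swp a b w a < swp a b w b := by rwa [swp_left, swp_right]
      rw [permOp_of_gt h, permOp_of_lt h', swp_swp]
      module
  · intro w _ hne heq
    refine hne ?_
    have : w a = w b := by
      have := congrFun heq b
      rwa [swp_right] at this
    rw [permOp_of_eq this, sub_self]

theorem fiberSum_permOp {ψ : (I → L) → K} {F : (I → L) → Finset (I → L)}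
    (h : ∀ w, (ψ (swp a b w) = ψ w ∧ (∀ w', w' ∈ F (swp a b w) ↔ swp a b w' ∈ F w) ∧
        (w a < w b ∧ (∀ w' ∈ F w, w' a < w' b) ∨ w b < w a ∧ ∀ w' ∈ F w, w' b < w' a)) ∨
      (F (swp a b w) = F w ∧ (∀ w' ∈ F w, swp a b w' ∈ F w) ∧
        (w a < w b → ψ (swp a b w) = q * ψ w) ∧ (w b < w a → ψ w = q * ψ (swp a b w))))
    (m : (I → L) → N) : fiberSum ψ F (permOp q a b m) = permOp q a b (fiberSum ψ F m) := by
  funext w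
  have e : ∀ m w, fiberSum (N := N) ψ F m w = ψ w • ∑ w' ∈ F w, m w' := fun _ _ => rfl
  rw [e]
  rcases h w with ⟨h1, h2, h3⟩ | ⟨h1, h2, h3, h4⟩
  · have hs : ∑ w' ∈ F w, m (swp a b w') = ∑ w' ∈ F (swp a b w), m w' :=
      Finset.sum_nbij' (swp a b) (swp a b) (fun w' hw' => by rwa [h2, swp_swp])
        (fun w' hw' => (h2 w').mp hw') (fun w' _ => swp_swp a b w') (fun w' _ => swp_swp a b w')
        (fun _ _ => rfl)
    rcases h3 with ⟨h, h3⟩ | ⟨h, h3⟩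
    · rw [permOp_of_lt h, e, h1, ← hs]
      congr 1
      exact Finset.sum_congr rfl fun w' hw' =>
        permOp_of_lt (h3 w' hw') m
    · rw [permOp_of_gt h, e, e, h1, ← hs, Finset.sum_congr rfl fun w' hw' =>
        permOp_of_gt (h3 w' hw') m,
        Finset.sum_add_distrib, ← Finset.smul_sum, ← Finset.smul_sum]
      module
  · rw [sum_permOp_of_mapsTo h2]
    rcases lt_trichotomy (w a) (w b) with h | h | h
    · rw [permOp_of_lt h, e, h1, h3 h]
      module
    · rw [permOp_of_eq h, e]
      module
    · rw [permOp_of_gt h, e, e, h1, h4 h]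
      module

/-- Identifying the letter `hi` with `lo`. -/
def mergeLetter (lo hi x : L) : L := if x = hi then lo else x

theorem swap_lt_swap_iff (hab : a ⋖ b) {c d : I} (h : ¬ (c = a ∧ d = b)) (h' : ¬ (c = b ∧ d = a)) :
    Equiv.swap a b c < Equiv.swap a b d ↔ c < d := by
  have h1 := hab.1
  have h2 := fun x => lt_iff_of_covBy (x := x) hab
  simp only [Equiv.swap_apply_def]
  have := h2 c
  have := h2 d
  split_ifs <;> simp_all

theorem mergeLetter_lt_iff (hlh : lo ⋖ hi) {x y x' y' : L}
    (hx : mergeLetter lo hi x' = mergeLetter lo hi x)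
    (hy : mergeLetter lo hi y' = mergeLetter lo hi y)
    (hxy : mergeLetter lo hi x ≠ mergeLetter lo hi y) : x' < y' ↔ x < y := by
  have h1 := hlh.1
  have a1 := lt_iff_of_covBy (x := x) hlh
  have a2 := lt_iff_of_covBy (x := y) hlh
  simp only [mergeLetter] at hx hy hxy
  grind

variable [Fintype I]

/-- The number of inversions between the letters `hi` and `lo`. -/
def inversions (lo hi : L) (w : I → L) : ℕ :=
  (Finset.univ.filter fun p : I × I => p.1 < p.2 ∧ w p.1 = hi ∧ w p.2 = lo).card

theorem inversions_swp (w : I → L) : inversions lo hi (swp a b w) =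
    (Finset.univ.filter fun p : I × I =>
      Equiv.swap a b p.1 < Equiv.swap a b p.2 ∧ w p.1 = hi ∧ w p.2 = lo).card := by
  refine Finset.card_equiv ((Equiv.swap a b).prodCongr (Equiv.swap a b)) fun p => ?_
  rw [Finset.mem_filter, Finset.mem_filter]
  simp [swp]

theorem inversions_swp_of_ne (hab : a ⋖ b) {w : I → L} (h : ¬ (w a = hi ∧ w b = lo))
    (h' : ¬ (w b = hi ∧ w a = lo)) : inversions lo hi (swp a b w) = inversions lo hi w := by
  rw [inversions_swp, inversions]
  congr 1
  refine Finset.filter_congr fun p _ => and_congr_left fun hp => swap_lt_swap_iff hab ?_ ?_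
  · rintro ⟨h1, h2⟩
    exact h ⟨h1 ▸ hp.1, h2 ▸ hp.2⟩
  · rintro ⟨h1, h2⟩
    exact h' ⟨h1 ▸ hp.1, h2 ▸ hp.2⟩

theorem inversions_swp_of_eq (hab : a ⋖ b) (hlt : lo < hi) {w : I → L} (h : w a = lo)
    (h' : w b = hi) : inversions lo hi (swp a b w) = inversions lo hi w + 1 := by
  rw [inversions_swp, inversions, ← Finset.card_cons (a := (b, a)) (by
    simp [hab.1.not_gt])]
  congr 1
  ext p
  simp only [Finset.mem_filter, Finset.mem_univ, true_and, Finset.mem_cons]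
  by_cases hp : p = (b, a)
  · subst hp
    simp [h, h', hab.1]
  · simp only [hp, false_or]
    refine and_congr_left fun hp' => swap_lt_swap_iff hab ?_ ?_
    · rintro ⟨h1, h2⟩
      rw [h1, h] at hp'
      exact hlt.ne hp'.1
    · rintro ⟨h1, h2⟩
      exact hp (Prod.ext h1 h2)

variable [Fintype L]

open Classical in
/-- The words with exactly one letter `hi` that agree with a given word after identifying `hi`
with `lo`. -/
noncomputable def mergeFiber (lo hi : L) (w : I → L) : Finset (I → L) :=
  Finset.univ.filter fun w' => (∃ i, ∀ j, w' j = hi ↔ j = i) ∧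
    ∀ j, mergeLetter lo hi (w' j) = mergeLetter lo hi (w j)

theorem mem_mergeFiber {w w' : I → L} : w' ∈ mergeFiber lo hi w ↔ (∃ i, ∀ j, w' j = hi ↔ j = i) ∧
    ∀ j, mergeLetter lo hi (w' j) = mergeLetter lo hi (w j) := by
  simp [mergeFiber]

theorem swp_mem_mergeFiber {w w' : I → L} (h : w' ∈ mergeFiber lo hi w) :
    swp a b w' ∈ mergeFiber lo hi (swp a b w) := by
  rw [mem_mergeFiber] at *
  obtain ⟨⟨i, hi⟩, h2⟩ := h
  refine ⟨⟨Equiv.swap a b i, fun j => ?_⟩, fun j => h2 _⟩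
  rw [swp, Function.comp_apply, hi, ← Equiv.swap_apply_eq_iff]

open Classical in
/-- The endomorphism of a permutation module that merges the letters `lo` and `hi` and splits them
again. -/
noncomputable def mergeOp (q : K) (lo hi : L) : Module.End K ((I → L) → N) :=
  fiberSum (fun w => if ∃ i, ∀ j, w j = hi ↔ j = i then q ^ inversions lo hi w else 0)
    (mergeFiber lo hi)

open Classical in
theorem mergeOp_apply (m : (I → L) → N) (w : I → L) : mergeOp q lo hi m w =
    (if ∃ i, ∀ j, w j = hi ↔ j = i then q ^ inversions lo hi w else 0) •
      ∑ w' ∈ mergeFiber lo hi w, m w' := rfl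

theorem mergeOp_permOp (hab : a ⋖ b) (hlh : lo ⋖ hi) (m : (I → L) → N) :
    mergeOp q lo hi (permOp q a b m) = permOp q a b (mergeOp q lo hi m) := by
  refine fiberSum_permOp (fun w => ?_) m
  have key : ∀ w', w' ∈ mergeFiber lo hi (swp a b w) ↔ swp a b w' ∈ mergeFiber lo hi w := fun w' =>
    ⟨fun h => by simpa [swp_swp] using swp_mem_mergeFiber (a := a) (b := b) h,
      fun h => by simpa [swp_swp] using swp_mem_mergeFiber (a := a) (b := b) h⟩
  by_cases h : mergeLetter lo hi (w a) = mergeLetter lo hi (w b)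
  · right
    have hF : mergeFiber lo hi (swp a b w) = mergeFiber lo hi w := by
      ext w'
      rw [mem_mergeFiber, mem_mergeFiber]
      refine and_congr_right fun _ => forall_congr' fun j => ?_
      have : mergeLetter lo hi (swp a b w j) = mergeLetter lo hi (w j) := by
        rw [swp, Function.comp_apply, Equiv.swap_apply_def]
        split_ifs with h1 h2
        · rw [h1, h]
        · rw [h2, h]
        · rfl
      rw [this]
    have hlt : ∀ {x y : L}, mergeLetter lo hi x = mergeLetter lo hi y → x < y → x = lo ∧ y = hi :=
        by
      intro x y hxy hlt
      have := hlh.1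
      simp only [mergeLetter] at hxy
      split_ifs at hxy with h1 h2 h2
      · exact absurd (h1.trans h2.symm) hlt.ne
      · subst h1 hxy
        exact absurd hlt this.not_gt
      · exact ⟨hxy, h2⟩
      · exact absurd hxy hlt.ne
    refine ⟨hF, fun w' hw' => hF ▸ swp_mem_mergeFiber hw', fun h1 => ?_, fun h1 => ?_⟩
    · obtain ⟨h2, h3⟩ := hlt h h1
      simp only [exists_swp_eq_iff]
      rw [inversions_swp_of_eq hab hlh.1 h2 h3, pow_succ', mul_ite, mul_zero]
    · obtain ⟨h2, h3⟩ := hlt h.symm h1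
      have := inversions_swp_of_eq hab hlh.1 (w := swp a b w) (by rwa [swp_left])
        (by rwa [swp_right])
      rw [swp_swp] at this
      simp only [exists_swp_eq_iff]
      rw [this, pow_succ', mul_ite, mul_zero]
  · left
    refine ⟨?_, key, ?_⟩
    · simp only [exists_swp_eq_iff]
      rw [inversions_swp_of_ne hab]
      · rintro ⟨h1, h2⟩
        exact h (by simp [h1, h2, mergeLetter])
      · rintro ⟨h1, h2⟩
        exact h (by simp [h1, h2, mergeLetter])
    · have hne : w a ≠ w b := fun h1 => h (by rw [h1])
      refine (lt_or_gt_of_ne hne).imp (fun h1 => ⟨h1, fun w' hw' => ?_⟩)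
        (fun h1 => ⟨h1, fun w' hw' => ?_⟩)
      · have hw' := (mem_mergeFiber.mp hw').2
        rwa [mergeLetter_lt_iff hlh (hw' a) (hw' b) h]
      · have hw' := (mem_mergeFiber.mp hw').2
        rwa [mergeLetter_lt_iff hlh (hw' b) (hw' a) (Ne.symm h)]

end mergeOp

section line

variable {K V N : Type} [Field K] [AddCommGroup V] [Module K V] [AddCommGroup N] [Module K N]
  {q : K} {d : ℕ}

theorem sum_pow_eq_zero (hq1 : q ≠ 1) (h : q ^ (d + 2) = 1) :
    ∑ k ∈ Finset.range (d + 2), q ^ (d + 1 - k) = 0 := by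
  have h1 := Finset.sum_range_reflect (fun j => q ^ j) (d + 2)
  have h2 := geom_sum_mul q (d + 2)
  rw [h, sub_self, mul_eq_zero, or_iff_left (sub_ne_zero.mpr hq1)] at h2
  rw [← h2, ← h1]
  exact Finset.sum_congr rfl fun k _ => by congr 1

/-- Two families of maps interpolating an operator on both sides force commutation. -/
theorem commute_of_interpolation (hq : q ≠ 0) (hq1 : q ≠ 1) (hqd : q ^ (d + 2) = 1)
    {x : Module.End K N} {T : ℕ → Module.End K V} {ev : ℕ → V →ₗ[K] N} {J : ℕ → N →ₗ[K] V}
    (hx : ∀ m, x (ev (d + 1) m) = ∑ l ∈ Finset.range (d + 2), ev l m)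
    (hev : ∀ k ≤ d, ∀ m, ev (k + 1) (T k m) = ev k m)
    (hev' : ∀ k < d, ∀ m, ev (d + 1) (T k m) = q • ev (d + 1) m)
    (hJ : ∀ k ≤ d, ∀ v, T k (J (k + 1) v) = q • J k v)
    (hJ' : ∀ k < d, ∀ v, T k (J (d + 1) v) = q • J (d + 1) v)
    (hJx : ∀ v, J (d + 1) (x v) = ∑ k ∈ Finset.range (d + 2), q ^ (d + 1 - k) • J k v)
    {c : Module.End K V} (hc : ∀ k ≤ d, ∀ m, c (T k m) = T k (c m)) (v : N) :
    ev (d + 1) (c (J (d + 1) (x v))) = x (ev (d + 1) (c (J (d + 1) v))) := by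
  have hA0 : ev d (c (J (d + 1) v)) = q • ev (d + 1) (c (J d v)) := by
    rw [← hev d le_rfl, ← hc d le_rfl, hJ d le_rfl, map_smul, map_smul]
  have hA : ∀ k ≤ d, ev (d + 1) (c (J k v)) = ev (d + 1) (c (J d v)) := fun k hk => by
    induction hk using Nat.decreasingInduction with
    | self => rfl
    | of_succ k hk ih =>
      rw [← ih]
      have hk' : k < d := hk
      apply smul_right_injective N hq
      change q • _ = q • _
      rw [← map_smul, ← map_smul, ← hJ k hk'.le, hc k hk'.le, hev' k hk']
  have hB : ∀ l ≤ d, ev l (c (J (d + 1) v)) = q ^ (d - l) • ev d (c (J (d + 1) v)) :=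
    fun l hl => by
    induction hl using Nat.decreasingInduction with
    | self => simp
    | of_succ l hl ih =>
      have hl' : l < d := hl
      rw [← hev l hl'.le, ← hc l hl'.le, hJ' l hl', map_smul, map_smul, ih, smul_smul, ← pow_succ']
      congr 2
      omega
  have hs := sum_pow_eq_zero hq1 hqd
  rw [Finset.sum_range_succ, Nat.sub_self, pow_zero] at hs
  have hs' : q * ∑ k ∈ Finset.range (d + 1), q ^ (d - k) =
      ∑ k ∈ Finset.range (d + 1), q ^ (d + 1 - k) := by
    rw [Finset.mul_sum]
    refine Finset.sum_congr rfl fun k hk => ?_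
    rw [← pow_succ']
    congr 1
    have := Finset.mem_range.mp hk
    omega
  rw [hJx, map_sum, map_sum, hx, Finset.sum_range_succ _ (d + 1), Finset.sum_range_succ _ (d + 1)]
  congr 1
  · rw [Finset.sum_congr rfl fun k hk => show ev (d + 1) (c (q ^ (d + 1 - k) • J k v)) =
      q ^ (d + 1 - k) • ev (d + 1) (c (J d v)) by
        rw [map_smul, map_smul, hA k (Nat.lt_succ_iff.mp (Finset.mem_range.mp hk))],
      Finset.sum_congr rfl fun l hl => hB l (Nat.lt_succ_iff.mp (Finset.mem_range.mp hl)),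
      ← Finset.sum_smul, ← Finset.sum_smul, hA0, smul_smul, mul_comm, hs']
  · simp

end line

section mergeOp

variable {K N L : Type} [Field K] [AddCommGroup N] [Module K N]
  [LinearOrder L] [Fintype L] {q : K} {lo hi : L} {n s e : ℕ}

theorem mergeOp_apply_eq_sum (hlh : lo ≠ hi) (hs : s + e ≤ n) {w : Fin n → L}
    (hw : ∀ i, mergeLetter lo hi (w i) = lo ↔ s ≤ (i : ℕ) ∧ (i : ℕ) < s + e) {j : ℕ} (hj : j < e)
    (hwj : ∀ i, w i = hi ↔ (i : ℕ) = s + j) (m : (Fin n → L) → N) :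
    mergeOp q lo hi m w = q ^ (e - 1 - j) • ∑ l ∈ Finset.range e,
      m (fun i => if (i : ℕ) = s + l then hi else mergeLetter lo hi (w i)) := by
  have hinv : inversions lo hi w = e - 1 - j := by
    have h1 : e - 1 - j = (Finset.Ioo (s + j) (s + e)).card := by
      rw [Nat.card_Ioo]
      omega
    have key : ∀ i, w i = lo ↔ (s ≤ (i : ℕ) ∧ (i : ℕ) < s + e) ∧ (i : ℕ) ≠ s + j := fun i => by
      rw [← hw, Ne, ← hwj, mergeLetter]
      grind
    rw [inversions, h1]
    refine Finset.card_bij (fun p _ => (p.2 : ℕ)) ?_ ?_ ?_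
    · intro p hp
      simp only [Finset.mem_filter, Finset.mem_univ, true_and, hwj, key, Fin.lt_def] at hp
      rw [Finset.mem_Ioo]
      omega
    · intro p hp p' hp' h
      simp only [Finset.mem_filter, Finset.mem_univ, true_and, hwj] at hp hp'
      exact Prod.ext (Fin.ext (hp.2.1.trans hp'.2.1.symm)) (Fin.ext h)
    · intro k hk
      rw [Finset.mem_Ioo] at hk
      refine ⟨(⟨s + j, by omega⟩, ⟨k, by omega⟩), ?_, rfl⟩
      simp only [Finset.mem_filter, Finset.mem_univ, true_and, hwj, key, Fin.lt_def]
      omega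
  have hex : ∃ i, ∀ j, w j = hi ↔ j = i :=
    ⟨⟨s + j, by omega⟩, fun i => by rw [hwj, Fin.ext_iff]⟩
  rw [mergeOp_apply, if_pos hex, hinv]
  congr 1
  symm
  refine Finset.sum_bij (fun l _ i => if (i : ℕ) = s + l then hi else mergeLetter lo hi (w i))
    ?_ ?_ ?_ (fun _ _ => rfl)
  · intro l hl
    have hl := Finset.mem_range.mp hl
    refine mem_mergeFiber.mpr ⟨⟨⟨s + l, by omega⟩, fun i => ?_⟩, fun i => ?_⟩
    · simp only [Fin.ext_iff, mergeLetter]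
      split_ifs <;> simp_all
    · have := hw i
      simp only [mergeLetter] at *
      grind
  · intro l hl l' hl' h
    have hl := Finset.mem_range.mp hl
    have := congrFun h ⟨s + l, by omega⟩
    simp only [mergeLetter, if_true] at this
    grind
  · intro w' hw'
    obtain ⟨⟨i, h1⟩, h2⟩ := mem_mergeFiber.mp hw'
    have h3 : s ≤ (i : ℕ) ∧ (i : ℕ) < s + e := by
      rw [← hw, ← h2, mergeLetter, if_pos ((h1 i).mpr rfl)]
    refine ⟨i - s, Finset.mem_range.mpr (by omega), funext fun k => ?_⟩
    rw [Nat.add_sub_cancel' h3.1, ← h2]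
    have := h1 k
    simp only [Fin.ext_iff, mergeLetter] at *
    grind

theorem mergeOp_apply_eq_zero {m : (Fin n → L) → N} {w : Fin n → L}
    (h : (∃ i, ∀ j, w j = hi ↔ j = i) → ∀ w' ∈ mergeFiber lo hi w, m w' = 0) :
    mergeOp q lo hi m w = 0 := by
  rw [mergeOp_apply]
  split_ifs with h1
  · rw [Finset.sum_eq_zero (h h1), smul_zero]
  · rw [zero_smul]

end mergeOp

section blockWord

variable {n e : ℕ} {a b : Fin n}

/-- A word with letters `0, 1` on the first `e` positions, `2, 3` on the next `e` positions and `4`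
on the other positions, with one letter `1` at position `j` and one letter `3` at position
`e + k`. -/
def blockWord (n e j k : ℕ) (i : Fin n) : Fin 5 :=
  if (i : ℕ) < e then (if (i : ℕ) = j then 1 else 0)
  else if (i : ℕ) < e + e then (if (i : ℕ) = e + k then 3 else 2) else 4

theorem blockWord_injective (hn : e + e ≤ n) {j k j' k' : ℕ} (hj : j < e) (hk : k < e)
    (h : blockWord n e j k = blockWord n e j' k') : j = j' ∧ k = k' := by
  have h1 := congrFun h ⟨j, by omega⟩
  have h2 := congrFun h ⟨e + k, by omega⟩
  simp only [blockWord] at h1 h2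
  constructor
  · split_ifs at h1 <;> omega
  · split_ifs at h2 <;> omega

theorem swp_blockWord_left {j l k : ℕ} (ha : (a : ℕ) = k) (hb : (b : ℕ) = k + 1) (hk : k + 1 < e) :
    swp a b (blockWord n e j l) =
      blockWord n e (if j = k then k + 1 else if j = k + 1 then k else j) l := by
  funext i
  simp only [swp, Function.comp_apply, Equiv.swap_apply_def, Fin.ext_iff, blockWord]
  grind

theorem swp_blockWord_right {j l k : ℕ} (ha : (a : ℕ) = e + k) (hb : (b : ℕ) = e + k + 1)
    (hk : k + 1 < e) : swp a b (blockWord n e j l) =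
      blockWord n e j (if l = k then k + 1 else if l = k + 1 then k else l) := by
  funext i
  simp only [swp, Function.comp_apply, Equiv.swap_apply_def, Fin.ext_iff, blockWord]
  grind

variable {K N : Type} [Field K] [AddCommGroup N] [Module K N] {q : K}

theorem permOp_blockWord_left {j l k : ℕ} (ha : (a : ℕ) = k) (hb : (b : ℕ) = k + 1) (hk : k + 1 < e)
    (m : (Fin n → Fin 5) → N) : permOp q a b m (blockWord n e j l) =
      if j = k then q • m (blockWord n e (k + 1) l) + (q - 1) • m (blockWord n e k l)
      else if j = k + 1 then m (blockWord n e k l) else q • m (blockWord n e j l) := by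
  have hs := swp_blockWord_left (n := n) (j := j) (l := l) ha hb hk
  split_ifs with h1 h2
  · subst h1
    rw [permOp_of_gt, hs, if_pos rfl]
    simp only [blockWord, ha, hb]
    grind
  · subst h2
    rw [permOp_of_lt, hs, if_neg h1, if_pos rfl]
    simp only [blockWord, ha, hb]
    grind
  · rw [permOp_of_eq]
    simp only [blockWord, ha, hb]
    grind

theorem permOp_blockWord_right {j l k : ℕ} (ha : (a : ℕ) = e + k) (hb : (b : ℕ) = e + k + 1)
    (hk : k + 1 < e) (m : (Fin n → Fin 5) → N) : permOp q a b m (blockWord n e j l) =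
      if l = k then q • m (blockWord n e j (k + 1)) + (q - 1) • m (blockWord n e j k)
      else if l = k + 1 then m (blockWord n e j k) else q • m (blockWord n e j l) := by
  have hs := swp_blockWord_right (n := n) (j := j) (l := l) ha hb hk
  split_ifs with h1 h2
  · subst h1
    rw [permOp_of_gt, hs, if_pos rfl]
    simp only [blockWord, ha, hb]
    grind
  · subst h2
    rw [permOp_of_lt, hs, if_neg h1, if_pos rfl]
    simp only [blockWord, ha, hb]
    grind
  · rw [permOp_of_eq]
    simp only [blockWord, ha, hb]
    grind

theorem mergeOp_blockWord_left (hn : e + e ≤ n) {j k : ℕ} (hj : j < e)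
    (m : (Fin n → Fin 5) → N) : mergeOp q 0 1 m (blockWord n e j k) =
      q ^ (e - 1 - j) • ∑ l ∈ Finset.range e, m (blockWord n e l k) := by
  rw [mergeOp_apply_eq_sum (s := 0) (e := e) (by decide) (by omega) ?_ hj]
  · congr 1
    refine Finset.sum_congr rfl fun l hl => congrArg m (funext fun i => ?_)
    have hl := Finset.mem_range.mp hl
    simp only [blockWord, mergeLetter]
    grind
  · intro i
    simp only [blockWord]
    grind
  · intro i
    simp only [blockWord, mergeLetter]
    grind

theorem mergeOp_blockWord_right (hn : e + e ≤ n) {j k : ℕ} (hk : k < e)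
    (m : (Fin n → Fin 5) → N) : mergeOp q 2 3 m (blockWord n e j k) =
      q ^ (e - 1 - k) • ∑ l ∈ Finset.range e, m (blockWord n e j l) := by
  rw [mergeOp_apply_eq_sum (s := e) (e := e) (by decide) (by omega) ?_ hk]
  · congr 1
    refine Finset.sum_congr rfl fun l hl => congrArg m (funext fun i => ?_)
    have hl := Finset.mem_range.mp hl
    simp only [blockWord, mergeLetter]
    grind
  · intro i
    simp only [blockWord]
    grind
  · intro i
    simp only [blockWord, mergeLetter]
    grind

/-- Functions supported on block words. -/
def blockFun (n e : ℕ) (r : ℕ → ℕ → N) (w : Fin n → Fin 5) : N :=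
  ∑ j ∈ Finset.range e, ∑ k ∈ Finset.range e, if w = blockWord n e j k then r j k else 0

theorem blockFun_blockWord (hn : e + e ≤ n) (r : ℕ → ℕ → N) {j k : ℕ} (hj : j < e) (hk : k < e) :
    blockFun n e r (blockWord n e j k) = r j k := by
  rw [blockFun, Finset.sum_eq_single_of_mem j (Finset.mem_range.mpr hj),
    Finset.sum_eq_single_of_mem k (Finset.mem_range.mpr hk), if_pos rfl]
  · exact fun k' _ hk' => if_neg fun h => hk' (blockWord_injective hn hj hk h).2.symm
  · exact fun j' _ hj' => Finset.sum_eq_zero fun k' _ =>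
      if_neg fun h => hj' (blockWord_injective hn hj hk h).1.symm

theorem blockFun_eq_zero {w : Fin n → Fin 5} (hw : ∀ j < e, ∀ k < e, w ≠ blockWord n e j k)
    (r : ℕ → ℕ → N) : blockFun n e r w = 0 :=
  Finset.sum_eq_zero fun j hj => Finset.sum_eq_zero fun k hk =>
    if_neg (hw j (Finset.mem_range.mp hj) k (Finset.mem_range.mp hk))

theorem eq_blockFun (hn : e + e ≤ n) {m : (Fin n → Fin 5) → N} {r : ℕ → ℕ → N}
    (h : ∀ j < e, ∀ k < e, m (blockWord n e j k) = r j k)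
    (h' : ∀ w, (∀ j < e, ∀ k < e, w ≠ blockWord n e j k) → m w = 0) : m = blockFun n e r := by
  funext w
  by_cases hw : ∀ j < e, ∀ k < e, w ≠ blockWord n e j k
  · rw [h' w hw, blockFun_eq_zero hw]
  · push Not at hw
    obtain ⟨j, hj, k, hk, rfl⟩ := hw
    rw [h j hj k hk, blockFun_blockWord hn r hj hk]

theorem permOp_eq_zero {m : (Fin n → Fin 5) → N} {w : Fin n → Fin 5} (h : m w = 0)
    (h' : m (swp a b w) = 0) : permOp q a b m w = 0 := by
  rcases lt_trichotomy (w a) (w b) with h1 | h1 | h1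
  · rw [permOp_of_lt h1, h']
  · rw [permOp_of_eq h1, h, smul_zero]
  · rw [permOp_of_gt h1, h, h', smul_zero, smul_zero, add_zero]

theorem permOp_blockFun_left (hn : e + e ≤ n) {k : ℕ} (ha : (a : ℕ) = k) (hb : (b : ℕ) = k + 1)
    (hk : k + 1 < e) (r : ℕ → ℕ → N) : permOp q a b (blockFun n e r) = blockFun n e fun j l =>
      if j = k then q • r (k + 1) l + (q - 1) • r k l else if j = k + 1 then r k l
      else q • r j l := by
  refine eq_blockFun hn (fun j hj l hl => ?_) fun w hw =>
    permOp_eq_zero (blockFun_eq_zero hw r) (blockFun_eq_zero (fun j hj l hl h => ?_) r)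
  · rw [permOp_blockWord_left ha hb hk, blockFun_blockWord hn r hk hl,
      blockFun_blockWord hn r (Nat.lt_of_succ_lt hk) hl, blockFun_blockWord hn r hj hl]
  · refine hw _ ?_ l hl (by rw [← swp_swp a b w, h, swp_blockWord_left ha hb hk])
    split_ifs <;> omega

theorem permOp_blockFun_right (hn : e + e ≤ n) {k : ℕ} (ha : (a : ℕ) = e + k)
    (hb : (b : ℕ) = e + k + 1) (hk : k + 1 < e) (r : ℕ → ℕ → N) :
    permOp q a b (blockFun n e r) = blockFun n e fun j l =>
      if l = k then q • r j (k + 1) + (q - 1) • r j k else if l = k + 1 then r j k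
      else q • r j l := by
  refine eq_blockFun hn (fun j hj l hl => ?_) fun w hw =>
    permOp_eq_zero (blockFun_eq_zero hw r) (blockFun_eq_zero (fun j hj l hl h => ?_) r)
  · rw [permOp_blockWord_right ha hb hk, blockFun_blockWord hn r hj hk,
      blockFun_blockWord hn r hj (Nat.lt_of_succ_lt hk), blockFun_blockWord hn r hj hl]
  · refine hw j hj _ ?_ (by rw [← swp_swp a b w, h, swp_blockWord_right ha hb hk])
    split_ifs <;> omega

theorem mergeOp_blockFun_left (hn : e + e ≤ n) (r : ℕ → ℕ → N) :
    mergeOp q 0 1 (blockFun n e r) =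
      blockFun n e fun j k => q ^ (e - 1 - j) • ∑ l ∈ Finset.range e, r l k := by
  refine eq_blockFun hn (fun j hj k hk => ?_) fun w hw => mergeOp_apply_eq_zero ?_
  · rw [mergeOp_blockWord_left hn hj]
    congr 1
    exact Finset.sum_congr rfl fun l hl => blockFun_blockWord hn r (Finset.mem_range.mp hl) hk
  · rintro ⟨i, hi⟩ w' hw'
    refine blockFun_eq_zero (fun l hl k hk h => ?_) r
    subst h
    have h2 := (mem_mergeFiber.mp hw').2
    have h3 := h2 i
    rw [mergeLetter, mergeLetter, if_pos ((hi i).mpr rfl)] at h3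
    have hie : (i : ℕ) < e := by
      simp only [blockWord] at h3
      grind
    refine hw i hie k hk (funext fun c => ?_)
    have h4 := h2 c
    have h5 := hi c
    simp only [blockWord, mergeLetter, Fin.ext_iff] at *
    grind

theorem mergeOp_blockFun_right (hn : e + e ≤ n) (r : ℕ → ℕ → N) :
    mergeOp q 2 3 (blockFun n e r) =
      blockFun n e fun j k => q ^ (e - 1 - k) • ∑ l ∈ Finset.range e, r j l := by
  refine eq_blockFun hn (fun j hj k hk => ?_) fun w hw => mergeOp_apply_eq_zero ?_
  · rw [mergeOp_blockWord_right hn hk]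
    congr 1
    exact Finset.sum_congr rfl fun l hl => blockFun_blockWord hn r hj (Finset.mem_range.mp hl)
  · rintro ⟨i, hi⟩ w' hw'
    refine blockFun_eq_zero (fun j hj l hl h => ?_) r
    subst h
    have h2 := (mem_mergeFiber.mp hw').2
    have h3 := h2 i
    rw [mergeLetter, mergeLetter, if_pos ((hi i).mpr rfl)] at h3
    have hie : e ≤ (i : ℕ) ∧ (i : ℕ) < e + e := by
      simp only [blockWord] at h3
      grind
    refine hw j hj (i - e) (by omega) (funext fun c => ?_)
    have h4 := h2 c
    have h5 := hi c
    simp only [blockWord, mergeLetter, Fin.ext_iff] at *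
    grind

end blockWord

section interpolation

variable {K N : Type} [Field K] [AddCommGroup N] [Module K N] {q : K} {n d : ℕ}
  {x y : Module.End K N}

theorem permOp_compLeft {I L : Type} [DecidableEq I] [LinearOrder L] {a b : I}
    (m : (I → L) → N) : permOp q a b (x.compLeft (I → L) m) = x.compLeft (I → L) (permOp q a b m)
        := by
  funext w
  simp only [LinearMap.compLeft_apply, Function.comp_apply]
  rcases lt_trichotomy (w a) (w b) with h | h | h
  · simp [permOp_of_lt h]
  · simp [permOp_of_eq h]
  · simp [permOp_of_gt h]

/-- The functions on words on which two given operators agree with the two merging operators. -/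
noncomputable def mergeLocus (q : K) (n : ℕ) (x y : Module.End K N) :
    Submodule K ((Fin n → Fin 5) → N) :=
  LinearMap.eqLocus (x.compLeft (Fin n → Fin 5)) (mergeOp q 0 1) ⊓
    LinearMap.eqLocus (y.compLeft (Fin n → Fin 5)) (mergeOp q 2 3)

theorem mem_mergeLocus {m : (Fin n → Fin 5) → N} : m ∈ mergeLocus q n x y ↔
    x.compLeft (Fin n → Fin 5) m = mergeOp q 0 1 m ∧
      y.compLeft (Fin n → Fin 5) m = mergeOp q 2 3 m := Iff.rfl

theorem permOp_mem_mergeLocus {m : (Fin n → Fin 5) → N} (hm : m ∈ mergeLocus q n x y) {a b : Fin n}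
    (hab : a ⋖ b) : permOp q a b m ∈ mergeLocus q n x y := by
  rw [mem_mergeLocus] at *
  rw [mergeOp_permOp hab ⟨by decide, by decide⟩, mergeOp_permOp hab ⟨by decide, by decide⟩, ← hm.1,
    ← hm.2, permOp_compLeft, permOp_compLeft]
  exact ⟨rfl, rfl⟩

/-- Coefficients of `interpMap`. -/
def interpCoeff (q : K) (d : ℕ) (x y : Module.End K N) (a b j k : ℕ) : Module.End K N :=
  (q ^ (d + 1 - j) * q ^ (d + 1 - k)) • 1 +
    (((if j = a then 1 else 0) - q ^ (d + 1 - j)) * q ^ (d + 1 - k)) • x +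
    (q ^ (d + 1 - j) * ((if k = b then 1 else 0) - q ^ (d + 1 - k))) • y

/-- Maps to `mergeLocus` indexed by block words. -/
def interpMap (q : K) (n d : ℕ) (x y : Module.End K N) (a b : ℕ) :
    N →ₗ[K] (Fin n → Fin 5) → N :=
  LinearMap.pi fun w => ∑ j ∈ Finset.range (d + 2), ∑ k ∈ Finset.range (d + 2),
    if w = blockWord n (d + 2) j k then interpCoeff q d x y a b j k else 0

theorem interpMap_apply (a b : ℕ) (v : N) : interpMap q n d x y a b v =
    blockFun n (d + 2) fun j k => interpCoeff q d x y a b j k v := by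
  funext w
  simp only [interpMap, LinearMap.pi_apply, blockFun, LinearMap.sum_apply]
  refine Finset.sum_congr rfl fun j _ => Finset.sum_congr rfl fun k _ => ?_
  split_ifs <;> rfl

theorem interpCoeff_apply_left (a b j k : ℕ) (v : N) : interpCoeff q d x y a b j k v =
    q ^ (d + 1 - j) • (q ^ (d + 1 - k) • v - q ^ (d + 1 - k) • x v +
      ((if k = b then 1 else 0) - q ^ (d + 1 - k)) • y v) +
      (if j = a then (1 : K) else 0) • (q ^ (d + 1 - k) • x v) := by
  simp only [interpCoeff, LinearMap.add_apply, LinearMap.smul_apply, Module.End.one_apply]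
  module

theorem interpCoeff_apply_right (a b j k : ℕ) (v : N) : interpCoeff q d x y a b j k v =
    q ^ (d + 1 - k) • (q ^ (d + 1 - j) • v - q ^ (d + 1 - j) • y v +
      ((if j = a then 1 else 0) - q ^ (d + 1 - j)) • x v) +
      (if k = b then (1 : K) else 0) • (q ^ (d + 1 - j) • y v) := by
  simp only [interpCoeff, LinearMap.add_apply, LinearMap.smul_apply, Module.End.one_apply]
  module

theorem smul_blockFun {e : ℕ} (c : K) (r : ℕ → ℕ → N) :
    c • blockFun n e r = blockFun n e fun j k => c • r j k := by
  funext w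
  simp only [blockFun, Pi.smul_apply, Finset.smul_sum]
  refine Finset.sum_congr rfl fun j _ => Finset.sum_congr rfl fun k _ => ?_
  split_ifs <;> simp

theorem blockFun_congr {e : ℕ} {r r' : ℕ → ℕ → N} (h : ∀ j < e, ∀ k < e, r j k = r' j k) :
    blockFun n e r = blockFun n e r' := by
  funext w
  refine Finset.sum_congr rfl fun j hj => Finset.sum_congr rfl fun k hk => ?_
  rw [h j (Finset.mem_range.mp hj) k (Finset.mem_range.mp hk)]

theorem interp_identity {a k j : ℕ} (hk : k ≤ d) (ha : a ≠ k) (A B : N) {f : ℕ → N}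
    (hf : ∀ j, f j = q ^ (d + 1 - j) • A + (if j = a then (1 : K) else 0) • B) :
    (if j = k then q • f (k + 1) + (q - 1) • f k else if j = k + 1 then f k else q • f j) =
      q • (q ^ (d + 1 - j) • A + (if j = if a = k + 1 then k else a then (1 : K) else 0) • B) := by
  have h1 : q ^ (d + 1 - k) = q * q ^ (d + 1 - (k + 1)) := by
    rw [← pow_succ']
    congr 1
    omega
  simp only [hf, h1]
  rw [if_neg ha.symm]
  split_ifs
  all_goals try subst_vars
  all_goals try rw [h1]
  all_goals try module
  all_goals omega

theorem permOp_interpMap_left (hn : d + 2 + (d + 2) ≤ n) {k a b : ℕ} {s t : Fin n}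
    (hs : (s : ℕ) = k) (ht : (t : ℕ) = k + 1) (hk : k ≤ d) (ha : a ≠ k) (v : N) :
    permOp q s t (interpMap q n d x y a b v) =
      q • interpMap q n d x y (if a = k + 1 then k else a) b v := by
  rw [interpMap_apply, interpMap_apply, permOp_blockFun_left hn hs ht (by omega), smul_blockFun]
  refine blockFun_congr fun j _ l _ => ?_
  rw [interpCoeff_apply_left (if a = k + 1 then k else a)]
  exact interp_identity (f := fun j => interpCoeff q d x y a b j l v) hk ha _ _
    fun j => interpCoeff_apply_left a b j l v

theorem permOp_interpMap_right (hn : d + 2 + (d + 2) ≤ n) {k a b : ℕ} {s t : Fin n}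
    (hs : (s : ℕ) = d + 2 + k) (ht : (t : ℕ) = d + 2 + k + 1) (hk : k ≤ d) (hb : b ≠ k) (v : N) :
    permOp q s t (interpMap q n d x y a b v) =
      q • interpMap q n d x y a (if b = k + 1 then k else b) v := by
  rw [interpMap_apply, interpMap_apply, permOp_blockFun_right hn hs ht (by omega), smul_blockFun]
  refine blockFun_congr fun j _ l _ => ?_
  rw [interpCoeff_apply_right _ (if b = k + 1 then k else b)]
  exact interp_identity (f := fun l => interpCoeff q d x y a b j l v) hk hb _ _
    fun l => interpCoeff_apply_right a b j l v

theorem sum_interpCoeff_left (h0 : ∑ k ∈ Finset.range (d + 2), q ^ (d + 1 - k) = 0) {a : ℕ}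
    (ha : a < d + 2) (b k : ℕ) (v : N) : ∑ j ∈ Finset.range (d + 2), interpCoeff q d x y a b j k v =
      q ^ (d + 1 - k) • x v := by
  rw [Finset.sum_congr rfl fun j _ => interpCoeff_apply_left a b j k v, Finset.sum_add_distrib,
    ← Finset.sum_smul, h0, ← Finset.sum_smul]
  simp [ha]

theorem sum_interpCoeff_right (h0 : ∑ k ∈ Finset.range (d + 2), q ^ (d + 1 - k) = 0) {b : ℕ}
    (hb : b < d + 2) (a j : ℕ) (v : N) : ∑ k ∈ Finset.range (d + 2), interpCoeff q d x y a b j k v =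
      q ^ (d + 1 - j) • y v := by
  rw [Finset.sum_congr rfl fun k _ => interpCoeff_apply_right a b j k v, Finset.sum_add_distrib,
    ← Finset.sum_smul, h0, ← Finset.sum_smul]
  simp [hb]

theorem interpMap_mem (hxx : ∀ v, x (x v) = 0) (hxy : ∀ v, x (y v) = 0) (hyx : ∀ v, y (x v) = 0)
    (hyy : ∀ v, y (y v) = 0) (hn : d + 2 + (d + 2) ≤ n)
    (h0 : ∑ k ∈ Finset.range (d + 2), q ^ (d + 1 - k) = 0) {a b : ℕ} (ha : a < d + 2)
    (hb : b < d + 2) (v : N) : interpMap q n d x y a b v ∈ mergeLocus q n x y := by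
  rw [mem_mergeLocus, interpMap_apply, mergeOp_blockFun_left hn, mergeOp_blockFun_right hn]
  constructor
  · refine eq_blockFun hn (fun j hj k hk => ?_) fun w hw => ?_
    · rw [sum_interpCoeff_left h0 ha, LinearMap.compLeft_apply, Function.comp_apply,
        blockFun_blockWord hn _ hj hk, interpCoeff_apply_left]
      simp only [map_add, map_sub, map_smul, hxx, hxy, show d + 2 - 1 = d + 1 from rfl]
      module
    · rw [LinearMap.compLeft_apply, Function.comp_apply, blockFun_eq_zero hw, map_zero]
  · refine eq_blockFun hn (fun j hj k hk => ?_) fun w hw => ?_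
    · rw [sum_interpCoeff_right h0 hb, LinearMap.compLeft_apply, Function.comp_apply,
        blockFun_blockWord hn _ hj hk, interpCoeff_apply_right]
      simp only [map_add, map_sub, map_smul, hyx, hyy, show d + 2 - 1 = d + 1 from rfl]
      module
    · rw [LinearMap.compLeft_apply, Function.comp_apply, blockFun_eq_zero hw, map_zero]

theorem sum_interpMap_left (hxx : ∀ v, x (x v) = 0) (hyx : ∀ v, y (x v) = 0)
    (hn : d + 2 + (d + 2) ≤ n) (h0 : ∑ k ∈ Finset.range (d + 2), q ^ (d + 1 - k) = 0) (c b : ℕ)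
    (v : N) : interpMap q n d x y c b (x v) =
      ∑ a ∈ Finset.range (d + 2), q ^ (d + 1 - a) • interpMap q n d x y a b v := by
  simp only [interpMap_apply]
  symm
  refine eq_blockFun hn (fun j hj k hk => ?_) fun w hw => ?_
  · simp only [Finset.sum_apply, Pi.smul_apply, blockFun_blockWord hn _ hj hk]
    simp only [interpCoeff_apply_left, hxx, hyx, smul_add, Finset.sum_add_distrib,
      ← Finset.sum_smul, h0]
    simp [ite_smul, hj]
  · simp only [Finset.sum_apply, Pi.smul_apply, blockFun_eq_zero hw]
    simp

theorem sum_interpMap_right (hxy : ∀ v, x (y v) = 0) (hyy : ∀ v, y (y v) = 0)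
    (hn : d + 2 + (d + 2) ≤ n) (h0 : ∑ k ∈ Finset.range (d + 2), q ^ (d + 1 - k) = 0) (a c : ℕ)
    (v : N) : interpMap q n d x y a c (y v) =
      ∑ b ∈ Finset.range (d + 2), q ^ (d + 1 - b) • interpMap q n d x y a b v := by
  simp only [interpMap_apply]
  symm
  refine eq_blockFun hn (fun j hj k hk => ?_) fun w hw => ?_
  · simp only [Finset.sum_apply, Pi.smul_apply, blockFun_blockWord hn _ hj hk]
    simp only [interpCoeff_apply_right, hxy, hyy, smul_add, Finset.sum_add_distrib,
      ← Finset.sum_smul, h0]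
    simp [ite_smul, hk]
  · simp only [Finset.sum_apply, Pi.smul_apply, blockFun_eq_zero hw]
    simp

theorem exists_interpolation (hq : q ≠ 0) (hq1 : q ≠ 1) (hqd : q ^ (d + 2) = 1)
    (hn : d + 2 + (d + 2) ≤ n) (hxx : ∀ v, x (x v) = 0) (hxy : ∀ v, x (y v) = 0)
    (hyx : ∀ v, y (x v) = 0) (hyy : ∀ v, y (y v) = 0)
    {T : ℕ → Module.End K (mergeLocus q n x y)} (hT : ∀ k (hk : k + 1 < n), ∀ m,
      (T k m : (Fin n → Fin 5) → N) = permOp q ⟨k, Nat.lt_of_succ_lt hk⟩ ⟨k + 1, hk⟩ m) :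
    ∃ (i : N →ₗ[K] mergeLocus q n x y) (p : mergeLocus q n x y →ₗ[K] N), (∀ v, p (i v) = v) ∧
      ∀ c : Module.End K (mergeLocus q n x y), (∀ k, k + 1 < n → ∀ m, c (T k m) = T k (c m)) →
        ∀ v, p (c (i (x v))) = x (p (c (i v))) ∧ p (c (i (y v))) = y (p (c (i v))) := by
  have h0 := sum_pow_eq_zero hq1 hqd
  set J : ∀ a b, a < d + 2 → b < d + 2 → N →ₗ[K] mergeLocus q n x y := fun a b ha hb =>
    (interpMap q n d x y a b).codRestrict _ (interpMap_mem hxx hxy hyx hyy hn h0 ha hb) with hJ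
  set ev : ℕ → ℕ → mergeLocus q n x y →ₗ[K] N := fun j k =>
    LinearMap.proj (blockWord n (d + 2) j k) ∘ₗ (mergeLocus q n x y).subtype with hev
  have hT' : ∀ k (hk : k + 1 < n), ∀ m w, (T k m).1 w =
      permOp q ⟨k, Nat.lt_of_succ_lt hk⟩ ⟨k + 1, hk⟩ m.1 w := fun k hk m w => by rw [hT k hk]
  refine ⟨J (d + 1) (d + 1) (by omega) (by omega), ev (d + 1) (d + 1), fun v => ?_,
    fun c hc v => ⟨?_, ?_⟩⟩
  · change interpMap q n d x y (d + 1) (d + 1) v _ = v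
    rw [interpMap_apply, blockFun_blockWord hn _ (by omega) (by omega), interpCoeff_apply_left]
    simp
  · have := commute_of_interpolation hq hq1 hqd (x := x) (T := T) (ev := fun k => ev k (d + 1))
      (J := fun k => if hk : k < d + 2 then J k (d + 1) hk (by omega) else 0)
      (fun m => ?_) (fun k hk m => ?_) (fun k hk m => ?_) (fun k hk v => ?_) (fun k hk v => ?_)
      (fun v => ?_) (c := c) (fun k hk m => hc k (by omega) m) v
    · simpa using this
    · have := congrFun (mem_mergeLocus.mp m.2).1 (blockWord n (d + 2) (d + 1) (d + 1))
      rw [mergeOp_blockWord_left hn (by omega)] at this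
      simpa [hev] using this
    · change (T k m).1 _ = m.1 _
      rw [hT' k (by omega), permOp_blockWord_left (k := k) rfl rfl (by omega), if_neg (by omega),
          if_pos rfl]
    · change (T k m).1 _ = q • m.1 _
      rw [hT' k (by omega), permOp_blockWord_left (k := k) rfl rfl (by omega), if_neg (by omega),
        if_neg (by omega)]
    · rw [dif_pos (by omega), dif_pos (by omega)]
      refine Subtype.ext ?_
      rw [hT k (by omega)]
      refine (permOp_interpMap_left hn (k := k) rfl rfl hk (by omega) v).trans ?_
      rw [if_pos rfl]
      rfl
    · rw [dif_pos (by omega)]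
      refine Subtype.ext ?_
      rw [hT k (by omega)]
      refine (permOp_interpMap_left hn (k := k) rfl rfl hk.le (by omega) v).trans ?_
      rw [if_neg (by omega)]
      rfl
    · rw [dif_pos (by omega)]
      refine Subtype.ext ?_
      refine (sum_interpMap_left hxx hyx hn h0 (d + 1) (d + 1) v).trans ?_
      rw [AddSubmonoidClass.coe_finsetSum]
      refine Finset.sum_congr rfl fun a ha => ?_
      rw [dif_pos (Finset.mem_range.mp ha)]
      rfl
  · have := commute_of_interpolation hq hq1 hqd (x := y) (T := fun k => T (d + 2 + k))
      (ev := fun k => ev (d + 1) k)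
      (J := fun k => if hk : k < d + 2 then J (d + 1) k (by omega) hk else 0)
      (fun m => ?_) (fun k hk m => ?_) (fun k hk m => ?_) (fun k hk v => ?_) (fun k hk v => ?_)
      (fun v => ?_) (c := c) (fun k hk m => hc (d + 2 + k) (by omega) m) v
    · simpa using this
    · have := congrFun (mem_mergeLocus.mp m.2).2 (blockWord n (d + 2) (d + 1) (d + 1))
      rw [mergeOp_blockWord_right hn (by omega)] at this
      simpa [hev] using this
    · change (T (d + 2 + k) m).1 _ = m.1 _
      rw [hT' _ (by omega), permOp_blockWord_right (k := k) rfl rfl (by omega),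
          if_neg (by omega), if_pos rfl]
    · change (T (d + 2 + k) m).1 _ = q • m.1 _
      rw [hT' _ (by omega), permOp_blockWord_right (k := k) rfl rfl (by omega), if_neg (by omega),
        if_neg (by omega)]
    · rw [dif_pos (by omega), dif_pos (by omega)]
      refine Subtype.ext ?_
      rw [hT _ (by omega)]
      refine (permOp_interpMap_right hn (k := k) rfl rfl hk (by omega) v).trans ?_
      rw [if_pos rfl]
      rfl
    · rw [dif_pos (by omega)]
      refine Subtype.ext ?_
      rw [hT _ (by omega)]
      refine (permOp_interpMap_right hn (k := k) rfl rfl hk.le (by omega) v).trans ?_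
      rw [if_neg (by omega)]
      rfl
    · rw [dif_pos (by omega)]
      refine Subtype.ext ?_
      refine (sum_interpMap_right hxy hyy hn h0 (d + 1) (d + 1) v).trans ?_
      rw [AddSubmonoidClass.coe_finsetSum]
      refine Finset.sum_congr rfl fun a ha => ?_
      rw [dif_pos (Finset.mem_range.mp ha)]
      rfl

end interpolation

section doubling

open Polynomial

variable {K : Type} [Field K]

theorem isUnit_adjoinRoot_X_pow {s : ℕ} {ε : AdjoinRoot (X ^ s : K[X]) →+* K}
    (hε : ∀ p : K[X], ε (AdjoinRoot.mk _ p) = p.eval 0) {r : AdjoinRoot (X ^ s : K[X])}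
    (hr : ε r ≠ 0) : IsUnit r := by
  obtain ⟨p, rfl⟩ := AdjoinRoot.mk_surjective r
  rw [hε] at hr
  rw [← divX_mul_X_add p, map_add, add_comm]
  have hp : p.coeff 0 ≠ 0 := by rwa [coeff_zero_eq_eval_zero]
  refine IsNilpotent.isUnit_add_left_of_commute (u := AdjoinRoot.mk (X ^ s : K[X]) (C (p.coeff 0)))
    ?_ ?_ (Commute.all _ _)
  · refine ⟨s, ?_⟩
    rw [← map_pow, mul_pow, map_mul, AdjoinRoot.mk_self, mul_zero]
  · exact (isUnit_C.mpr (isUnit_iff_ne_zero.mpr hp)).map _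

/-- Representations of the algebra with generators `x`, `y` all of whose products vanish, of
arbitrarily large dimension and with local endomorphism rings. -/
theorem exists_large_local (K : Type) [Field K] (s : ℕ) : ∃ (N : Type) (_ : AddCommGroup N)
    (_ : Module K N) (_ : FiniteDimensional K N) (x y : Module.End K N),
    (∀ v, x (x v) = 0) ∧ (∀ v, x (y v) = 0) ∧ (∀ v, y (x v) = 0) ∧ (∀ v, y (y v) = 0) ∧
    s < Module.finrank K N ∧ ∀ (α : Type) (_ : Fintype α) (f : α → Module.End K N),
      (∀ j v, f j (x v) = x (f j v) ∧ f j (y v) = y (f j v)) → ∑ j, f j = 1 →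
      ∃ j, Function.Injective (f j) := by
  set g : K[X] := X ^ (s + 1) with hg
  have hm : g.Monic := monic_X_pow _
  have := hm.finite_adjoinRoot
  have hf : Module.finrank K (AdjoinRoot g) = s + 1 := by
    rw [(AdjoinRoot.powerBasis' hm).finrank, AdjoinRoot.powerBasis'_dim, hg, natDegree_X_pow]
  set ε : AdjoinRoot g →+* K := AdjoinRoot.lift (RingHom.id K) 0 (by simp [hg]) with hε
  have hε' : ∀ p : K[X], ε (AdjoinRoot.mk _ p) = p.eval 0 := fun p => by
    rw [hε, AdjoinRoot.lift_mk, eval₂_id]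
  set Z : Module.End K (AdjoinRoot g) := LinearMap.mulLeft K (AdjoinRoot.root g)
  refine ⟨AdjoinRoot g × AdjoinRoot g, inferInstance, inferInstance, inferInstance,
    LinearMap.inr K _ _ ∘ₗ LinearMap.fst K _ _, LinearMap.inr K _ _ ∘ₗ Z ∘ₗ LinearMap.fst K _ _,
    by simp, by simp, by simp [Z], by simp [Z], ?_, fun α _ f hc hsum => ?_⟩
  · rw [Module.finrank_prod, hf]
    omega
  · have h1 : ∀ j v, f j (0, v) = (0, (f j (v, 0)).1) := fun j v => by
      simpa using (hc j (v, 0)).1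
    have h2 : ∀ j v, (f j (AdjoinRoot.root g * v, 0)).1 = AdjoinRoot.root g * (f j (v, 0)).1 :=
      fun j v => by
        have := (hc j (v, 0)).2
        simp only [LinearMap.comp_apply, LinearMap.fst_apply, LinearMap.inr_apply, Z,
          LinearMap.mulLeft_apply, h1] at this
        simpa using this
    have h3 : ∀ j (p : K[X]), (f j (AdjoinRoot.mk g p, 0)).1 =
        AdjoinRoot.mk g p * (f j (1, 0)).1 := fun j p => by
      have hadd : ∀ v w, (f j (v + w, 0)).1 = (f j (v, 0)).1 + (f j (w, 0)).1 := fun v w => by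
        rw [← Prod.fst_add, ← map_add]
        simp
      have hsmul : ∀ (c : K) v, (f j (c • v, 0)).1 = c • (f j (v, 0)).1 := fun c v => by
        rw [← Prod.smul_fst, ← map_smul]
        simp
      induction p using Polynomial.induction_on' with
      | add p p' hp hp' => rw [map_add, hadd, hp, hp', add_mul]
      | monomial k c =>
        have hC : ∀ v, AdjoinRoot.mk g (C c) * v = c • v := fun v => by
          rw [Algebra.smul_def]
          rfl
        rw [← C_mul_X_pow_eq_monomial, map_mul, map_pow, AdjoinRoot.mk_X, mul_assoc, hC, hC, hsmul]
        congr 1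
        induction k with
        | zero => simp
        | succ k ih => rw [pow_succ', h2, ih, mul_assoc]
    have h4 : ∑ j, (f j (1, 0)).1 = 1 := by
      have := congrArg Prod.fst (LinearMap.congr_fun hsum (1, 0))
      simpa [Prod.fst_sum] using this
    obtain ⟨j, -, hj⟩ : ∃ j ∈ Finset.univ, ε (f j (1, 0)).1 ≠ 0 := by
      refine Finset.exists_ne_zero_of_sum_ne_zero ?_
      rw [← map_sum, h4, map_one]
      exact one_ne_zero
    have hu := isUnit_adjoinRoot_X_pow hε' hj
    have h5 : ∀ v, (f j (v, 0)).1 = 0 → v = 0 := fun v hv => by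
      obtain ⟨p, rfl⟩ := AdjoinRoot.mk_surjective v
      rwa [h3, hu.mul_left_eq_zero] at hv
    refine ⟨j, (injective_iff_map_eq_zero (f j)).mpr ?_⟩
    rintro ⟨v, w⟩ h
    have h6 : f j (v, w) = f j (v, 0) + f j (0, w) := by
      rw [← map_add]
      simp
    rw [h6, h1] at h
    have hv : v = 0 := h5 v (by simpa using congrArg Prod.fst h)
    subst hv
    rw [show ((0, 0) : AdjoinRoot g × AdjoinRoot g) = 0 from rfl, map_zero, zero_add] at h
    rw [h5 w (congrArg Prod.snd h)]
    rfl

end doubling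

theorem isHecke_of_permOp {K N : Type} [Field K] [AddCommGroup N] [Module K N] {q : K} {n : ℕ}
    {P : Submodule K ((Fin n → Fin 5) → N)} {T : ℕ → Module.End K P}
    (hT : ∀ k (hk : k + 1 < n), ∀ m, (T k m : (Fin n → Fin 5) → N) =
      permOp q ⟨k, Nat.lt_of_succ_lt hk⟩ ⟨k + 1, hk⟩ m) : IsHecke q T n := by
  refine ⟨fun k hk => ?_, fun k hk => ?_, fun i j hi hj => ?_⟩ <;>
    refine LinearMap.ext fun m => Subtype.ext ?_
  · simpa [hT k hk] using LinearMap.congr_fun (permOp_quad (N := N) (L := Fin 5) (I := Fin n) q) m.1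
  · simpa [hT k (by omega), hT (k + 1) hk] using LinearMap.congr_fun (permOp_braid (N := N)
      (L := Fin 5) (I := Fin n) q (a := ⟨k, by omega⟩) (b := ⟨k + 1, by omega⟩)
      (c := ⟨k + 2, by omega⟩) (by simp) (by simp) (by simp)) m.1
  · simpa [hT i (by omega), hT j hj] using LinearMap.congr_fun (permOp_comm (N := N) (L := Fin 5)
      (I := Fin n) q (a := ⟨i, by omega⟩) (b := ⟨i + 1, by omega⟩) (c := ⟨j, by omega⟩)
      (d := ⟨j + 1, by omega⟩) (by simp; omega) (by simp; omega) (by simp; omega)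
      (by simp; omega)) m.1

theorem IsHecke.isTypeB_neg_one {K A : Type*} [Field K] [Ring A] [Algebra K A] {q Q : K}
    {T : ℕ → A} {n : ℕ} (h : IsHecke q T n) : IsTypeB q Q (-1) T n :=
  ⟨h, ⟨fun _ _ _ => by simp, fun _ => by simp⟩, by simp⟩

namespace OpRep

variable {K : Type} [Field K] {q Q : K} {n : ℕ}

theorem IsB.of_injective {M N : OpRep K ℕ} {f : M.V →ₗ[K] N.V} (hn : 0 < n)
    (hf : IsHom (Set.Iio n) M N f) (hinj : Function.Injective f) (h : IsB q Q n N) :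
    IsB q Q n M := by
  have h0 v : f (M.T 0 v) = N.T 0 (f v) := hf 0 hn v
  have hl k (hk : k + 1 < n) v : f (M.T (k + 1) v) = N.T (k + 1) (f v) := hf (k + 1) hk v
  refine ⟨⟨fun k hk => ?_, fun k hk => ?_, fun i j hi hj => ?_⟩, ⟨fun k hk hk' => ?_, fun h1 => ?_⟩,
    ?_⟩ <;> refine LinearMap.ext fun v => hinj ?_
  · simpa [hl k hk] using LinearMap.congr_fun (h.hecke.quad k hk) (f v)
  · simpa [hl k (by omega), hl (k + 1) (by omega)] using
      LinearMap.congr_fun (h.hecke.braid k hk) (f v)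
  · simpa [hl i (by omega), hl j (by omega)] using
      LinearMap.congr_fun (h.hecke.comm i j hi hj) (f v)
  · simpa [hl k hk', h0] using LinearMap.congr_fun (h.start.comm k hk hk') (f v)
  · simpa [hl 0 (by omega), h0] using LinearMap.congr_fun (h.start.braid h1) (f v)
  · simpa [h0] using LinearMap.congr_fun h.quad (f v)

theorem not_finType_isB (hq : q ≠ 0) (hq1 : q ≠ 1) (he : 0 < orderOf q) (hn : 2 * orderOf q ≤ n) :
    ¬ FinType (Set.Iio n) (IsB (K := K) q Q n) := by
  rintro ⟨r, X, hX⟩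
  obtain ⟨d, hd⟩ : ∃ d, orderOf q = d + 2 :=
    ⟨orderOf q - 2, by have := orderOf_eq_one_iff.not.mpr hq1; omega⟩
  obtain ⟨N, _, _, _, x, y, hxx, hxy, hyx, hyy, hs, hloc⟩ :=
    exists_large_local K (∑ j, Module.finrank K (X j).V)
  have hqd : q ^ (d + 2) = 1 := hd ▸ pow_orderOf_eq_one q
  set T : ℕ → Module.End K (mergeLocus q n x y) := fun k => if hk : k + 1 < n then
    (permOp q ⟨k, Nat.lt_of_succ_lt hk⟩ ⟨k + 1, hk⟩).restrict
      fun m hm => permOp_mem_mergeLocus hm (by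
        rw [Fin.covBy_iff, Nat.covBy_iff_add_one_eq]) else 0 with hTdef
  have hT : ∀ k (hk : k + 1 < n), ∀ m, (T k m : (Fin n → Fin 5) → N) =
      permOp q ⟨k, Nat.lt_of_succ_lt hk⟩ ⟨k + 1, hk⟩ m := fun k hk m => by
    simp only [hTdef, dif_pos hk]
    rfl
  obtain ⟨i, p, hpi, hc⟩ := exists_interpolation hq hq1 hqd (by omega) hxx hxy hyx hyy hT
  let M : OpRep K ℕ := ⟨mergeLocus q n x y, fun k => Nat.casesOn k (-1) T⟩
  have hM : IsB q Q n M := (isHecke_of_permOp hT).isTypeB_neg_one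
  obtain ⟨α, hα, c, hind, hinj, hsum⟩ := exists_decomposition (Set.Iio n) M
  let I : ∀ j, (c j).Y.V →ₗ[K] mergeLocus q n x y := fun j => (c j).i
  let J : ∀ j, mergeLocus q n x y →ₗ[K] (c j).Y.V := fun j => (c j).p
  have hsum' : ∀ m, ∑ j, I j (J j m) = m := fun m => by
    have := LinearMap.congr_fun hsum m
    rw [LinearMap.sum_apply] at this
    exact this
  have hcomm j k (hk : k + 1 < n) (m : mergeLocus q n x y) :
      (I j ∘ₗ J j) (T k m) = T k ((I j ∘ₗ J j) m) :=
    (congrArg (I j) ((c j).isHom_p (k + 1) hk m)).trans ((c j).isHom_i (k + 1) hk _)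
  have hone : ∑ j, (p ∘ₗ I j ∘ₗ J j ∘ₗ i : Module.End K N) = 1 := LinearMap.ext fun v => by
    rw [LinearMap.sum_apply]
    simp only [LinearMap.comp_apply, ← map_sum, hsum', hpi]
    rfl
  obtain ⟨j, hj⟩ := hloc α hα (fun j => p ∘ₗ I j ∘ₗ J j ∘ₗ i)
    (fun j v => hc (I j ∘ₗ J j) (hcomm j) v) hone
  have hinj' : Function.Injective (J j ∘ₗ i) := fun v w h => hj (by
    have := congrArg (fun u => p (I j u)) h
    exact this)
  obtain ⟨k, e, -⟩ := hX (c j).Y (IsB.of_injective (by omega) (c j).isHom_i (hinj j) hM) (hind j)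
  have h1 := LinearMap.finrank_le_finrank_of_injective hinj'
  rw [e.finrank_eq] at h1
  have h2 := Finset.single_le_sum (f := fun j => Module.finrank K (X j).V)
    (fun _ _ => Nat.zero_le _) (Finset.mem_univ k)
  exact absurd (hs.trans_le h1) (not_lt.mpr h2)

end OpRep

section TypeBModules

open MulOpposite

variable {K : Type} [Field K] {q Q : K} {n : ℕ}

theorem isTypeB_iff_lift_eq {A : Type*} [Ring A] [Algebra K A] (hn : 0 < n) (S : ℕ → A) :
    IsTypeB q Q (S 0) (fun k => S (k + 1)) n ↔ ∀ ⦃a b⦄, HeckeBRel K (-1) Q q n a b →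
      FreeAlgebra.lift K (fun i : Fin n => op (S i)) a =
        FreeAlgebra.lift K (fun i : Fin n => op (S i)) b := by
  have hquad (t : A) : t * t = (q - 1) • t + q • 1 ↔
      (t - algebraMap K A q) * (t + 1) = 0 := by
    rw [← sub_eq_zero, ← Algebra.algebraMap_eq_smul_one]
    refine Eq.congr ?_ rfl
    simp only [Algebra.smul_def, map_sub, map_one]
    noncomm_ring
  have hquad' (t : A) : (t - algebraMap K A Q) * (t + 1) = (t + 1) * (t - Q • 1) := by
    have := Algebra.commutes Q t
    rw [← Algebra.algebraMap_eq_smul_one, sub_mul, mul_sub, add_mul, mul_add, mul_add, add_mul,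
      this]
    noncomm_ring
  constructor
  · intro h a b hab
    induction hab with
    | quad_zero i hi =>
      apply unop_injective
      simpa [hi, hquad'] using h.quad
    | quad i hi =>
      obtain ⟨_ | k, hk⟩ := i
      · simp at hi
      apply unop_injective
      simpa using (hquad _).mp (h.hecke.quad k hk)
    | braid_zero i j hi hj =>
      apply unop_injective
      have := h.start.braid (by omega)
      simpa [hi, hj, mul_assoc] using this.symm
    | braid i j hi hij =>
      obtain ⟨_ | k, hk⟩ := i
      · simp at hi
      apply unop_injective
      have := h.hecke.braid k (by have := j.2; simp at hij; omega)
      simpa [hij, mul_assoc] using this.symm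
    | comm i j hij =>
      obtain ⟨_ | l, hl⟩ := j
      · simp at hij
      obtain ⟨_ | k, hk⟩ := i
      · apply unop_injective
        simpa using h.start.comm l (by simpa using hij) hl
      · apply unop_injective
        simpa using (h.hecke.comm k l (by simpa using hij) hl).symm
  · intro h
    refine ⟨⟨fun k hk => ?_, fun k hk => ?_, fun i j hi hj => ?_⟩, ⟨fun k hk hk' => ?_,
      fun h1 => ?_⟩, ?_⟩
    · rw [hquad]
      simpa using congrArg unop (h (.quad ⟨k + 1, hk⟩ (by simp)))
    · simpa [mul_assoc] using
        (congrArg unop (h (.braid ⟨k + 1, by omega⟩ ⟨k + 2, hk⟩ (by simp) (by simp)))).symm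
    · simpa using
        (congrArg unop (h (.comm ⟨i + 1, by omega⟩ ⟨j + 1, hj⟩ (by simpa using hi)))).symm
    · simpa using congrArg unop (h (.comm ⟨0, hn⟩ ⟨k + 1, hk'⟩ (by simpa using hk)))
    · simpa [mul_assoc] using
        (congrArg unop (h (.braid_zero ⟨0, hn⟩ ⟨1, h1⟩ rfl rfl))).symm
    · rw [← hquad']
      simpa using congrArg unop (h (.quad_zero ⟨0, hn⟩ rfl))

/-- The generators of the Hecke algebra of type `B`. -/
noncomputable def HeckeB.gen (α β q : K) {n : ℕ} (i : Fin n) : HeckeB K α β q n :=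
  RingQuot.mkAlgHom K _ (FreeAlgebra.ι K i)

theorem HeckeB.induction {α β : K} {C : HeckeB K α β q n → Prop}
    (algebraMap : ∀ r, C (algebraMap K _ r)) (gen : ∀ i, C (gen α β q i))
    (mul : ∀ a b, C a → C b → C (a * b)) (add : ∀ a b, C a → C b → C (a + b)) (a) : C a := by
  obtain ⟨a, rfl⟩ := RingQuot.mkAlgHom_surjective K (HeckeBRel K α β q n) a
  induction a using FreeAlgebra.induction with
  | grade0 r => simpa using algebraMap r
  | grade1 i => exact gen i
  | mul a b ha hb => simpa using mul _ _ ha hb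
  | add a b ha hb => simpa using add _ _ ha hb

theorem Submodule.isCompl_iff_forall_exists {R M : Type*} [Ring R] [AddCommGroup M] [Module R M]
    {P P' : Submodule R M} :
    IsCompl P P' ↔ (∀ v ∈ P, v ∈ P' → v = 0) ∧ ∀ v, ∃ w ∈ P, ∃ w' ∈ P', w + w' = v := by
  rw [isCompl_iff, Submodule.disjoint_def, codisjoint_iff, Submodule.eq_top_iff']
  simp only [Submodule.mem_sup]

namespace FDRightModule

/-- The operators by which the generators act on a right module. -/
noncomputable def operator {α β : K} (M : FDRightModule K (HeckeB K α β q n)) (k : ℕ) :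
    Module.End K M.carrier :=
  if hk : k < n then Algebra.lsmul K K M.carrier (op (HeckeB.gen α β q ⟨k, hk⟩)) else 0

/-- The underlying space of a right module with the operators given by the generators. -/
noncomputable def opRep {α β : K} (M : FDRightModule K (HeckeB K α β q n)) : OpRep K ℕ :=
  ⟨M.carrier, M.operator⟩

theorem operator_apply {α β : K} {M : FDRightModule K (HeckeB K α β q n)} (i : Fin n)
    (v : M.carrier) : M.operator i v = op (HeckeB.gen α β q i) • v := by
  rw [operator, dif_pos i.2]
  rfl

theorem opRep_T {α β : K} {M : FDRightModule K (HeckeB K α β q n)} (i : Fin n) (v : M.carrier) :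
    M.opRep.T i v = op (HeckeB.gen α β q i) • v :=
  operator_apply i v

theorem isB_opRep (hn : 0 < n) (M : FDRightModule K (HeckeB K (-1) Q q n)) :
    OpRep.IsB q Q n M.opRep := by
  refine (isTypeB_iff_lift_eq hn M.operator).mpr fun a b hab => ?_
  have h : FreeAlgebra.lift K (fun i : Fin n => op (M.operator i)) =
      (AlgHom.opComm.symm (Algebra.lsmul K K M.carrier)).comp
        (RingQuot.mkAlgHom K (HeckeBRel K (-1) Q q n)) := by
    refine FreeAlgebra.hom_ext (funext fun i => unop_injective (LinearMap.ext fun v => ?_))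
    simpa [HeckeB.gen] using operator_apply i v
  have h' a := DFunLike.congr_fun h a
  refine (h' a).trans (Eq.trans ?_ (h' b).symm)
  rw [AlgHom.comp_apply, AlgHom.comp_apply, RingQuot.mkAlgHom_rel K hab]

theorem smul_mem_of_stable {α β : K} {M : FDRightModule K (HeckeB K α β q n)}
    {P : Submodule K M.carrier} (hP : M.opRep.Stable (Set.Iio n) P) (a : HeckeB K α β q n) :
    ∀ v ∈ P, op a • v ∈ P := by
  induction a using HeckeB.induction with
  | algebraMap r =>
    intro v hv
    have : op (algebraMap K (HeckeB K α β q n) r) • v = r • v := algebraMap_smul _ r v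
    exact this ▸ P.smul_mem r hv
  | gen i => exact fun v hv => opRep_T i v ▸ hP i i.2 v hv
  | mul a b ha hb => exact fun v hv => by rw [op_mul, mul_smul]; exact hb _ (ha _ hv)
  | add a b ha hb => exact fun v hv => by rw [op_add, add_smul]; exact P.add_mem (ha _ hv) (hb _ hv)

theorem map_smul_of_isHom {α β : K} {M N : FDRightModule K (HeckeB K α β q n)}
    {f : M.carrier →ₗ[K] N.carrier} (hf : OpRep.IsHom (Set.Iio n) M.opRep N.opRep f)
    (a : HeckeB K α β q n) : ∀ v, f (op a • v) = op a • f v := by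
  induction a using HeckeB.induction with
  | algebraMap r =>
    intro v
    have h1 : op (algebraMap K (HeckeB K α β q n) r) • v = r • v := algebraMap_smul _ r v
    have h2 : op (algebraMap K (HeckeB K α β q n) r) • f v = r • f v := algebraMap_smul _ r _
    rw [h1, h2, map_smul]
  | gen i => exact fun v => by rw [← opRep_T, ← opRep_T]; exact hf i i.2 v
  | mul a b ha hb => exact fun v => by rw [op_mul, mul_smul, hb, ha, mul_smul]
  | add a b ha hb => exact fun v => by rw [op_add, add_smul, map_add, ha, hb, add_smul]

theorem opRep_iso_iff {α β : K} {M N : FDRightModule K (HeckeB K α β q n)} :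
    OpRep.Iso (Set.Iio n) M.opRep N.opRep ↔
      Nonempty (M.carrier ≃ₗ[(HeckeB K α β q n)ᵐᵒᵖ] N.carrier) := by
  refine ⟨fun ⟨e, he⟩ => ?_, fun ⟨e⟩ => ⟨e.restrictScalars K, fun i hi v => ?_⟩⟩
  · let f : M.carrier ≃ₗ[K] N.carrier := e
    exact ⟨{ f with map_smul' := fun a v => map_smul_of_isHom (f := f.toLinearMap) he a.unop v }⟩
  · have h1 := opRep_T (M := M) ⟨i, hi⟩ v
    have h2 := opRep_T (M := N) ⟨i, hi⟩ (e v)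
    exact (congrArg e h1).trans ((e.map_smul _ _).trans h2.symm)

theorem indec_opRep_iff {α β : K} {M : FDRightModule K (HeckeB K α β q n)} :
    OpRep.Indec (Set.Iio n) M.opRep ↔ IsIndecomposableModule (HeckeB K α β q n)ᵐᵒᵖ M.carrier := by
  refine and_congr Iff.rfl ⟨fun h N₁ N₂ hN => ?_, fun h P P' hP hP' hc => ?_⟩
  · have hs (N : Submodule (HeckeB K α β q n)ᵐᵒᵖ M.carrier) :
        M.opRep.Stable (Set.Iio n) (N.restrictScalars K) := fun i hi v hv => by
      have h1 := opRep_T (M := M) ⟨i, hi⟩ v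
      exact h1 ▸ N.smul_mem _ hv
    refine (h _ _ (hs N₁) (hs N₂) (Submodule.isCompl_iff_forall_exists.mpr
      (Submodule.isCompl_iff_forall_exists (P := N₁).mp hN))).imp (fun h => ?_) fun h => ?_
    all_goals
      have h1 := (Submodule.eq_bot_iff _).mp h
      exact (Submodule.eq_bot_iff _).mpr h1
  · let N (P : Submodule K M.carrier) (hP : M.opRep.Stable (Set.Iio n) P) :
        Submodule (HeckeB K α β q n)ᵐᵒᵖ M.carrier :=
      { P with smul_mem' := fun a v hv => smul_mem_of_stable hP a.unop v hv }
    refine (h (N P hP) (N P' hP') (Submodule.isCompl_iff_forall_exists.mpr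
      (Submodule.isCompl_iff_forall_exists (P := P).mp hc))).imp (fun h => ?_) fun h => ?_
    all_goals
      have h1 := (Submodule.eq_bot_iff _).mp h
      exact (Submodule.eq_bot_iff _).mpr h1

end FDRightModule

/-- The right module given by operators satisfying the relations of type `B`. -/
noncomputable def OpRep.IsB.rightModule {M : OpRep K ℕ} (h : OpRep.IsB q Q n M) (hn : 0 < n) :
    FDRightModule K (HeckeB K (-1) Q q n) :=
  letI φ := AlgHom.opComm (RingQuot.liftAlgHom K
    ⟨FreeAlgebra.lift K (fun i : Fin n => op (M.T i)), (isTypeB_iff_lift_eq hn M.T).mp h⟩)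
  letI := Module.compHom M.V φ.toRingHom
  { carrier := M.V
    isTower := ⟨fun r a v => LinearMap.congr_fun (map_smul φ r a) v⟩ }

theorem OpRep.IsB.iso_opRep_rightModule {M : OpRep K ℕ} (h : OpRep.IsB q Q n M) (hn : 0 < n) :
    OpRep.Iso (Set.Iio n) M (h.rightModule hn).opRep := by
  refine ⟨LinearEquiv.refl K M.V, fun i hi v => ?_⟩
  refine Eq.trans ?_ (FDRightModule.opRep_T (M := h.rightModule hn) ⟨i, hi⟩ v).symm
  change M.T i v = (unop (RingQuot.liftAlgHom K ⟨FreeAlgebra.lift K (fun i : Fin n => op (M.T i)),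
    (isTypeB_iff_lift_eq hn M.T).mp h⟩ (HeckeB.gen (-1) Q q ⟨i, hi⟩)) : Module.End K M.V) v
  rw [HeckeB.gen, RingQuot.liftAlgHom_mkAlgHom_apply, FreeAlgebra.lift_ι_apply]
  rfl

theorem OpRep.Indec.of_iso {ι : Type} {S : Set ι} {M N : OpRep K ι} (hM : OpRep.Indec S M)
    (h : OpRep.Iso S M N) : OpRep.Indec S N := by
  obtain ⟨e, he⟩ := h
  have := hM.1
  have hs (P : Submodule K N.V) (hP : N.Stable S P) :
      M.Stable S (P.comap e.toLinearMap) := fun i hi v hv => by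
    rw [Submodule.mem_comap, he i hi]
    exact hP i hi _ hv
  refine ⟨e.symm.toEquiv.nontrivial, fun P P' hP hP' hc => ?_⟩
  let o := (Submodule.orderIsoMapComap e).symm
  exact (hM.2 _ _ (hs P hP) (hs P' hP') (o.isCompl hc)).imp
    (fun h => (map_eq_bot_iff o).mp h) (fun h => (map_eq_bot_iff o).mp h)

theorem hasFiniteRepresentationType_heckeB_iff (hn : 0 < n) :
    HasFiniteRepresentationType K (HeckeB K (-1) Q q n) ↔
      OpRep.FinType (Set.Iio n) (OpRep.IsB (K := K) q Q n) := by
  constructor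
  · intro h
    obtain ⟨r, ⟨e⟩⟩ := finite_iff_exists_equiv_fin.mp h
    refine ⟨r, fun j => (e.symm j).out.1.opRep, fun M hM hM' => ?_⟩
    have hiso := hM.iso_opRep_rightModule hn
    have hind := FDRightModule.indec_opRep_iff.mp (hM'.of_iso hiso)
    refine ⟨e (Quot.mk _ ⟨_, hind⟩), hiso.trans (FDRightModule.opRep_iso_iff.mpr ?_)⟩
    rw [e.symm_apply_apply]
    have heq : Equivalence fun M N : {M : FDRightModule K (HeckeB K (-1) Q q n) //
        IsIndecomposableModule (HeckeB K (-1) Q q n)ᵐᵒᵖ M.carrier} =>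
        Nonempty (M.1.carrier ≃ₗ[(HeckeB K (-1) Q q n)ᵐᵒᵖ] N.1.carrier) :=
      ⟨fun _ => ⟨.refl _ _⟩, fun ⟨e⟩ => ⟨e.symm⟩, fun ⟨e⟩ ⟨f⟩ => ⟨e.trans f⟩⟩
    exact heq.eqvGen_iff.mp (Quot.eqvGen_exact (Quot.out_eq (Quot.mk _ ⟨_, hind⟩)).symm)
  · rintro ⟨r, X, hX⟩
    choose j hj using fun c : Quot fun M N : {M : FDRightModule K (HeckeB K (-1) Q q n) //
        IsIndecomposableModule (HeckeB K (-1) Q q n)ᵐᵒᵖ M.carrier} =>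
        Nonempty (M.1.carrier ≃ₗ[(HeckeB K (-1) Q q n)ᵐᵒᵖ] N.1.carrier) =>
      hX c.out.1.opRep (FDRightModule.isB_opRep hn _) (FDRightModule.indec_opRep_iff.mpr c.out.2)
    refine Finite.of_injective j fun c c' h => ?_
    rw [← c.out_eq, ← c'.out_eq]
    exact Quot.sound (FDRightModule.opRep_iso_iff.mp ((hj c).trans (h ▸ (hj c').symm)))

end TypeBModules

theorem isSeparated_of_generic {K : Type} [Field K] {q Q : K} (hq : q ≠ 0)
    (hgen : ∀ f : ℤ, Q ≠ -q ^ f) :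
    IsSeparated q Q (Set.range fun m : ℤ => Q * q ^ m) (Set.range fun m : ℤ => -q ^ m) where
  disj := by
    rw [Set.disjoint_left]
    rintro _ ⟨m, rfl⟩ ⟨k, hk⟩
    refine hgen (k - m) ?_
    rw [zpow_sub₀ hq, ← neg_div, eq_div_iff (zpow_ne_zero _ hq)]
    exact hk.symm
  mem := ⟨0, by simp⟩
  mem' := ⟨0, by simp⟩
  shift := by
    rintro _ ⟨m, rfl⟩
    exact ⟨⟨m + 1, by simp only [zpow_add_one₀ hq]; ring⟩,
      ⟨m - 1, by simp only [zpow_sub_one₀ hq]; ring⟩⟩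
  shift' := by
    rintro _ ⟨m, rfl⟩
    exact ⟨⟨m + 1, by simp only [zpow_add_one₀ hq]; ring⟩,
      ⟨m - 1, by simp only [zpow_sub_one₀ hq]; ring⟩⟩

theorem lt_two_mul_multOrder_iff {M : Type*} [Monoid M] {x : M} {n : ℕ} :
    (n : ℕ∞) < 2 * multOrder x ↔ (0 < orderOf x → n < 2 * orderOf x) := by
  unfold multOrder
  split_ifs with h
  · simp [h, ENat.mul_top]
  · simp only [Nat.pos_of_ne_zero h, forall_const]
    exact_mod_cast Iff.rfl

theorem heckeB_finite_representation_type_iff_of_generic_Q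
    (K : Type) [Field K] (q Q : K) (hq0 : q ≠ 0) (hq1 : q ≠ 1) (hQ : Q ≠ 0)
    (hgen : ∀ f : ℤ, Q ≠ -q ^ f) (n : ℕ) (hn : 1 ≤ n) :
    HasFiniteRepresentationType K (HeckeB K (-1) Q q n) ↔ (n : ℕ∞) < 2 * multOrder q := by
  rw [hasFiniteRepresentationType_heckeB_iff hn, lt_two_mul_multOrder_iff]
  refine ⟨fun h he => ?_, OpRep.finType_isB hq0 hq1 (isSeparated_of_generic hq0 hgen) hn⟩
  by_contra hlt
  exact OpRep.not_finType_isB hq0 hq1 he (not_lt.mp hlt) h
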